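/- Let D be an irreducible deformation space of G-trees. If a finitely generated subgroup F ⊆ Out(G) fixes a tree T₀ ∈ D, then the fixed point set of F in D is contractible in the weak topology. -/

import Mathlib

set_option autoImplicit false
set_option maxHeartbeats 1000000
open scoped Classical

universe u

section Trees

variable (G : Type u) [Group G]

/-- A (minimal, simplicial) `G`-tree: a simplicial tree together with an action of `G` by
simplicial automorphisms, without inversions, admitting no proper invariant subtree. -/
structure GTree : Type (u + 1) where
  V : Type u
  nonempty : Nonempty V
  graph : SimpleGraph V
  isTree : graph.IsTree
  act : G →* Equiv.Perm V
  adj_act : ∀ (g : G) (u v : V), graph.Adj u v → graph.Adj (act g u) (act g v)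
  noInversion : ∀ (g : G) (u v : V), graph.Adj u v → ¬(act g u = v ∧ act g v = u)
  minimal : ∀ S : Set V, S.Nonempty → (∀ (g : G), ∀ v ∈ S, act g v ∈ S) →
      (∀ u ∈ S, ∀ v ∈ S, ∀ p : graph.Walk u v, p.IsPath → ∀ w ∈ p.support, w ∈ S) →
      S = Set.univ

variable {G}

namespace GTree

variable (T : GTree G)

/-- The stabilizer of a vertex. -/
def stab (v : T.V) : Subgroup G where
  carrier := {g : G | T.act g v = v}
  one_mem' := by simp
  mul_mem' := by
    intro a b ha hb
    simp only [Set.mem_setOf_eq, map_mul, Equiv.Perm.mul_apply] at *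
    rw [hb, ha]
  inv_mem' := by
    intro a ha
    simp only [Set.mem_setOf_eq] at *
    have h : T.act a⁻¹ (T.act a v) = v := by
      rw [← Equiv.Perm.mul_apply, ← map_mul, inv_mul_cancel, map_one, Equiv.Perm.one_apply]
    rwa [ha] at h

/-- The (pointwise) stabilizer of an edge `uv`; since the action has no inversions this is
the full stabilizer of the edge. -/
def edgeStab (u v : T.V) : Subgroup G := T.stab u ⊓ T.stab v

/-- A subgroup of `G` is elliptic if it fixes a vertex. -/
def Elliptic (H : Subgroup G) : Prop := ∃ v : T.V, ∀ h ∈ H, T.act h v = v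

/-- An element of `G` is elliptic if it fixes a vertex. -/
def EllipticElt (g : G) : Prop := ∃ v : T.V, T.act g v = v

/-- An element of `G` is hyperbolic if it fixes no vertex. -/
def Hyperbolic (g : G) : Prop := ∀ v : T.V, T.act g v ≠ v

/-- A `G`-tree is reduced if whenever the stabilizer of an edge `uv` equals the stabilizer
of `u` (i.e. `G_u ≤ G_v`), the two endpoints are in the same orbit. -/
def Reduced : Prop :=
  ∀ u v : T.V, T.graph.Adj u v → T.stab u ≤ T.stab v → ∃ g : G, T.act g u = v

/-- `T` is a single point. -/
protected def Trivial : Prop := ∀ u v : T.V, u = v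

/-- `T` is a (simplicial) line. -/
def IsLine : Prop := ∀ v : T.V, ∃ a b : T.V, a ≠ b ∧ {w : T.V | T.graph.Adj v w} = {a, b}

/-- `G` fixes an end of `T`: there is an equivariant choice, for each vertex, of the next
vertex in the direction of the fixed end. -/
def FixesEnd : Prop :=
  ∃ next : T.V → T.V, (∀ v, T.graph.Adj v (next v)) ∧
    (∀ (g : G) (v : T.V), next (T.act g v) = T.act g (next v)) ∧
    (∀ v, next (next v) ≠ v)

/-- Linear abelian type: `T` is a line on which `G` acts by translations (every element acts
either trivially or freely). -/
def LinearAbelian : Prop :=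
  T.IsLine ∧ ∀ g : G, (∀ v : T.V, T.act g v = v) ∨ (∀ v : T.V, T.act g v ≠ v)

/-- Dihedral type: `T` is a line and some element acts as a reflection. -/
def Dihedral : Prop :=
  T.IsLine ∧ ∃ g : G, (∃ v : T.V, T.act g v = v) ∧ (∃ w : T.V, T.act g w ≠ w)

/-- Genuine abelian type: `G` fixes an end and `T` is not a line. -/
def GenuineAbelian : Prop := T.FixesEnd ∧ ¬T.IsLine

/-- Irreducibility, via the characterization by hyperbolicity of a commutator. -/
def Irred : Prop :=
  ∃ g h : G, T.Hyperbolic g ∧ T.Hyperbolic h ∧ T.Hyperbolic (g * h * g⁻¹ * h⁻¹)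

/-- The image of a dart (oriented edge) under the action of `g`. -/
def dartAct (g : G) (d : T.graph.Dart) : T.graph.Dart :=
  ⟨(T.act g d.toProd.1, T.act g d.toProd.2), T.adj_act g d.toProd.1 d.toProd.2 d.adj⟩

/-- Three oriented edges are aligned (in this order) if some geodesic crosses them
successively, with the correct orientations. -/
def Aligned (d₁ d₂ d₃ : T.graph.Dart) : Prop :=
  ∃ (u v : T.V) (p : T.graph.Walk u v), p.IsPath ∧ [d₁, d₂, d₃].Sublist p.darts

end GTree

/-- Two `G`-trees lie in the same deformation space iff they have the same elliptic
subgroups. -/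
def SameDef (T T' : GTree G) : Prop := ∀ H : Subgroup G, T.Elliptic H ↔ T'.Elliptic H

/-- An equivariant isomorphism of simplicial `G`-trees. -/
def SimpIso (T T' : GTree G) : Prop :=
  ∃ e : T.V ≃ T'.V, (∀ (g : G) (v : T.V), e (T.act g v) = T'.act g (e v)) ∧
    ∀ u v : T.V, T.graph.Adj u v ↔ T'.graph.Adj (e u) (e v)

end Trees
section Collapses

variable {G : Type u} [Group G]

/-- Two ordered pairs of adjacent vertices span edges in the same `G`-orbit
(as non-oriented edges). -/
def InEdgeOrbit (T : GTree G) (a b c d : T.V) : Prop :=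
  ∃ g : G, (T.act g a = c ∧ T.act g b = d) ∨ (T.act g a = d ∧ T.act g b = c)

/-- `c` exhibits `T'` as a (possibly non-elementary) collapse of `T`: it is equivariant,
surjective, sends non-collapsed edges to edges, is onto the edges of `T'`, and its point
preimages are subtrees. -/
def IsCollapseMap (T T' : GTree G) (c : T.V → T'.V) : Prop :=
  (∀ (g : G) (v : T.V), c (T.act g v) = T'.act g (c v)) ∧
  Function.Surjective c ∧
  (∀ u v : T.V, T.graph.Adj u v → c u ≠ c v → T'.graph.Adj (c u) (c v)) ∧
  (∀ u' v' : T'.V, T'.graph.Adj u' v' → ∃ u v : T.V, T.graph.Adj u v ∧ c u = u' ∧ c v = v') ∧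
  (∀ u v : T.V, c u = c v → ∀ p : T.graph.Walk u v, p.IsPath → ∀ w ∈ p.support, c w = c u)

/-- `T'` is obtained from `T` by a (possibly non-elementary) collapse. -/
def CollapseOf (T' T : GTree G) : Prop := ∃ c : T.V → T'.V, IsCollapseMap T T' c

/-- `T'` is obtained from `T` by collapsing (exactly) all the edges in the orbit of a
single edge. -/
def IsOrbitCollapse (T' T : GTree G) : Prop :=
  ∃ (c : T.V → T'.V) (u₀ v₀ : T.V), T.graph.Adj u₀ v₀ ∧ IsCollapseMap T T' c ∧
    ∀ u v : T.V, T.graph.Adj u v → (c u = c v ↔ InEdgeOrbit T u v u₀ v₀)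

/-- An elementary collapse: collapsing the orbit of a collapsible edge, i.e. an orbit
collapse staying in the same deformation space. -/
def ElemCollapse (T T' : GTree G) : Prop := IsOrbitCollapse T' T ∧ SameDef T T'

/-- An elementary move: an elementary collapse or an elementary expansion. -/
def ElemMove (T T' : GTree G) : Prop := ElemCollapse T T' ∨ ElemCollapse T' T

/-- An elementary deformation: a finite sequence of elementary collapses and expansions. -/
def ElemDeformation (T T' : GTree G) : Prop := Relation.ReflTransGen ElemMove T T'

/-- A slide move: an edge `f = vx` with `G_f ≤ G_e` slides across `e = vw` (and
equivariantly so does its orbit), becoming an edge `f' = wx`. -/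
def SlideMove (T T' : GTree G) : Prop :=
  ∃ (e : T.V ≃ T'.V) (v w x : T.V),
    T.graph.Adj v w ∧ T.graph.Adj v x ∧ w ≠ x ∧
    T.edgeStab v x ≤ T.edgeStab v w ∧
    ¬InEdgeOrbit T v w v x ∧
    (∀ (g : G) (u : T.V), e (T.act g u) = T'.act g (e u)) ∧
    (∀ a b : T.V, T'.graph.Adj (e a) (e b) ↔
      ((T.graph.Adj a b ∧ ¬InEdgeOrbit T a b v x) ∨ InEdgeOrbit T a b w x))

end Collapses

section MetricTrees

variable (G : Type u) [Group G]

/-- A metric `G`-tree: a simplicial `G`-tree together with an equivariant assignment of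
positive lengths to the edges. -/
structure MGTree extends GTree G : Type (u + 1) where
  len : V → V → ℝ
  len_symm : ∀ u v : V, len u v = len v u
  len_pos : ∀ u v : V, graph.Adj u v → 0 < len u v
  len_equivariant : ∀ (g : G) (u v : V), len (act g u) (act g v) = len u v

variable {G}

namespace MGTree

variable (T : MGTree G)

/-- The length of a walk. -/
noncomputable def walkLen {u v : T.V} (p : T.graph.Walk u v) : ℝ :=
  (p.darts.map fun d => T.len d.toProd.1 d.toProd.2).sum

/-- The distance between two vertices: the length of the unique reduced path joining them. -/
noncomputable def dist (u v : T.V) : ℝ :=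
  sInf {x : ℝ | ∃ p : T.graph.Walk u v, p.IsPath ∧ x = T.walkLen p}

/-- The translation length of `g`. -/
noncomputable def ell (g : G) : ℝ :=
  sInf {x : ℝ | ∃ v : T.V, x = T.dist v (T.act g v)}

/-- The axis (or characteristic set) of `g`: the set of points moved exactly `ℓ(g)`. -/
def Axis (g : G) : Set T.V := {v : T.V | T.dist v (T.act g v) = T.ell g}

/-- `T` is abelian: its length function is the absolute value of a homomorphism to `ℝ`
with cyclic image. -/
def IsAbelian : Prop :=
  ∃ φ : G → ℝ, (∀ g h : G, φ (g * h) = φ g + φ h) ∧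
    (∃ a : ℝ, ∀ g : G, ∃ n : ℤ, φ g = (n : ℝ) * a) ∧
    ∀ g : G, T.ell g = |φ g|

/-- Irreducibility for metric trees: two hyperbolic elements with disjoint axes. -/
def Irr : Prop :=
  ∃ g h : G, T.toGTree.Hyperbolic g ∧ T.toGTree.Hyperbolic h ∧ T.Axis g ∩ T.Axis h = ∅

end MGTree

/-- An equivariant simplicial isomorphism multiplying all edge lengths by `c`. -/
def EquivHomothety (c : ℝ) (T T' : MGTree G) : Prop :=
  ∃ e : T.V ≃ T'.V, (∀ (g : G) (v : T.V), e (T.act g v) = T'.act g (e v)) ∧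
    (∀ u v : T.V, T.graph.Adj u v ↔ T'.graph.Adj (e u) (e v)) ∧
    ∀ u v : T.V, T.graph.Adj u v → T'.len (e u) (e v) = c * T.len u v

/-- An equivariant isometry of metric `G`-trees. -/
def EquivIsometric (T T' : MGTree G) : Prop := EquivHomothety 1 T T'

/-- The action of an automorphism of `G` on metric `G`-trees, by precomposition. -/
def MGTree.precomp (φ : MulAut G) (T : MGTree G) : MGTree G where
  V := T.V
  nonempty := T.nonempty
  graph := T.graph
  isTree := T.isTree
  act := T.act.comp φ.toMonoidHom
  adj_act := fun g u v h => T.adj_act (φ g) u v h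
  noInversion := fun g u v h => T.noInversion (φ g) u v h
  minimal := fun S h1 h2 h3 => T.minimal S h1
    (fun g v hv => by simpa using h2 (φ.symm g) v hv) h3
  len := T.len
  len_symm := T.len_symm
  len_pos := T.len_pos
  len_equivariant := fun g u v => T.len_equivariant (φ g) u v

end MetricTrees
section Topologies

variable (G : Type u) [Group G]

/-- Basic Gromov–Hausdorff neighbourhood of the metric `G`-tree `T` determined by finite
sets `X ⊆ T`, `A ⊆ G` and `ε > 0`: the trees admitting an `ε`-approximate equivariant
lift of `X`. -/
def gromovBasic (T : MGTree G) (X : Finset T.V) (A : Finset G) (ε : ℝ) : Set (MGTree G) :=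
  {T' : MGTree G | ∃ f : T.V → T'.V, ∀ x ∈ X, ∀ y ∈ X, ∀ g ∈ A,
    |T.dist x (T.act g y) - T'.dist (f x) (T'.act g (f y))| < ε}

/-- The equivariant Gromov–Hausdorff topology on the space of metric `G`-trees. -/
noncomputable def gromovTop : TopologicalSpace (MGTree G) where
  IsOpen U := ∀ T ∈ U, ∃ (X : Finset T.V) (A : Finset G) (ε : ℝ), 0 < ε ∧
    gromovBasic G T X A ε ⊆ U
  isOpen_univ := fun T _ => ⟨∅, ∅, 1, one_pos, Set.subset_univ _⟩
  isOpen_inter := by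
    intro U V hU hV T hT
    obtain ⟨X₁, A₁, ε₁, hε₁, h₁⟩ := hU T hT.1
    obtain ⟨X₂, A₂, ε₂, hε₂, h₂⟩ := hV T hT.2
    refine ⟨X₁ ∪ X₂, A₁ ∪ A₂, min ε₁ ε₂, lt_min hε₁ hε₂, ?_⟩
    intro T' hT'
    obtain ⟨f, hf⟩ := hT'
    constructor
    · exact h₁ ⟨f, fun x hx y hy g hg =>
        lt_of_lt_of_le (hf x (Finset.mem_union_left _ hx) y (Finset.mem_union_left _ hy) g
          (Finset.mem_union_left _ hg)) (min_le_left _ _)⟩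
    · exact h₂ ⟨f, fun x hx y hy g hg =>
        lt_of_lt_of_le (hf x (Finset.mem_union_right _ hx) y (Finset.mem_union_right _ hy) g
          (Finset.mem_union_right _ hg)) (min_le_right _ _)⟩
  isOpen_sUnion := by
    intro s hs T hT
    obtain ⟨U, hUs, hTU⟩ := hT
    obtain ⟨X, A, ε, hε, h⟩ := hs U hUs T hTU
    exact ⟨X, A, ε, hε, h.trans (Set.subset_sUnion_of_mem hUs)⟩

variable {G}

/-- The closed cone of the (restricted) deformation space `D` spanned by `T`: the trees
of `D` obtained from trees having the same underlying simplicial tree as `T` by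
(elementary) collapses. -/
def closedCone (D : Set (MGTree G)) (T : MGTree G) : Set (MGTree G) :=
  {T' : MGTree G | T' ∈ D ∧ CollapseOf T'.toGTree T.toGTree}

/-- The open cone containing `T`: the trees with the same underlying simplicial tree. -/
def openCone (D : Set (MGTree G)) (T : MGTree G) : Set (MGTree G) :=
  {T' : MGTree G | T' ∈ D ∧ SimpIso T'.toGTree T.toGTree}

variable (G)

/-- The weak topology on a deformation space `D`: a set is closed if and only if its
intersection with every closed cone of `D` is closed (each closed cone carrying the
Gromov topology). -/
noncomputable def weakTop (D : Set (MGTree G)) : TopologicalSpace ↥D :=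
  ⨆ (T : MGTree G) (_ : T ∈ D), TopologicalSpace.coinduced
    (fun x : {S : MGTree G // S ∈ closedCone D T} => (⟨x.1, x.2.1⟩ : ↥D))
    (TopologicalSpace.induced (fun x : {S : MGTree G // S ∈ closedCone D T} => x.1)
      (gromovTop G))

variable {G}

/-- The projectivizing relation on a deformation space: agreement up to rescaling, i.e.
equivariant homothety. -/
def projRel (D : Set (MGTree G)) (a b : ↥D) : Prop :=
  ∃ c : ℝ, 0 < c ∧ EquivHomothety c a.1 b.1

/-- The relation of equivariant isometry on a deformation space. -/
def isomRel (D : Set (MGTree G)) (a b : ↥D) : Prop := EquivIsometric a.1 b.1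

end Topologies

section Morphisms

variable {G : Type u} [Group G]

/-- A morphism of simplicial `G`-trees: an equivariant map sending each edge onto a
non-degenerate edge path (obtained by subdividing the edge into finitely many subsegments,
each mapped bijectively onto an edge). -/
structure GMorphism (T T' : GTree G) where
  f : T.V → T'.V
  equivariant : ∀ (g : G) (v : T.V), f (T.act g v) = T'.act g (f v)
  edgeWalk : ∀ u v : T.V, T.graph.Adj u v → T'.graph.Walk (f u) (f v)
  edgeWalk_ne_nil : ∀ (u v : T.V) (h : T.graph.Adj u v), ¬(edgeWalk u v h).Nil
  edgeWalk_symm : ∀ (u v : T.V) (h : T.graph.Adj u v),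
    (edgeWalk v u h.symm).support = (edgeWalk u v h).support.reverse
  edgeWalk_equivariant : ∀ (g : G) (u v : T.V) (h : T.graph.Adj u v),
    (edgeWalk (T.act g u) (T.act g v) (T.adj_act g u v h)).support =
      (edgeWalk u v h).support.map (fun x => T'.act g x)

/-- `H` is bi-elliptic in `T`: it fixes two distinct points. -/
def BiElliptic (T : GTree G) (H : Subgroup G) : Prop :=
  ∃ u v : T.V, u ≠ v ∧ ∀ h ∈ H, T.act h u = u ∧ T.act h v = v

/-- `H` is a generalized edge group of `T`: it is squeezed between two edge stabilizers. -/
def GenEdgeGroup (T : GTree G) (H : Subgroup G) : Prop :=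
  ∃ u v u' v' : T.V, T.graph.Adj u v ∧ T.graph.Adj u' v' ∧
    T.edgeStab u v ≤ H ∧ H ≤ T.edgeStab u' v'

/-- `H` belongs to `𝒜_min` (relative to the deformation space of `T₀`): it fixes an edge
in every tree of the deformation space. -/
def Amin (T₀ : GTree G) (H : Subgroup G) : Prop :=
  ∀ T : GTree G, SameDef T₀ T → ∃ u v : T.V, T.graph.Adj u v ∧ H ≤ T.edgeStab u v

/-- A maximal elliptic subgroup (of the deformation space of `T₀`). -/
def MaxElliptic (T₀ : GTree G) (H : Subgroup G) : Prop :=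
  T₀.Elliptic H ∧ ∀ K : Subgroup G, T₀.Elliptic K → H ≤ K → K = H

end Morphisms

section OutG

variable (G : Type u) [Group G]

instance innRange_normal : ((MulAut.conj : G →* MulAut G).range).Normal := by
  constructor
  intro a ha φ
  obtain ⟨g, rfl⟩ := ha
  refine ⟨φ g, ?_⟩
  ext x
  simp only [MulAut.mul_apply, MulAut.conj_apply, map_mul, map_inv]
  simp [MulAut.inv_def]

/-- The outer automorphism group of `G`. -/
def OutG := MulAut G ⧸ (MulAut.conj : G →* MulAut G).range

noncomputable instance : Group (OutG G) := QuotientGroup.Quotient.group _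

/-- The class of an automorphism in `Out(G)`. -/
def toOutG (φ : MulAut G) : OutG G := QuotientGroup.mk φ

end OutG
section RealTrees

variable (G : Type u) [Group G]

/-- A non-trivial minimal `ℝ`-tree with an isometric action of `G`: a geodesic metric
space in which any two points are joined by a unique arc. -/
structure RGTree : Type (u + 1) where
  X : Type u
  [ms : MetricSpace X]
  nontrivial : Nontrivial X
  geodesic : ∀ x y : X, ∃ f : ℝ → X, f 0 = x ∧ f (dist x y) = y ∧
    ∀ s ∈ Set.Icc (0 : ℝ) (dist x y), ∀ t ∈ Set.Icc (0 : ℝ) (dist x y),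
      dist (f s) (f t) = |s - t|
  unique_arc : ∀ (x y : X) (γ : Set.Icc (0 : ℝ) 1 → X), Continuous γ →
    Function.Injective γ → γ ⟨0, by constructor <;> norm_num⟩ = x →
    γ ⟨1, by constructor <;> norm_num⟩ = y →
    ∀ z ∈ Set.range γ, dist x z + dist z y = dist x y
  act : G →* Equiv.Perm X
  isom : ∀ g : G, Isometry (act g)
  minimal : ∀ S : Set X, S.Nonempty → (∀ (g : G), ∀ x ∈ S, act g x ∈ S) →
    (∀ x ∈ S, ∀ y ∈ S, ∀ z : X, dist x z + dist z y = dist x y → z ∈ S) →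
    S = Set.univ

attribute [instance] RGTree.ms

variable {G}

namespace RGTree

variable (R : RGTree G)

/-- `z` lies between `x` and `y` (i.e. on the arc from `x` to `y`). -/
def Btw (x z y : R.X) : Prop := dist x z + dist z y = dist x y

/-- A subgroup is elliptic if it fixes a point. -/
def Elliptic (H : Subgroup G) : Prop := ∃ x : R.X, ∀ h ∈ H, R.act h x = x

/-- A hyperbolic element fixes no point. -/
def Hyperbolic (g : G) : Prop := ∀ x : R.X, R.act g x ≠ x

/-- The translation length of `g`. -/
noncomputable def ell (g : G) : ℝ :=
  sInf {r : ℝ | ∃ x : R.X, r = dist x (R.act g x)}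

/-- The characteristic set of `g`: its axis if `g` is hyperbolic, its fixed point set
if `g` is elliptic. -/
def Axis (g : G) : Set R.X := {x : R.X | dist x (R.act g x) = R.ell g}

/-- The fixed point set of `g`. -/
def Fix (g : G) : Set R.X := {x : R.X | R.act g x = x}

/-- The fixed point set of a subgroup. -/
def FixSub (H : Subgroup G) : Set R.X := {x : R.X | ∀ h ∈ H, R.act h x = x}

/-- Irreducibility: two hyperbolic elements with disjoint characteristic sets. -/
def Irr : Prop :=
  ∃ g h : G, R.Hyperbolic g ∧ R.Hyperbolic h ∧ R.Axis g ∩ R.Axis h = ∅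

/-- The distance between the characteristic sets of `g` and `h`. -/
noncomputable def axesDist (g h : G) : ℝ :=
  sInf {r : ℝ | ∃ x ∈ R.Axis g, ∃ y ∈ R.Axis h, r = dist x y}

end RGTree

/-- `f` realizes the metric simplicial `G`-tree `T` inside the `ℝ`-tree `R`. -/
def IsRealizationMap (R : RGTree G) (T : MGTree G) (f : T.V → R.X) : Prop :=
  (∀ (g : G) (v : T.V), f (T.act g v) = R.act g (f v)) ∧
  (∀ u v : T.V, dist (f u) (f v) = T.dist u v) ∧
  ∀ x : R.X, ∃ u v : T.V, T.graph.Adj u v ∧ R.Btw (f u) x (f v)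

/-- The `ℝ`-tree `R` is (equivariantly isometric to) the geometric realization of the
metric simplicial `G`-tree `T`. -/
def RealizationOf (R : RGTree G) (T : MGTree G) : Prop := ∃ f : T.V → R.X, IsRealizationMap R T f

variable (G)

/-- The equivariant Gromov–Hausdorff topology on the space of `ℝ`-trees. -/
noncomputable def gromovTopR : TopologicalSpace (RGTree G) where
  IsOpen U := ∀ R ∈ U, ∃ (X : Finset R.X) (A : Finset G) (ε : ℝ), 0 < ε ∧
    {R' : RGTree G | ∃ f : R.X → R'.X, ∀ x ∈ X, ∀ y ∈ X, ∀ g ∈ A,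
      |dist x (R.act g y) - dist (f x) (R'.act g (f y))| < ε} ⊆ U
  isOpen_univ := fun R _ => ⟨∅, ∅, 1, one_pos, Set.subset_univ _⟩
  isOpen_inter := by
    intro U V hU hV R hR
    obtain ⟨X₁, A₁, ε₁, hε₁, h₁⟩ := hU R hR.1
    obtain ⟨X₂, A₂, ε₂, hε₂, h₂⟩ := hV R hR.2
    refine ⟨X₁ ∪ X₂, A₁ ∪ A₂, min ε₁ ε₂, lt_min hε₁ hε₂, ?_⟩
    rintro R' ⟨f, hf⟩
    constructor
    · exact h₁ ⟨f, fun x hx y hy g hg =>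
        lt_of_lt_of_le (hf x (Finset.mem_union_left _ hx) y (Finset.mem_union_left _ hy) g
          (Finset.mem_union_left _ hg)) (min_le_left _ _)⟩
    · exact h₂ ⟨f, fun x hx y hy g hg =>
        lt_of_lt_of_le (hf x (Finset.mem_union_right _ hx) y (Finset.mem_union_right _ hy) g
          (Finset.mem_union_right _ hg)) (min_le_right _ _)⟩
  isOpen_sUnion := by
    intro s hs R hR
    obtain ⟨U, hUs, hRU⟩ := hR
    obtain ⟨X, A, ε, hε, h⟩ := hs U hUs R hRU
    exact ⟨X, A, ε, hε, h.trans (Set.subset_sUnion_of_mem hUs)⟩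

/-- The axes topology: the coarsest topology making all translation length functions
continuous. -/
noncomputable def axesTopR : TopologicalSpace (RGTree G) :=
  TopologicalSpace.induced (fun (R : RGTree G) (g : G) => R.ell g) Pi.topologicalSpace

variable {G}

/-- A morphism of `ℝ`-trees: an equivariant map such that every segment is a finite union
of subsegments on each of which the map is isometric. -/
structure RMorphism (R S : RGTree G) where
  f : R.X → S.X
  equivariant : ∀ (g : G) (x : R.X), f (R.act g x) = S.act g (f x)
  piecewise : ∀ x y : R.X, ∃ (n : ℕ) (c : Fin (n + 1) → R.X),
    c 0 = x ∧ c (Fin.last n) = y ∧ (∀ i : Fin (n + 1), R.Btw x (c i) y) ∧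
    ∀ i : Fin n, ∀ p q : R.X, R.Btw (c i.castSucc) p (c i.succ) →
      R.Btw (c i.castSucc) q (c i.succ) → dist (f p) (f q) = dist p q

/-- `M` is the intermediate tree at time `t` of Skora's deformation of the morphism `φ`:
the quotient of the source in which `x` and `y` are identified exactly when `φ` maps the
segment `[x,y]` into the ball of radius `t` around `φ(x) = φ(y)`. -/
def IsSkoraIntermediate {R S : RGTree G} (φ : RMorphism R S) (t : ℝ) (M : RGTree G) : Prop :=
  ∃ (p : R.X → M.X) (q : M.X → S.X), Function.Surjective p ∧
    (∀ (g : G) (x : R.X), p (R.act g x) = M.act g (p x)) ∧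
    (∀ (g : G) (m : M.X), q (M.act g m) = S.act g (q m)) ∧
    (∀ x : R.X, q (p x) = φ.f x) ∧
    (∀ x y : R.X, dist (p x) (p y) ≤ dist x y) ∧
    (∀ m m' : M.X, dist (q m) (q m') ≤ dist m m') ∧
    ∀ x y : R.X, p x = p y ↔ (φ.f x = φ.f y ∧
      ∀ z : R.X, R.Btw x z y → dist (φ.f z) (φ.f x) ≤ t)

/-- `P` is the basepoint of `R` determined by `g` and `h` (the endpoint of the
intersection of the two characteristic sets, resp. the projection of one onto the other),
characterized by the metric system (1) of [Guirardel–Levitt]. -/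
noncomputable def IsBasepoint (R : RGTree G) (g h : G) (P : R.X) : Prop :=
  dist P (R.act g P) = R.ell g ∧
  dist P (R.act h P) = R.ell h + 2 * R.axesDist g h ∧
  dist (R.act g P) (R.act h P) = R.ell g + R.ell h + 2 * R.axesDist g h ∧
  dist (R.act g P) (R.act h⁻¹ P) = R.ell g + R.ell h + 2 * R.axesDist g h

/-- `p` is a projection of `x` to the set `S` (a closest point of `S`). -/
def IsProj (R : RGTree G) (x : R.X) (S : Set R.X) (p : R.X) : Prop :=
  p ∈ S ∧ ∀ q ∈ S, dist x p ≤ dist x q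

/-- Equivariant isometry of `ℝ`-trees. -/
def RIsom (R R' : RGTree G) : Prop :=
  ∃ e : R.X ≃ R'.X, (∀ (g : G) (x : R.X), e (R.act g x) = R'.act g (e x)) ∧
    ∀ x y : R.X, dist (e x) (e y) = dist x y

/-- Equivariant homothety of `ℝ`-trees, with ratio `c`. -/
def RHomothety (c : ℝ) (R R' : RGTree G) : Prop :=
  ∃ e : R.X ≃ R'.X, (∀ (g : G) (x : R.X), e (R.act g x) = R'.act g (e x)) ∧
    ∀ x y : R.X, dist (e x) (e y) = c * dist x y

end RealTrees
section MoreDefs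

variable {G : Type u} [Group G]

/-- `H` is contained in a conjugate of `K`. -/
def ConjLe (H K : Subgroup G) : Prop := ∃ g : G, ∀ h ∈ H, g * h * g⁻¹ ∈ K

/-- `H` represents a maximal element of the vertical set `ℳ` associated to the
deformation space of `T₀`. -/
def MaxVert (T₀ : GTree G) (H : Subgroup G) : Prop :=
  T₀.Elliptic H ∧ ∀ K : Subgroup G, T₀.Elliptic K → ConjLe H K → ConjLe K H

/-- The vertical set `ℳ`: equivalence classes of maximal elements for containment in a
conjugate, among elliptic subgroups. -/
def vertSet (T₀ : GTree G) : Type u :=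
  Quot (fun H K : {H : Subgroup G // MaxVert T₀ H} => ConjLe H.1 K.1 ∧ ConjLe K.1 H.1)

namespace GTree

variable (T : GTree G)

/-- The set of `G`-orbits of vertices (the vertices of the quotient graph `T/G`). -/
def vertexOrbits : Type u := Quot (fun u v : T.V => ∃ g : G, T.act g u = v)

/-- Orbits of neighbours of `v` under the stabilizer of `v`: the oriented edges of the
quotient graph of groups issued from the image of `v`, whose number is the valence of
the image of `v`. -/
def nbrOrbits (v : T.V) : Type u :=
  Quot (fun a b : {w : T.V // T.graph.Adj v w} => ∃ g : G, T.act g v = v ∧ T.act g a.1 = b.1)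

/-- The set of `G`-orbits of (non-oriented) edges. -/
def edgeOrbits : Type u :=
  Quot (fun d d' : T.graph.Dart => ∃ g : G, T.dartAct g d = d' ∨ T.dartAct g d = d'.symm)

/-- BF-reduced: if an edge-to-vertex inclusion `G_e → G_u` is onto, then the image of `u`
in the quotient graph has valence at least 3. -/
def BFReduced : Prop :=
  ∀ u w : T.V, T.graph.Adj u w → T.stab u ≤ T.stab w →
    3 ≤ Cardinal.mk (T.nbrOrbits u)

end GTree

/-- The quotient graph of groups of `T` has a strict ascending loop: an edge whose
endpoints are in the same orbit, exactly one of the two edge-to-vertex inclusions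
being onto. -/
def HasSAL (T : GTree G) : Prop :=
  ∃ u v : T.V, T.graph.Adj u v ∧ (∃ g : G, T.act g u = v) ∧
    Xor' (T.stab u ≤ T.stab v) (T.stab v ≤ T.stab u)

/-- The edge (orbit of) `uv` is a surviving edge: `T` can be made reduced by a collapse
(within its deformation space) not collapsing `uv`. -/
def Surviving (T : GTree G) (u v : T.V) : Prop :=
  ∃ (T' : GTree G) (c : T.V → T'.V), IsCollapseMap T T' c ∧ SameDef T T' ∧
    T'.Reduced ∧ c u ≠ c v

/-- Containment in a conjugate by an element of `G₀`. -/
def perLe (G₀ : Subgroup G) (H K : Subgroup G) : Prop :=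
  ∃ g ∈ G₀, ∀ h ∈ H, g * h * g⁻¹ ∈ K

/-- `H` represents a maximal element of the peripheral structure `ℳ₀` of `G₀`. -/
def PeriphMax (T₀ : GTree G) (G₀ : Subgroup G) (H : Subgroup G) : Prop :=
  H ≤ G₀ ∧ Amin T₀ H ∧
    ∀ K : Subgroup G, K ≤ G₀ → Amin T₀ K → perLe G₀ H K → perLe G₀ K H

/-- The peripheral structure `ℳ₀` of `G₀`, as a set of equivalence classes. -/
def periphSet (T₀ : GTree G) (G₀ : Subgroup G) : Type u :=
  Quot (fun H K : {H : Subgroup G // PeriphMax T₀ G₀ H} =>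
    perLe G₀ H.1 K.1 ∧ perLe G₀ K.1 H.1)

end MoreDefs

namespace Skora
section PocSec

/-- partially ordered sets with complementation -/
class Poc (P : Type u) extends PartialOrder P, Compl P where
  cc : ∀ h : P, compl (compl h) = h
  anti : ∀ {h k : P}, h ≤ k → compl k ≤ compl h

/-- actions on pocsets -/
class PocAct (G : Type u) (P : Type u) [Group G] [Poc P] extends MulAction G P where
  mono : ∀ (g : G) {h k : P}, h ≤ k → g • h ≤ g • k
  scompl : ∀ (g : G) (h : P), g • hᶜ = (g • h)ᶜ

attribute [simp] Poc.cc

/-- a point: a global coherent orientation -/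
structure Pt (P : Type u) [Poc P] where
  m : Set P
  up : ∀ {h k : P}, h ≤ k → h ∈ m → k ∈ m
  co : ∀ h : P, hᶜ ∈ m ↔ h ∉ m

variable {G P : Type u} [Group G] [Poc P] [PocAct G P]

theorem compl_inj' {h k : P} (e : hᶜ = kᶜ) : h = k := by
  rw [← Poc.cc h, e, Poc.cc]

theorem le_compl_comm' {h k : P} (e : h ≤ kᶜ) : k ≤ hᶜ := by
  have := Poc.anti e; rwa [Poc.cc] at this

theorem compl_le_comm' {h k : P} (e : hᶜ ≤ k) : kᶜ ≤ h := by
  have := Poc.anti e; rwa [Poc.cc] at this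

theorem compl_le_compl' {h k : P} (e : hᶜ ≤ kᶜ) : k ≤ h := by
  have := Poc.anti e; rwa [Poc.cc, Poc.cc] at this

theorem smul_le_iff' (g : G) {h k : P} : g • h ≤ g • k ↔ h ≤ k := by
  constructor
  · intro e
    have := PocAct.mono g⁻¹ e
    simpa using this
  · exact PocAct.mono g

theorem smul_lt_iff' (g : G) {h k : P} : g • h < g • k ↔ h < k := by
  rw [lt_iff_le_not_ge, lt_iff_le_not_ge, smul_le_iff', smul_le_iff']

/-- wall systems -/
structure Sys (G : Type u) {P : Type u} [Group G] [Poc P] [PocAct G P] (o : Pt P)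
    (L : Set P) : Prop where
  compl : ∀ {h : P}, h ∈ L → hᶜ ∈ L
  smul : ∀ (g : G) {h : P}, h ∈ L → g • h ∈ L
  nested : ∀ {h k : P}, h ∈ L → k ∈ L → h ≤ k ∨ k ≤ h ∨ h ≤ kᶜ ∨ hᶜ ≤ k
  fin : ∀ g : G, {h ∈ L | h ∈ o.m ∧ g • h ∉ o.m}.Finite
  hit : ∀ {h : P}, h ∈ L → ∃ g : G, g • h ∈ o.m

/-- vertices of the dual tree -/
structure IsVtx (o : Pt P) (L : Set P) (v : Set P) : Prop where
  sub : ∀ {h : P}, h ∈ v → h ∈ L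
  tot : ∀ {h : P}, h ∈ L → (hᶜ ∈ v ↔ h ∉ v)
  up : ∀ {h k : P}, h ∈ v → k ∈ L → h ≤ k → k ∈ v
  fin : {h ∈ v | h ∉ o.m}.Finite

/-- the vertex set of the dual tree -/
abbrev Vtx (o : Pt P) (L : Set P) : Type u := {v : Set P // IsVtx o L v}

variable {o : Pt P} {L : Set P}

theorem Sys.not_le_compl (S : Sys G o L) {h : P} (hh : h ∈ L) : ¬ h ≤ hᶜ := by
  intro e
  obtain ⟨g, hg⟩ := S.hit hh
  have h1 := o.up (PocAct.mono g e) hg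
  rw [PocAct.scompl, o.co] at h1
  exact h1 hg

theorem Sys.not_both (S : Sys G o L) {h k : P} (hh : h ∈ L) (h1 : h ≤ k) (h2 : h ≤ kᶜ) : False :=
  S.not_le_compl hh (h2.trans (Poc.anti h1))

theorem IsVtx.cod {v : Set P} (hv : IsVtx o L v) {h : P} (hh : h ∈ v) : hᶜ ∉ v := by
  rw [hv.tot (hv.sub hh)]; exact fun k => k hh

theorem vtx_ext {u v : Vtx o L} (h : ∀ k ∈ u.1, k ∈ v.1) : u = v := by
  apply Subtype.ext
  apply Set.Subset.antisymm h
  intro k hk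
  by_contra hn
  have h1 := (u.2.tot (v.2.sub hk)).2 hn
  exact v.2.cod hk (h _ h1)

theorem IsVtx.dfin {u v : Set P} (hu : IsVtx o L u) (hv : IsVtx o L v) : (u \ v).Finite := by
  apply (hu.fin.union (hv.fin.image (fun h => hᶜ))).subset
  rintro h ⟨h1, h2⟩
  by_cases ho : h ∈ o.m
  · right
    refine ⟨hᶜ, ⟨(hv.tot (hu.sub h1)).2 h2, ?_⟩, Poc.cc h⟩
    rw [o.co]; exact fun k => k ho
  · left; exact ⟨h1, ho⟩

theorem dcompl {u v : Set P} (hu : IsVtx o L u) (hv : IsVtx o L v) {h : P} (hh : h ∈ u \ v) :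
    hᶜ ∈ v \ u :=
  ⟨(hv.tot (hu.sub hh.1)).2 hh.2, hu.cod hh.1⟩

/-- the dual graph -/
def dualGraph (o : Pt P) (L : Set P) : SimpleGraph (Vtx o L) where
  Adj u v := ∃ h, u.1 \ v.1 = {h}
  symm := ⟨by
    rintro u v ⟨h, hh⟩
    refine ⟨hᶜ, ?_⟩
    ext k
    simp only [Set.mem_singleton_iff]
    constructor
    · intro hk
      have := dcompl v.2 u.2 hk
      rw [hh] at this
      have h2 : kᶜ = h := this
      rw [← h2, Poc.cc]
    · rintro rfl
      exact dcompl u.2 v.2 (by rw [hh]; rfl)⟩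
  loopless := ⟨by
    rintro u ⟨h, hh⟩
    have : h ∈ u.1 \ u.1 := by rw [hh]; rfl
    exact this.2 this.1⟩

theorem four (S : Sys G o L) {h k : P} (hh : h ∈ L) (hk : k ∈ L) {a b c d : Set P}
    (ha : IsVtx o L a) (hb : IsVtx o L b) (hc : IsVtx o L c) (hd : IsVtx o L d)
    (a1 : h ∈ a) (a2 : k ∈ a) (b1 : h ∈ b) (b2 : k ∉ b) (c1 : h ∉ c) (c2 : k ∈ c)
    (d1 : h ∉ d) (d2 : k ∉ d) : False := by
  rcases S.nested hh hk with e | e | e | e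
  · exact b2 (hb.up b1 hk e)
  · exact c1 (hc.up c2 hh e)
  · exact ha.cod a2 (ha.up a1 (S.compl hk) e)
  · exact d2 (hd.up ((hd.tot hh).2 d1) hk e)

theorem edge_unique (S : Sys G o L) {u v u' v' : Vtx o L} {h : P} (e : u.1 \ v.1 = {h})
    (e' : u'.1 \ v'.1 = {h}) : u = u' := by
  have m : h ∈ u.1 \ v.1 := by rw [e]; rfl
  have m' : h ∈ u'.1 \ v'.1 := by rw [e']; rfl
  apply vtx_ext
  intro k hk
  by_contra hn
  have hkL := u.2.sub hk
  have k1 : k ∈ v.1 := by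
    by_contra h2
    have : k ∈ u.1 \ v.1 := ⟨hk, h2⟩
    rw [e] at this
    have h3 : k = h := this
    exact hn (h3 ▸ m'.1)
  have k2 : k ∉ v'.1 := by
    intro h2
    have h3 : kᶜ ∈ u'.1 \ v'.1 := ⟨(u'.2.tot hkL).2 hn, v'.2.cod h2⟩
    rw [e'] at h3
    have h4 : kᶜ = h := h3
    exact u.2.cod hk (h4 ▸ m.1)
  exact four S (u.2.sub m.1) hkL u.2 u'.2 v.2 v'.2 m.1 hk m'.1 hn m.2 k1 m'.2 k2

theorem edge_unique' (S : Sys G o L) {u v u' v' : Vtx o L} {h : P} (e : u.1 \ v.1 = {h})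
    (e' : u'.1 \ v'.1 = {h}) : v = v' := by
  have f : ∀ {u v : Vtx o L}, u.1 \ v.1 = {h} → v.1 \ u.1 = {hᶜ} := by
    intro u v e
    obtain ⟨k, hk⟩ := (dualGraph o L).symm.symm u v ⟨h, e⟩
    have m : h ∈ u.1 \ v.1 := by rw [e]; rfl
    have := dcompl u.2 v.2 m
    rw [hk] at this ⊢
    have h2 : hᶜ = k := this
    rw [h2]
  exact edge_unique S (f e) (f e')

theorem flip_vtx (S : Sys G o L) {u : Set P} (hu : IsVtx o L u) {h : P} (hh : h ∈ u)
    (hmin : ∀ k ∈ u, k ≤ h → k = h) : IsVtx o L ((u \ {h}) ∪ {hᶜ}) := by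
  have hne : h ≠ hᶜ := fun e => hu.cod hh (e ▸ hh)
  refine ⟨?_, ?_, ?_, ?_⟩
  · rintro k (⟨hk, _⟩ | rfl)
    · exact hu.sub hk
    · exact S.compl (hu.sub hh)
  · intro k hk
    have t := hu.tot hk
    by_cases e1 : k = h
    · subst e1; simp [hne]
    by_cases e2 : k = hᶜ
    · subst e2; simp [hne]
    have e3 : kᶜ ≠ h := fun e => e2 (by rw [← e, Poc.cc])
    have e4 : kᶜ ≠ hᶜ := fun e => e1 (compl_inj' e)
    simp [e1, e2, e3, e4, t]
  · rintro j k (⟨hj, hj2⟩ | rfl) hk hle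
    · have hku := hu.up hj hk hle
      left
      refine ⟨hku, ?_⟩
      rintro rfl
      exact hj2 (hmin j hj hle)
    · by_cases e : k = hᶜ
      · right; exact e
      left
      constructor
      · by_contra hn
        have := hmin kᶜ ((hu.tot hk).2 hn) (compl_le_comm' hle)
        exact e (by rw [← this, Poc.cc])
      · rintro rfl
        exact S.not_le_compl (S.compl hk) (by rwa [Poc.cc])
  · apply (hu.fin.union (Set.finite_singleton hᶜ)).subset
    rintro k ⟨⟨hk, _⟩ | hk, hk2⟩
    · left; exact ⟨hk, hk2⟩
    · right; exact hk

theorem exists_step (S : Sys G o L) (u v : Vtx o L) (hne : u ≠ v) :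
    ∃ (u' : Vtx o L) (h : P), u.1 \ u'.1 = {h} ∧ h ∈ u.1 \ v.1 ∧ u'.1 \ v.1 = (u.1 \ v.1) \ {h} := by
  have hn : (u.1 \ v.1).Nonempty := by
    by_contra h
    rw [Set.not_nonempty_iff_eq_empty] at h
    exact hne (vtx_ext (fun k hk => by
      by_contra h2
      have : k ∈ u.1 \ v.1 := ⟨hk, h2⟩
      rw [h] at this; exact this))
  obtain ⟨h, hh⟩ := (u.2.dfin v.2).exists_minimal hn
  have hm : ∀ k ∈ u.1, k ≤ h → k = h := by
    intro k hk hle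
    apply le_antisymm hle
    apply hh.2 ⟨hk, fun hkv => hh.1.2 (v.2.up hkv (u.2.sub hh.1.1) hle)⟩ hle
  have hne : h ≠ hᶜ := fun e => u.2.cod hh.1.1 (e ▸ hh.1.1)
  have hcu := u.2.cod hh.1.1
  refine ⟨⟨_, flip_vtx S u.2 hh.1.1 hm⟩, h, ?_, hh.1, ?_⟩
  · ext k
    simp only [Set.mem_sdiff, Set.mem_union, Set.mem_singleton_iff]
    constructor
    · rintro ⟨a, b⟩; by_contra hc; exact b (Or.inl ⟨a, hc⟩)
    · rintro rfl; exact ⟨hh.1.1, by simp [hne]⟩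
  · ext k
    simp only [Set.mem_sdiff, Set.mem_union, Set.mem_singleton_iff]
    constructor
    · rintro ⟨⟨a, b⟩ | rfl, c⟩
      · exact ⟨⟨a, c⟩, b⟩
      · exact absurd ((v.2.tot (u.2.sub hh.1.1)).2 hh.1.2) c
    · rintro ⟨⟨a, b⟩, c⟩; exact ⟨Or.inl ⟨a, c⟩, b⟩

theorem dual_reach (S : Sys G o L) (n : ℕ) : ∀ u v : Vtx o L, (u.1 \ v.1).ncard = n →
    (dualGraph o L).Reachable u v := by
  induction n with
  | zero =>
    intro u v h
    by_cases e : u = v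
    · rw [e]
    obtain ⟨u', k, _, hk, _⟩ := exists_step S u v e
    rw [Set.ncard_eq_zero (u.2.dfin v.2)] at h
    rw [h] at hk; exact absurd hk (by simp)
  | succ n ih =>
    intro u v h
    by_cases e : u = v
    · rw [e]
    obtain ⟨u', k, h1, hk, h2⟩ := exists_step S u v e
    have a : (dualGraph o L).Adj u u' := ⟨k, h1⟩
    refine a.reachable.trans (ih u' v ?_)
    rw [h2, Set.ncard_sdiff_singleton_of_mem hk, h]; rfl

theorem side_const (S : Sys G o L) {u v x y : Vtx o L} {h : P} (e : u.1 \ v.1 = {h})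
    (a : (dualGraph o L).Adj x y) (hne : s(x, y) ≠ s(u, v)) : h ∈ x.1 ↔ h ∈ y.1 := by
  have key : ∀ x y : Vtx o L, (dualGraph o L).Adj x y → s(x, y) ≠ s(u, v) → h ∈ x.1 → h ∈ y.1 := by
    intro x y ⟨k, hk⟩ hne hx
    by_contra hy
    have : h ∈ x.1 \ y.1 := ⟨hx, hy⟩
    rw [hk] at this
    have h2 : h = k := this
    subst h2
    exact hne (by rw [edge_unique S hk e, edge_unique' S hk e])
  exact ⟨key x y a hne, key y x a.symm (by rwa [Sym2.eq_swap])⟩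

theorem cross (S : Sys G o L) {h : P} {u v : Vtx o L} (p : (dualGraph o L).Walk u v)
    (hu : h ∈ u.1) (hv : h ∉ v.1) : ∃ x y : Vtx o L, x.1 \ y.1 = {h} ∧ s(x, y) ∈ p.edges := by
  induction p with
  | nil => exact absurd hu hv
  | @cons a b c e p ih =>
    by_cases hb : h ∈ b.1
    · obtain ⟨x, y, h1, h2⟩ := ih hb hv
      exact ⟨x, y, h1, by simp [h2]⟩
    · have e0 := e
      obtain ⟨k, hk⟩ := e0
      have : h ∈ a.1 \ b.1 := ⟨hu, hb⟩
      rw [hk] at this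
      have h2 : h = k := this
      subst h2
      exact ⟨a, b, hk, by simp⟩

theorem cross' (S : Sys G o L) {h : P} {u v : Vtx o L} (p : (dualGraph o L).Walk u v)
    (hu : h ∉ u.1) (hv : h ∈ v.1) : ∃ x y : Vtx o L, x.1 \ y.1 = {h} ∧ s(x, y) ∈ p.edges := by
  obtain ⟨x, y, a, b⟩ := cross S p.reverse hv hu
  exact ⟨x, y, a, by simpa using b⟩

theorem dual_isTree (S : Sys G o L) [Nonempty (Vtx o L)] : (dualGraph o L).IsTree := by
  refine ⟨⟨fun u v => dual_reach S _ u v rfl⟩, ?_⟩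
  rw [SimpleGraph.isAcyclic_iff_forall_adj_isBridge]
  intro u v a
  rw [SimpleGraph.isBridge_iff]
  obtain ⟨h, e⟩ := a
  have m : h ∈ u.1 \ v.1 := by rw [e]; rfl
  rintro ⟨p⟩
  have : ∀ x y : Vtx o L, ∀ p : ((dualGraph o L).deleteEdges {s(u, v)}).Walk x y,
      h ∈ x.1 → h ∈ y.1 := by
    intro x y p
    induction p with
    | nil => exact id
    | cons a p ih =>
      intro hx
      rw [SimpleGraph.deleteEdges_adj] at a
      exact ih ((side_const S e a.1 (by simpa using a.2)).1 hx)
  exact m.2 (this _ _ p m.1)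

theorem path_btw (S : Sys G o L) {u v w : Vtx o L} {h : P} (p : (dualGraph o L).Walk u v)
    (hp : p.IsPath) (hw : w ∈ p.support) (hu : h ∈ u.1) (hv : h ∈ v.1) : h ∈ w.1 := by
  by_contra hn
  obtain ⟨q, r, e⟩ := SimpleGraph.Walk.mem_support_iff_exists_append.1 hw
  obtain ⟨x, y, a1, b1⟩ := cross S q hu hn
  obtain ⟨x', y', a2, b2⟩ := cross' S r hn hv
  rw [← edge_unique S a1 a2, ← edge_unique' S a1 a2] at b2
  have := hp.isTrail.edges_nodup
  rw [e, SimpleGraph.Walk.edges_append, List.nodup_append] at this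
  exact this.2.2 _ b1 _ b2 rfl

theorem path_first (S : Sys G o L) {u v w : Vtx o L} {h : P} (p : (dualGraph o L).Walk u v)
    (e : u.1 \ w.1 = {h}) (hv : h ∉ v.1) : w ∈ p.support := by
  have m : h ∈ u.1 \ w.1 := by rw [e]; rfl
  obtain ⟨x, y, a1, b1⟩ := cross S p m.1 hv
  rw [edge_unique' S e a1]
  exact SimpleGraph.Walk.snd_mem_support_of_mem_edges _ b1

theorem path_sum (S : Sys G o L) (wt : P → ℝ) {u v : Vtx o L} (p : (dualGraph o L).Walk u v)
    (hp : p.IsPath) (len : Vtx o L → Vtx o L → ℝ)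
    (hl : ∀ (x y : Vtx o L) (h : P), x.1 \ y.1 = {h} → len x y = wt h) :
    (p.darts.map fun d => len d.toProd.1 d.toProd.2).sum = ∑ᶠ h ∈ u.1 \ v.1, wt h := by
  induction p with
  | nil => simp
  | @cons a b c e p ih =>
    rw [SimpleGraph.Walk.cons_isPath_iff] at hp
    have e0 := e
    obtain ⟨h, hk⟩ := e0
    have m : h ∈ a.1 \ b.1 := by rw [hk]; rfl
    have hc : h ∉ c.1 := by
      intro hc
      obtain ⟨x, y, a1, b1⟩ := cross' S p m.2 hc
      apply hp.2
      rw [edge_unique S hk a1]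
      exact SimpleGraph.Walk.fst_mem_support_of_mem_edges _ b1
    have hd : a.1 \ c.1 = insert h (b.1 \ c.1) := by
      ext k
      simp only [Set.mem_sdiff, Set.mem_insert_iff]
      constructor
      · rintro ⟨h1, h2⟩
        by_cases hb : k ∈ b.1
        · right; exact ⟨hb, h2⟩
        · left
          have : k ∈ a.1 \ b.1 := ⟨h1, hb⟩
          rw [hk] at this; exact this
      · rintro (rfl | ⟨h1, h2⟩)
        · exact ⟨m.1, hc⟩
        · refine ⟨?_, h2⟩
          by_contra ha
          have := dcompl b.2 a.2 ⟨h1, ha⟩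
          rw [hk] at this
          have h3 : kᶜ = h := this
          exact hc (h3 ▸ (c.2.tot (b.2.sub h1)).2 h2)
    rw [hd, finsum_mem_insert _ (fun x => m.2 x.1) (b.2.dfin c.2)]
    simp only [SimpleGraph.Walk.darts_cons, List.map_cons, List.sum_cons]
    rw [ih hp.1, hl a b h hk]

end PocSec

section RhoSec

variable {G P : Type u} [Group G] [Poc P] [PocAct G P] {o : Pt P} {L : Set P}

/-- essential elements -/
def Ess (G : Type u) {P : Type u} [Group G] [Poc P] [PocAct G P] (h : P) : Prop := ∃ g : G, g • h < h

theorem Ess.smul {h : P} (e : Ess G h) (g : G) : Ess G (g • h) := by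
  obtain ⟨k, hk⟩ := e
  refine ⟨g * k * g⁻¹, ?_⟩
  rw [smul_smul, inv_mul_cancel_right, mul_smul, smul_lt_iff']
  exact hk

theorem compl_lt' {h k : P} (e : h < k) : kᶜ < hᶜ := by
  rw [lt_iff_le_not_ge] at e ⊢
  exact ⟨Poc.anti e.1, fun x => e.2 (compl_le_compl' x)⟩

theorem lt_compl_iff' {h k : P} : hᶜ < kᶜ ↔ k < h :=
  ⟨fun e => by simpa using compl_lt' e, compl_lt'⟩

theorem Ess.compl {h : P} (e : Ess G h) : Ess G hᶜ := by
  obtain ⟨k, hk⟩ := e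
  refine ⟨k⁻¹, ?_⟩
  rw [PocAct.scompl, lt_compl_iff', ← smul_lt_iff' k, smul_inv_smul]
  exact hk

theorem chain_anti {h : P} {g : G} (e : g • h < h) : StrictAnti (fun n : ℕ => g ^ n • h) := by
  apply strictAnti_nat_of_succ_lt
  intro n
  show g ^ (n + 1) • h < g ^ n • h
  rw [pow_succ, mul_smul, smul_lt_iff']
  exact e

theorem chain_inf {h : P} {g : G} (e : g • h < h) {s : Set P} (hs : s.Finite)
    (H : ∀ n : ℕ, g ^ n • h ∈ s) : False :=
  Set.infinite_of_injective_forall_mem (chain_anti e).injective H hs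

/-- translate of a vertex -/
def sv (g : G) (v : Set P) : Set P := {h | g⁻¹ • h ∈ v}

theorem mem_sv {g : G} {v : Set P} {h : P} : h ∈ sv g v ↔ g⁻¹ • h ∈ v := Iff.rfl

theorem sv_vtx (S : Sys G o L) (g : G) {v : Set P} (hv : IsVtx o L v) : IsVtx o L (sv g v) := by
  refine ⟨?_, ?_, ?_, ?_⟩
  · intro h hh
    have := S.smul g (hv.sub hh)
    rwa [smul_inv_smul] at this
  · intro h hh
    rw [mem_sv, PocAct.scompl]
    exact hv.tot (S.smul _ hh)
  · intro h k hh hk hle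
    exact hv.up hh (S.smul _ hk) (PocAct.mono _ hle)
  · have : {h ∈ sv g v | h ∉ o.m} ⊆ (fun h => g • h) '' ({h ∈ v | h ∉ o.m} ∪ {h ∈ L | h ∈ o.m ∧ g • h ∉ o.m}) := by
      rintro h ⟨h1, h2⟩
      refine ⟨g⁻¹ • h, ?_, smul_inv_smul _ _⟩
      by_cases h3 : g⁻¹ • h ∈ o.m
      · right; exact ⟨hv.sub h1, h3, by rwa [smul_inv_smul]⟩
      · left; exact ⟨h1, h3⟩
    exact ((hv.fin.union (S.fin g)).image _).subset this

theorem sv_mul (g k : G) (v : Set P) : sv (g * k) v = sv g (sv k v) := by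
  ext h; simp only [mem_sv, mul_inv_rev, mul_smul]

theorem sv_one (v : Set P) : sv (1 : G) v = v := by
  ext h; simp [mem_sv]

theorem sv_diff (g : G) (u v : Set P) : sv g u \ sv g v = (fun h => g • h) '' (u \ v) := by
  ext h
  constructor
  · intro hh; exact ⟨g⁻¹ • h, hh, smul_inv_smul _ _⟩
  · rintro ⟨k, hk, rfl⟩
    exact ⟨by simpa [mem_sv] using hk.1, by simpa [mem_sv] using hk.2⟩

/-- action on vertices -/
def actV (S : Sys G o L) : G →* Equiv.Perm (Vtx o L) where
  toFun g := ⟨fun v => ⟨sv g v.1, sv_vtx S g v.2⟩, fun v => ⟨sv g⁻¹ v.1, sv_vtx S g⁻¹ v.2⟩,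
    fun v => Subtype.ext (by show sv g⁻¹ (sv g v.1) = v.1; rw [← sv_mul, inv_mul_cancel, sv_one]),
    fun v => Subtype.ext (by show sv g (sv g⁻¹ v.1) = v.1; rw [← sv_mul, mul_inv_cancel, sv_one])⟩
  map_one' := by ext v; exact Set.ext_iff.1 (sv_one v.1) _
  map_mul' g k := by ext v; exact Set.ext_iff.1 (sv_mul g k v.1) _

theorem actV_val (S : Sys G o L) (g : G) (v : Vtx o L) : (actV S g v).1 = sv g v.1 := rfl

/-- base vertex -/
theorem base_vtx (S : Sys G o L) : IsVtx o L (o.m ∩ L) := by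
  refine ⟨fun h => h.2, ?_, ?_, ?_⟩
  · intro h hh
    constructor
    · rintro ⟨a, _⟩ ⟨b, _⟩; exact (o.co h).1 a b
    · intro hn; exact ⟨(o.co h).2 fun a => hn ⟨a, hh⟩, S.compl hh⟩
  · intro h k hh hk hle; exact ⟨o.up hle hh.1, hk⟩
  · convert Set.finite_empty
    ext h; simp only [Set.mem_ofPred_eq, Set.mem_empty_iff_false, iff_false]; rintro ⟨a, b⟩; exact b a.1

/-- systems giving trees -/
structure TSys (G : Type u) {P : Type u} [Group G] [Poc P] [PocAct G P] (o : Pt P)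
    (L : Set P) : Prop extends Sys G o L where
  noinv : ∀ (g : G) {h : P}, h ∈ L → g • h ≠ hᶜ
  ess : ∀ {h : P}, h ∈ L → Ess G h

theorem dual_min (S : TSys G o L) (X : Set (Vtx o L)) (hX : X.Nonempty)
    (inv : ∀ (g : G), ∀ v ∈ X, actV S.toSys g v ∈ X)
    (conv : ∀ u ∈ X, ∀ v ∈ X, ∀ p : (dualGraph o L).Walk u v, p.IsPath → ∀ w ∈ p.support, w ∈ X) :
    X = Set.univ := by
  by_contra hne
  obtain ⟨v, hv⟩ := (Set.ne_univ_iff_exists_notMem _).1 hne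
  obtain ⟨s, hs, hmin⟩ := exists_minimalFor_of_wellFoundedLT (fun s => s ∈ X)
    (fun s : Vtx o L => (s.1 \ v.1).ncard) hX
  have hsv : s ≠ v := fun e => hv (e ▸ hs)
  obtain ⟨s', h, e1, e2, e3⟩ := exists_step S.toSys s v hsv
  have all : ∀ t ∈ X, h ∈ t.1 := by
    intro t ht
    by_contra hn
    obtain ⟨p, hp⟩ := (dual_reach S.toSys _ s t rfl).exists_isPath
    have hs' := conv s hs t ht p hp s' (path_first S.toSys p e1 hn)
    have := hmin hs'
    have hlt : (s'.1 \ v.1).ncard < (s.1 \ v.1).ncard := by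
      rw [e3]
      exact Set.ncard_sdiff_singleton_lt_of_mem e2 (s.2.dfin v.2)
    exact absurd (this hlt.le) (not_le.2 hlt)
  have hL := s.2.sub e2.1
  have all' : ∀ g : G, g • h ∈ s.1 := by
    intro g
    have := all _ (inv g⁻¹ s hs)
    rw [actV_val, mem_sv, inv_inv] at this
    exact this
  obtain ⟨g', hg'⟩ := S.hit (S.compl hL)
  rw [PocAct.scompl, o.co] at hg'
  obtain ⟨g, hg⟩ := (S.ess hL).smul g'
  refine chain_inf hg s.2.fin fun n => ⟨?_, ?_⟩
  · rw [smul_smul]; exact all' _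
  · intro h2
    apply hg'
    refine o.up ?_ h2
    have := (chain_anti hg).antitone (Nat.zero_le n)
    simpa using this

/-- the dual tree -/
def dualT (S : TSys G o L) : GTree G where
  V := Vtx o L
  nonempty := ⟨⟨_, base_vtx S.toSys⟩⟩
  graph := dualGraph o L
  isTree := by
    have : Nonempty (Vtx o L) := ⟨⟨_, base_vtx S.toSys⟩⟩
    exact dual_isTree S.toSys
  act := actV S.toSys
  adj_act := by
    rintro g u v ⟨h, hh⟩
    refine ⟨g • h, ?_⟩
    rw [actV_val, actV_val, sv_diff, hh, Set.image_singleton]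
  noInversion := by
    rintro g u v ⟨h, hh⟩ ⟨h1, h2⟩
    have m : h ∈ u.1 \ v.1 := by rw [hh]; rfl
    have m2 := dcompl u.2 v.2 m
    have e : v.1 \ u.1 = (fun h => g • h) '' (u.1 \ v.1) := by
      rw [← sv_diff, ← actV_val S.toSys, ← actV_val S.toSys, h1, h2]
    rw [e, hh, Set.image_singleton] at m2
    exact S.noinv g (u.2.sub m.1) m2.symm
  minimal := dual_min S

/-- length function -/
noncomputable def dlen (o : Pt P) (L : Set P) (wt : P → ℝ) (u v : Vtx o L) : ℝ :=
  ∑ᶠ h ∈ u.1 \ v.1, wt h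

theorem dlen_symm (wt : P → ℝ) (hc : ∀ h, wt hᶜ = wt h) (u v : Vtx o L) :
    dlen o L wt u v = dlen o L wt v u := by
  unfold dlen
  apply finsum_mem_eq_of_bijOn (fun h => hᶜ)
  · refine ⟨fun h hh => dcompl u.2 v.2 hh, fun h _ k _ e => compl_inj' e, fun h hh => ?_⟩
    exact ⟨hᶜ, dcompl v.2 u.2 hh, Poc.cc h⟩
  · intro h _; exact (hc h).symm

theorem dlen_act (S : Sys G o L) (wt : P → ℝ) (hg : ∀ (g : G) h, wt (g • h) = wt h) (g : G)
    (u v : Vtx o L) : dlen o L wt (actV S g u) (actV S g v) = dlen o L wt u v := by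
  unfold dlen
  symm
  rw [actV_val, actV_val, sv_diff]
  apply finsum_mem_eq_of_bijOn (fun h => g • h)
  · exact Set.InjOn.bijOn_image (fun a _ b _ e => MulAction.injective g e)
  · intro h _; exact (hg g h).symm

/-- the dual metric tree -/
noncomputable def dualM (S : TSys G o L) (wt : P → ℝ) (hpos : ∀ h ∈ L, 0 < wt h)
    (hc : ∀ h, wt hᶜ = wt h) (hg : ∀ (g : G) h, wt (g • h) = wt h) : MGTree G where
  toGTree := dualT S
  len := dlen o L wt
  len_symm := dlen_symm wt hc
  len_pos := by
    rintro u v ⟨h, hh⟩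
    have m : h ∈ u.1 \ v.1 := by rw [hh]; rfl
    unfold dlen
    rw [hh, finsum_mem_singleton]
    exact hpos h (u.2.sub m.1)
  len_equivariant := dlen_act S.toSys wt hg

theorem tree_dist (T : MGTree G) {u v : T.V} (p : T.graph.Walk u v) (hp : p.IsPath) :
    T.dist u v = T.walkLen p := by
  unfold MGTree.dist
  have : {x : ℝ | ∃ p : T.graph.Walk u v, p.IsPath ∧ x = T.walkLen p} = {T.walkLen p} := by
    ext x
    constructor
    · rintro ⟨q, hq, rfl⟩
      have := (T.isTree.isAcyclic.subsingleton_path u v).elim ⟨q, hq⟩ ⟨p, hp⟩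
      rw [Subtype.mk.injEq] at this
      rw [this]; rfl
    · rintro rfl; exact ⟨p, hp, rfl⟩
  rw [this, csInf_singleton]

theorem tree_path (T : GTree G) (u v : T.V) : ∃ p : T.graph.Walk u v, p.IsPath :=
  (T.isTree.connected u v).exists_isPath

theorem dualM_dist (S : TSys G o L) (wt : P → ℝ) (hpos : ∀ h ∈ L, 0 < wt h)
    (hc : ∀ h, wt hᶜ = wt h) (hg : ∀ (g : G) h, wt (g • h) = wt h) (u v : Vtx o L) :
    (dualM S wt hpos hc hg).dist u v = dlen o L wt u v := by
  obtain ⟨p, hp⟩ := tree_path (dualT S) u v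
  rw [tree_dist (dualM S wt hpos hc hg) p hp]
  exact path_sum S.toSys wt p hp (dlen o L wt) (by
    intro x y h e; unfold dlen; rw [e, finsum_mem_singleton])

end RhoSec

section GoodSec

theorem ms_mono {α : Type*} {f : α → ℝ} (hf : ∀ a, 0 ≤ f a) {s t : Set α} (ht : t.Finite) (h : s ⊆ t) :
    ∑ᶠ a ∈ s, f a ≤ ∑ᶠ a ∈ t, f a := by
  rw [finsum_mem_eq_finite_toFinset_sum f (ht.subset h), finsum_mem_eq_finite_toFinset_sum f ht]
  apply Finset.sum_le_sum_of_subset_of_nonneg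
  · intro a; simpa using fun x => h x
  · intro a _ _; exact hf a

theorem ms_nonneg {α : Type*} {f : α → ℝ} (hf : ∀ a, 0 ≤ f a) (s : Set α) :
    0 ≤ ∑ᶠ a ∈ s, f a := finsum_nonneg fun a => finsum_nonneg fun _ => hf a

theorem ms_union {α : Type*} {f : α → ℝ} (hf : ∀ a, 0 ≤ f a) {s t : Set α} (hs : s.Finite)
    (ht : t.Finite) : ∑ᶠ a ∈ s ∪ t, f a ≤ ∑ᶠ a ∈ s, f a + ∑ᶠ a ∈ t, f a := by
  rw [← finsum_mem_union_inter hs ht]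
  linarith [ms_nonneg hf (s ∩ t)]

/-- crossing lemma for generators -/
theorem gen_cross (G : Type u) [Group G] [Group.FG G] : ∃ S : Set G, S.Finite ∧ ∀ p : G → Prop, p 1 →
    ∀ g, ¬ p g → ∃ g' s, s ∈ S ∧ p g' ∧ ¬ p (g' * s) := by
  obtain ⟨S, hS⟩ := (Group.fg_def.1 inferInstance : (⊤ : Subgroup G).FG)
  refine ⟨(S : Set G) ∪ (S : Set G)⁻¹, S.finite_toSet.union S.finite_toSet.inv, ?_⟩
  intro p p1 g hg
  by_contra hn
  push Not at hn
  let M : Subgroup G :=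
    { carrier := {g | ∀ g', p g' ↔ p (g' * g)}
      one_mem' := by intro g'; simp
      mul_mem' := by
        intro a b ha hb g'
        rw [ha g', hb (g' * a), mul_assoc]
      inv_mem' := by
        intro a ha g'
        have := ha (g' * a⁻¹)
        rw [inv_mul_cancel_right] at this
        exact this.symm }
  have hM : Subgroup.closure (S : Set G) ≤ M := by
    rw [Subgroup.closure_le]
    intro s hs g'
    constructor
    · intro h; exact hn g' s (Or.inl hs) h
    · intro h
      have := hn (g' * s) s⁻¹ (Or.inr (by simpa using hs)) h
      simpa using this
  rw [hS] at hM
  have := (hM (Subgroup.mem_top g)) 1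
  rw [one_mul] at this
  exact hg (this.1 p1)

variable {G P : Type u} [Group G] [Poc P] [PocAct G P] {o : Pt P} {L : Set P}

/-- support -/
def sp {P : Type u} (wt : P → ℝ) : Set P := {h | wt h ≠ 0}

/-- essential support -/
def ep (G : Type u) {P : Type u} [Group G] [Poc P] [PocAct G P] (wt : P → ℝ) : Set P :=
  {h | wt h ≠ 0 ∧ Ess G h}

/-- walls separating base points -/
def sepo (o : Pt P) (L : Set P) (g : G) : Set P := {h ∈ L | h ∈ o.m ∧ g • h ∉ o.m}

/-- good weights -/
structure Good (El : Subgroup G → Prop) (o : Pt P) (wt : P → ℝ) : Prop where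
  nonneg : ∀ h, 0 ≤ wt h
  wc : ∀ h, wt hᶜ = wt h
  wg : ∀ (g : G) h, wt (g • h) = wt h
  sys : Sys G o (sp wt)
  noinv : ∀ (g : G) {h : P}, wt h ≠ 0 → g • h ≠ hᶜ
  E1 : ∀ K, El K → ∃ C : ℕ, ∀ k ∈ K, (sepo o (sp wt) k).ncard ≤ C
  E2 : ∀ K : Subgroup G, (∃ C : ℝ, ∀ k ∈ K, ∑ᶠ h ∈ sepo o (sp wt) k, wt h ≤ C) → El K

theorem Good.pos {El : Subgroup G → Prop} {wt : P → ℝ} (H : Good El o wt) {h : P} (hh : wt h ≠ 0) :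
    0 < wt h := lt_of_le_of_ne (H.nonneg h) (Ne.symm hh)

theorem sys_sub (S : Sys G o L) {L' : Set P} (h : L' ⊆ L) (hc : ∀ {h}, h ∈ L' → hᶜ ∈ L')
    (hs : ∀ (g : G) {h}, h ∈ L' → g • h ∈ L') : Sys G o L' :=
  ⟨hc, hs, fun a b => S.nested (h a) (h b), fun g => (S.fin g).subset fun _ x => ⟨h x.1, x.2⟩,
    fun a => S.hit (h a)⟩

theorem Good.tsys {El : Subgroup G → Prop} {wt : P → ℝ} (H : Good El o wt) : TSys G o (ep G wt) := by
  refine ⟨sys_sub H.sys (fun h hh => hh.1) ?_ ?_, ?_, ?_⟩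
  · intro h hh; exact ⟨by rw [H.wc]; exact hh.1, hh.2.compl⟩
  · intro g h hh; exact ⟨by rw [H.wg]; exact hh.1, hh.2.smul g⟩
  · intro g h hh; exact H.noinv g hh.1
  · intro h hh; exact hh.2

/-- the tree of a good weight -/
noncomputable def rho {El : Subgroup G → Prop} {wt : P → ℝ} (H : Good El o wt) : MGTree G :=
  dualM H.tsys wt (fun _ hh => H.pos hh.1) H.wc H.wg

theorem noness_type (S : Sys G o L) (ni : ∀ (g : G) {h : P}, h ∈ L → g • h ≠ hᶜ) {h : P} (hL : h ∈ L)
    (hn : ¬ Ess G h) : (∀ g : G, g • h = h ∨ g • h ≤ hᶜ) ∨ (∀ g : G, g • hᶜ = hᶜ ∨ g • hᶜ ≤ h) := by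
  have key : ∀ g : G, g • h ≤ h → g • h = h := by
    intro g e
    by_contra hne
    exact hn ⟨g, lt_of_le_of_ne e hne⟩
  have all : ∀ g : G, g • h = h ∨ g • h ≤ hᶜ ∨ g • hᶜ ≤ h := by
    intro g
    rcases S.nested (S.smul g hL) hL with e | e | e | e
    · exact Or.inl (key g e)
    · left
      have := key g⁻¹ (by rw [← smul_le_iff' g, smul_inv_smul]; exact e)
      rw [inv_smul_eq_iff] at this; exact this.symm
    · exact Or.inr (Or.inl e)
    · right; right; rw [PocAct.scompl]; exact e
  by_contra hcon
  push Not at hcon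
  obtain ⟨⟨g1, a1, a2⟩, g2, b1, b2⟩ := hcon
  have a3 : g1 • hᶜ ≤ h := by rcases all g1 with e | e | e; exacts [absurd e a1, absurd e a2, e]
  have b3 : g2 • h ≤ hᶜ := by
    rcases all g2 with e | e | e
    · exact absurd (by rw [PocAct.scompl, e]) b1
    · exact e
    · exact absurd e b2
  have a4 : hᶜ ≤ g1⁻¹ • h := by rw [← smul_le_iff' g1, smul_inv_smul]; exact a3
  have c1 : g1 • (g2 • h) ≤ h := by
    have := PocAct.mono g1 (b3.trans a4); rwa [smul_inv_smul] at this
  rw [smul_smul] at c1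
  have c2 := key _ c1
  rw [mul_smul, ← eq_inv_smul_iff] at c2
  exact ni g2 hL (le_antisymm b3 (by rw [c2]; exact a4))

theorem noness_gen {S : Set G} (hS : ∀ p : G → Prop, p 1 → ∀ g, ¬ p g → ∃ g' s, s ∈ S ∧ p g' ∧ ¬ p (g' * s))
    {h : P} (ht : ∀ g : G, g • h = h ∨ g • h ≤ hᶜ) (ho : h ∈ o.m) {k : G} (hk : k • h ∉ o.m) :
    ∃ s ∈ S, s⁻¹ • h ∉ o.m := by
  obtain ⟨g', s, hs, h1, h2⟩ := hS (fun g => g⁻¹ • h ∈ o.m) (by simpa using ho) k⁻¹ (by simpa using hk)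
  refine ⟨s, hs, ?_⟩
  rcases ht g'⁻¹ with e | e
  · rw [mul_inv_rev, mul_smul, e] at h2; exact h2
  · exact absurd ho ((o.co h).1 (o.up e h1))

theorem ms_bound {f : P → ℝ} (hf : ∀ a, 0 ≤ f a) (hg : ∀ (g : G) h, f (g • h) = f h) (k : G) {s M M' : Set P}
    (hM : M.Finite) (hM' : M'.Finite) (h : s ⊆ M ∪ {h | k • h ∈ M'}) :
    ∑ᶠ a ∈ s, f a ≤ ∑ᶠ a ∈ M, f a + ∑ᶠ a ∈ M', f a := by
  have e : {h | k • h ∈ M'} = (fun h => k⁻¹ • h) '' M' := by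
    ext h; constructor
    · intro hh; exact ⟨k • h, hh, inv_smul_smul _ _⟩
    · rintro ⟨a, ha, rfl⟩; simpa using ha
  have f2 : {h | k • h ∈ M'}.Finite := by rw [e]; exact hM'.image _
  have e2 : ∑ᶠ a ∈ M', f a = ∑ᶠ a ∈ {h | k • h ∈ M'}, f a := by
    rw [e]
    apply finsum_mem_eq_of_bijOn (fun h => k⁻¹ • h)
    · exact Set.InjOn.bijOn_image (fun a _ b _ e => MulAction.injective k⁻¹ e)
    · intro h _; exact (hg _ h).symm
  rw [e2]
  exact (ms_mono hf (hM.union f2) h).trans (ms_union hf hM f2)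

theorem rho_el_mp [Group.FG G] {El : Subgroup G → Prop} {wt : P → ℝ} (H : Good El o wt) {K : Subgroup G}
    (hK : (rho H).toGTree.Elliptic K) : El K := by
  obtain ⟨v, hv⟩ := hK
  obtain ⟨S, hSf, hS⟩ := gen_cross G
  have v2 : IsVtx o (ep G wt) v.1 := v.2
  set N1 : Set P := ⋃ s ∈ S, sepo o (sp wt) s⁻¹ with hN1
  have fN1 : N1.Finite := hSf.biUnion fun s _ => H.sys.fin _
  set Fv : Set P := {h ∈ v.1 | h ∉ o.m} with hFv
  have fFv : Fv.Finite := v2.fin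
  apply H.E2
  refine ⟨_, fun k hk => ms_bound H.nonneg H.wg k (M := compl '' Fv ∪ N1) (M' := Fv ∪ compl '' N1)
    ((fFv.image _).union fN1) (fFv.union (fN1.image _)) ?_⟩
  rintro h ⟨h1, h2, h3⟩
  have hfix : sv k v.1 = v.1 := congrArg Subtype.val (hv k hk)
  by_cases he : Ess G h
  · by_cases hhv : h ∈ v.1
    · right; left
      refine ⟨?_, h3⟩
      rw [← hfix, mem_sv, inv_smul_smul]; exact hhv
    · left; left
      exact ⟨hᶜ, ⟨(v2.tot ⟨h1, he⟩).2 hhv, fun x => (o.co h).1 x h2⟩, Poc.cc h⟩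
  · rcases noness_type H.sys H.noinv h1 he with ht | ht
    · left; right
      obtain ⟨s, hs, hs2⟩ := noness_gen hS ht h2 h3
      exact Set.mem_biUnion hs ⟨h1, h2, hs2⟩
    · right; right
      refine ⟨(k • h)ᶜ, ?_, Poc.cc _⟩
      have ht' : ∀ g : G, g • (k • hᶜ) = k • hᶜ ∨ g • (k • hᶜ) ≤ (k • hᶜ)ᶜ := by
        intro g
        rw [← PocAct.scompl, Poc.cc]
        rcases ht (k⁻¹ * g * k) with e | e
        · left
          rw [mul_smul, mul_smul, inv_smul_eq_iff] at e; exact e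
        · right
          rw [mul_smul, mul_smul] at e
          have := PocAct.mono k e
          rwa [smul_inv_smul] at this
      rw [← PocAct.scompl]
      have m1 : k • hᶜ ∈ o.m := by rw [PocAct.scompl]; exact (o.co _).2 h3
      obtain ⟨s, hs, hs2⟩ := noness_gen hS ht' m1 (k := k⁻¹) (by
        rw [inv_smul_smul]; exact fun x => (o.co h).1 x h2)
      exact Set.mem_biUnion hs ⟨H.sys.smul k (H.sys.compl h1), m1, hs2⟩

/-- centre of a bounded orbit -/
def ctr {Λ : Type u} [Group Λ] [PocAct Λ P] (K : Subgroup Λ) (m : Set P) (h : P) : Prop :=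
  (∃ k ∈ K, k • hᶜ < h) ∨ ((∀ k ∈ K, k • h = h) ∧ h ∈ m)

end GoodSec

section CtrSec
variable {Λ P : Type u} [Group Λ] [Poc P] [PocAct Λ P] {o : Pt P} {L : Set P} {K : Subgroup Λ}

/-- hypotheses for centres -/
structure CtrH (K : Subgroup Λ) (o : Pt P) (L : Set P) : Prop where
  compl : ∀ {h : P}, h ∈ L → hᶜ ∈ L
  smul : ∀ k ∈ K, ∀ {h : P}, h ∈ L → k • h ∈ L
  nested : ∀ {h k : P}, h ∈ L → k ∈ L → h ≤ k ∨ k ≤ h ∨ h ≤ kᶜ ∨ hᶜ ≤ k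
  nle : ∀ {h : P}, h ∈ L → ¬ h ≤ hᶜ
  noinv : ∀ k ∈ K, ∀ {h : P}, h ∈ L → k • h ≠ hᶜ
  nlt : ∀ k ∈ K, ∀ {h : P}, h ∈ L → ¬ k • h < h
  bdd : ∃ C : ℕ, ∀ k ∈ K, (sepo o L k).Finite ∧ (sepo o L k).ncard ≤ C

theorem ctr_tri (H : CtrH K o L) {h : P} (hh : h ∈ L) :
    (∃ k ∈ K, k • hᶜ < h) ∨ (∃ k ∈ K, k • h < hᶜ) ∨ (∀ k ∈ K, k • h = h) := by
  by_contra hcon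
  push Not at hcon
  obtain ⟨h1, h2, k, hk, h3⟩ := hcon
  rcases H.nested (H.smul k hk hh) hh with e | e | e | e
  · exact H.nlt k hk hh (lt_of_le_of_ne e h3)
  · refine H.nlt k⁻¹ (K.inv_mem hk) hh (lt_of_le_of_ne ?_ ?_)
    · rw [← smul_le_iff' k, smul_inv_smul]; exact e
    · intro e2; rw [inv_smul_eq_iff] at e2; exact h3 e2.symm
  · exact h2 k hk (lt_of_le_of_ne e (H.noinv k hk hh))
  · rw [← PocAct.scompl] at e
    refine h1 k hk (lt_of_le_of_ne e ?_)
    have := H.noinv k hk (H.compl hh)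
    rwa [Poc.cc] at this

theorem ctr_excl (H : CtrH K o L) {h : P} (hh : h ∈ L) (h1 : ∃ k ∈ K, k • hᶜ < h)
    (h2 : ∃ k ∈ K, k • h < hᶜ) : False := by
  obtain ⟨k, hk, e⟩ := h1
  obtain ⟨k', hk', e'⟩ := h2
  refine H.nlt (k' * k) (K.mul_mem hk' hk) (H.compl hh) ?_
  rw [mul_smul]
  exact ((smul_lt_iff' k').2 e).trans e'

theorem ctr_vtx (H : CtrH K o L) : IsVtx o L {h ∈ L | ctr K o.m h} := by
  have tot : ∀ {h : P}, h ∈ L → (ctr K o.m hᶜ ↔ ¬ ctr K o.m h) := by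
    intro h hh
    have fixc : (∀ k ∈ K, k • h = h) → ∀ k ∈ K, k • hᶜ = hᶜ := fun x k hk => by
      rw [PocAct.scompl, x k hk]
    have ex1 : (∀ k ∈ K, k • h = h) → ¬ (∃ k ∈ K, k • hᶜ < h) := by
      rintro x ⟨k, hk, e⟩
      rw [fixc x k hk] at e
      exact H.nle (H.compl hh) (by rw [Poc.cc]; exact e.le)
    have ex2 : (∀ k ∈ K, k • h = h) → ¬ (∃ k ∈ K, k • h < hᶜ) := by
      rintro x ⟨k, hk, e⟩
      rw [x k hk] at e
      exact H.nle hh e.le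
    have fixc' : (∀ k ∈ K, k • hᶜ = hᶜ) → (∀ k ∈ K, k • h = h) := fun x k hk => by
      have := x k hk; rw [PocAct.scompl] at this; exact compl_inj' this
    unfold ctr
    rw [Poc.cc, o.co]
    rcases ctr_tri H hh with a | a | a
    · have b : ¬ ∃ k ∈ K, k • h < hᶜ := fun b => ctr_excl H hh a b
      have c : ¬ ∀ k ∈ K, k • hᶜ = hᶜ := fun c => ex1 (fixc' c) a
      simp only [a, b, c, true_or, false_or, false_and, not_true]
    · have b : ¬ ∃ k ∈ K, k • hᶜ < h := fun b => ctr_excl H hh b a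
      have c : ¬ ∀ k ∈ K, k • h = h := fun c => ex2 c a
      simp only [a, b, c, true_or, false_or, false_and, not_false_eq_true]
    · have b := ex1 a
      have b2 := ex2 a
      have b3 := fixc a
      rw [iff_false_intro b, iff_false_intro b2, iff_true_intro a, iff_true_intro b3]
      simp only [false_or, true_and]
  have up : ∀ {h k : P}, h ∈ L → ctr K o.m h → k ∈ L → h ≤ k → ctr K o.m k := by
    intro h h' hh hc hh' hle
    rcases hc with ⟨k, hk, e⟩ | ⟨a, b⟩
    · left
      exact ⟨k, hk, ((PocAct.mono k (Poc.anti hle)).trans_lt e).trans_le hle⟩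
    · rcases ctr_tri H hh' with c | ⟨k, hk, e⟩ | c
      · exact Or.inl c
      · exfalso
        have h1 := PocAct.mono k hle
        rw [a k hk] at h1
        exact H.nle hh ((h1.trans e.le).trans (Poc.anti hle))
      · exact Or.inr ⟨c, o.up hle b⟩
  refine ⟨fun h => h.1, ?_, ?_, ?_⟩
  · intro h hh
    constructor
    · rintro ⟨_, a⟩ ⟨_, b⟩; exact (tot hh).1 a b
    · intro hn; exact ⟨H.compl hh, (tot hh).2 fun a => hn ⟨hh, a⟩⟩
  · rintro h k ⟨a, b⟩ hk hle; exact ⟨hk, up a b hk hle⟩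
  · by_contra hinf
    obtain ⟨C, hC⟩ := H.bdd
    obtain ⟨s, hs, hcard⟩ := Set.Infinite.exists_subset_card_eq hinf (C + 1)
    have hne : s.Nonempty := by rw [← Finset.card_pos, hcard]; omega
    obtain ⟨h, hmem, hmin⟩ := s.exists_minimal hne
    have chn : ∀ k ∈ s, h ≤ k := by
      intro k hk
      obtain ⟨⟨a1, a2⟩, a3⟩ := hs hmem
      obtain ⟨⟨b1, b2⟩, b3⟩ := hs hk
      rcases H.nested a1 b1 with e | e | e | e
      · exact e
      · exact hmin hk e
      · exact absurd b2 ((tot b1).1 (up a1 a2 (H.compl b1) e))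
      · exact absurd (o.up e ((o.co h).2 a3)) b3
    obtain ⟨⟨a1, a2⟩, a3⟩ := hs hmem
    rcases a2 with ⟨k, hk, e⟩ | ⟨_, b⟩
    · obtain ⟨f1, f2⟩ := hC k hk
      have sub : compl '' (s : Set P) ⊆ sepo o L k := by
        rintro _ ⟨j, hj, rfl⟩
        obtain ⟨⟨b1, _⟩, b3⟩ := hs hj
        refine ⟨H.compl b1, (o.co j).2 b3, ?_⟩
        intro hx
        apply b3
        exact o.up (((PocAct.mono k (Poc.anti (chn j hj))).trans e.le).trans (chn j hj)) hx
      have := Set.ncard_le_ncard sub f1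
      rw [Set.ncard_image_of_injective _ (fun a b e => compl_inj' e), Set.ncard_coe_finset] at this
      omega
    · exact a3 b

theorem ctr_inv {m : Set P} {k : Λ} (hk : k ∈ K) {h : P} : ctr K m (k • h) ↔ ctr K m h := by
  have key : ∀ (k : Λ), k ∈ K → ∀ h : P, ctr K m h → ctr K m (k • h) := by
    rintro k hk h (⟨j, hj, e⟩ | ⟨a, b⟩)
    · left
      refine ⟨k * j * k⁻¹, K.mul_mem (K.mul_mem hk hj) (K.inv_mem hk), ?_⟩
      rw [← PocAct.scompl, mul_smul, mul_smul, inv_smul_smul, smul_lt_iff']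
      exact e
    · right
      rw [a k hk]; exact ⟨a, b⟩
  refine ⟨fun e => ?_, key k hk h⟩
  have := key k⁻¹ (K.inv_mem hk) _ e
  rwa [inv_smul_smul] at this

end CtrSec

section ElSec
variable {G P : Type u} [Group G] [Poc P] [PocAct G P] {o : Pt P} {L : Set P}

theorem chain_out (S : Sys G o L) {h : P} (hL : h ∈ L) {k : G} (hk : k • h < h) :
    ∃ n : ℕ, k ^ n • h ∉ o.m := by
  by_contra hcon
  push Not at hcon
  obtain ⟨g, hg⟩ := S.hit (S.compl hL)
  refine chain_inf hk (S.fin g) fun n => ⟨S.smul _ hL, hcon n, ?_⟩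
  intro hx
  rw [PocAct.scompl, o.co] at hg
  exact hg (o.up (PocAct.mono g (by simpa using (chain_anti hk).antitone (Nat.zero_le n))) hx)

theorem orbit_unb (S : Sys G o L) {h : P} (hL : h ∈ L) {k : G} (hk : k • h < h) (C : ℕ) :
    ∃ n : ℕ, C < (sepo o L (k ^ n)).ncard := by
  have hk' : k⁻¹ • hᶜ < hᶜ := by
    rw [PocAct.scompl, lt_compl_iff', ← smul_lt_iff' k, smul_inv_smul]; exact hk
  obtain ⟨i, hi⟩ := chain_out S (S.compl hL) hk'
  rw [PocAct.scompl, o.co, not_not] at hi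
  have a0 : k • (k⁻¹ ^ i • h) < k⁻¹ ^ i • h := by
    rw [smul_smul, ((Commute.refl k).inv_right.pow_right i).eq, mul_smul, smul_lt_iff']
    exact hk
  have hex := chain_out S (S.smul (k⁻¹ ^ i) hL) a0
  have hm := Nat.find_spec hex
  have hp : Nat.find hex ≠ 0 := by
    intro e; rw [e] at hm; simp only [pow_zero, one_smul] at hm; exact hm hi
  obtain ⟨m, hm2⟩ := Nat.exists_eq_succ_of_ne_zero hp
  have hm3 := Nat.find_min hex (m := m) (by omega)
  rw [not_not] at hm3
  rw [hm2] at hm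
  set a : P := k ^ m • k⁻¹ ^ i • h with ha
  have aL : a ∈ L := S.smul _ (S.smul _ hL)
  have ka : k • a ∉ o.m := by rwa [ha, smul_smul, ← pow_succ']
  have alt : k • a < a := by
    rw [ha, smul_smul, ← pow_succ', pow_succ, mul_smul, smul_lt_iff']; exact a0
  have ca := chain_anti alt
  have alt' : k⁻¹ • aᶜ < aᶜ := by
    rw [PocAct.scompl, lt_compl_iff', ← smul_lt_iff' k, smul_inv_smul]; exact alt
  have ca' := chain_anti alt'
  refine ⟨C + 1, ?_⟩
  have inj : Function.Injective fun n : ℕ => k⁻¹ ^ n • a := by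
    intro x y e
    apply ca'.injective
    simp only [PocAct.scompl] at e ⊢
    rw [e]
  have sub : (fun n : ℕ => k⁻¹ ^ n • a) '' (Finset.range (C + 1) : Set ℕ) ⊆ sepo o L (k ^ (C + 1)) := by
    rintro _ ⟨n, hn, rfl⟩
    simp only [Finset.coe_range, Set.mem_Iio] at hn
    refine ⟨S.smul _ aL, ?_, ?_⟩
    · have := ca'.antitone (Nat.zero_le n)
      simp only [pow_zero, one_smul, PocAct.scompl] at this
      exact o.up (compl_le_compl' this) hm3
    · intro hx
      apply ka
      have e1 : k ^ (C + 1) • k⁻¹ ^ n • a = k ^ (C + 1 - n) • a := by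
        rw [smul_smul]; congr 1
        rw [inv_pow, ← pow_sub k hn.le]
      simp only at hx
      rw [e1] at hx
      have := ca.antitone (show 1 ≤ C + 1 - n by omega)
      simp only [pow_one] at this
      exact o.up this hx
  have := Set.ncard_le_ncard sub (S.fin _)
  rw [Set.ncard_image_of_injective _ inj, Set.ncard_coe_finset, Finset.card_range] at this
  omega

theorem bdd_fix (S : Sys G o L) (ni : ∀ (g : G) {h : P}, h ∈ L → g • h ≠ hᶜ) {K : Subgroup G} {C : ℕ}
    (hC : ∀ k ∈ K, (sepo o L k).ncard ≤ C) : ∃ v, IsVtx o L v ∧ ∀ k ∈ K, sv k v = v := by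
  have CH : CtrH K o L :=
    { compl := fun hh => S.compl hh
      smul := fun k _ _ hh => S.smul k hh
      nested := fun a b => S.nested a b
      nle := fun hh => S.not_le_compl hh
      noinv := fun k _ _ hh => ni k hh
      nlt := by
        intro k hk h hh e
        obtain ⟨n, hn⟩ := orbit_unb S hh e C
        exact absurd (hC _ (K.pow_mem hk n)) (by omega)
      bdd := ⟨C, fun k hk => ⟨S.fin k, hC k hk⟩⟩ }
  refine ⟨_, ctr_vtx CH, fun k hk => ?_⟩
  ext h
  rw [mem_sv]
  constructor
  · rintro ⟨a, b⟩
    have := S.smul k a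
    rw [smul_inv_smul] at this
    exact ⟨this, (ctr_inv (K.inv_mem hk)).1 b⟩
  · rintro ⟨a, b⟩
    exact ⟨S.smul _ a, (ctr_inv (K.inv_mem hk)).2 b⟩

theorem rho_el_mpr {El : Subgroup G → Prop} {wt : P → ℝ} (H : Good El o wt) {K : Subgroup G}
    (hK : El K) : (rho H).toGTree.Elliptic K := by
  have TS := H.tsys
  obtain ⟨C, hC⟩ := H.E1 K hK
  have sub : ∀ k : G, sepo o (ep G wt) k ⊆ sepo o (sp wt) k := fun k h hh => ⟨hh.1.1, hh.2⟩
  obtain ⟨v, hv, hf⟩ := bdd_fix TS.toSys (fun g _ hh => TS.noinv g hh) (C := C) fun k hk =>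
    (Set.ncard_le_ncard (sub k) (H.sys.fin k)).trans (hC k hk)
  exact ⟨⟨v, hv⟩, fun k hk => Subtype.ext (hf k hk)⟩

theorem Sys.orb [Group.FG G] (S : Sys G o L) : ∃ M : Set P, M.Finite ∧ M ⊆ L ∧ ∀ h ∈ L, ∃ g : G, g • h ∈ M := by
  obtain ⟨X, hXf, hX⟩ := gen_cross G
  refine ⟨⋃ s ∈ X, sepo o L s⁻¹, hXf.biUnion fun s _ => S.fin _, ?_, ?_⟩
  · intro h hh
    simp only [Set.mem_iUnion] at hh
    obtain ⟨s, _, hs⟩ := hh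
    exact hs.1
  · intro h hh
    obtain ⟨g1, h1⟩ := S.hit hh
    obtain ⟨g2, h2⟩ := S.hit (S.compl hh)
    rw [PocAct.scompl, o.co] at h2
    obtain ⟨g', s, hs, a, b⟩ := hX (fun g => g⁻¹ • g1 • h ∈ o.m) (by simpa using h1) (g2 * g1⁻¹)⁻¹
      (by rw [inv_inv, mul_smul, inv_smul_smul]; exact h2)
    refine ⟨g'⁻¹ * g1, ?_⟩
    simp only [Set.mem_iUnion]
    rw [mul_inv_rev, mul_smul] at b
    rw [mul_smul]
    exact ⟨s, hs, S.smul _ (S.smul _ hh), a, b⟩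

theorem rho_el [Group.FG G] {El : Subgroup G → Prop} {wt : P → ℝ} (H : Good El o wt) (K : Subgroup G) :
    (rho H).toGTree.Elliptic K ↔ El K := ⟨rho_el_mp H, rho_el_mpr H⟩

end ElSec

section SetPoc

instance setPoc (α : Type u) : Poc (Set α) where
  cc := fun h => compl_compl h
  anti := fun h => Set.compl_subset_compl.2 h

instance setAct (G α : Type u) [Group G] [MulAction G α] : PocAct G (Set α) where
  smul g A := {x | g⁻¹ • x ∈ A}
  one_smul A := by ext x; show (1 : G)⁻¹ • x ∈ A ↔ _; simp
  mul_smul g k A := by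
    ext x; show (g * k)⁻¹ • x ∈ A ↔ k⁻¹ • g⁻¹ • x ∈ A; rw [mul_inv_rev, mul_smul]
  mono g h k e := fun x hx => e hx
  scompl g h := rfl

theorem mem_sact {G α : Type u} [Group G] [MulAction G α] {g : G} {A : Set α} {x : α} :
    x ∈ g • A ↔ g⁻¹ • x ∈ A := Iff.rfl

theorem smul_mem_sact {G α : Type u} [Group G] [MulAction G α] {g : G} {A : Set α} {x : α} :
    g • x ∈ g • A ↔ x ∈ A := by rw [mem_sact, inv_smul_smul]

/-- principal points -/
def ppt {α : Type u} (x : α) : Pt (Set α) where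
  m := {A | x ∈ A}
  up := fun e h => e h
  co := fun _ => Iff.rfl

theorem mem_ppt {α : Type u} {x : α} {A : Set α} : A ∈ (ppt x).m ↔ x ∈ A := Iff.rfl

end SetPoc

section Half
variable {V : Type u} {Γ : SimpleGraph V}

/-- half tree -/
def half (Γ : SimpleGraph V) (u v : V) : Set V := {x | (Γ.deleteEdges {s(u, v)}).Reachable x u}

theorem half_self (u v : V) : u ∈ half Γ u v := SimpleGraph.Reachable.refl u

theorem half_not (ht : Γ.IsTree) {u v : V} (a : Γ.Adj u v) : v ∉ half Γ u v := by
  have := SimpleGraph.isAcyclic_iff_forall_adj_isBridge.1 ht.isAcyclic a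
  rw [SimpleGraph.isBridge_iff] at this
  exact fun h => this h.symm

theorem half_step {u v x y : V} (a : Γ.Adj x y) (h : s(x, y) ≠ s(u, v)) :
    x ∈ half Γ u v ↔ y ∈ half Γ u v := by
  have b : (Γ.deleteEdges {s(u, v)}).Adj x y := by
    rw [SimpleGraph.deleteEdges_adj]; exact ⟨a, by simpa using h⟩
  exact ⟨fun hx => b.symm.reachable.trans hx, fun hx => b.reachable.trans hx⟩

theorem half_cross (ht : Γ.IsTree) {u v x y : V} (a : Γ.Adj u v) (b : Γ.Adj x y) (hx : x ∈ half Γ u v)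
    (hy : y ∉ half Γ u v) : x = u ∧ y = v := by
  by_cases h : s(x, y) = s(u, v)
  · rw [Sym2.eq_iff] at h
    rcases h with h | h
    · exact h
    · obtain ⟨rfl, rfl⟩ := h
      exact absurd (half_self _ _) hy
  · exact absurd ((half_step b h).1 hx) hy

theorem half_compl (ht : Γ.IsTree) {u v : V} (a : Γ.Adj u v) : (half Γ u v)ᶜ = half Γ v u := by
  have key : ∀ x : V, x ∈ half Γ u v ∨ x ∈ half Γ v u := by
    intro x
    obtain ⟨p⟩ := ht.connected x u
    induction p with
    | nil => exact Or.inl (half_self _ _)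
    | @cons x y z e p ih =>
      by_cases h : s(x, y) = s(z, v)
      · rw [Sym2.eq_iff] at h
        rcases h with ⟨rfl, rfl⟩ | ⟨rfl, rfl⟩
        · exact Or.inl (half_self _ _)
        · exact Or.inr (half_self _ _)
      · rw [half_step e h, half_step (u := v) (v := z) e (by rwa [Sym2.eq_swap (a := v)])]
        exact ih a
  ext x
  constructor
  · intro h; exact (key x).resolve_left h
  · intro h1 h2
    have : half Γ v u = {x | (Γ.deleteEdges {s(u, v)}).Reachable x v} := by
      unfold half; rw [Sym2.eq_swap]
    rw [this] at h1
    exact half_not ht a (h1.symm.trans h2)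

theorem half_sub {u v u' v' : V} (h1 : u' ∉ half Γ u v) (h2 : v' ∉ half Γ u v) {x : V} (hx : x ∈ half Γ u v) :
    (x ∈ half Γ u' v' ↔ u ∈ half Γ u' v') := by
  have key : ∀ {x y : V}, (Γ.deleteEdges {s(u, v)}).Walk x y → y ∈ half Γ u v →
      (x ∈ half Γ u' v' ↔ y ∈ half Γ u' v') := by
    intro x y p hy
    induction p with
    | nil => rfl
    | @cons x y z e p ih =>
      have hx : x ∈ half Γ u v := (SimpleGraph.Walk.reachable (p.cons e)).trans hy
      rw [SimpleGraph.deleteEdges_adj] at e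
      rw [half_step e.1, ih hy]
      intro h
      rw [Sym2.eq_iff] at h
      rcases h with ⟨rfl, rfl⟩ | ⟨rfl, rfl⟩
      · exact h1 hx
      · exact h2 hx
  obtain ⟨p⟩ := hx
  exact key p (half_self _ _)

/-- set of half trees -/
def HL (Γ : SimpleGraph V) : Set (Set V) := {A | ∃ u v, Γ.Adj u v ∧ A = half Γ u v}

theorem HL_compl (ht : Γ.IsTree) {A : Set V} (h : A ∈ HL Γ) : Aᶜ ∈ HL Γ := by
  obtain ⟨u, v, a, rfl⟩ := h
  exact ⟨v, u, a.symm, half_compl ht a⟩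

theorem half_inj (ht : Γ.IsTree) {u v u' v' : V} (a : Γ.Adj u v) (a' : Γ.Adj u' v')
    (e : half Γ u v = half Γ u' v') : u = u' ∧ v = v' :=
  half_cross ht a' a (e ▸ half_self u v) (e ▸ half_not ht a)

theorem HL_nested (ht : Γ.IsTree) {A B : Set V} (hA : A ∈ HL Γ) (hB : B ∈ HL Γ) :
    A ≤ B ∨ B ≤ A ∨ A ≤ Bᶜ ∨ Aᶜ ≤ B := by
  obtain ⟨u, v, a, rfl⟩ := hA
  obtain ⟨u', v', a', rfl⟩ := hB
  have key : ∀ {u v : V}, Γ.Adj u v → u' ∉ half Γ u v → v' ∉ half Γ u v →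
      half Γ u v ≤ half Γ u' v' ∨ half Γ u v ≤ (half Γ u' v')ᶜ := by
    intro u v a h1 h2
    by_cases h : u ∈ half Γ u' v'
    · left; intro x hx; exact (half_sub h1 h2 hx).2 h
    · right; intro x hx hx2; exact h ((half_sub h1 h2 hx).1 hx2)
  by_cases h1 : u' ∈ half Γ u v <;> by_cases h2 : v' ∈ half Γ u v
  · rw [← half_compl ht a.symm] at h1 h2
    rcases key a.symm h1 h2 with h | h
    · right; right; right; rw [half_compl ht a]; exact h
    · right; left; rw [← half_compl ht a] at h; exact Set.compl_subset_compl.1 h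
  · obtain ⟨rfl, rfl⟩ := half_cross ht a a' h1 h2
    exact Or.inl le_rfl
  · obtain ⟨rfl, rfl⟩ := half_cross ht a a'.symm h2 h1
    right; right; left; rw [half_compl ht a']
  · rcases key a h1 h2 with h | h
    · exact Or.inl h
    · exact Or.inr (Or.inr (Or.inl h))

theorem walk_exit {A : Set V} {x y : V} (p : Γ.Walk x y) (hx : x ∈ A) (hy : y ∉ A) :
    ∃ d ∈ p.darts, d.toProd.1 ∈ A ∧ d.toProd.2 ∉ A := by
  induction p with
  | nil => exact absurd hx hy
  | @cons a b c e p ih =>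
    by_cases hb : b ∈ A
    · obtain ⟨d, h1, h2⟩ := ih hb hy
      exact ⟨d, by simp [h1], h2⟩
    · exact ⟨⟨(a, b), e⟩, by simp, hx, hb⟩

theorem half_convex (ht : Γ.IsTree) {A : Set V} (hA : A ∈ HL Γ) {x y w : V} (p : Γ.Walk x y) (hp : p.IsPath)
    (hw : w ∈ p.support) (hx : x ∈ A) (hy : y ∈ A) : w ∈ A := by
  by_contra hn
  obtain ⟨u, v, a, rfl⟩ := hA
  obtain ⟨q, r, e⟩ := SimpleGraph.Walk.mem_support_iff_exists_append.1 hw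
  obtain ⟨d, b1, c1⟩ := walk_exit q hx hn
  obtain ⟨d', b2, c2⟩ := walk_exit r.reverse hy hn
  obtain ⟨f1, f2⟩ := half_cross ht a d.adj c1.1 c1.2
  obtain ⟨f3, f4⟩ := half_cross ht a d'.adj c2.1 c2.2
  have e1 : d.edge ∈ q.edges := List.mem_map_of_mem b1
  have e2 : d'.edge ∈ r.edges := by
    have : d'.edge ∈ r.reverse.edges := List.mem_map_of_mem b2
    simpa using this
  have e3 : d = d' := by
    apply SimpleGraph.Dart.ext; exact Prod.ext (f1.trans f3.symm) (f2.trans f4.symm)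
  have := hp.isTrail.edges_nodup
  rw [e, SimpleGraph.Walk.edges_append, List.nodup_append] at this
  exact this.2.2 _ e1 _ e2 (by rw [e3])

/-- half trees separating two points -/
def hsep (Γ : SimpleGraph V) (x y : V) : Set (Set V) := {A ∈ HL Γ | x ∈ A ∧ y ∉ A}

theorem hsep_fin (ht : Γ.IsTree) (x y : V) : (hsep Γ x y).Finite := by
  obtain ⟨p⟩ := ht.connected x y
  have : (hsep Γ x y) ⊆ (fun d : Γ.Dart => half Γ d.toProd.1 d.toProd.2) '' {d | d ∈ p.darts} := by
    rintro A ⟨⟨u, v, a, rfl⟩, hx, hy⟩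
    obtain ⟨d, h1, h2, h3⟩ := walk_exit p hx hy
    obtain ⟨e1, e2⟩ := half_cross ht a d.adj h2 h3
    exact ⟨d, h1, by simp only [e1, e2]⟩
  exact (p.darts.finite_toSet.image _).subset this

theorem hsep_adj (ht : Γ.IsTree) {u v : V} (a : Γ.Adj u v) : hsep Γ u v = {half Γ u v} := by
  ext A
  constructor
  · rintro ⟨⟨x, y, b, rfl⟩, h1, h2⟩
    obtain ⟨rfl, rfl⟩ := half_cross ht b a h1 h2
    rfl
  · rintro rfl
    exact ⟨⟨u, v, a, rfl⟩, half_self _ _, half_not ht a⟩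

theorem hsep_empty (ht : Γ.IsTree) {x y : V} (h : ∀ A ∈ HL Γ, x ∈ A → y ∈ A) : x = y := by
  obtain ⟨p, hp⟩ := (ht.connected x y).exists_isPath
  cases p with
  | nil => rfl
  | @cons _ b _ e p =>
    have h2 := h (half Γ x b) ⟨x, b, e, rfl⟩ (half_self _ _)
    rw [SimpleGraph.Walk.cons_isPath_iff] at hp
    obtain ⟨d, h3, h4, h5⟩ := walk_exit p.reverse h2 (half_not ht e)
    obtain ⟨h6, _⟩ := half_cross ht e d.adj h4 h5
    have := p.reverse.dart_fst_mem_support_of_mem_darts h3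
    rw [h6] at this
    exact absurd (by simpa using this) hp.2

end Half

section TreeSec
variable {G : Type u} [Group G]

instance tAct (T : GTree G) : MulAction G T.V := MulAction.compHom T.V T.act

theorem tact (T : GTree G) (g : G) (x : T.V) : T.act g x = g • x := rfl

variable (T : GTree G)

theorem adj_smul {g : G} {u v : T.V} : T.graph.Adj (g • u) (g • v) ↔ T.graph.Adj u v := by
  constructor
  · intro h
    have := T.adj_act g⁻¹ _ _ h
    rw [tact, tact, inv_smul_smul, inv_smul_smul] at this
    exact this
  · exact T.adj_act g u v

theorem half_smul {V Λ : Type u} {H : SimpleGraph V} [Group Λ] [MulAction Λ V]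
    (ha : ∀ (g : Λ) {u v : V}, H.Adj u v → H.Adj (g • u) (g • v)) (g : Λ) (u v : V) :
    g • half H u v = half H (g • u) (g • v) := by
  have key : ∀ (g : Λ) (u v : V) {x : V}, x ∈ half H u v → g • x ∈ half H (g • u) (g • v) := by
    intro g u v x hx
    have : ∀ {x y : V}, (H.deleteEdges {s(u, v)}).Walk x y →
        (g • x ∈ half H (g • u) (g • v) ↔ g • y ∈ half H (g • u) (g • v)) := by
      intro x y p
      induction p with
      | nil => rfl
      | @cons x y z e p ih =>
        rw [SimpleGraph.deleteEdges_adj] at e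
        rw [half_step (ha g e.1), ih]
        intro h
        apply e.2
        rw [Set.mem_singleton_iff]
        rw [Sym2.eq_iff] at h ⊢
        simpa using h
    obtain ⟨p⟩ := hx
    exact (this p).2 (half_self _ _)
  ext x
  rw [mem_sact]
  constructor
  · intro h
    have := key g u v h
    rwa [smul_inv_smul] at this
  · intro h
    have := key g⁻¹ _ _ h
    rwa [inv_smul_smul, inv_smul_smul] at this

theorem smul_half (g : G) (u v : T.V) : g • half T.graph u v = half T.graph (g • u) (g • v) :=
  half_smul (fun _ _ _ => (adj_smul T).2) g u v

theorem HL_smul (g : G) {A : Set T.V} (h : A ∈ HL T.graph) : g • A ∈ HL T.graph := by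
  obtain ⟨u, v, a, rfl⟩ := h
  exact ⟨g • u, g • v, (adj_smul T).2 a, smul_half T g u v⟩

theorem HL_noinv (g : G) {A : Set T.V} (h : A ∈ HL T.graph) : g • A ≠ Aᶜ := by
  obtain ⟨u, v, a, rfl⟩ := h
  intro e
  rw [smul_half, half_compl T.isTree a] at e
  obtain ⟨h1, h2⟩ := half_inj T.isTree ((adj_smul T).2 a) a.symm e
  exact T.noInversion g u v a ⟨h1, h2⟩

theorem convex_univ {X : Set T.V} (hne : X.Nonempty) (hs : ∀ (g : G), ∀ v ∈ X, g • v ∈ X)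
    (hc : ∀ x, x ∉ X → ∃ A ∈ HL T.graph, X ⊆ A ∧ x ∉ A) : X = Set.univ := by
  apply T.minimal X hne hs
  intro a ha b hb p hp w hw
  by_contra hn
  obtain ⟨A, hA, h1, h2⟩ := hc w hn
  exact h2 (half_convex T.isTree hA p hp hw (h1 ha) (h1 hb))

theorem HL_hit (x : T.V) {A : Set T.V} (hA : A ∈ HL T.graph) : ∃ g : G, x ∈ g • A := by
  by_contra hcon
  push Not at hcon
  obtain ⟨u, v, a, rfl⟩ := hA
  let X : Set T.V := {y | ∀ B ∈ HL T.graph, (∀ g : G, g • x ∈ B) → y ∈ B}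
  have hX : X = Set.univ := by
    apply convex_univ T
    · exact ⟨x, fun B _ h => by simpa using h 1⟩
    · intro g y hy B hB h
      have := hy (g⁻¹ • B) (HL_smul T _ hB) (fun k => by
        rw [mem_sact, inv_inv, smul_smul]; exact h _)
      rwa [mem_sact, inv_inv] at this
    · intro y hy
      have hy' : ¬ ∀ B ∈ HL T.graph, (∀ g : G, g • x ∈ B) → y ∈ B := hy
      push Not at hy'
      obtain ⟨B, hB, h1, h2⟩ := hy'
      exact ⟨B, hB, fun z hz => hz B hB h1, h2⟩
  have : u ∈ X := by rw [hX]; trivial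
  have := this _ (HL_compl T.isTree ⟨u, v, a, rfl⟩) (fun g h => hcon g⁻¹ (by rw [mem_sact, inv_inv]; exact h))
  exact this (half_self _ _)

theorem sepo_hsep (x : T.V) (g : G) : sepo (ppt x) (HL T.graph) g = hsep T.graph x (g⁻¹ • x) := rfl

theorem HL_sys (x : T.V) : Sys G (ppt x) (HL T.graph) where
  compl := HL_compl T.isTree
  smul := fun g _ h => HL_smul T g h
  nested := HL_nested T.isTree
  fin := fun g => hsep_fin T.isTree x (g⁻¹ • x)
  hit := fun h => HL_hit T x h

theorem HL_ess {A : Set T.V} (hA : A ∈ HL T.graph) : Ess G A := by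
  obtain ⟨x⟩ := T.nonempty
  have key : ∀ {A : Set T.V}, A ∈ HL T.graph → ¬ ∀ g : G, g • A = A ∨ g • A ≤ Aᶜ := by
    intro A hA h
    have hA' := hA
    obtain ⟨u, v, a, rfl⟩ := hA
    let X : Set T.V := {y | ∀ g : G, y ∉ g • half T.graph u v}
    have hX : X = Set.univ := by
      apply convex_univ T
      · refine ⟨v, fun g hg => ?_⟩
        rcases h g with e | e
        · rw [e] at hg; exact half_not T.isTree a hg
        · rw [smul_half] at e hg
          have hu : u ∉ half T.graph (g • u) (g • v) := fun hu => e hu (half_self _ _)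
          obtain ⟨e1, e2⟩ := half_cross T.isTree ((adj_smul T).2 a) a.symm hg hu
          exact T.noInversion g u v a ⟨e1.symm, e2.symm⟩
      · intro g y hy k hk
        apply hy (g⁻¹ * k)
        rw [mul_smul, mem_sact, inv_inv]; exact hk
      · intro y hy
        have hy' : ¬ ∀ g : G, y ∉ g • half T.graph u v := hy
        push Not at hy'
        obtain ⟨g, hg⟩ := hy'
        exact ⟨(g • half T.graph u v)ᶜ, HL_compl T.isTree (HL_smul T g hA'), fun z hz => hz g, fun h => h hg⟩
    have : u ∈ X := by rw [hX]; trivial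
    exact this 1 (by rw [one_smul]; exact half_self _ _)
  by_contra hn
  rcases noness_type (HL_sys T x) (fun g _ h => HL_noinv T g h) hA hn with h | h
  · exact key hA h
  · refine key (HL_compl T.isTree hA) fun g => ?_
    rw [Poc.cc]; exact h g

theorem hsep_tri (x y z : T.V) : (hsep T.graph x z).ncard ≤ (hsep T.graph x y).ncard + (hsep T.graph y z).ncard := by
  refine (Set.ncard_le_ncard ?_ ((hsep_fin T.isTree x y).union (hsep_fin T.isTree y z))).trans
    (Set.ncard_union_le _ _)
  rintro A ⟨h1, h2, h3⟩
  by_cases h : y ∈ A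
  · exact Or.inr ⟨h1, h, h3⟩
  · exact Or.inl ⟨h1, h2, h⟩

theorem hsep_smul (g : G) (x y : T.V) : hsep T.graph (g • x) (g • y) = (fun A => g • A) '' hsep T.graph x y := by
  ext A
  constructor
  · rintro ⟨h1, h2, h3⟩
    refine ⟨g⁻¹ • A, ⟨HL_smul T _ h1, ?_, ?_⟩, smul_inv_smul _ _⟩
    · rw [mem_sact, inv_inv]; exact h2
    · rw [mem_sact, inv_inv]; exact h3
  · rintro ⟨B, ⟨h1, h2, h3⟩, rfl⟩
    exact ⟨HL_smul T _ h1, smul_mem_sact.2 h2, fun h => h3 (smul_mem_sact.1 h)⟩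

theorem hsep_smul_card (g : G) (x y : T.V) : (hsep T.graph (g • x) (g • y)).ncard = (hsep T.graph x y).ncard := by
  rw [hsep_smul, Set.ncard_image_of_injective _ (MulAction.injective g)]

/-- the vertex of a point -/
def tv (x y : T.V) : Vtx (ppt x) (HL T.graph) := ⟨{A ∈ HL T.graph | y ∈ A}, by
  refine ⟨fun h => h.1, ?_, ?_, ?_⟩
  · intro A hA
    constructor
    · intro h1 h2; exact h1.2 h2.2
    · intro h; exact ⟨HL_compl T.isTree hA, fun h1 => h ⟨hA, h1⟩⟩
  · intro A B hA hB e; exact ⟨hB, e hA.2⟩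
  · refine (hsep_fin T.isTree y x).subset ?_
    rintro A ⟨⟨h1, h2⟩, h3⟩; exact ⟨h1, h2, h3⟩⟩

theorem tv_diff (x y z : T.V) : (tv T x y).1 \ (tv T x z).1 = hsep T.graph y z := by
  ext A; constructor
  · rintro ⟨⟨h1, h2⟩, h3⟩; exact ⟨h1, h2, fun h => h3 ⟨h1, h⟩⟩
  · rintro ⟨h1, h2, h3⟩; exact ⟨⟨h1, h2⟩, fun h => h3 h.2⟩

theorem tv_inj (x : T.V) : Function.Injective (tv T x) := by
  intro y z e
  apply hsep_empty T.isTree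
  intro A hA hy
  have : A ∈ (tv T x y).1 := ⟨hA, hy⟩
  rw [e] at this
  exact this.2

theorem tv_adj (x : T.V) {y z : T.V} : (dualGraph _ _).Adj (tv T x y) (tv T x z) ↔ T.graph.Adj y z := by
  constructor
  · rintro ⟨A, hA⟩
    have m : A ∈ (tv T x y).1 \ (tv T x z).1 := by rw [hA]; rfl
    obtain ⟨u, v, a, rfl⟩ := m.1.1
    have h2 := tv_diff T x u v
    rw [hsep_adj T.isTree a] at h2
    have e1 := tv_inj T x (edge_unique (HL_sys T x) hA h2)
    have e2 := tv_inj T x (edge_unique' (HL_sys T x) hA h2)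
    rw [e1, e2]; exact a
  · intro a
    exact ⟨_, (tv_diff T x y z).trans (hsep_adj T.isTree a)⟩

theorem tv_surj (x : T.V) : Function.Surjective (tv T x) := by
  intro v
  obtain ⟨p⟩ : (dualGraph _ _).Reachable v (tv T x x) := dual_reach (HL_sys T x) _ _ _ rfl
  generalize hw : tv T x x = w at p
  have hw2 : ∃ y, tv T x y = w := ⟨x, hw⟩
  clear hw
  induction p with
  | nil => exact hw2
  | @cons a b c e p ih =>
    obtain ⟨y, rfl⟩ := ih hw2
    obtain ⟨A, hA⟩ := e
    have m : A ∈ a.1 \ (tv T x y).1 := by rw [hA]; rfl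
    obtain ⟨u, v, a', rfl⟩ := a.2.sub m.1
    have h2 := tv_diff T x u v
    rw [hsep_adj T.isTree a'] at h2
    exact ⟨u, (edge_unique (HL_sys T x) hA h2).symm⟩

theorem tv_act (x y : T.V) (g : G) : (tv T x (g • y)).1 = sv g (tv T x y).1 := by
  ext A
  rw [mem_sv]
  constructor
  · rintro ⟨h1, h2⟩; exact ⟨HL_smul T _ h1, by rw [mem_sact, inv_inv]; exact h2⟩
  · rintro ⟨h1, h2⟩
    rw [mem_sact, inv_inv] at h2
    have := HL_smul T g h1
    rw [smul_inv_smul] at this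
    exact ⟨this, h2⟩

end TreeSec

section MTreeSec
variable {G : Type u} [Group G] (T : MGTree G)

/-- weights of half trees -/
noncomputable def tw (A : Set T.V) : ℝ :=
  if h : ∃ p : T.V × T.V, T.graph.Adj p.1 p.2 ∧ A = half T.graph p.1 p.2 then
    T.len h.choose.1 h.choose.2 else 0

theorem tw_half {u v : T.V} (a : T.graph.Adj u v) : tw T (half T.graph u v) = T.len u v := by
  have h : ∃ p : T.V × T.V, T.graph.Adj p.1 p.2 ∧ half T.graph u v = half T.graph p.1 p.2 := ⟨(u, v), a, rfl⟩
  unfold tw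
  rw [dif_pos h]
  obtain ⟨h1, h2⟩ := h.choose_spec
  obtain ⟨e1, e2⟩ := half_inj T.isTree a h1 h2
  rw [← e1, ← e2]

theorem tw_zero {A : Set T.V} (h : A ∉ HL T.graph) : tw T A = 0 := by
  unfold tw
  rw [dif_neg]
  rintro ⟨⟨u, v⟩, a, e⟩
  exact h ⟨u, v, a, e⟩

theorem tw_pos {A : Set T.V} (h : A ∈ HL T.graph) : 0 < tw T A := by
  obtain ⟨u, v, a, rfl⟩ := h
  rw [tw_half T a]; exact T.len_pos _ _ a

theorem sp_tw : sp (tw T) = HL T.graph := by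
  ext A
  constructor
  · intro h; by_contra hn; exact h (tw_zero T hn)
  · intro h; exact (tw_pos T h).ne'

theorem tw_HL {h : Set T.V} (hh : tw T h ≠ 0) : h ∈ HL T.graph := by rw [← sp_tw]; exact hh

theorem ep_tw : ep G (tw T) = HL T.graph := by
  ext A
  constructor
  · intro h; rw [← sp_tw]; exact h.1
  · intro h; exact ⟨(tw_pos T h).ne', HL_ess T.toGTree h⟩

theorem tw_compl (A : Set T.V) : tw T Aᶜ = tw T A := by
  by_cases h : A ∈ HL T.graph
  · obtain ⟨u, v, a, rfl⟩ := h
    rw [half_compl T.isTree a, tw_half T a, tw_half T a.symm, T.len_symm]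
  · rw [tw_zero T h, tw_zero]
    intro h2
    have := HL_compl T.isTree h2
    rw [compl_compl] at this
    exact h this

theorem tw_smul (g : G) (A : Set T.V) : tw T (g • A) = tw T A := by
  by_cases h : A ∈ HL T.graph
  · obtain ⟨u, v, a, rfl⟩ := h
    rw [smul_half, tw_half T a, tw_half T ((adj_smul T.toGTree).2 a)]
    exact T.len_equivariant g u v
  · rw [tw_zero T h, tw_zero]
    intro h2
    have := HL_smul T.toGTree g⁻¹ h2
    rw [inv_smul_smul] at this
    exact h this

theorem tw_lb [Group.FG G] : ∃ ε : ℝ, 0 < ε ∧ ∀ A ∈ HL T.graph, ε ≤ tw T A := by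
  obtain ⟨x⟩ := T.nonempty
  obtain ⟨M, hM, hML, horb⟩ := (HL_sys T.toGTree x).orb
  rcases M.eq_empty_or_nonempty with h | h
  · refine ⟨1, one_pos, fun A hA => ?_⟩
    obtain ⟨g, hg⟩ := horb A hA
    rw [h] at hg; exact absurd hg (Set.notMem_empty _)
  · obtain ⟨B, hB, hmin⟩ := Set.exists_min_image M (tw T) hM h
    refine ⟨tw T B, tw_pos T (hML hB), fun A hA => ?_⟩
    obtain ⟨g, hg⟩ := horb A hA
    rw [← tw_smul T g A]; exact hmin _ hg

theorem goodT [Group.FG G] (x : T.V) : Good T.toGTree.Elliptic (ppt x) (tw T) where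
  nonneg := fun A => by
    by_cases h : A ∈ HL T.graph
    · exact (tw_pos T h).le
    · rw [tw_zero T h]
  wc := tw_compl T
  wg := tw_smul T
  sys := by rw [sp_tw]; exact HL_sys T.toGTree x
  noinv := by
    intro g A hA
    have : A ∈ sp (tw T) := hA
    rw [sp_tw] at this
    exact HL_noinv T.toGTree g this
  E1 := by
    rintro K ⟨y, hy⟩
    refine ⟨(hsep T.graph x y).ncard + (hsep T.graph y x).ncard, fun k hk => ?_⟩
    rw [sp_tw, sepo_hsep]
    refine (hsep_tri T.toGTree x y _).trans ?_
    rw [← hsep_smul_card T.toGTree k y, smul_inv_smul, ← tact, hy k hk]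
  E2 := by
    rintro K ⟨C, hC⟩
    obtain ⟨ε, hε, hlb⟩ := tw_lb T
    obtain ⟨v, hv, hf⟩ := bdd_fix (HL_sys T.toGTree x) (fun g _ h => HL_noinv T.toGTree g h) (K := K)
      (C := ⌊C / ε⌋₊) (by
        intro k hk
        have h1 := hC k hk
        rw [sp_tw] at h1
        have fin : (sepo (ppt x) (HL T.graph) k).Finite := (HL_sys T.toGTree x).fin k
        apply Nat.le_floor
        rw [le_div_iff₀ hε]
        refine le_trans ?_ h1
        change (Set.ncard (sepo (ppt x) (HL T.graph) k) : ℝ) * ε ≤ _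
        rw [finsum_mem_eq_finite_toFinset_sum _ fin, Set.ncard_eq_toFinset_card _ fin, ← nsmul_eq_mul]
        apply Finset.card_nsmul_le_sum
        intro A hA
        exact hlb A ((Set.Finite.mem_toFinset _).1 hA).1)
    obtain ⟨y, hy⟩ := tv_surj T.toGTree x ⟨v, hv⟩
    refine ⟨y, fun k hk => tv_inj T.toGTree x (Subtype.ext ?_)⟩
    rw [tact, tv_act, hy]
    exact hf k hk

theorem iso_dist {T T' : MGTree G} (e : T.V ≃ T'.V) (h1 : ∀ u v : T.V, T.graph.Adj u v ↔ T'.graph.Adj (e u) (e v))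
    (h2 : ∀ u v : T.V, T.graph.Adj u v → T'.len (e u) (e v) = T.len u v) (u v : T.V) :
    T'.dist (e u) (e v) = T.dist u v := by
  obtain ⟨p, hp⟩ := tree_path T.toGTree u v
  let f : T.graph →g T'.graph := ⟨e, fun {a b} h => (h1 a b).1 h⟩
  rw [tree_dist T p hp, show T'.dist (e u) (e v) = T'.dist (f u) (f v) from rfl,
    tree_dist T' (p.map f) (SimpleGraph.Walk.IsPath.map e.injective hp)]
  unfold MGTree.walkLen
  rw [SimpleGraph.Walk.darts_map, List.map_map]
  congr 1
  apply List.map_congr_left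
  intro d _
  exact h2 _ _ d.adj

theorem tv_TS (x : T.V) : TSys G (ppt x) (HL T.graph) :=
  ⟨HL_sys T.toGTree x, fun g _ h => HL_noinv T.toGTree g h, fun h => HL_ess T.toGTree h⟩

theorem iso_rho [Group.FG G] (x : T.V) : EquivIsometric T (rho (goodT T x)) := by
  have key : ∀ (L : Set (Set T.V)) (hL : L = HL T.graph) (S : TSys G (ppt x) L) (h1 : ∀ h ∈ L, 0 < tw T h)
      h2 h3, EquivIsometric T (dualM S (tw T) h1 h2 h3) := by
    rintro L rfl S h1 h2 h3
    refine ⟨Equiv.ofBijective (tv T.toGTree x) ⟨tv_inj _ _, tv_surj _ _⟩, ?_, ?_, ?_⟩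
    · intro g v; exact Subtype.ext (tv_act T.toGTree x v g)
    · intro u v; exact (tv_adj T.toGTree x).symm
    · intro u v a
      show (∑ᶠ h ∈ (tv T.toGTree x u).1 \ (tv T.toGTree x v).1, tw T h) = 1 * T.len u v
      rw [tv_diff, hsep_adj T.isTree a, finsum_mem_singleton,
        tw_half T a, one_mul]
  exact key _ (ep_tw T) _ _ _ _

theorem tdist (x y : T.V) : T.dist x y = ∑ᶠ A ∈ hsep T.graph x y, tw T A := by
  have := iso_dist (T := T) (T' := dualM (tv_TS T x) (tw T) (fun _ h => tw_pos T h) (tw_compl T) (tw_smul T))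
    (Equiv.ofBijective (tv T.toGTree x) ⟨tv_inj _ _, tv_surj _ _⟩) (fun u v => (tv_adj T.toGTree x).symm)
    (fun u v a => by
      show (∑ᶠ h ∈ (tv T.toGTree x u).1 \ (tv T.toGTree x v).1, tw T h) = T.len u v
      rw [tv_diff, hsep_adj T.isTree a, finsum_mem_singleton, tw_half T a]) x y
  refine this.symm.trans ((dualM_dist _ _ _ _ _ _ _).trans ?_)
  show (∑ᶠ h ∈ (tv T.toGTree x x).1 \ (tv T.toGTree x y).1, tw T h) = _
  rw [tv_diff]

end MTreeSec

section TopSec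
open Topology
variable {G : Type u} [Group G]

theorem self_basic (T : MGTree G) (X : Finset T.V) (A : Finset G) {ε : ℝ} (h : 0 < ε) : T ∈ gromovBasic G T X A ε :=
  ⟨id, fun x _ y _ g _ => by simpa using h⟩

noncomputable instance grTop : TopologicalSpace (MGTree G) := gromovTop G

theorem gr_isOpen {U : Set (MGTree G)} : IsOpen U ↔ ∀ T ∈ U, ∃ (X : Finset T.V) (A : Finset G) (ε : ℝ), 0 < ε ∧
    gromovBasic G T X A ε ⊆ U := Iff.rfl

theorem basic_open (T : MGTree G) (X : Finset T.V) (A : Finset G) (ε : ℝ) : IsOpen (gromovBasic G T X A ε) := by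
  rw [gr_isOpen]
  rintro T' ⟨f, hf⟩
  have : ∃ δ : ℝ, 0 < δ ∧ ∀ x ∈ X, ∀ y ∈ X, ∀ g ∈ A,
      |T.dist x (T.act g y) - T'.dist (f x) (T'.act g (f y))| + δ ≤ ε := by
    rcases (X ×ˢ X ×ˢ A).eq_empty_or_nonempty with h | h
    · refine ⟨1, one_pos, fun x hx y hy g hg => ?_⟩
      have : (x, y, g) ∈ X ×ˢ X ×ˢ A := by simp [hx, hy, hg]
      rw [h] at this; exact absurd this (Finset.notMem_empty _)
    · obtain ⟨⟨x, y, g⟩, hm, hmax⟩ := Finset.exists_max_image (X ×ˢ X ×ˢ A)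
        (fun q => |T.dist q.1 (T.act q.2.2 q.2.1) - T'.dist (f q.1) (T'.act q.2.2 (f q.2.1))|) h
      simp only [Finset.mem_product] at hm
      refine ⟨ε - |T.dist x (T.act g y) - T'.dist (f x) (T'.act g (f y))|,
        sub_pos.2 (hf x hm.1 y hm.2.1 g hm.2.2), fun x' hx y' hy g' hg => ?_⟩
      have := hmax (x', y', g') (by simp [hx, hy, hg])
      simp only at this
      linarith
  obtain ⟨δ, hδ, hd⟩ := this
  refine ⟨X.image f, A, δ, hδ, ?_⟩
  rintro T'' ⟨f', hf'⟩
  refine ⟨f' ∘ f, fun x hx y hy g hg => ?_⟩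
  have h1 := hd x hx y hy g hg
  have h2 := hf' (f x) (Finset.mem_image_of_mem f hx) (f y) (Finset.mem_image_of_mem f hy) g hg
  have h3 := abs_sub_le (T.dist x (T.act g y)) (T'.dist (f x) (T'.act g (f y)))
    (T''.dist ((f' ∘ f) x) (T''.act g ((f' ∘ f) y)))
  simp only [Function.comp] at h3 ⊢
  linarith

theorem basic_nhds (T : MGTree G) (X : Finset T.V) (A : Finset G) {ε : ℝ} (h : 0 < ε) :
    gromovBasic G T X A ε ∈ 𝓝 T := (basic_open T X A ε).mem_nhds (self_basic T X A h)

theorem gr_spec {T T' : MGTree G} (f : T.V → T'.V) (h1 : ∀ (g : G) (x : T.V), f (g • x) = g • f x)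
    (h2 : ∀ x y, T'.dist (f x) (f y) = T.dist x y) : T' ⤳ T := by
  rw [specializes_iff_forall_open]
  intro U hU hT
  obtain ⟨X, A, ε, hε, hs⟩ := gr_isOpen.1 hU T hT
  apply hs
  refine ⟨f, fun x _ y _ g _ => ?_⟩
  rw [tact, tact, ← h1, h2, sub_self, abs_zero]
  exact hε

/-- the deformation space with the weak topology -/
def DSp (D : Set (MGTree G)) : Type (u + 1) := ↥D

noncomputable instance dspTop (D : Set (MGTree G)) : TopologicalSpace (DSp D) := weakTop G D

/-- inclusion of a closed cone -/
def cinc (D : Set (MGTree G)) (S : MGTree G) (x : {T : MGTree G // T ∈ closedCone D S}) : DSp D := ⟨x.1, x.2.1⟩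

theorem cinc_cont {D : Set (MGTree G)} {S : MGTree G} (hS : S ∈ D) : Continuous (cinc D S) := by
  rw [continuous_iff_coinduced_le]
  exact le_iSup₂_of_le (f := fun (T : MGTree G) (_ : T ∈ D) => TopologicalSpace.coinduced
    (fun x : {S : MGTree G // S ∈ closedCone D T} => (⟨x.1, x.2.1⟩ : ↥D))
    (TopologicalSpace.induced (fun x : {S : MGTree G // S ∈ closedCone D T} => x.1)
      (gromovTop G))) S hS le_rfl

theorem dsp_closed {D : Set (MGTree G)} {C : Set (DSp D)} : IsClosed C ↔ ∀ S ∈ D, IsClosed (cinc D S ⁻¹' C) := by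
  show IsClosed[⨆ (T : MGTree G) (_ : T ∈ D), TopologicalSpace.coinduced (cinc D T) inferInstance] C ↔ _
  rw [isClosed_iSup_iff]
  simp_rw [isClosed_iSup_iff, isClosed_coinduced]

theorem dsp_dom {D : Set (MGTree G)} {Z : Type*} [TopologicalSpace Z] {f : DSp D → Z}
    (h : ∀ S ∈ D, Continuous (f ∘ cinc D S)) : Continuous f := by
  rw [continuous_iff_isClosed]
  intro C hC
  rw [dsp_closed]
  intro S hS
  exact hC.preimage (h S hS)

/-- maps out of a closed subset -/
theorem sub_dom {D : Set (MGTree G)} {Y : Set (DSp D)} (hY : IsClosed Y) {Z : Type*} [TopologicalSpace Z] {f : Y → Z}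
    (h : ∀ S ∈ D, Continuous (fun x : {x : {T : MGTree G // T ∈ closedCone D S} // cinc D S x ∈ Y} =>
      f ⟨cinc D S x.1, x.2⟩)) : Continuous f := by
  rw [continuous_iff_isClosed]
  intro C hC
  have : IsClosed (Subtype.val '' (f ⁻¹' C)) := by
    rw [dsp_closed]
    intro S hS
    have h1 := hC.preimage (h S hS)
    have h2 := (hY.preimage (cinc_cont hS)).isClosedEmbedding_subtypeVal.isClosedMap _ h1
    convert h2 using 1
    ext x
    constructor
    · rintro ⟨⟨y, hy⟩, hf, e⟩
      have e' : y = cinc D S x := e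
      subst e'
      exact ⟨⟨x, hy⟩, hf, rfl⟩
    · rintro ⟨⟨y, hy⟩, hf, rfl⟩
      exact ⟨_, hf, rfl⟩
  have h2 := this.preimage (continuous_subtype_val (p := (· ∈ Y)))
  rwa [Set.preimage_image_eq _ Subtype.val_injective] at h2

/-- homotopies out of a closed subset -/
theorem sub_dom_I {D : Set (MGTree G)} {Y : Set (DSp D)} (hY : IsClosed Y) {Z : Type*} [TopologicalSpace Z]
    {f : Y × unitInterval → Z}
    (h : ∀ S ∈ D, Continuous (fun x : {x : {T : MGTree G // T ∈ closedCone D S} // cinc D S x ∈ Y} × unitInterval =>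
      f (⟨cinc D S x.1.1, x.1.2⟩, x.2))) : Continuous f := by
  have hc : ∀ y : Y, Continuous (fun t : unitInterval => f (y, t)) := by
    intro y
    have hS : y.1.1 ∈ D := y.1.2
    have hm : y.1.1 ∈ closedCone D y.1.1 := ⟨hS, id, fun _ _ => rfl, Function.surjective_id, fun _ _ a _ => a,
      fun u v a => ⟨u, v, a, rfl, rfl⟩, by
        rintro u v (rfl : u = v) p hp w hw
        have : p = SimpleGraph.Walk.nil := by
          cases p with
          | nil => rfl
          | cons a q => simp at hp
        subst this
        simpa using hw⟩
    have := (h _ hS).comp (Continuous.prodMk (continuous_const (y := (⟨⟨y.1.1, hm⟩, y.2⟩ :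
      {x : {T : MGTree G // T ∈ closedCone D y.1.1} // cinc D y.1.1 x ∈ Y}))) (continuous_id (X := unitInterval)))
    exact this
  let F : Y → C(unitInterval, Z) := fun y => ⟨fun t => f (y, t), hc y⟩
  have hF : Continuous F := by
    apply sub_dom hY
    intro S hS
    exact (ContinuousMap.curry ⟨_, h S hS⟩).continuous
  exact ContinuousMap.continuous_uncurry_of_continuous ⟨F, hF⟩

theorem dsp_spec {D : Set (MGTree G)} {R : MGTree G} (hR : R ∈ D) {x y : DSp D} (hx : x.1 ∈ closedCone D R)
    (hy : y.1 ∈ closedCone D R) (h : x.1 ⤳ y.1) : x ⤳ y := by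
  have : (⟨x.1, hx⟩ : {T : MGTree G // T ∈ closedCone D R}) ⤳ ⟨y.1, hy⟩ := (subtype_specializes_iff _ _).2 h
  exact this.map (cinc_cont hR)

theorem collapse_self (T : GTree G) : CollapseOf T T :=
  ⟨id, fun _ _ => rfl, Function.surjective_id, fun _ _ a _ => a, fun u v a => ⟨u, v, a, rfl, rfl⟩, by
    rintro u v (rfl : u = v) p hp w hw
    have : p = SimpleGraph.Walk.nil := by
      cases p with
      | nil => rfl
      | cons a q => simp at hp
    subst this
    simpa using hw⟩

theorem iso_collapse {T T' : GTree G} (e : T.V ≃ T'.V) (h0 : ∀ (g : G) (v : T.V), e (T.act g v) = T'.act g (e v))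
    (h1 : ∀ u v : T.V, T.graph.Adj u v ↔ T'.graph.Adj (e u) (e v)) : CollapseOf T' T := by
  refine ⟨e, h0, e.surjective, fun u v a _ => (h1 u v).1 a, fun u v a =>
    ⟨e.symm u, e.symm v, (h1 _ _).2 (by simpa using a), by simp, by simp⟩, ?_⟩
  intro u v huv p hp w hw
  have := e.injective huv
  subst this
  have : p = SimpleGraph.Walk.nil := by
    cases p with
    | nil => rfl
    | cons a q => simp at hp
  subst this
  rw [SimpleGraph.Walk.support_nil, List.mem_singleton] at hw
  rw [hw]

theorem iso_dist' {T T' : MGTree G} (h : EquivIsometric T T') : ∃ e : T.V ≃ T'.V,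
    (∀ (g : G) (v : T.V), e (T.act g v) = T'.act g (e v)) ∧
    (∀ u v : T.V, T.graph.Adj u v ↔ T'.graph.Adj (e u) (e v)) ∧ ∀ u v, T'.dist (e u) (e v) = T.dist u v := by
  obtain ⟨e, h0, h1, h2⟩ := h
  exact ⟨e, h0, h1, iso_dist e h1 (fun u v a => by rw [h2 u v a, one_mul])⟩

theorem iso_symm {T T' : MGTree G} (h : EquivIsometric T T') : EquivIsometric T' T := by
  obtain ⟨e, h0, h1, h2⟩ := h
  refine ⟨e.symm, ?_, ?_, ?_⟩
  · intro g v
    rw [Equiv.symm_apply_eq, h0, Equiv.apply_symm_apply]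
  · intro u v; rw [h1]; simp
  · intro u v a
    have := h2 (e.symm u) (e.symm v) (by rw [h1]; simpa using a)
    simp at this
    rw [this, one_mul]

theorem iso_trans {T T' T'' : MGTree G} (h : EquivIsometric T T') (k : EquivIsometric T' T'') : EquivIsometric T T'' := by
  obtain ⟨e, h0, h1, h2⟩ := h
  obtain ⟨f, k0, k1, k2⟩ := k
  refine ⟨e.trans f, fun g v => ?_, fun u v => ?_, fun u v a => ?_⟩
  · simp [h0, k0]
  · rw [h1, k1]; rfl
  · show T''.len (f (e u)) (f (e v)) = _
    rw [k2 _ _ ((h1 _ _).1 a), h2 _ _ a, one_mul]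

theorem iso_insep {D : Set (MGTree G)} {x y : DSp D} (h : EquivIsometric x.1 y.1) : Inseparable x y := by
  have key : ∀ {x y : DSp D}, EquivIsometric x.1 y.1 → y ⤳ x := by
    intro x y h
    obtain ⟨e, h0, h1, h2⟩ := iso_dist' h
    exact dsp_spec (R := x.1) x.2 ⟨y.2, iso_collapse e h0 h1⟩ ⟨x.2, collapse_self _⟩ (gr_spec e h0 h2)
  exact (key (iso_symm h)).antisymm (key h)

theorem spec_homotopic {X Y : Type*} [TopologicalSpace X] [TopologicalSpace Y] (f g : C(X, Y))
    (h : ∀ x, f x ⤳ g x) : f.Homotopic g := by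
  refine ⟨⟨⟨fun p => if p.1 = 1 then g p.2 else f p.2, ?_⟩, ?_, ?_⟩⟩
  · rw [continuous_def]
    intro V hV
    have : (fun p : unitInterval × X => if p.1 = 1 then g p.2 else f p.2) ⁻¹' V =
        ({1}ᶜ ×ˢ (f ⁻¹' V)) ∪ (Set.univ ×ˢ (g ⁻¹' V)) := by
      ext ⟨t, x⟩
      have hs : g x ∈ V → f x ∈ V := fun hx => (h x).mem_open hV hx
      by_cases ht : t = 1
      · simp [ht]
      · simp [ht]; exact hs
    rw [this]
    exact (isOpen_compl_singleton.prod (hV.preimage f.continuous)).union (isOpen_univ.prod (hV.preimage g.continuous))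
  · intro x; simp
  · intro x; simp

/-- passing to the quotient by isometries -/
theorem quot_contr {X : Type*} [TopologicalSpace X] (r : X → X → Prop) (hr : ∀ x y, r x y → Inseparable x y)
    [ContractibleSpace X] : ContractibleSpace (Quot r) := by
  have hs : ∀ x : X, Inseparable (Quot.out (Quot.mk r x)) x := by
    intro x
    have key : ∀ a b, Relation.EqvGen r a b → Inseparable a b := by
      intro a b this
      induction this with
      | rel x y h => exact hr _ _ h
      | refl x => exact Inseparable.refl x
      | symm x y _ ih => exact ih.symm
      | trans x y z _ _ i1 i2 => exact i1.trans i2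
    exact key _ _ (Quot.eqvGen_exact (Quot.out_eq _))
  have hc : Continuous (Quot.out : Quot r → X) := by
    rw [continuous_def]
    intro U hU
    show IsOpen (Quot.mk r ⁻¹' (Quot.out ⁻¹' U))
    convert hU using 1
    ext x
    exact (hs x).mem_open_iff hU
  have h1 : (ContinuousMap.id X).Nullhomotopic := (contractible_iff_id_nullhomotopic X).1 inferInstance
  rw [contractible_iff_id_nullhomotopic]
  have h2 := (h1.comp_left ⟨Quot.out, hc⟩)
  have h3 := h2.comp_right ⟨Quot.mk r, continuous_quot_mk⟩
  convert h3 using 1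
  ext x
  exact (Quot.out_eq x).symm
end TopSec

section ColSec
variable {G P P' : Type u} [Group G] [Poc P] [PocAct G P] [Poc P'] [PocAct G P']

structure Emb (G : Type u) {P P' : Type u} [Group G] [Poc P] [PocAct G P] [Poc P'] [PocAct G P']
    (o : Pt P) (L : Set P) (o' : Pt P') (L' : Set P') (σ : P → P') : Prop where
  maps : ∀ {h}, h ∈ L → σ h ∈ L'
  inj : ∀ {h k}, h ∈ L → k ∈ L → σ h = σ k → h = k
  mono : ∀ {h k}, h ∈ L → k ∈ L → h ≤ k → σ h ≤ σ k
  compl : ∀ {h}, h ∈ L → σ hᶜ = (σ h)ᶜ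
  smul : ∀ (g : G) {h}, h ∈ L → σ (g • h) = g • σ h
  base : ∀ {h}, h ∈ L → (σ h ∈ o'.m ↔ h ∈ o.m)
  lc : ∀ {h}, h ∈ L → hᶜ ∈ L

variable {o : Pt P} {L : Set P} {o' : Pt P'} {L' : Set P'} {σ : P → P'}

theorem Emb.refl' (S : Sys G o L) (S' : Sys G o' L') (E : Emb G o L o' L' σ) {a b : P} (ha : a ∈ L) (hb : b ∈ L)
    (h : σ a ≤ σ b) : a ≤ b := by
  rcases S.nested ha hb with h1 | h1 | h1 | h1
  · exact h1
  · exact (E.inj ha hb (le_antisymm h (E.mono hb ha h1))).le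
  · have := E.mono ha (S.compl hb) h1
    rw [E.compl hb] at this
    exact (S'.not_both (E.maps ha) h this).elim
  · have := E.mono (S.compl ha) hb h1
    rw [E.compl ha] at this
    exact (S'.not_both (S'.compl (E.maps hb)) (compl_le_comm' this) (Poc.anti h)).elim

theorem Emb.pull (E : Emb G o L o' L' σ) {v : Set P'} (hv : IsVtx o' L' v) : IsVtx o L {h ∈ L | σ h ∈ v} := by
  refine ⟨fun h => h.1, ?_, ?_, ?_⟩
  · intro h hh
    constructor
    · rintro ⟨h1, h2⟩ ⟨_, h3⟩
      rw [E.compl hh] at h2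
      exact (hv.tot (E.maps hh)).1 h2 h3
    · intro hn
      refine ⟨E.lc hh, ?_⟩
      rw [E.compl hh, hv.tot (E.maps hh)]
      exact fun h3 => hn ⟨hh, h3⟩
  · rintro h k ⟨h1, h2⟩ hk e
    exact ⟨hk, hv.up h2 (E.maps hk) (E.mono h1 hk e)⟩
  · apply Set.Finite.of_injOn (f := σ) (t := {h ∈ v | h ∉ o'.m}) _ _ hv.fin
    · rintro h ⟨⟨h1, h2⟩, h3⟩
      exact ⟨h2, by rw [E.base h1]; exact h3⟩
    · rintro h ⟨⟨h1, h2⟩, h3⟩ k ⟨⟨k1, k2⟩, k3⟩ e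
      exact E.inj h1 k1 e

theorem Emb.push (S : Sys G o L) (S' : Sys G o' L') (E : Emb G o L o' L' σ) (v : Vtx o L) :
    ∃ v' : Vtx o' L', {h ∈ L | σ h ∈ v'.1} = v.1 := by
  let F : P' → Prop := fun k => ∃ h ∈ v.1, σ h ≤ k
  have hF : ∀ k, F k → F kᶜ → False := by
    rintro k ⟨h, h1, h2⟩ ⟨h', h1', h2'⟩
    have e : σ h ≤ σ h'ᶜ := by
      rw [E.compl (v.2.sub h1')]
      exact h2.trans (le_compl_comm' h2')
    have := E.refl' S S' (v.2.sub h1) (S.compl (v.2.sub h1')) e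
    exact v.2.cod h1' (v.2.up h1 (S.compl (v.2.sub h1')) this)
  let V : Set P' := {k ∈ L' | F k ∨ (k ∈ o'.m ∧ ¬ F kᶜ)}
  have hV : IsVtx o' L' V := by
    refine ⟨fun h => h.1, ?_, ?_, ?_⟩
    · intro k hk
      have h1 := hF k
      have h2 := o'.co k
      have h3 := S'.compl hk
      show (kᶜ ∈ L' ∧ (F kᶜ ∨ (kᶜ ∈ o'.m ∧ ¬ F kᶜᶜ))) ↔ ¬ (k ∈ L' ∧ (F k ∨ (k ∈ o'.m ∧ ¬ F kᶜ)))
      rw [Poc.cc]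
      generalize F k = a at *
      generalize F kᶜ = b at *
      tauto
    · rintro h k ⟨h1, h2⟩ hk e
      refine ⟨hk, ?_⟩
      rcases h2 with ⟨a, a1, a2⟩ | ⟨b1, b2⟩
      · exact Or.inl ⟨a, a1, a2.trans e⟩
      · refine Or.inr ⟨o'.up e b1, ?_⟩
        rintro ⟨a, a1, a2⟩
        exact b2 ⟨a, a1, a2.trans (Poc.anti e)⟩
    · have : {k ∈ V | k ∉ o'.m} ⊆ ⋃ h ∈ {h ∈ v.1 | h ∉ o.m}, {k ∈ L' | σ h ≤ k ∧ k ∉ o'.m} := by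
        rintro k ⟨⟨hk, hk2⟩, hk3⟩
        rcases hk2 with ⟨a, a1, a2⟩ | ⟨b1, _⟩
        · refine Set.mem_biUnion (x := a) ⟨a1, fun ha => hk3 (o'.up a2 ((E.base (v.2.sub a1)).2 ha))⟩ ⟨hk, a2, hk3⟩
        · exact absurd b1 hk3
      refine (v.2.fin.biUnion fun h hh => ?_).subset this
      obtain ⟨g, hg⟩ := S'.hit (E.maps (v.2.sub hh.1))
      refine ((S'.fin g).image (fun k => kᶜ)).subset ?_
      rintro k ⟨k1, k2, k3⟩
      refine ⟨kᶜ, ⟨S'.compl k1, (o'.co k).2 k3, ?_⟩, Poc.cc k⟩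
      rw [PocAct.scompl, o'.co, not_not]
      exact o'.up (PocAct.mono g k2) hg
  refine ⟨⟨V, hV⟩, ?_⟩
  have hp := E.pull hV
  have := vtx_ext (u := v) (v := ⟨_, hp⟩) (fun k hk => ⟨v.2.sub hk, E.maps (v.2.sub hk), Or.inl ⟨k, hk, le_rfl⟩⟩)
  exact (congrArg Subtype.val this).symm

/-- the collapse map of an embedding -/
def Emb.c (E : Emb G o L o' L' σ) (v : Vtx o' L') : Vtx o L := ⟨{h ∈ L | σ h ∈ v.1}, E.pull v.2⟩

theorem Emb.c_diff (E : Emb G o L o' L' σ) (u v : Vtx o' L') :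
    (E.c u).1 \ (E.c v).1 = {h ∈ L | σ h ∈ u.1 \ v.1} := by
  ext h
  constructor
  · rintro ⟨⟨h1, h2⟩, h3⟩
    exact ⟨h1, h2, fun h4 => h3 ⟨h1, h4⟩⟩
  · rintro ⟨h1, h2, h3⟩
    exact ⟨⟨h1, h2⟩, fun h4 => h3 h4.2⟩

theorem Emb.collapse (S : TSys G o L) (S' : TSys G o' L') (E : Emb G o L o' L' σ) :
    IsCollapseMap (dualT S') (dualT S) E.c := by
  have hsurj : Function.Surjective E.c := by
    intro v
    obtain ⟨v', h⟩ := E.push S.toSys S'.toSys v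
    exact ⟨v', Subtype.ext h⟩
  refine ⟨?_, hsurj, ?_, ?_, ?_⟩
  · intro g v
    apply Subtype.ext
    ext h
    show (h ∈ L ∧ g⁻¹ • σ h ∈ v.1) ↔ (g⁻¹ • h ∈ L ∧ σ (g⁻¹ • h) ∈ v.1)
    constructor
    · rintro ⟨h1, h2⟩
      exact ⟨S.smul _ h1, by rw [E.smul _ h1]; exact h2⟩
    · rintro ⟨h1, h2⟩
      have h3 : h ∈ L := by simpa using S.smul g h1
      exact ⟨h3, by rw [← E.smul _ h3]; exact h2⟩
  · rintro (u : Vtx o' L') (v : Vtx o' L') ⟨k, hk⟩ hne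
    show ∃ h, (E.c u).1 \ (E.c v).1 = {h}
    rw [E.c_diff, hk]
    have : ∃ h ∈ L, σ h = k := by
      by_contra hcon
      push Not at hcon
      apply hne
      apply vtx_ext
      intro h hh
      by_contra hn
      have : h ∈ (E.c u).1 \ (E.c v).1 := ⟨hh, hn⟩
      rw [E.c_diff, hk] at this
      exact hcon h this.1 this.2
    obtain ⟨h, h1, rfl⟩ := this
    refine ⟨h, ?_⟩
    ext h'
    constructor
    · rintro ⟨a, b⟩
      exact E.inj a h1 b
    · rintro rfl
      exact ⟨h1, rfl⟩
  · rintro (u : Vtx o L) (v : Vtx o L) ⟨h, hh⟩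
    obtain ⟨u', rfl⟩ := hsurj u
    obtain ⟨v', rfl⟩ := hsurj v
    obtain ⟨p, hp⟩ := tree_path (dualT S') u' v'
    have hm : h ∈ (E.c u').1 \ (E.c v').1 := by rw [hh]; rfl
    rw [E.c_diff] at hm
    obtain ⟨x, y, e, _⟩ := cross S'.toSys p hm.2.1 hm.2.2
    have e2 : (E.c x).1 \ (E.c y).1 = {h} := by
      rw [E.c_diff, e]
      ext h'
      constructor
      · rintro ⟨a, b⟩
        exact E.inj a hm.1 b
      · rintro rfl
        exact ⟨hm.1, rfl⟩
    exact ⟨x, y, ⟨_, e⟩, edge_unique S.toSys e2 hh, edge_unique' S.toSys e2 hh⟩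
  · intro u v e p hp w hw
    symm
    apply vtx_ext
    intro h hh
    have h2 : h ∈ (E.c v).1 := by
      have := hh
      rwa [show E.c u = E.c v from e] at this
    exact ⟨hh.1, path_btw S'.toSys p hp hw hh.2 h2.2⟩

end ColSec

section ContSec
open Topology Filter
variable {G P : Type u} [Group G] [Poc P] [PocAct G P] {o : Pt P} {El : Subgroup G → Prop}

theorem emb_id {L L' : Set P} (S : Sys G o L) (h : L ⊆ L') : Emb G o L o L' id :=
  ⟨fun a => h a, fun _ _ e => e, fun _ _ e => e, fun _ => rfl, fun _ _ _ => rfl, fun _ => Iff.rfl, fun a => S.compl a⟩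

theorem ep_mono {w w' : P → ℝ} (h : sp w ⊆ sp w') : ep G w ⊆ ep G w' := fun _ a => ⟨h a.1, a.2⟩

theorem rho_dist {w : P → ℝ} (H : Good El o w) (u v : Vtx o (ep G w)) :
    (rho H).dist u v = dlen o (ep G w) w u v := dualM_dist _ _ _ _ _ _ _

theorem emb_dlen {w w' : P → ℝ} (H : Good El o w) (hs : sp w ⊆ sp w')
    (u v : Vtx o (ep G w')) :
    dlen o (ep G w) w ((emb_id H.tsys.toSys (ep_mono (G := G) hs)).c u) ((emb_id H.tsys.toSys (ep_mono (G := G) hs)).c v)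
      = ∑ h ∈ (u.2.dfin v.2).toFinset, w h := by
  unfold dlen
  rw [Emb.c_diff, ← finsum_mem_coe_finset, Set.Finite.coe_toFinset]
  apply finsum_mem_inter_support_eq'
  intro h hh
  constructor
  · rintro ⟨_, a⟩
    exact a
  · intro a
    exact ⟨⟨hh, (u.2.sub a.1).2⟩, a⟩

theorem rho_cone {w w' : P → ℝ} (H : Good El o w) (H' : Good El o w') (hs : sp w ⊆ sp w') :
    CollapseOf (rho H).toGTree (rho H').toGTree :=
  ⟨_, (emb_id H.tsys.toSys (ep_mono (G := G) hs)).collapse H.tsys H'.tsys⟩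

def mkD {D : Set (MGTree G)} (T : MGTree G) (h : T ∈ D) : DSp D := ⟨T, h⟩

theorem rho_cont {K : Type*} [TopologicalSpace K] {D : Set (MGTree G)} (wt : K → P → ℝ)
    (H : ∀ κ, Good El o (wt κ)) (hD : ∀ κ, rho (H κ) ∈ D) (hb : ∀ h, Continuous (fun κ => wt κ h))
    {M : Set P} (hM : M.Finite) (hc : ∀ κ h, wt κ h ≠ 0 → ∃ g : G, g • h ∈ M) :
    Continuous (fun κ => mkD (rho (H κ)) (hD κ)) := by
  let tr : K → Set P := fun κ => {h ∈ M | wt κ h ≠ 0}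
  have htr : ∀ κ κ', tr κ ⊆ tr κ' → sp (wt κ) ⊆ sp (wt κ') := by
    intro κ κ' e h hh
    obtain ⟨g, hg⟩ := hc κ h hh
    have := e (show g • h ∈ tr κ from ⟨hg, by rw [(H κ).wg]; exact hh⟩)
    have h2 := this.2
    rw [(H κ').wg] at h2
    exact h2
  have hfin : (Set.range tr).Finite := hM.finite_subsets.subset (by
    rintro _ ⟨κ, rfl⟩
    exact fun h hh => hh.1)
  have : Finite (Set.range tr) := hfin
  apply LocallyFinite.continuous (f := fun s : Set.range tr => {κ | tr κ ⊆ s.1}) (locallyFinite_of_finite _)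
  · ext κ
    simp only [Set.mem_iUnion, Set.mem_univ, iff_true]
    exact ⟨⟨tr κ, κ, rfl⟩, fun _ h => h⟩
  · rintro ⟨s, κ1, rfl⟩
    have : {κ | tr κ ⊆ tr κ1} = ⋂ h ∈ {h ∈ M | wt κ1 h = 0}, {κ | wt κ h = 0} := by
      ext κ
      simp only [Set.mem_iInter]
      constructor
      · intro e h hh
        by_contra hn
        exact (e (show h ∈ tr κ from ⟨hh.1, hn⟩)).2 hh.2
      · intro e h hh
        refine ⟨hh.1, fun h0 => hh.2 (e h ⟨hh.1, h0⟩)⟩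
    show IsClosed {κ | tr κ ⊆ tr κ1}
    rw [this]
    exact isClosed_biInter fun h _ => isClosed_eq (hb h) continuous_const
  · rintro ⟨s, κ1, rfl⟩
    rw [continuousOn_iff_continuous_domRestrict]
    let Z := {κ | tr κ ⊆ tr κ1}
    have hsub : ∀ κ : Z, sp (wt κ.1) ⊆ sp (wt κ1) := fun κ => htr _ _ κ.2
    let F : Z → {T : MGTree G // T ∈ closedCone D (rho (H κ1))} :=
      fun κ => ⟨rho (H κ.1), hD _, rho_cone (H _) (H _) (hsub κ)⟩
    suffices hF : Continuous F from (cinc_cont (hD κ1)).comp hF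
    refine Continuous.subtype_mk ?_ _
    rw [continuous_iff_continuousAt]
    intro κ2
    rw [ContinuousAt, tendsto_def]
    intro s hs
    obtain ⟨U, hUs, hU, h2⟩ := mem_nhds_iff.1 hs
    obtain ⟨X, A, ε, hε, hB⟩ := gr_isOpen.1 hU _ h2
    refine Filter.mem_of_superset ?_ (Set.preimage_mono (hB.trans hUs))
    have E := fun κ : Z => emb_id (H κ.1).tsys.toSys (ep_mono (G := G) (hsub κ))
    have col := fun κ : Z => (E κ).collapse (H κ.1).tsys (H κ1).tsys
    choose lift hl using (col κ2).2.1
    have key : ∀ (κ : Z) (x y : Vtx o (ep G (wt κ1))) (g : G), (rho (H κ.1)).dist ((E κ).c x) ((rho (H κ.1)).act g ((E κ).c y))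
        = ∑ h ∈ (x.2.dfin (actV (H κ1).tsys.toSys g y).2).toFinset, wt κ.1 h := by
      intro κ x y g
      have h1 : (rho (H κ.1)).act g ((E κ).c y) = (E κ).c (actV (H κ1).tsys.toSys g y) := ((col κ).1 g y).symm
      rw [h1]
      exact (rho_dist _ _ _).trans (emb_dlen (H κ.1) (hsub κ) _ _)
    have fin : ∀ᶠ κ : Z in 𝓝 κ2, ∀ x ∈ X, ∀ y ∈ X, ∀ g ∈ A,
        |(rho (H κ2.1)).dist x ((rho (H κ2.1)).act g y) - (rho (H κ.1)).dist ((E κ).c (lift x)) ((rho (H κ.1)).act g ((E κ).c (lift y)))| < ε := by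
      rw [Filter.eventually_all_finset]
      intro x _
      rw [Filter.eventually_all_finset]
      intro y _
      rw [Filter.eventually_all_finset]
      intro g _
      have e1 : (rho (H κ2.1)).dist x ((rho (H κ2.1)).act g y) = ∑ h ∈ ((lift x).2.dfin (actV (H κ1).tsys.toSys g (lift y)).2).toFinset, wt κ2.1 h := by
        have := key κ2 (lift x) (lift y) g
        rw [hl x, hl y] at this
        exact this
      have e2 : ∀ κ : Z, (rho (H κ.1)).dist ((E κ).c (lift x)) ((rho (H κ.1)).act g ((E κ).c (lift y))) =
        ∑ h ∈ ((lift x).2.dfin (actV (H κ1).tsys.toSys g (lift y)).2).toFinset, wt κ.1 h := fun κ => key κ _ _ g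
      have hcont : Continuous (fun κ : Z => ∑ h ∈ ((lift x).2.dfin (actV (H κ1).tsys.toSys g (lift y)).2).toFinset, wt κ.1 h) :=
        continuous_finsetSum _ fun h _ => (hb h).comp continuous_subtype_val
      have := Metric.tendsto_nhds.1 (hcont.tendsto κ2) ε hε
      filter_upwards [this] with κ hκ
      rw [dist_comm, Real.dist_eq] at hκ
      rw [e1, e2]
      exact hκ
    filter_upwards [fin] with κ hκ
    exact ⟨fun x => (E κ).c (lift x), hκ⟩

end ContSec

section SubSec
open Topology Filter
variable {G P P' : Type u} [Group G] [Poc P] [PocAct G P] [Poc P'] [PocAct G P'] {o : Pt P} {o' : Pt P'}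
  {El : Subgroup G → Prop}

/-- projections between weighted wall systems -/
structure Proj (G : Type u) {P P' : Type u} [Group G] [Poc P] [PocAct G P] [Poc P'] [PocAct G P']
    (o : Pt P) (o' : Pt P') (wt : P → ℝ) (wt' : P' → ℝ) (p : P' → P) : Prop where
  mono : ∀ {h k}, wt' h ≠ 0 → wt' k ≠ 0 → h ≤ k → p h ≤ p k
  compl : ∀ {h}, wt' h ≠ 0 → p hᶜ = (p h)ᶜ
  smul : ∀ (g : G) {h}, wt' h ≠ 0 → p (g • h) = g • p h
  base : ∀ {h}, wt' h ≠ 0 → (h ∈ o'.m ↔ p h ∈ o.m)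
  sum : ∀ A, wt A = ∑ᶠ h ∈ {h | wt' h ≠ 0 ∧ p h = A}, wt' h

variable {wt : P → ℝ} {wt' : P' → ℝ} {p : P' → P}

theorem Proj.fib (S' : Sys G o' (sp wt')) (Q : Proj G o o' wt wt' p) (A : P) : {h | wt' h ≠ 0 ∧ p h = A}.Finite := by
  by_cases hne : ∃ h, wt' h ≠ 0 ∧ p h = A
  · obtain ⟨h0, h1, rfl⟩ := hne
    obtain ⟨g1, a1⟩ := S'.hit (h := h0) h1
    obtain ⟨g2, a2⟩ := S'.hit (S'.compl (h := h0) h1)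
    rw [PocAct.scompl, o'.co] at a2
    refine (((S'.fin (g2 * g1⁻¹)).image (fun h => g1⁻¹ • h))).subset ?_
    rintro h ⟨b1, b2⟩
    refine ⟨g1 • h, ⟨S'.smul g1 b1, ?_, ?_⟩, inv_smul_smul _ _⟩
    · rw [Q.base (S'.smul g1 b1), Q.smul _ b1, b2, ← Q.smul _ h1, ← Q.base (S'.smul g1 h1)]
      exact a1
    · rw [mul_smul, inv_smul_smul, Q.base (S'.smul g2 b1), Q.smul _ b1, b2, ← Q.smul _ h1, ← Q.base (S'.smul g2 h1)]
      exact a2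
  · convert Set.finite_empty
    ext h
    constructor
    · intro hh; exact hne ⟨h, hh⟩
    · rintro ⟨⟩

theorem Proj.ne (H' : Good El o' wt') (Q : Proj G o o' wt wt' p) {h : P'} (hh : wt' h ≠ 0) : wt (p h) ≠ 0 := by
  have hf := Q.fib H'.sys (p h)
  rw [Q.sum, ← hf.coe_toFinset, finsum_mem_coe_finset]
  apply ne_of_gt
  apply Finset.sum_pos'
  · intro i _; exact H'.nonneg i
  · exact ⟨h, by simp [hh], H'.pos hh⟩

theorem Proj.surj (Q : Proj G o o' wt wt' p) {A : P} (hA : wt A ≠ 0) : ∃ h, wt' h ≠ 0 ∧ p h = A := by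
  by_contra hn
  apply hA
  rw [Q.sum]
  have : {h | wt' h ≠ 0 ∧ p h = A} = ∅ := by
    ext h
    constructor
    · intro hh; exact hn ⟨h, hh⟩
    · rintro ⟨⟩
  rw [this, finsum_mem_empty]

theorem Proj.ess (H : Good El o wt) (H' : Good El o' wt') (Q : Proj G o o' wt wt' p) {h : P'} (hh : wt' h ≠ 0) :
    Ess G h ↔ Ess G (p h) := by
  have S' := H'.sys
  have S := H.sys
  have hn := Q.ne H' hh
  constructor
  · rintro ⟨g, hg⟩
    refine ⟨g, lt_of_le_of_ne ?_ ?_⟩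
    · rw [← Q.smul _ hh]; exact Q.mono (S'.smul g hh) hh hg.le
    · intro e
      apply chain_inf hg (Q.fib S' (p h))
      intro n
      refine ⟨S'.smul _ hh, ?_⟩
      rw [Q.smul _ hh]
      induction n with
      | zero => simp
      | succ n ih => rw [pow_succ, mul_smul, e, ih]
  · rintro ⟨g, hg⟩
    refine ⟨g, lt_of_le_of_ne ?_ ?_⟩
    · have hgh := S'.smul g (h := h) hh
      rcases S'.nested hgh (show h ∈ sp wt' from hh) with e | e | e | e
      · exact e
      · have := Q.mono hh hgh e
        rw [Q.smul _ hh] at this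
        exact absurd this (not_le_of_gt hg)
      · have := Q.mono hgh (S'.compl (h := h) hh) e
        rw [Q.smul _ hh, Q.compl hh] at this
        exact (S.not_both (S.smul g (h := p h) hn) hg.le this).elim
      · have := Q.mono (S'.compl hgh) hh e
        rw [Q.compl hgh, Q.smul _ hh] at this
        exact (S.not_both (S.compl (h := p h) hn) (compl_le_comm' this) (Poc.anti hg.le)).elim
    · intro e
      rw [← Q.smul _ hh, e] at hg
      exact hg.ne rfl

theorem Proj.le (H : Good El o wt) (H' : Good El o' wt') (Q : Proj G o o' wt wt' p) {h k : P'} (hh : wt' h ≠ 0)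
    (hk : wt' k ≠ 0) (hl : p h < p k) : h ≤ k := by
  have S' := H'.sys
  have S := H.sys
  rcases S'.nested (show h ∈ sp wt' from hh) (show k ∈ sp wt' from hk) with e | e | e | e
  · exact e
  · exact absurd (Q.mono hk hh e) (not_le_of_gt hl)
  · have := Q.mono hh (S'.compl (h := k) hk) e
    rw [Q.compl hk] at this
    exact (S.not_both (Q.ne H' hh) hl.le this).elim
  · have := Q.mono (S'.compl (h := h) hh) hk e
    rw [Q.compl hh] at this
    exact (S.not_both (S.compl (Q.ne H' hk)) (compl_le_comm' this) (Poc.anti hl.le)).elim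

theorem Proj.fmin (H : Good El o wt) (H' : Good El o' wt') (Q : Proj G o o' wt wt' p) {A : P} (hA : wt A ≠ 0) :
    ∃ h, (wt' h ≠ 0 ∧ p h = A) ∧ ∀ k, wt' k ≠ 0 → p k = A → h ≤ k := by
  obtain ⟨h, hm⟩ := (Q.fib H'.sys A).exists_minimal (Q.surj hA)
  refine ⟨h, hm.1, fun k k1 k2 => ?_⟩
  have S' := H'.sys
  have S := H.sys
  have hh := hm.1.1
  rcases S'.nested (show h ∈ sp wt' from hh) (show k ∈ sp wt' from k1) with e | e | e | e
  · exact e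
  · exact hm.2 ⟨k1, k2⟩ e
  · have := Q.mono hh (S'.compl (h := k) k1) e
    rw [Q.compl k1, k2, hm.1.2] at this
    exact (S.not_both (show A ∈ sp wt from hA) le_rfl this).elim
  · have := Q.mono (S'.compl (h := h) hh) k1 e
    rw [Q.compl hh, k2, hm.1.2] at this
    exact (S.not_both (S.compl (show A ∈ sp wt from hA)) this le_rfl).elim

theorem Proj.emb [Nonempty P'] (H : Good El o wt) (H' : Good El o' wt') (Q : Proj G o o' wt wt' p) :
    ∃ σ, Emb G o (ep G wt) o' (ep G wt') σ := by
  have S' := H'.sys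
  have S := H.sys
  let orb : P → Set P := fun A => MulAction.orbit G A
  let O : P → Prop := fun A => WellOrderingRel (orb A) (orb Aᶜ)
  have orbg : ∀ (g : G) A, orb (g • A) = orb A := fun g A => MulAction.orbit_smul g A
  have Og : ∀ (g : G) A, O (g • A) ↔ O A := by
    intro g A
    show WellOrderingRel _ _ ↔ WellOrderingRel _ _
    rw [← PocAct.scompl, orbg, orbg]
  have Oc : ∀ A, wt A ≠ 0 → (O Aᶜ ↔ ¬ O A) := by
    intro A hA
    show WellOrderingRel _ _ ↔ ¬ WellOrderingRel _ _
    rw [Poc.cc]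
    have hne : orb A ≠ orb Aᶜ := by
      intro e
      have : A ∈ orb Aᶜ := by rw [← e]; exact MulAction.mem_orbit_self A
      obtain ⟨g, hg⟩ := this
      have hg' : g • Aᶜ = A := hg
      apply H.noinv g⁻¹ hA
      rw [inv_smul_eq_iff]
      exact hg'.symm
    rcases trichotomous_of WellOrderingRel (orb A) (orb Aᶜ) with e | e | e
    · exact ⟨fun x => (asymm e x).elim, fun x => (x e).elim⟩
    · exact absurd e hne
    · exact ⟨fun _ x => asymm e x, fun _ => e⟩
  choose! mn hmn hmin using fun A => Q.fmin H H' (A := A)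
  have mg : ∀ (g : G) A, wt A ≠ 0 → mn (g • A) = g • mn A := by
    intro g A hA
    have hgA : wt (g • A) ≠ 0 := S.smul g (h := A) hA
    have a1 := hmn A hA
    have a2 := hmn (g • A) hgA
    apply le_antisymm
    · apply hmin _ hgA
      · exact S'.smul g (h := mn A) a1.1
      · rw [Q.smul _ a1.1, a1.2]
    · have := hmin A hA (g⁻¹ • mn (g • A)) (S'.smul g⁻¹ (h := mn (g • A)) a2.1) (by rw [Q.smul _ a2.1, a2.2, inv_smul_smul])
      have h2 := PocAct.mono g this
      rwa [smul_inv_smul] at h2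
  let σ : P → P' := fun A => if O A then mn A else (mn Aᶜ)ᶜ
  have hσ : ∀ A, wt A ≠ 0 → wt' (σ A) ≠ 0 ∧ p (σ A) = A := by
    intro A hA
    by_cases h : O A
    · simp only [σ, h, if_true]; exact hmn A hA
    · simp only [σ, h, if_false]
      have := hmn Aᶜ (S.compl (h := A) hA)
      refine ⟨S'.compl (h := mn Aᶜ) this.1, ?_⟩
      rw [Q.compl this.1, this.2, Poc.cc]
  refine ⟨σ, ?_, ?_, ?_, ?_, ?_, ?_, ?_⟩
  · intro A hA
    have := hσ A hA.1
    exact ⟨this.1, (Q.ess H H' this.1).2 (by rw [this.2]; exact hA.2)⟩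
  · intro A B hA hB e
    rw [← (hσ A hA.1).2, e, (hσ B hB.1).2]
  · intro A B hA hB e
    rcases eq_or_lt_of_le e with rfl | e
    · exact le_rfl
    · apply Q.le H H' (hσ A hA.1).1 (hσ B hB.1).1
      rw [(hσ A hA.1).2, (hσ B hB.1).2]; exact e
  · intro A hA
    have := Oc A hA.1
    by_cases h : O A
    · have h2 : ¬ O Aᶜ := by rw [this]; exact fun x => x h
      simp only [σ, h, h2, if_true, if_false, Poc.cc]
    · have h2 : O Aᶜ := by rw [this]; exact h
      simp only [σ, h, h2, if_true, if_false, Poc.cc]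
  · intro g A hA
    by_cases h : O A
    · have h2 : O (g • A) := (Og g A).2 h
      simp only [σ, h, h2, if_true]; exact mg g A hA.1
    · have h2 : ¬ O (g • A) := fun x => h ((Og g A).1 x)
      simp only [σ, h, h2, if_false]
      rw [← PocAct.scompl, mg g _ (S.compl (h := A) hA.1), PocAct.scompl]
  · intro A hA
    rw [Q.base (hσ A hA.1).1, (hσ A hA.1).2]
  · intro A hA; exact H.tsys.compl hA

theorem Proj.vtx (H : Good El o wt) (H' : Good El o' wt') (Q : Proj G o o' wt wt' p) (v : Vtx o (ep G wt)) :
    IsVtx o' (ep G wt') {h ∈ ep G wt' | p h ∈ v.1} := by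
  have pe : ∀ {h}, h ∈ ep G wt' → p h ∈ ep G wt := fun hh => ⟨Q.ne H' hh.1, (Q.ess H H' hh.1).1 hh.2⟩
  refine ⟨fun hh => hh.1, ?_, ?_, ?_⟩
  · intro h hh
    have h1 := v.2.tot (pe hh)
    have h2 := H'.tsys.compl hh
    show (hᶜ ∈ ep G wt' ∧ p hᶜ ∈ v.1) ↔ ¬ (h ∈ ep G wt' ∧ p h ∈ v.1)
    rw [Q.compl hh.1, h1]
    tauto
  · rintro h k ⟨h1, h2⟩ hk e
    exact ⟨hk, v.2.up h2 (pe hk) (Q.mono h1.1 hk.1 e)⟩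
  · refine (v.2.fin.biUnion fun A _ => Q.fib H'.sys A).subset ?_
    rintro h ⟨⟨h1, h2⟩, h3⟩
    refine Set.mem_biUnion (x := p h) ⟨h2, ?_⟩ ⟨h1.1, rfl⟩
    rwa [← Q.base h1.1]

theorem Proj.spec [Group.FG G] [Nonempty P'] {D : Set (MGTree G)} (H : Good El o wt) (H' : Good El o' wt')
    (Q : Proj G o o' wt wt' p) (h1 : rho H ∈ D) (h2 : rho H' ∈ D) : mkD (rho H') h2 ⤳ mkD (rho H) h1 := by
  obtain ⟨σ, E⟩ := Q.emb H H'
  refine dsp_spec (R := rho H') h2 ⟨h2, collapse_self _⟩ ⟨h1, E.c, E.collapse H.tsys H'.tsys⟩ ?_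
  refine gr_spec (T := rho H) (T' := rho H') (fun v => ⟨_, Q.vtx H H' v⟩) ?_ ?_
  · intro g (v : Vtx o (ep G wt))
    apply Subtype.ext
    ext h
    show (h ∈ ep G wt' ∧ g⁻¹ • p h ∈ v.1) ↔ (g⁻¹ • h ∈ ep G wt' ∧ p (g⁻¹ • h) ∈ v.1)
    constructor
    · rintro ⟨a, b⟩
      exact ⟨H'.tsys.smul _ a, by rw [Q.smul _ a.1]; exact b⟩
    · rintro ⟨a, b⟩
      have a' : h ∈ ep G wt' := by simpa using H'.tsys.smul g a
      exact ⟨a', by rw [← Q.smul _ a'.1]; exact b⟩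
  · intro (u : Vtx o (ep G wt)) (v : Vtx o (ep G wt))
    refine (rho_dist H' _ _).trans (Eq.trans ?_ (rho_dist H _ _).symm)
    unfold dlen
    have e : ({h ∈ ep G wt' | p h ∈ u.1} \ {h ∈ ep G wt' | p h ∈ v.1}) = ⋃ A ∈ u.1 \ v.1, {h | wt' h ≠ 0 ∧ p h = A} := by
      ext h
      simp only [Set.mem_iUnion]
      constructor
      · rintro ⟨⟨a, b⟩, c⟩
        exact ⟨p h, ⟨b, fun x => c ⟨a, x⟩⟩, a.1, rfl⟩
      · rintro ⟨_, ⟨a, b⟩, c, rfl⟩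
        exact ⟨⟨⟨c, (Q.ess H H' c).2 (u.2.sub a).2⟩, a⟩, fun x => b x.2⟩
    show ∑ᶠ h ∈ ({h ∈ ep G wt' | p h ∈ u.1} \ {h ∈ ep G wt' | p h ∈ v.1}), wt' h = _
    rw [e, finsum_mem_biUnion]
    · apply finsum_mem_congr rfl
      intro A _
      exact (Q.sum A).symm
    · intro A _ B _ hAB
      refine Set.disjoint_left.2 ?_
      rintro h ⟨_, rfl⟩ ⟨_, e⟩
      exact hAB e
    · exact u.2.dfin v.2
    · intro A _; exact Q.fib H'.sys A

end SubSec

section Fl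
variable {G P : Type u} [Group G] [Poc P] [PocAct G P]

/-- elements flipping a wall -/
def fl (G : Type u) {P : Type u} [Group G] [Poc P] [PocAct G P] (h : P) : Set G := {γ | γ • hᶜ < h}

theorem fl_mono {h k : P} (e : h ≤ k) : fl G h ⊆ fl G k := fun γ hγ =>
  (PocAct.mono γ (Poc.anti e)).trans_lt (lt_of_lt_of_le hγ e)

theorem fl_disj {h : P} {γ : G} (h1 : γ ∈ fl G h) (h2 : γ ∈ fl G hᶜ) : False := by
  have e1 : γ • hᶜ < h := h1
  have e2 : γ • hᶜᶜ < hᶜ := h2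
  rw [PocAct.scompl] at e1
  rw [Poc.cc] at e2
  have := Poc.anti e1.le
  rw [Poc.cc] at this
  exact absurd e2 (not_lt_of_ge this)

theorem fl_smul {h : P} {g γ : G} : γ ∈ fl G (g • h) ↔ g⁻¹ * γ * g ∈ fl G h := by
  show γ • (g • h)ᶜ < g • h ↔ (g⁻¹ * γ * g) • hᶜ < h
  rw [← PocAct.scompl, ← smul_lt_iff' g (h := (g⁻¹ * γ * g) • hᶜ), smul_smul, smul_smul]
  congr! 2
  group

end Fl

section CA
variable {G : Type u} [Group G] (T : GTree G)

theorem HL_fix {g : G} (hg : T.Hyperbolic g) {A : Set T.V} (h : A ∈ HL T.graph) : g • A ≠ A := by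
  obtain ⟨u, v, a, rfl⟩ := h
  intro e
  rw [smul_half] at e
  exact hg u (half_inj T.isTree ((adj_smul T).2 a) a e).1

theorem HL_ne {A : Set T.V} (h : A ∈ HL T.graph) : A.Nonempty := by
  obtain ⟨u, v, a, rfl⟩ := h
  exact ⟨u, half_self u v⟩

theorem HL_ne' {A : Set T.V} (h : A ∈ HL T.graph) : ∃ x, x ∉ A := HL_ne T (HL_compl T.isTree h)

theorem hyp_cases {g : G} (hg : T.Hyperbolic g) {A : Set T.V} (h : A ∈ HL T.graph) :
    g ∈ fl G A ∨ g ∈ fl G Aᶜ ∨ g • A < A ∨ A < g • A := by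
  have hn := HL_fix T hg h
  have hi := HL_noinv T g h
  rcases HL_nested T.isTree (HL_smul T g h) h with e | e | e | e
  · exact Or.inr (Or.inr (Or.inl (lt_of_le_of_ne e hn)))
  · exact Or.inr (Or.inr (Or.inr (lt_of_le_of_ne e hn.symm)))
  · refine Or.inr (Or.inl ?_)
    show g • Aᶜᶜ < Aᶜ
    rw [Poc.cc]
    exact lt_of_le_of_ne e hi
  · refine Or.inl ?_
    show g • Aᶜ < A
    rw [PocAct.scompl]
    exact lt_of_le_of_ne e fun e' => hi (compl_inj' (by rw [Poc.cc]; exact e'))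

theorem pow_lt {g : G} {A : Set T.V} (h : g • A < A) (n : ℕ) : g ^ n • A ≤ A := by
  induction n with
  | zero => rw [pow_zero, one_smul]
  | succ n ih =>
    rw [pow_succ, mul_smul]
    exact (PocAct.mono _ h.le).trans ih

theorem inv_lt {g : G} {A : Set T.V} (h : g • A < A) : A < g⁻¹ • A := by
  rw [← smul_lt_iff' g, smul_inv_smul]; exact h

theorem inv_lt_c {g : G} {A : Set T.V} (h : g • A < A) : g⁻¹ • Aᶜ < Aᶜ := by
  have := inv_lt T h
  rw [PocAct.scompl]
  exact compl_lt_compl_iff_lt.2 this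

theorem absorb {g : G} {A : Set T.V} (h : g • A < A) (hA : A ∈ HL T.graph) (z : T.V) :
    ∃ n : ℕ, ∀ m ≥ n, g ^ m • z ∈ A := by
  have hex : ∃ n : ℕ, g ^ n • z ∈ A := by
    by_contra hcon
    push Not at hcon
    obtain ⟨x, hx⟩ := HL_ne T hA
    refine chain_inf (g := g⁻¹) (h := Aᶜ) (s := (fun B => Bᶜ) '' hsep T.graph x z) (inv_lt_c T h)
      ((hsep_fin T.isTree x z).image _) fun n => ?_
    refine ⟨g⁻¹ ^ n • A, ⟨?_, ?_, ?_⟩, rfl⟩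
    · exact HL_smul T _ hA
    · rw [mem_sact, inv_pow, inv_inv]
      have := pow_lt T h n
      exact this (smul_mem_sact.2 hx)
    · rw [mem_sact, inv_pow, inv_inv]; exact hcon n
  obtain ⟨n, hn⟩ := hex
  refine ⟨n, fun m hm => ?_⟩
  obtain ⟨k, rfl⟩ := Nat.exists_eq_add_of_le hm
  rw [add_comm, pow_add, mul_smul]
  exact pow_lt T h k (smul_mem_sact.2 hn)

theorem meet {g : G} {A B : Set T.V} (hA : g • A < A) (hB : g • B < B) (h1 : A ∈ HL T.graph)
    (h2 : B ∈ HL T.graph) : ¬ A ≤ Bᶜ := by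
  intro e
  obtain ⟨x, -⟩ := HL_ne T h1
  obtain ⟨n, hn⟩ := absorb T hA h1 x
  obtain ⟨m, hm⟩ := absorb T hB h2 x
  exact e (hn (max n m) (le_max_left _ _)) (hm (max n m) (le_max_right _ _))

theorem meet_cmp {g : G} {A B : Set T.V} {x : T.V} (hA : g • A < A) (hB : g • B < B) (h1 : A ∈ HL T.graph)
    (h2 : B ∈ HL T.graph) (h3 : x ∉ A) (h4 : x ∉ B) : A ≤ B ∨ B ≤ A := by
  rcases HL_nested T.isTree h1 h2 with e | e | e | e
  · exact Or.inl e
  · exact Or.inr e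
  · exact (meet T hA hB h1 h2 e).elim
  · exact (h4 (e h3)).elim

theorem int_fin {A B : Set T.V} (hA : A ∈ HL T.graph) (hB : B ∈ HL T.graph) :
    {J ∈ HL T.graph | A ≤ J ∧ J ≤ B}.Finite := by
  obtain ⟨x, hx⟩ := HL_ne T hA
  obtain ⟨y, hy⟩ := HL_ne' T hB
  exact (hsep_fin T.isTree x y).subset fun J hJ => ⟨hJ.1, hJ.2.1 hx, fun h => hy (hJ.2.2 h)⟩

theorem CA_shift {a : G} {x : T.V} {H0 : Set T.V} {Z E : Set (Set T.V)} (h0 : H0 ∈ HL T.graph) (hx : x ∉ H0)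
    (ha0 : a • H0 < H0) (hZ : Z.Infinite) (hZ1 : ∀ H ∈ Z, H ∈ HL T.graph ∧ H ≤ H0 ∧ a • H < H)
    (hE : E = {K ∈ HL T.graph | K ≤ H0 ∧ ∃ H ∈ Z, H ≤ K}) :
    (∀ K ∈ E, a • K < K) ∧ (∀ K ∈ E, a • K ∈ E) ∧
    ∃ c : ℕ, ∀ K ∈ E, {J ∈ E | a • K ≤ J}.ncard = {J ∈ E | K ≤ J}.ncard + c := by
  subst hE
  have lt : ∀ K ∈ {K ∈ HL T.graph | K ≤ H0 ∧ ∃ H ∈ Z, H ≤ K}, a • K < K := by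
    rintro K ⟨k1, k2, H, hH, k3⟩
    obtain ⟨z1, z2, z3⟩ := hZ1 H hH
    have nle : ¬ K ≤ a • K := by
      intro e
      refine chain_inf ha0 (int_fin T k1 h0) fun n => ⟨HL_smul T _ h0, ?_, pow_lt T ha0 n⟩
      have : K ≤ a ^ n • K := by
        induction n with
        | zero => rw [pow_zero, one_smul]
        | succ n ih =>
          rw [pow_succ, mul_smul]
          exact ih.trans (PocAct.mono _ e)
      exact this.trans (PocAct.mono _ k2)
    rcases HL_nested T.isTree (HL_smul T a k1) k1 with e | e | e | e
    · exact lt_of_le_not_ge e nle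
    · exact (nle e).elim
    · obtain ⟨y, hy⟩ := HL_ne T (HL_smul T a z1)
      exact (e (PocAct.mono a k3 hy) (k3 (z3.le hy))).elim
    · exfalso
      have : x ∈ a • K := by
        by_contra hn
        exact hx (k2 (e hn))
      exact hx (ha0.le (PocAct.mono a k2 this))
  have mp : ∀ K ∈ {K ∈ HL T.graph | K ≤ H0 ∧ ∃ H ∈ Z, H ≤ K}, a • K ∈ {K ∈ HL T.graph | K ≤ H0 ∧ ∃ H ∈ Z, H ≤ K} := by
    intro K hK
    have l := lt K hK
    refine ⟨HL_smul T a hK.1, l.le.trans hK.2.1, ?_⟩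
    by_contra hcon
    push Not at hcon
    apply hZ
    refine (int_fin T (HL_smul T a hK.1) h0).subset fun H hH => ?_
    obtain ⟨z1, z2, z3⟩ := hZ1 H hH
    refine ⟨z1, ?_, z2⟩
    rcases meet_cmp T (x := x) z3 ((smul_lt_iff' a).2 l) z1 (HL_smul T a hK.1) (fun h => hx (z2 h))
      (fun h => hx (hK.2.1 (l.le h))) with e | e
    · exact (hcon H hH e).elim
    · exact e
  refine ⟨lt, mp, {J ∈ {K ∈ HL T.graph | K ≤ H0 ∧ ∃ H ∈ Z, H ≤ K} | a • H0 < J}.ncard, fun K hK => ?_⟩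
  have e1 : {J ∈ {K ∈ HL T.graph | K ≤ H0 ∧ ∃ H ∈ Z, H ≤ K} | a • K ≤ J} =
      (fun J => a • J) '' {J ∈ {K ∈ HL T.graph | K ≤ H0 ∧ ∃ H ∈ Z, H ≤ K} | K ≤ J} ∪
      {J ∈ {K ∈ HL T.graph | K ≤ H0 ∧ ∃ H ∈ Z, H ≤ K} | a • H0 < J} := by
    ext J
    constructor
    · rintro ⟨hJ, e⟩
      have l := lt J hJ
      rcases meet_cmp T (x := x) l ((smul_lt_iff' a).2 ha0) hJ.1 (HL_smul T a h0) (fun h => hx (hJ.2.1 h))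
        (fun h => hx (ha0.le h)) with e' | e'
      · left
        refine ⟨a⁻¹ • J, ⟨⟨HL_smul T _ hJ.1, ?_, ?_⟩, ?_⟩, smul_inv_smul a J⟩
        · rw [← smul_le_iff' a, smul_inv_smul]; exact e'
        · obtain ⟨H, hH, k3⟩ := hK.2.2
          refine ⟨H, hH, k3.trans ?_⟩
          rw [← smul_le_iff' a, smul_inv_smul]; exact e
        · rw [← smul_le_iff' a, smul_inv_smul]; exact e
      · rcases eq_or_lt_of_le e' with e' | e'
        · left
          refine ⟨H0, ⟨⟨h0, le_rfl, ?_⟩, hK.2.1⟩, e'⟩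
          obtain ⟨H, hH, k3⟩ := hK.2.2
          exact ⟨H, hH, k3.trans hK.2.1⟩
        · exact Or.inr ⟨hJ, e'⟩
    · rintro (⟨J, ⟨hJ, e⟩, rfl⟩ | ⟨hJ, e⟩)
      · exact ⟨mp J hJ, PocAct.mono a e⟩
      · exact ⟨hJ, (PocAct.mono a hK.2.1).trans e.le⟩
  have d1 : Disjoint ((fun J => a • J) '' {J ∈ {K ∈ HL T.graph | K ≤ H0 ∧ ∃ H ∈ Z, H ≤ K} | K ≤ J})
      {J ∈ {K ∈ HL T.graph | K ≤ H0 ∧ ∃ H ∈ Z, H ≤ K} | a • H0 < J} := by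
    rw [Set.disjoint_left]
    rintro _ ⟨J, ⟨hJ, e⟩, rfl⟩ ⟨-, e2⟩
    exact absurd e2 (not_lt_of_ge (PocAct.mono a hJ.2.1))
  have d2 : ((fun J => a • J) '' {J ∈ {K ∈ HL T.graph | K ≤ H0 ∧ ∃ H ∈ Z, H ≤ K} | K ≤ J}).Finite :=
    ((int_fin T hK.1 h0).subset fun J hJ => ⟨hJ.1.1, hJ.2, hJ.1.2.1⟩).image _
  have d3 : {J ∈ {K ∈ HL T.graph | K ≤ H0 ∧ ∃ H ∈ Z, H ≤ K} | a • H0 < J}.Finite :=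
    (int_fin T (HL_smul T a h0) h0).subset fun J hJ => ⟨hJ.1.1, hJ.2.le, hJ.1.2.1⟩
  rw [e1, Set.ncard_union_eq d1 d2 d3, Set.ncard_image_of_injective _ (MulAction.injective a)]

theorem CA0 {a b : G} {x : T.V} {Z : Set (Set T.V)} (hZ : Z.Infinite)
    (h1 : ∀ H ∈ Z, H ∈ HL T.graph ∧ x ∉ H ∧ a • H < H ∧ b • H < H) :
    ∃ M ∈ HL T.graph, a • b • M = b • a • M := by
  obtain ⟨H0, hH0⟩ := hZ.nonempty
  obtain ⟨h0, hx, ha0, hb0⟩ := h1 H0 hH0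
  have hZ' : {H ∈ Z | H ≤ H0}.Infinite := by
    intro hf
    apply hZ
    obtain ⟨y, hy⟩ := HL_ne T h0
    refine (hf.union (hsep_fin T.isTree y x)).subset fun H hH => ?_
    obtain ⟨z1, z2, z3, z4⟩ := h1 H hH
    rcases meet_cmp T (x := x) z3 ha0 z1 h0 z2 hx with e | e
    · exact Or.inl ⟨hH, e⟩
    · exact Or.inr ⟨z1, e hy, z2⟩
  obtain ⟨E, hE⟩ : ∃ E, E = {K ∈ HL T.graph | K ≤ H0 ∧ ∃ H ∈ {H ∈ Z | H ≤ H0}, H ≤ K} := ⟨_, rfl⟩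
  obtain ⟨la, ma, ca, ea⟩ := CA_shift T h0 hx ha0 hZ' (fun H hH => ⟨(h1 H hH.1).1, hH.2, (h1 H hH.1).2.2.1⟩) hE
  obtain ⟨lb, mb, cb, eb⟩ := CA_shift T h0 hx hb0 hZ' (fun H hH => ⟨(h1 H hH.1).1, hH.2, (h1 H hH.1).2.2.2⟩) hE
  have hE0 : H0 ∈ E := by rw [hE]; exact ⟨h0, le_rfl, H0, ⟨hH0, le_rfl⟩, le_rfl⟩
  have r1 := ea _ (mb _ hE0)
  have r2 := eb _ (ma _ hE0)
  rw [eb _ hE0] at r1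
  rw [ea _ hE0] at r2
  have key : ∀ K ∈ E, ∀ K' ∈ E, {J ∈ E | K ≤ J}.ncard = {J ∈ E | K' ≤ J}.ncard → K ≤ K' → K = K' := by
    intro K hK K' hK' e le
    by_contra hn
    have : {J ∈ E | K' ≤ J} ⊂ {J ∈ E | K ≤ J} := by
      refine ⟨fun J hJ => ⟨hJ.1, le.trans hJ.2⟩, fun hs => ?_⟩
      exact hn (le_antisymm le (hs ⟨hK, le_rfl⟩).2)
    have hf : {J ∈ E | K ≤ J}.Finite := by
      rw [hE] at hK
      refine (int_fin T hK.1 h0).subset fun J hJ => ?_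
      have := hJ.1
      rw [hE] at this
      exact ⟨this.1, hJ.2, this.2.1⟩
    exact absurd e (Set.ncard_lt_ncard this hf).ne'
  have m1 := ma _ (mb _ hE0)
  have m2 := mb _ (ma _ hE0)
  refine ⟨H0, h0, ?_⟩
  have q1 := m1
  have q2 := m2
  rw [hE] at q1 q2
  rcases meet_cmp T (x := x) (la _ m1) (la _ m2) q1.1 q2.1 (fun h => hx (q1.2.1 h)) (fun h => hx (q2.2.1 h)) with e | e
  · exact key _ m1 _ m2 (by omega) e
  · exact (key _ m2 _ m1 (by omega) e).symm

theorem CA1 {a b : G} (hc : T.Hyperbolic (a * b * a⁻¹ * b⁻¹)) :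
    {H ∈ HL T.graph | a • H < H ∧ b • H < H}.Finite := by
  by_contra hinf
  have hinf : {H ∈ HL T.graph | a • H < H ∧ b • H < H}.Infinite := hinf
  obtain ⟨x⟩ := T.nonempty
  have fin : ∀ M ∈ HL T.graph, a • b • M = b • a • M → False := by
    intro M hM e
    refine HL_fix T hc (HL_smul T b (HL_smul T a hM)) ?_
    have : (a * b * a⁻¹ * b⁻¹) • b • a • M = a • b • M := by simp only [mul_smul, inv_smul_smul]
    rw [this, e]
  by_cases h : {H ∈ HL T.graph | a • H < H ∧ b • H < H ∧ x ∉ H}.Infinite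
  · obtain ⟨M, hM, e⟩ := CA0 T (a := a) (b := b) (x := x) h fun H hH => ⟨hH.1, hH.2.2.2, hH.2.1, hH.2.2.1⟩
    exact fin M hM e
  · have h2 : {H ∈ HL T.graph | a • H < H ∧ b • H < H ∧ x ∈ H}.Infinite := by
      intro hf
      refine hinf (((Set.not_infinite.1 h).union hf).subset fun H hH => ?_)
      by_cases hx : x ∈ H
      · exact Or.inr ⟨hH.1, hH.2.1, hH.2.2, hx⟩
      · exact Or.inl ⟨hH.1, hH.2.1, hH.2.2, hx⟩
    obtain ⟨M, hM, e⟩ := CA0 T (a := a⁻¹) (b := b⁻¹) (x := x) (Set.Infinite.image (f := fun H => Hᶜ)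
      (fun a _ b _ e => compl_inj' e) h2) (by
      rintro _ ⟨H, hH, rfl⟩
      exact ⟨HL_compl T.isTree hH.1, fun h => h hH.2.2.2, inv_lt_c T hH.2.1, inv_lt_c T hH.2.2.1⟩)
    have e' : a • b • (a⁻¹ • b⁻¹ • M) = b • a • (a⁻¹ • b⁻¹ • M) := by
      have r1 : a • b • (a⁻¹ • b⁻¹ • M) = M := by rw [e, smul_inv_smul, smul_inv_smul]
      rw [r1, smul_inv_smul, smul_inv_smul]
    exact fin _ (HL_smul T _ (HL_smul T _ hM)) e'

theorem hyp_inv {g : G} (h : T.Hyperbolic g) : T.Hyperbolic g⁻¹ := by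
  intro v e
  refine h v ?_
  have e : g⁻¹ • v = v := e
  show g • v = v
  rw [inv_smul_eq_iff] at e
  exact e.symm

theorem hyp_conj {g : G} (k : G) (h : T.Hyperbolic g) : T.Hyperbolic (k * g * k⁻¹) := by
  intro v e
  have e : (k * g * k⁻¹) • v = v := e
  refine h (k⁻¹ • v) ?_
  show g • k⁻¹ • v = k⁻¹ • v
  rw [← mul_smul, eq_inv_smul_iff, ← mul_smul, ← mul_assoc]
  exact e

/-- a pair of hyperbolic elements with hyperbolic commutator -/
structure GoodPair (a b : G) : Prop where
  ha : T.Hyperbolic a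
  hb : T.Hyperbolic b
  hc : T.Hyperbolic (a * b * a⁻¹ * b⁻¹)

variable {T}

theorem CA {a b : G} (h : GoodPair T a b) :
    {H ∈ HL T.graph | a ∉ fl G H ∧ a ∉ fl G Hᶜ ∧ b ∉ fl G H ∧ b ∉ fl G Hᶜ}.Finite := by
  have c2 : T.Hyperbolic (a * b⁻¹ * a⁻¹ * b⁻¹⁻¹) := by
    have := hyp_conj T b⁻¹ (hyp_inv T h.hc)
    convert this using 1
    group
  have f1 := CA1 T h.hc
  have f2 := CA1 T c2
  refine ((f1.union f2).union ((f1.image compl).union (f2.image compl))).subset ?_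
  rintro H ⟨hH, n1, n2, n3, n4⟩
  have cl : ∀ g : G, H < g • H → g • Hᶜ < Hᶜ := fun g hh => by
    rw [PocAct.scompl]; exact compl_lt_compl_iff_lt.2 hh
  have il : ∀ g : G, H < g • H → g⁻¹ • H < H := fun g hh => by
    rw [← smul_lt_iff' g, smul_inv_smul]; exact hh
  rcases hyp_cases T h.ha hH with e | e | e | e
  · exact (n1 e).elim
  · exact (n2 e).elim
  · rcases hyp_cases T h.hb hH with e' | e' | e' | e'
    · exact (n3 e').elim
    · exact (n4 e').elim
    · exact Or.inl (Or.inl ⟨hH, e, e'⟩)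
    · exact Or.inl (Or.inr ⟨hH, e, il b e'⟩)
  · rcases hyp_cases T h.hb hH with e' | e' | e' | e'
    · exact (n3 e').elim
    · exact (n4 e').elim
    · exact Or.inr (Or.inr ⟨Hᶜ, ⟨HL_compl T.isTree hH, cl a e, inv_lt_c T e'⟩, Poc.cc H⟩)
    · exact Or.inr (Or.inl ⟨Hᶜ, ⟨HL_compl T.isTree hH, cl a e, cl b e'⟩, Poc.cc H⟩)

theorem fl_sep {g : G} {H : Set T.V} (x : T.V) (hH : H ∈ HL T.graph) (h : g ∈ fl G H) (hx : x ∉ H) :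
    H ∈ hsep T.graph (g • x) x :=
  ⟨hH, (show g • Hᶜ < H from h).le (smul_mem_sact.2 hx), hx⟩

theorem flip {a b : G} (h : GoodPair T a b) {H : Set T.V} (hH : H ∈ HL T.graph) : (fl G H).Nonempty := by
  obtain ⟨g, hg⟩ := HL_ess T hH
  obtain ⟨x⟩ := T.nonempty
  by_contra hcon
  rw [Set.not_nonempty_iff_eq_empty] at hcon
  have em : ∀ k : G, ∀ γ : G, γ ∉ fl G (k • H) := by
    intro n γ hγ
    rw [fl_smul, hcon] at hγ
    exact hγ
  obtain ⟨n0, k0⟩ := absorb T hg hH x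
  obtain ⟨n1, k1⟩ := absorb T hg hH (a • x)
  obtain ⟨n2, k2⟩ := absorb T hg hH (b • x)
  have st : g⁻¹ • ((g ^ (n0 + n1 + n2))⁻¹ • Hᶜ) < ((g ^ (n0 + n1 + n2))⁻¹ • Hᶜ) := by
    have := inv_lt_c T hg
    rw [← smul_lt_iff' (g ^ (n0 + n1 + n2))⁻¹] at this
    convert this using 1
    rw [← mul_smul, ← mul_smul, ← mul_inv_rev, ← mul_inv_rev, ← pow_succ', ← pow_succ]
  refine chain_inf st ((CA h).image compl) fun n => ?_
  have e1 : g⁻¹ ^ n • (g ^ (n0 + n1 + n2))⁻¹ • Hᶜ = ((g ^ (n + (n0 + n1 + n2)))⁻¹ • H)ᶜ := by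
    rw [← PocAct.scompl, ← mul_smul, inv_pow, ← mul_inv_rev, ← pow_add, add_comm]
  rw [e1]
  refine ⟨_, ⟨HL_smul T _ hH, em _ _, ?_, em _ _, ?_⟩, rfl⟩
  · intro hf
    have hf : a • ((g ^ (n + (n0 + n1 + n2)))⁻¹ • H)ᶜᶜ < ((g ^ (n + (n0 + n1 + n2)))⁻¹ • H)ᶜ := hf
    rw [Poc.cc] at hf
    refine hf.le (smul_mem_sact.2 (show x ∈ _ from ?_)) ?_
    · rw [mem_sact, inv_inv]; exact k0 _ (by omega)
    · rw [mem_sact, inv_inv]; exact k1 _ (by omega)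
  · intro hf
    have hf : b • ((g ^ (n + (n0 + n1 + n2)))⁻¹ • H)ᶜᶜ < ((g ^ (n + (n0 + n1 + n2)))⁻¹ • H)ᶜ := hf
    rw [Poc.cc] at hf
    refine hf.le (smul_mem_sact.2 (show x ∈ _ from ?_)) ?_
    · rw [mem_sact, inv_inv]; exact k0 _ (by omega)
    · rw [mem_sact, inv_inv]; exact k2 _ (by omega)

end CA

section PtExt
variable {P : Type u} [Poc P]

theorem pt_ext (hne : ∀ h : P, h ≠ hᶜ) {s : Set P} (hs : ∀ h ∈ s, ∀ k ∈ s, ¬ h ≤ kᶜ) : ∃ o : Pt P, s ⊆ o.m := by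
  obtain ⟨m, hsm, hm⟩ := zorn_subset_nonempty {t : Set P | ∀ h ∈ t, ∀ k ∈ t, ¬ h ≤ kᶜ} (by
    intro c hc hch _
    refine ⟨⋃₀ c, ?_, fun t ht => Set.subset_sUnion_of_mem ht⟩
    rintro h ⟨t, ht, hh⟩ k ⟨t', ht', hk⟩
    rcases hch.total ht ht' with e | e
    · exact hc ht' h (e hh) k hk
    · exact hc ht h hh k (e hk)) s hs
  have cons : ∀ h ∈ m, ∀ k ∈ m, ¬ h ≤ kᶜ := hm.prop
  have ins : ∀ h, h ∉ m → h ≤ hᶜ ∨ ∃ k ∈ m, h ≤ kᶜ := by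
    intro h hh
    by_contra hcon
    push Not at hcon
    apply hh
    refine hm.le_of_ge (y := insert h m) ?_ (Set.subset_insert _ _) (Set.mem_insert _ _)
    rintro a (rfl | ha) b (rfl | hb)
    · exact hcon.1
    · exact hcon.2 b hb
    · intro e; exact hcon.2 a ha (le_compl_comm' e)
    · exact cons a ha b hb
  have one : ∀ h, h ∉ m → hᶜ ∈ m := by
    intro h hh
    by_contra hc
    rcases ins h hh with e | ⟨k, hk, e⟩
    · rcases ins _ hc with e' | ⟨k', hk', e'⟩
      · rw [Poc.cc] at e'; exact hne h (le_antisymm e e')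
      · have := compl_le_compl' e'
        exact cons k' hk' k' hk' (this.trans (e.trans e'))
    · rcases ins _ hc with e' | ⟨k', hk', e'⟩
      · rw [Poc.cc] at e'
        have := le_compl_comm' e
        exact cons k hk k hk (this.trans (e'.trans e))
      · have := compl_le_compl' e'
        exact cons k' hk' k hk (this.trans e)
  have no : ∀ h, h ∈ m → hᶜ ∉ m := fun h hh hc => cons _ hc h hh le_rfl
  refine ⟨⟨m, fun {h k} e hh => ?_, fun h => ⟨fun a b => no h b a, one h⟩⟩, hsm⟩
  by_contra hk
  exact cons h hh _ (one k hk) (by rw [Poc.cc]; exact e)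

end PtExt

section Push
variable {G P P' : Type u} [Group G] [Poc P] [PocAct G P] [Poc P'] [PocAct G P'] {o : Pt P} {o' : Pt P'}
  {El : Subgroup G → Prop} {wt' : P' → ℝ} {p : P' → P}

noncomputable def pushw (wt' : P' → ℝ) (p : P' → P) (A : P) : ℝ := ∑ᶠ h ∈ {h | wt' h ≠ 0 ∧ p h = A}, wt' h

/-- hypotheses for pushing weights -/
structure PushH (G : Type u) {P P' : Type u} [Group G] [Poc P] [PocAct G P] [Poc P'] [PocAct G P']
    (o : Pt P) (o' : Pt P') (wt' : P' → ℝ) (p : P' → P) : Prop where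
  mono : ∀ {h k}, wt' h ≠ 0 → wt' k ≠ 0 → h ≤ k → p h ≤ p k
  compl : ∀ {h}, wt' h ≠ 0 → p hᶜ = (p h)ᶜ
  smul : ∀ (g : G) {h}, wt' h ≠ 0 → p (g • h) = g • p h
  fib : ∀ A, {h | wt' h ≠ 0 ∧ p h = A}.Finite
  noinv : ∀ (g : G) {h}, wt' h ≠ 0 → g • p h ≠ (p h)ᶜ
  diff : {h | wt' h ≠ 0 ∧ ¬ (h ∈ o'.m ↔ p h ∈ o.m)}.Finite
  ess : ∀ {h}, wt' h ≠ 0 → Ess G h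

theorem pushw_ne (H' : Good El o' wt') (Q : PushH G o o' wt' p) (A : P) :
    pushw wt' p A ≠ 0 ↔ ∃ h, wt' h ≠ 0 ∧ p h = A := by
  constructor
  · intro h
    by_contra hn
    apply h
    unfold pushw
    have : {h | wt' h ≠ 0 ∧ p h = A} = ∅ := by
      ext h
      constructor
      · intro hh; exact hn ⟨h, hh⟩
      · rintro ⟨⟩
    rw [this, finsum_mem_empty]
  · rintro ⟨h, hh, e⟩
    have hf := Q.fib A
    unfold pushw
    rw [← hf.coe_toFinset, finsum_mem_coe_finset]
    apply ne_of_gt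
    apply Finset.sum_pos'
    · intro i _; exact H'.nonneg i
    · exact ⟨h, by simp [hh, e], H'.pos hh⟩

theorem push_sum (H' : Good El o' wt') (Q : PushH G o o' wt' p) {s : Set P} (hs : s.Finite) :
    ∑ᶠ A ∈ s, pushw wt' p A = ∑ᶠ h ∈ {h | wt' h ≠ 0 ∧ p h ∈ s}, wt' h := by
  have : {h | wt' h ≠ 0 ∧ p h ∈ s} = ⋃ A ∈ s, {h | wt' h ≠ 0 ∧ p h = A} := by
    ext h; simp
  rw [this, finsum_mem_biUnion _ hs fun A _ => Q.fib A]
  · rfl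
  · intro A _ B _ hne
    rw [Function.onFun, Set.disjoint_left]
    rintro h ⟨_, rfl⟩ ⟨_, e⟩
    exact hne e

theorem push_good (H' : Good El o' wt') (Q : PushH G o o' wt' p) : Good El o (pushw wt' p) := by
  have S' := H'.sys
  have ne := pushw_ne H' Q
  have comp' : ∀ {h}, wt' h ≠ 0 → wt' hᶜ ≠ 0 := fun {h} hh => by rw [H'.wc]; exact hh
  have sm' : ∀ (g : G) {h}, wt' h ≠ 0 → wt' (g • h) ≠ 0 := fun g {h} hh => by rw [H'.wg]; exact hh
  have wc : ∀ A, pushw wt' p Aᶜ = pushw wt' p A := by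
    intro A
    unfold pushw
    apply finsum_mem_eq_of_bijOn (fun h => hᶜ)
    · refine ⟨?_, fun a _ b _ e => compl_inj' e, ?_⟩
      · rintro h ⟨h1, h2⟩
        exact ⟨comp' h1, by rw [Q.compl h1, h2, Poc.cc]⟩
      · rintro h ⟨h1, h2⟩
        exact ⟨hᶜ, ⟨comp' h1, by rw [Q.compl h1, h2]⟩, Poc.cc h⟩
    · intro h _; exact (H'.wc h).symm
  have wg : ∀ (g : G) A, pushw wt' p (g • A) = pushw wt' p A := by
    intro g A
    unfold pushw
    symm
    apply finsum_mem_eq_of_bijOn (fun h => g • h)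
    · refine ⟨?_, fun a _ b _ e => MulAction.injective g e, ?_⟩
      · rintro h ⟨h1, h2⟩
        exact ⟨sm' g h1, by rw [Q.smul g h1, h2]⟩
      · rintro h ⟨h1, h2⟩
        exact ⟨g⁻¹ • h, ⟨sm' _ h1, by rw [Q.smul _ h1, h2, inv_smul_smul]⟩, smul_inv_smul g h⟩
    · intro h _; exact (H'.wg g h).symm
  have cover : ∀ g : G, {h | wt' h ≠ 0 ∧ p h ∈ sepo o (sp (pushw wt' p)) g} ⊆
      sepo o' (sp wt') g ∪ ({h | wt' h ≠ 0 ∧ ¬ (h ∈ o'.m ↔ p h ∈ o.m)} ∪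
        {h | g • h ∈ {h | wt' h ≠ 0 ∧ ¬ (h ∈ o'.m ↔ p h ∈ o.m)}}) := by
    rintro g h ⟨h1, -, h2, h3⟩
    by_cases d1 : (h ∈ o'.m ↔ p h ∈ o.m)
    · by_cases d2 : (g • h ∈ o'.m ↔ p (g • h) ∈ o.m)
      · left
        refine ⟨h1, d1.2 h2, ?_⟩
        rw [d2, Q.smul g h1]; exact h3
      · exact Or.inr (Or.inr ⟨sm' g h1, d2⟩)
    · exact Or.inr (Or.inl ⟨h1, d1⟩)
  have pre : ∀ g : G, {h | g • h ∈ {h | wt' h ≠ 0 ∧ ¬ (h ∈ o'.m ↔ p h ∈ o.m)}} =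
      (fun h => g⁻¹ • h) '' {h | wt' h ≠ 0 ∧ ¬ (h ∈ o'.m ↔ p h ∈ o.m)} := by
    intro g
    ext h
    constructor
    · intro hh; exact ⟨g • h, hh, inv_smul_smul g h⟩
    · rintro ⟨k, hk, rfl⟩
      rw [Set.mem_ofPred_eq, smul_inv_smul]; exact hk
  have img : ∀ g : G, sepo o (sp (pushw wt' p)) g ⊆ p '' (sepo o' (sp wt') g ∪
      ({h | wt' h ≠ 0 ∧ ¬ (h ∈ o'.m ↔ p h ∈ o.m)} ∪ (fun h => g⁻¹ • h) '' {h | wt' h ≠ 0 ∧ ¬ (h ∈ o'.m ↔ p h ∈ o.m)})) := by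
    intro g A hA
    obtain ⟨h, h1, rfl⟩ := (ne A).1 hA.1
    refine ⟨h, ?_, rfl⟩
    rw [← pre]
    exact cover g ⟨h1, hA⟩
  have ufin : ∀ g : G, (sepo o' (sp wt') g ∪
      ({h | wt' h ≠ 0 ∧ ¬ (h ∈ o'.m ↔ p h ∈ o.m)} ∪ (fun h => g⁻¹ • h) '' {h | wt' h ≠ 0 ∧ ¬ (h ∈ o'.m ↔ p h ∈ o.m)})).Finite :=
    fun g => (S'.fin g).union (Q.diff.union (Q.diff.image _))
  have sfin : ∀ g : G, (sepo o (sp (pushw wt' p)) g).Finite := fun g => ((ufin g).image p).subset (img g)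
  refine ⟨fun A => ms_nonneg H'.nonneg _, wc, wg, ⟨?_, ?_, ?_, sfin, ?_⟩, ?_, ?_, ?_⟩
  · intro h hh; show _ ≠ _; rw [wc]; exact hh
  · intro g h hh; show _ ≠ _; rw [wg]; exact hh
  · intro A B hA hB
    obtain ⟨h, h1, rfl⟩ := (ne A).1 hA
    obtain ⟨k, k1, rfl⟩ := (ne B).1 hB
    rcases S'.nested h1 k1 with e | e | e | e
    · exact Or.inl (Q.mono h1 k1 e)
    · exact Or.inr (Or.inl (Q.mono k1 h1 e))
    · refine Or.inr (Or.inr (Or.inl ?_))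
      rw [← Q.compl k1]; exact Q.mono h1 (comp' k1) e
    · refine Or.inr (Or.inr (Or.inr ?_))
      rw [← Q.compl h1]; exact Q.mono (comp' h1) k1 e
  · intro A hA
    obtain ⟨h, h1, rfl⟩ := (ne A).1 hA
    obtain ⟨g0, hg0⟩ := S'.hit h1
    obtain ⟨g, hg⟩ := Q.ess (sm' g0 h1)
    by_contra hcon
    push Not at hcon
    have hgc : g⁻¹ • (g0 • h)ᶜ < (g0 • h)ᶜ := by
      rw [← smul_lt_iff' g, smul_inv_smul, PocAct.scompl]
      exact compl_lt' hg
    refine chain_inf hgc (Q.diff.image (fun h => hᶜ)) fun n => ?_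
    refine ⟨g⁻¹ ^ n • g0 • h, ⟨sm' _ (sm' _ h1), ?_⟩, ?_⟩
    · intro hiff
      rw [← mul_smul, Q.smul _ h1] at hiff
      refine hcon _ (hiff.1 ?_)
      rw [mul_smul]
      refine o'.up ?_ hg0
      clear hiff
      induction n with
      | zero => rw [pow_zero, one_smul]
      | succ n ih =>
        rw [pow_succ, mul_smul]
        refine ih.trans (PocAct.mono _ ?_)
        rw [← smul_le_iff' g, smul_inv_smul]; exact hg.le
    · show (g⁻¹ ^ n • g0 • h)ᶜ = _
      rw [PocAct.scompl]
  · intro g A hA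
    obtain ⟨h, h1, rfl⟩ := (ne A).1 hA
    exact Q.noinv g h1
  · intro K hK
    obtain ⟨C, hC⟩ := H'.E1 K hK
    refine ⟨C + (Q.diff.toFinset.card + Q.diff.toFinset.card), fun k hk => ?_⟩
    have c1 : {h | wt' h ≠ 0 ∧ ¬ (h ∈ o'.m ↔ p h ∈ o.m)}.ncard = Q.diff.toFinset.card :=
      Set.ncard_eq_toFinset_card _ Q.diff
    calc _ ≤ _ := Set.ncard_le_ncard (img k) ((ufin k).image p)
      _ ≤ _ := Set.ncard_image_le (ufin k)
      _ ≤ _ := Set.ncard_union_le _ _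
      _ ≤ C + _ := Nat.add_le_add (hC k hk) (Set.ncard_union_le _ _)
      _ ≤ _ := by
        have := Set.ncard_image_le (f := fun h => k⁻¹ • h) Q.diff
        omega
  · rintro K ⟨C, hC⟩
    refine H'.E2 K ⟨C + (∑ᶠ h ∈ {h | wt' h ≠ 0 ∧ ¬ (h ∈ o'.m ↔ p h ∈ o.m)}, wt' h +
      ∑ᶠ h ∈ {h | wt' h ≠ 0 ∧ ¬ (h ∈ o'.m ↔ p h ∈ o.m)}, wt' h), fun k hk => ?_⟩
    have f1 : {h | wt' h ≠ 0 ∧ p h ∈ sepo o (sp (pushw wt' p)) k}.Finite := by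
      refine (ufin k).subset ?_
      rw [← pre]; exact cover k
    have f3 : {h | k • h ∈ {h | wt' h ≠ 0 ∧ ¬ (h ∈ o'.m ↔ p h ∈ o.m)}}.Finite := by
      rw [pre]; exact Q.diff.image _
    have inc : sepo o' (sp wt') k ⊆ {h | wt' h ≠ 0 ∧ p h ∈ sepo o (sp (pushw wt' p)) k} ∪
        ({h | wt' h ≠ 0 ∧ ¬ (h ∈ o'.m ↔ p h ∈ o.m)} ∪ {h | k • h ∈ {h | wt' h ≠ 0 ∧ ¬ (h ∈ o'.m ↔ p h ∈ o.m)}}) := by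
      rintro h ⟨h1, h2, h3⟩
      by_cases d1 : (h ∈ o'.m ↔ p h ∈ o.m)
      · by_cases d2 : (k • h ∈ o'.m ↔ p (k • h) ∈ o.m)
        · left
          refine ⟨h1, (ne _).2 ⟨h, h1, rfl⟩, d1.1 h2, ?_⟩
          rw [← Q.smul k h1, ← d2]; exact h3
        · exact Or.inr (Or.inr ⟨sm' k h1, d2⟩)
      · exact Or.inr (Or.inl ⟨h1, d1⟩)
    have r1 := ms_mono H'.nonneg (f1.union (Q.diff.union f3)) inc
    have r2 := ms_union H'.nonneg f1 (Q.diff.union f3)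
    have r3 := ms_bound H'.nonneg H'.wg k Q.diff Q.diff
      (s := {h | wt' h ≠ 0 ∧ ¬ (h ∈ o'.m ↔ p h ∈ o.m)} ∪ {h | k • h ∈ {h | wt' h ≠ 0 ∧ ¬ (h ∈ o'.m ↔ p h ∈ o.m)}}) (le_refl _)
    have r4 := push_sum H' Q (sfin k)
    have r5 := hC k hk
    linarith

end Push

section BaseCh
variable {G P : Type u} [Group G] [Poc P] [PocAct G P] {o o' : Pt P} {El : Subgroup G → Prop} {wt : P → ℝ}

theorem pushw_id : pushw wt (fun h : P => h) = wt := by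
  funext A
  unfold pushw
  by_cases h : wt A = 0
  · have : {h | wt h ≠ 0 ∧ h = A} = ∅ := by
      ext k
      constructor
      · rintro ⟨h1, rfl⟩; exact h1 h
      · rintro ⟨⟩
    rw [this, finsum_mem_empty, h]
  · have : {h | wt h ≠ 0 ∧ h = A} = {A} := by
      ext k
      constructor
      · rintro ⟨h1, rfl⟩; rfl
      · rintro rfl; exact ⟨h, rfl⟩
    rw [this, finsum_mem_singleton]

theorem base_good (H' : Good El o' wt) (hd : {h | wt h ≠ 0 ∧ ¬ (h ∈ o'.m ↔ h ∈ o.m)}.Finite)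
    (he : ∀ {h}, wt h ≠ 0 → Ess G h) : Good El o wt := by
  have := push_good (o := o) (p := fun h => h) H' ⟨fun _ _ h => h, fun _ => rfl, fun _ _ _ => rfl,
    fun A => (Set.finite_singleton A).subset fun h hh => hh.2, fun g _ h => H'.noinv g h, hd, he⟩
  rwa [pushw_id] at this

theorem base_iso (H' : Good El o' wt) (H : Good El o wt) (hd : {h | wt h ≠ 0 ∧ ¬ (h ∈ o'.m ↔ h ∈ o.m)}.Finite) :
    EquivIsometric (rho H') (rho H) := by
  have key : ∀ v, IsVtx o' (ep G wt) v ↔ IsVtx o (ep G wt) v := by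
    intro v
    constructor
    · intro h
      refine ⟨h.sub, h.tot, h.up, (h.fin.union hd).subset ?_⟩
      rintro k ⟨k1, k2⟩
      by_cases k3 : k ∈ o'.m
      · exact Or.inr ⟨(h.sub k1).1, fun e => k2 (e.1 k3)⟩
      · exact Or.inl ⟨k1, k3⟩
    · intro h
      refine ⟨h.sub, h.tot, h.up, (h.fin.union hd).subset ?_⟩
      rintro k ⟨k1, k2⟩
      by_cases k3 : k ∈ o.m
      · exact Or.inr ⟨(h.sub k1).1, fun e => k2 (e.2 k3)⟩
      · exact Or.inl ⟨k1, k3⟩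
  refine ⟨(Equiv.subtypeEquivRight key : Vtx o' (ep G wt) ≃ Vtx o (ep G wt)), ?_, ?_, ?_⟩
  · intro g (v : Vtx o' (ep G wt)); rfl
  · intro u v; rfl
  · intro (u : Vtx o' (ep G wt)) (v : Vtx o' (ep G wt)) a
    rw [one_mul]
    rfl

end BaseCh

section Btw
variable {G : Type u} [Group G] (T : GTree G)

theorem fl_inv {P : Type u} [Poc P] [PocAct G P] {h : P} {g : G} (e : g ∈ fl G h) : g⁻¹ ∈ fl G h := by
  have e : g • hᶜ < h := e
  show g⁻¹ • hᶜ < h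
  rw [← smul_lt_iff' g, smul_inv_smul]
  rw [PocAct.scompl] at e
  have := compl_lt' e
  rwa [Poc.cc] at this

theorem fl_self {P : Type u} [Poc P] [PocAct G P] {h : P} {g : G} : g ∈ fl G (g • h) ↔ g ∈ fl G h := by
  rw [fl_smul]; simp

def Btw (x y z : T.V) : Prop := ∀ A ∈ HL T.graph, x ∈ A → z ∈ A → y ∈ A
def Chr (g : G) (x : T.V) : Prop := ∀ J ∈ HL T.graph, g ∈ fl G J → x ∈ J
def Br (α β : G) : Set (Set T.V) := {H ∈ HL T.graph | α ∈ fl G H ∧ β ∈ fl G Hᶜ}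
variable {T}

theorem Btw.symm {x y z : T.V} (h : Btw T x y z) : Btw T z y x := fun A hA h1 h2 => h A hA h2 h1

theorem Btw.smul {x y z : T.V} (h : Btw T x y z) (g : G) : Btw T (g • x) (g • y) (g • z) := by
  intro A hA h1 h2
  have := h (g⁻¹ • A) (HL_smul T _ hA) (by rwa [mem_sact, inv_inv]) (by rwa [mem_sact, inv_inv])
  rwa [mem_sact, inv_inv] at this

theorem Btw.glue {a b c d : T.V} (h1 : Btw T a b c) (h2 : Btw T b c d) (hne : b ≠ c) : Btw T a b d := by
  intro A hA ha hd
  by_contra hb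
  have hc : c ∉ A := fun hc => hb (h1 A hA ha hc)
  have : ∃ B ∈ HL T.graph, b ∈ B ∧ c ∉ B := by
    by_contra hcon
    push Not at hcon
    exact hne (hsep_empty T.isTree hcon)
  obtain ⟨B, hB, bB, cB⟩ := this
  have aB : a ∈ B := by
    by_contra h; exact h1 Bᶜ (HL_compl T.isTree hB) h cB bB
  have dB : d ∉ B := fun h => cB (h2 B hB bB h)
  rcases HL_nested T.isTree hA hB with e | e | e | e
  · exact dB (e hd)
  · exact hb (e bB)
  · exact e ha aB
  · exact cB (e hc)

theorem half_min {x x' : T.V} (a : T.graph.Adj x x') {A : Set T.V} (hA : A ∈ HL T.graph) (hx : x ∈ A)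
    (h : A ≤ half T.graph x x') : A = half T.graph x x' := by
  obtain ⟨u, v, b, rfl⟩ := hA
  obtain ⟨rfl, rfl⟩ := half_cross T.isTree b a hx (fun h' => half_not T.isTree a (h h'))
  rfl

theorem Br_fin (α β : G) : (Br T α β).Finite := by
  obtain ⟨z⟩ := T.nonempty
  refine ((hsep_fin T.isTree (β • z) z).image compl |>.union (hsep_fin T.isTree (α • z) z)).subset ?_
  rintro H ⟨hH, h1, h2⟩
  by_cases hz : z ∈ H
  · exact Or.inl ⟨Hᶜ, fl_sep z (HL_compl T.isTree hH) h2 (fun h => h hz), Poc.cc H⟩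
  · exact Or.inr (fl_sep z hH h1 hz)

theorem fl_mem {g : G} {J : Set T.V} {x : T.V} (h : g ∈ fl G J) (hx : x ∉ J) : g • x ∈ J :=
  (show g • Jᶜ < J from h).le (smul_mem_sact.2 hx)

theorem Chr.act {g : G} {x : T.V} (h : Chr T g x) : Chr T g (g • x) := by
  intro J hJ hg
  have := h (g⁻¹ • J) (HL_smul T _ hJ) (by rw [fl_smul]; simpa using hg)
  rwa [mem_sact, inv_inv] at this

theorem Chr.btw {g : G} {x : T.V} (h : Chr T g x) : Btw T x (g • x) (g • g • x) := by
  intro A hA h0 h2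
  by_contra h1
  rcases HL_nested T.isTree (HL_smul T g hA) hA with e | e | e | e
  · exact h1 (e (smul_mem_sact.2 h0))
  · exact h1 (smul_mem_sact.1 (e h2))
  · refine h Aᶜ (HL_compl T.isTree hA) ?_ h0
    show g • Aᶜᶜ < Aᶜ
    rw [Poc.cc]; exact lt_of_le_of_ne e (HL_noinv T g hA)
  · refine h1 (h.act A hA ?_)
    show g • Aᶜ < A
    rw [PocAct.scompl]
    exact lt_of_le_of_ne e fun e' => HL_noinv T g hA (compl_inj' (by rw [Poc.cc]; exact e'))

theorem bridge_end {α β : G} (h : (Br T α β).Nonempty) :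
    ∃ H ∈ Br T α β, ∃ x x', T.graph.Adj x x' ∧ H = half T.graph x x' ∧ Chr T α x ∧ ∀ J ∈ Br T α β, H ≤ J := by
  obtain ⟨H, hH⟩ := (Br_fin α β).exists_minimal h
  obtain ⟨⟨⟨x, x', a, rfl⟩, h1, h2⟩, hmin⟩ := hH
  have hHL : half T.graph x x' ∈ HL T.graph := ⟨x, x', a, rfl⟩
  have key : ∀ J ∈ HL T.graph, α ∈ fl G J → half T.graph x x' ≤ J ∨ J = (half T.graph x x')ᶜ ∨ (half T.graph x x')ᶜ < J := by
    intro J hJ hf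
    rcases HL_nested T.isTree hJ hHL with e | e | e | e
    · exact Or.inl (hmin ⟨hJ, hf, fl_mono (Poc.anti e) h2⟩ e)
    · exact Or.inl e
    · exact (fl_disj h1 (fl_mono e hf)).elim
    · have := compl_le_comm' e
      rcases eq_or_lt_of_le this with e' | e'
      · exact Or.inr (Or.inl e'.symm)
      · exact Or.inr (Or.inr e')
  refine ⟨_, ⟨hHL, h1, h2⟩, x, x', a, rfl, ?_, ?_⟩
  · intro J hJ hf
    rcases key J hJ hf with e | e | e
    · exact e (half_self _ _)
    · rw [e] at hf; exact (fl_disj h1 hf).elim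
    · by_contra hx
      have : x' ∈ J := e.le (half_not T.isTree a)
      have := half_min a (HL_compl T.isTree hJ) hx (compl_le_comm' e.le)
      exact e.ne (by rw [← this, Poc.cc])
  · intro J hJ
    rcases key J hJ.1 hJ.2.1 with e | e | e
    · exact e
    · rw [e] at hJ; exact (fl_disj h1 hJ.2.1).elim
    · exact (fl_disj (fl_mono (compl_le_comm' e.le) hJ.2.2) h2).elim

theorem Br_symm {α β : G} {H : Set T.V} (h : H ∈ Br T α β) : Hᶜ ∈ Br T β α :=
  ⟨HL_compl T.isTree h.1, h.2.2, by rw [Poc.cc]; exact h.2.1⟩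

theorem bridge_half {α β : G} {x y : T.V} (hx : Chr T α x) (hs : hsep T.graph x y = Br T α β) :
    Btw T y x (α • x) ∧ Btw T y x (α • y) ∧ Btw T x (α • x) (α • y) := by
  have key : ∀ A ∈ HL T.graph, y ∈ A → x ∉ A → α ∈ fl G Aᶜ := by
    intro A hA h1 h2
    have : Aᶜ ∈ Br T α β := by rw [← hs]; exact ⟨HL_compl T.isTree hA, h2, fun h => h h1⟩
    exact this.2.1
  refine ⟨?_, ?_, ?_⟩
  · intro A hA h1 h2
    by_contra h3
    exact hx.act _ (HL_compl T.isTree hA) (key A hA h1 h3) h2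
  · intro A hA h1 h2
    by_contra h3
    exact fl_mem (key A hA h1 h3) (fun h => h h1) h2
  · intro A hA h1 h2
    by_contra h3
    have := key (α⁻¹ • A) (HL_smul T _ hA) (by rwa [mem_sact, inv_inv]) (by rwa [mem_sact, inv_inv])
    rw [← PocAct.scompl, fl_smul] at this
    exact hx Aᶜ (HL_compl T.isTree hA) (by simpa using this) h1

theorem bridge {α β : G} (h : (Br T α β).Nonempty) :
    ∃ x y, x ≠ y ∧ hsep T.graph x y = Br T α β ∧ Chr T α x ∧ Chr T β y := by
  obtain ⟨H, hH, x, x', a, e, cx, mx⟩ := bridge_end h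
  obtain ⟨K, hK, y, y', b, e', cy, my⟩ := bridge_end (T := T) (α := β) (β := α) ⟨_, Br_symm hH⟩
  have HK : K ≤ Hᶜ := my _ (Br_symm hH)
  have xH : x ∈ H := by rw [e]; exact half_self _ _
  have yK : y ∈ K := by rw [e']; exact half_self _ _
  have hs : hsep T.graph x y = Br T α β := by
    ext A
    constructor
    · rintro ⟨hA, h1, h2⟩
      have e1 : H ≤ A := by
        rcases HL_nested T.isTree hA hH.1 with q | q | q | q
        · rw [e] at q ⊢; exact (half_min a hA h1 q).ge
        · exact q
        · exact (q h1 xH).elim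
        · exact (HK yK (q h2)).elim
      have e2 : K ≤ Aᶜ := by
        rcases HL_nested T.isTree (HL_compl T.isTree hA) hK.1 with q | q | q | q
        · rw [e'] at q ⊢; exact (half_min b (HL_compl T.isTree hA) h2 q).ge
        · exact q
        · exact (q h2 yK).elim
        · rw [Poc.cc] at q; exact (HK (q h1) xH).elim
      exact ⟨hA, fl_mono e1 hH.2.1, fl_mono e2 hK.2.1⟩
    · intro hA
      exact ⟨hA.1, cx _ hA.1 hA.2.1, cy _ (HL_compl T.isTree hA.1) hA.2.2⟩
  refine ⟨x, y, ?_, hs, cx, cy⟩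
  rintro rfl
  exact HK yK xH

section Dw
variable (T)
/-- weighted distance -/
noncomputable def Dw (w : Set T.V → ℝ) (x y : T.V) : ℝ := ∑ᶠ A ∈ hsep T.graph x y, w A

/-- invariant weights -/
structure Wt (w : Set T.V → ℝ) : Prop where
  nn : ∀ A, 0 ≤ w A
  wc : ∀ A, w Aᶜ = w A
  wg : ∀ (g : G) A, w (g • A) = w A
variable {T}
variable {w : Set T.V → ℝ}

theorem Dw_symm (hw : Wt T w) (x y : T.V) : Dw T w x y = Dw T w y x := by
  unfold Dw
  refine finsum_mem_eq_of_bijOn compl ⟨?_, ?_, ?_⟩ fun A _ => (hw.wc A).symm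
  · exact fun A h => ⟨HL_compl T.isTree h.1, h.2.2, fun h' => h' h.2.1⟩
  · exact fun A _ B _ h => compl_injective h
  · exact fun A h => ⟨Aᶜ, ⟨HL_compl T.isTree h.1, h.2.2, fun h' => h' h.2.1⟩, compl_compl A⟩

theorem Dw_smul (hw : Wt T w) (g : G) (x y : T.V) : Dw T w (g • x) (g • y) = Dw T w x y := by
  unfold Dw
  rw [hsep_smul, finsum_mem_image ((MulAction.injective g).injOn)]
  simp_rw [hw.wg]

theorem Dw_nn (hw : Wt T w) (x y : T.V) : 0 ≤ Dw T w x y :=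
  finsum_nonneg fun A => finsum_nonneg fun _ => hw.nn A

theorem Dw_add {x y z : T.V} (h : Btw T x y z) : Dw T w x z = Dw T w x y + Dw T w y z := by
  unfold Dw
  rw [← finsum_mem_union ?_ (hsep_fin T.isTree x y) (hsep_fin T.isTree y z)]
  · refine finsum_mem_congr ?_ fun _ _ => rfl
    ext A
    constructor
    · rintro ⟨h1, h2, h3⟩
      by_cases hy : y ∈ A
      · exact Or.inr ⟨h1, hy, h3⟩
      · exact Or.inl ⟨h1, h2, hy⟩
    · rintro (⟨h1, h2, h3⟩ | ⟨h1, h2, h3⟩)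
      · exact ⟨h1, h2, fun h4 => h3 (h A h1 h2 h4)⟩
      · refine ⟨h1, ?_, h3⟩
        by_contra h4
        exact h Aᶜ (HL_compl T.isTree h1) h4 h3 h2
  · rw [Set.disjoint_left]
    exact fun A h1 h2 => h1.2.2 h2.2.1

theorem Dw_br (hw : Wt T w) {α β : G} {x y : T.V} (hne : x ≠ y) (hs : hsep T.graph x y = Br T α β) (hx : Chr T α x)
    (hy : Chr T β y) : Btw T x ((α * β) • x) ((α * β) • (α * β) • x) ∧
      Dw T w x ((α * β) • x) = Dw T w x (α • x) + Dw T w y (β • y) + 2 * Dw T w x y := by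
  have hs' : hsep T.graph y x = Br T β α := by
    ext A
    have : A ∈ hsep T.graph y x ↔ Aᶜ ∈ hsep T.graph x y :=
      ⟨fun h => ⟨HL_compl T.isTree h.1, h.2.2, fun h' => h' h.2.1⟩, fun h =>
        ⟨by simpa using HL_compl T.isTree h.1, by simpa using h.2.2, h.2.1⟩⟩
    rw [this, hs]
    exact ⟨fun h => by simpa using Br_symm h, fun h => Br_symm h⟩
  obtain ⟨a1, a2, a3⟩ := bridge_half hx hs
  obtain ⟨b1, b2, b3⟩ := bridge_half hy hs'
  have c1 := b1.smul α
  have c2 := b2.smul α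
  have c3 := b3.smul α
  simp only [← mul_smul] at c1 c2 c3
  have ne1 : α • x ≠ α • y := fun h => hne (MulAction.injective α h)
  have d1 := a3.glue c2 ne1
  have d2 : Btw T x ((α * β) • y) ((α * β) • x) := fun A hA h1 h2 => c3 A hA (c2 A hA (d1 A hA h1 h2) h2) h2
  have d3 : Btw T y (α • x) (α • y) := fun A hA h1 h2 => a3 A hA (a2 A hA h1 h2) h2
  have d4 := d3.glue c2 ne1
  have d5 : Btw T y x ((α * β) • x) := fun A hA h1 h2 => a1 A hA h1 (d4 A hA h1 h2)
  have ne2 : (α * β) • x ≠ (α * β) • y := fun h => hne (MulAction.injective _ h)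
  refine ⟨((d5.smul (α * β)).symm.glue d2.symm ne2).symm, ?_⟩
  rw [Dw_add d1, Dw_add c2, Dw_add c3, Dw_smul hw, Dw_smul hw, mul_smul, Dw_smul hw α y, Dw_symm hw y x]
  ring

/-- four point condition -/
theorem Dw_four (hw : Wt T w) (x y z v : T.V) :
    Dw T w x y + Dw T w z v ≤ max (Dw T w x z + Dw T w y v) (Dw T w x v + Dw T w y z) := by
  let S : Set T.V := {x, y, z, v}
  let U : Set (Set T.V) := {A ∈ HL T.graph | ∃ p ∈ S, ∃ q ∈ S, A ∈ hsep T.graph p q}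
  have hU : U.Finite := by
    refine ((Set.toFinite S).biUnion fun p _ =>
      (Set.toFinite S).biUnion fun q _ => hsep_fin T.isTree p q).subset ?_
    rintro A ⟨-, p, hp, q, hq, h⟩
    simp only [Set.mem_iUnion]
    exact ⟨p, hp, q, hq, h⟩
  have hD : ∀ p ∈ S, ∀ q ∈ S,
      Dw T w p q = ∑ A ∈ hU.toFinset, w A * (if p ∈ A ∧ q ∉ A then 1 else 0) := by
    intro p hp q hq
    unfold Dw
    rw [finsum_mem_eq_finite_toFinset_sum _ (hsep_fin T.isTree p q)]
    simp only [mul_ite, mul_one, mul_zero]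
    rw [← Finset.sum_filter]
    refine Finset.sum_congr ?_ fun _ _ => rfl
    ext A
    simp only [Set.Finite.mem_toFinset, Finset.mem_filter]
    exact ⟨fun h => ⟨⟨h.1, p, hp, q, hq, h⟩, h.2⟩, fun h => ⟨h.1.1, h.2⟩⟩
  have hD2 : ∀ p ∈ S, ∀ q ∈ S,
      2 * Dw T w p q = ∑ A ∈ hU.toFinset, w A * ((if p ∈ A ∧ q ∉ A then 1 else 0) + (if q ∈ A ∧ p ∉ A then 1 else 0)) := by
    intro p hp q hq
    simp_rw [mul_add]
    rw [Finset.sum_add_distrib, ← hD p hp q hq, ← hD q hq p hp, Dw_symm hw q p]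
    ring
  have key : ∀ p ∈ S, ∀ q ∈ S, (∀ A ∈ HL T.graph, ¬ (x ∈ A ∧ p ∈ A ∧ y ∉ A ∧ q ∉ A)) →
      Dw T w x y + Dw T w p q ≤ Dw T w x p + Dw T w y q := by
    intro p hp q hq hn
    suffices h : 2 * Dw T w x y + 2 * Dw T w p q ≤ 2 * Dw T w x p + 2 * Dw T w y q by linarith
    rw [hD2 x (by simp [S]) y (by simp [S]), hD2 p hp q hq, hD2 x (by simp [S]) p hp, hD2 y (by simp [S]) q hq,
      ← Finset.sum_add_distrib, ← Finset.sum_add_distrib]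
    refine Finset.sum_le_sum fun A hA => ?_
    rw [← mul_add, ← mul_add]
    refine mul_le_mul_of_nonneg_left ?_ (hw.nn A)
    have hA : A ∈ HL T.graph := ((Set.Finite.mem_toFinset _).1 hA).1
    have n1 := hn A hA
    have n2 := hn Aᶜ (HL_compl T.isTree hA)
    simp only [Set.mem_compl_iff, not_not] at n2
    clear hn hD hD2
    by_cases x ∈ A <;> by_cases y ∈ A <;> by_cases p ∈ A <;> by_cases q ∈ A <;> simp_all
  by_cases hq : ∃ A ∈ HL T.graph, x ∈ A ∧ z ∈ A ∧ y ∉ A ∧ v ∉ A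
  · refine le_max_of_le_right ?_
    rw [Dw_symm hw z v]
    refine key v (by simp [S]) z (by simp [S]) ?_
    rintro B hB ⟨h1, h2, h3, h4⟩
    obtain ⟨A, hA, k1, k2, k3, k4⟩ := hq
    rcases HL_nested T.isTree hA hB with e | e | e | e
    · exact h4 (e k2)
    · exact k4 (e h2)
    · exact e k1 h1
    · exact h3 (e k3)
  · exact le_max_of_le_left (key z (by simp [S]) v (by simp [S]) fun B hB h => hq ⟨B, hB, h⟩)

theorem Dw_self (x : T.V) : Dw T w x x = 0 := by
  unfold Dw
  have : hsep T.graph x x = ∅ := by ext A; simp [hsep]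
  rw [this, finsum_mem_empty]

theorem Dw_tri (hw : Wt T w) (x y z : T.V) : Dw T w x z ≤ Dw T w x y + Dw T w y z := by
  have := Dw_four hw x z y y
  rw [Dw_self, Dw_symm hw z y, max_self] at this
  linarith

/-- translation length -/
noncomputable def Lw (w : Set T.V → ℝ) (g : G) (x : T.V) : ℝ := max 0 (Dw T w x (g • g • x) - Dw T w x (g • x))

theorem Lw_btw {g : G} (hw : Wt T w) {x : T.V} (h : Btw T x (g • x) (g • g • x)) : Lw w g x = Dw T w x (g • x) := by
  unfold Lw
  rw [Dw_add h, Dw_smul hw]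
  simp [Dw_nn hw]

theorem Lw_pow (hw : Wt T w) (g : G) (x : T.V) (n : ℕ) :
    |Dw T w x (g ^ n • x) - n * Lw w g x| ≤ 2 * Dw T w x (g • x) := by
  have sh : ∀ i j : ℕ, Dw T w (g ^ i • x) (g ^ (i + j) • x) = Dw T w x (g ^ j • x) := fun i j => by
    rw [pow_add, mul_smul, Dw_smul hw]
  have p1 : g ^ 1 • x = g • x := by rw [pow_one]
  have p2 : g ^ 2 • x = g • g • x := by rw [pow_two, mul_smul]
  have p0 : g ^ 0 • x = x := by rw [pow_zero, one_smul]
  generalize ha : (fun n : ℕ => Dw T w x (g ^ n • x)) = a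
  have ha' : ∀ n, Dw T w x (g ^ n • x) = a n := fun n => by rw [← ha]
  have a0 : a 0 = 0 := by rw [← ha', p0, Dw_self]
  have hp : ∀ n, 0 ≤ a n := fun n => by rw [← ha']; exact Dw_nn hw _ _
  have dd : ∀ i j k : ℕ, j = i + k → Dw T w (g ^ i • x) (g ^ j • x) = a k := by
    rintro i j k rfl
    rw [sh, ha']
  have four2 : ∀ i j k : ℕ, a (i + j) + a (j + k) ≤ max (a i + a k) (a (i + j + k) + a j) := by
    intro i j k
    have := Dw_four hw (g ^ 0 • x) (g ^ (i + j) • x) (g ^ i • x) (g ^ (i + j + k) • x)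
    rwa [dd 0 (i + j) (i + j) (by omega), dd i (i + j + k) (j + k) (by omega), dd 0 i i (by omega),
      dd (i + j) (i + j + k) k (by omega), dd 0 (i + j + k) (i + j + k) (by omega), Dw_symm hw (g ^ (i + j) • x),
      dd i (i + j) j (by omega)] at this
  have four3 : ∀ i j k : ℕ, a (i + j + k) + a j ≤ max (a (i + j) + a (j + k)) (a i + a k) := by
    intro i j k
    have := Dw_four hw (g ^ 0 • x) (g ^ (i + j + k) • x) (g ^ (i + j) • x) (g ^ i • x)
    rwa [Dw_symm hw (g ^ (i + j) • x), Dw_symm hw (g ^ (i + j + k) • x), Dw_symm hw (g ^ (i + j + k) • x), dd 0 (i + j) (i + j) (by omega), dd i (i + j + k) (j + k) (by omega), dd 0 i i (by omega),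
      dd (i + j) (i + j + k) k (by omega), dd 0 (i + j + k) (i + j + k) (by omega),
      dd i (i + j) j (by omega)] at this
  have hL : Lw w g x = max 0 (a 2 - a 1) := by
    unfold Lw; rw [← p2, ha', ← p1, ha']
  rw [← p1, ha', ha', hL]
  by_cases h : a 2 ≤ a 1
  · have hb : ∀ n, a n ≤ a 1 ∧ a (n + 1) ≤ a 1 := by
      intro n
      induction n with
      | zero => exact ⟨by rw [a0]; exact hp 1, le_rfl⟩
      | succ n ih =>
        refine ⟨ih.2, ?_⟩
        have := four3 1 1 n
        rw [show 1 + 1 + n = n + 2 by ring, show 1 + 1 = 2 by rfl, show 1 + n = n + 1 by ring] at this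
        show a (n + 2) ≤ a 1
        rcases le_max_iff.1 this with q | q <;> linarith [ih.1, ih.2]
    rw [max_eq_left (by linarith), mul_zero, sub_zero, abs_of_nonneg (hp n)]
    linarith [hb n, hp 1]
  · push Not at h
    have hb : ∀ n, a (n + 1) = a 1 + n * (a 2 - a 1) ∧ a (n + 2) = a 1 + (n + 1) * (a 2 - a 1) := by
      intro n
      induction n with
      | zero => constructor <;> norm_num
      | succ n ih =>
        refine ⟨by rw [ih.2]; push_cast; ring, ?_⟩
        have q1 := four3 1 (n + 1) 1
        have q2 := four2 1 (n + 1) 1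
        rw [show 1 + (n + 1) + 1 = n + 3 by ring, show 1 + (n + 1) = n + 2 by ring, show n + 1 + 1 = n + 2 by ring] at q1 q2
        have q3 : a 1 < a (n + 2) := by
          rw [ih.2]; nlinarith
        rw [max_eq_left (by linarith)] at q1
        have q2 : a (n + 2) + a (n + 2) ≤ a (n + 3) + a (n + 1) := by
          rcases le_max_iff.1 q2 with q | q <;> linarith
        have : a (n + 3) = 2 * a (n + 2) - a (n + 1) := by linarith
        show a (n + 3) = _
        rw [this, ih.1, ih.2]; push_cast; ring
    rw [max_eq_right (by linarith)]
    have tr : a 2 ≤ 2 * a 1 := by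
      have := Dw_tri hw x (g • x) (g • g • x)
      rw [Dw_smul hw, ← p2, ha', ← p1, ha'] at this
      linarith
    cases n with
    | zero => rw [a0]; simp; exact hp 1
    | succ n =>
      rw [(hb n).1, abs_le]; push_cast
      constructor <;> nlinarith [hp 1]

theorem Lw_ind (hw : Wt T w) (g : G) (x y : T.V) : Lw w g x = Lw w g y := by
  have key : ∀ n : ℕ, (n : ℝ) * |Lw w g x - Lw w g y| ≤ 2 * Dw T w x (g • x) + 2 * Dw T w y (g • y) + 2 * Dw T w x y := by
    intro n
    have h1 := abs_le.1 (Lw_pow hw g x n)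
    have h2 := abs_le.1 (Lw_pow hw g y n)
    have t1 := Dw_tri hw x y (g ^ n • y)
    have t2 := Dw_tri hw x (g ^ n • y) (g ^ n • x)
    have t3 := Dw_tri hw y x (g ^ n • x)
    have t4 := Dw_tri hw y (g ^ n • x) (g ^ n • y)
    rw [Dw_smul hw] at t2 t4
    rw [Dw_symm hw y x] at t2 t3
    rw [← abs_of_nonneg (Nat.cast_nonneg (α := ℝ) n), ← abs_mul, abs_le]
    constructor <;> nlinarith
  by_contra hne
  have hp : 0 < |Lw w g x - Lw w g y| := abs_pos.2 (sub_ne_zero.2 hne)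
  obtain ⟨n, hn⟩ := exists_nat_gt ((2 * Dw T w x (g • x) + 2 * Dw T w y (g • y) + 2 * Dw T w x y) / |Lw w g x - Lw w g y|)
  rw [div_lt_iff₀ hp] at hn
  linarith [key n]

theorem Lw_Br (hw : Wt T w) {α β : G} (h : (Br T α β).Nonempty) (z : T.V) :
    ∑ᶠ A ∈ Br T α β, w A = (Lw w (α * β) z - Lw w α z - Lw w β z) / 2 := by
  obtain ⟨x, y, hne, hs, hx, hy⟩ := bridge h
  obtain ⟨h1, h2⟩ := Dw_br hw hne hs hx hy
  rw [Lw_ind hw (α * β) z x, Lw_ind hw α z x, Lw_ind hw β z y, Lw_btw hw h1, Lw_btw hw hx.btw, Lw_btw hw hy.btw, h2, ← hs]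
  unfold Dw
  ring
end Dw
end Btw

section Mini
variable {G : Type u} [Group G] {T : GTree G}

theorem fl_of_le {g : G} {A : Set T.V} (hA : A ∈ HL T.graph) (e : (g • A)ᶜ ≤ A) : g ∈ fl G A := by
  show g • Aᶜ < A
  rw [PocAct.scompl]
  exact lt_of_le_of_ne e fun e' => HL_noinv T g hA (compl_inj' (by rw [Poc.cc]; exact e'))

theorem fl_of_le' {g : G} {A : Set T.V} (hA : A ∈ HL T.graph) (e : g • A ≤ Aᶜ) : g ∈ fl G Aᶜ := by
  refine fl_of_le (HL_compl T.isTree hA) ?_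
  rw [← PocAct.scompl, Poc.cc]; exact e

theorem Br_cmp {α β : G} {J H : Set T.V} (h1 : J ∈ Br T α β) (h2 : H ∈ Br T α β) : J ≤ H ∨ H ≤ J := by
  rcases HL_nested T.isTree h1.1 h2.1 with e | e | e | e
  · exact Or.inl e
  · exact Or.inr e
  · exact (fl_disj h2.2.1 (fl_mono e h1.2.1)).elim
  · exact (fl_disj (fl_mono e h1.2.2) h2.2.2).elim

theorem br_branch {α β κ : G} {J K H : Set T.V} (hJ : J ∈ Br T α β) (hH : H ∈ Br T α β) (h : J < H)
    (h1 : K ≤ Jᶜ) (h2 : K < H) (hκ : κ ∈ fl G K) :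
    ∃ α', H ∈ Br T α' β ∧ Br T α' β ⊆ Br T α β ∧ J ∉ Br T α' β := by
  have hκ' : κ • Kᶜ < K := hκ
  have hα : α • Jᶜ < J := hJ.2.1
  have e1 : (α * κ) • Hᶜ < J := by
    rw [mul_smul]
    refine lt_of_le_of_lt ?_ hα
    refine PocAct.mono α ?_
    exact ((PocAct.mono κ (Poc.anti h2.le)).trans hκ'.le).trans h1
  have e3 : (α * κ) • J < J := by
    rw [mul_smul]
    refine lt_of_le_of_lt ?_ hα
    refine PocAct.mono α ?_
    exact ((PocAct.mono κ (le_compl_comm' h1)).trans hκ'.le).trans h1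
  have e2 : α * κ ∉ fl G J := by
    intro hf
    have hf : (α * κ) • Jᶜ < J := hf
    have c := compl_lt' e3
    rw [← PocAct.scompl] at c
    have := lt_trans c hf
    obtain ⟨x, hx⟩ := HL_ne' T hJ.1
    exact hx (this.le hx)
  refine ⟨α * κ, ⟨hH.1, lt_trans e1 h, hH.2.2⟩, ?_, fun h => e2 h.2.1⟩
  intro M hM
  refine ⟨hM.1, ?_, hM.2.2⟩
  rcases HL_nested T.isTree hM.1 hJ.1 with e | e | e | e
  · exact (e2 (fl_mono e hM.2.1)).elim
  · exact fl_mono e hJ.2.1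
  · have := fl_mono e hM.2.1
    have q : (α * κ) • Jᶜᶜ < Jᶜ := this
    rw [Poc.cc] at q
    obtain ⟨x, hx⟩ := HL_ne T (HL_smul T (α * κ) hJ.1)
    exact (q.le hx (e3.le hx)).elim
  · exact (fl_disj (fl_mono e hM.2.2) hJ.2.2).elim

theorem br_drop {α β : G} {J H : Set T.V} (hJ : J ∈ Br T α β) (hH : H ∈ Br T α β) (h : J < H)
    (hq : ¬ (fl G J = fl G H ∧ fl G Jᶜ = fl G Hᶜ)) :
    ∃ α', H ∈ Br T α' β ∧ Br T α' β ⊆ Br T α β ∧ J ∉ Br T α' β := by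
  have case1 : ∀ γ, γ ∈ fl G H → γ ∉ fl G J → ∃ α', H ∈ Br T α' β ∧ Br T α' β ⊆ Br T α β ∧ J ∉ Br T α' β := by
    intro γ g1 g2
    by_cases hs : Br T γ β ⊆ Br T α β
    · exact ⟨γ, ⟨hH.1, g1, hH.2.2⟩, hs, fun h => g2 h.2.1⟩
    · rw [Set.not_subset] at hs
      obtain ⟨M, hM, hM'⟩ := hs
      have nJ : ¬ J ≤ M := fun e => hM' ⟨hM.1, fl_mono e hJ.2.1, hM.2.2⟩
      have hMH : M < H := by
        rcases Br_cmp hM (⟨hH.1, g1, hH.2.2⟩ : H ∈ Br T γ β) with e | e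
        · exact lt_of_le_of_ne e fun e' => nJ (e' ▸ h.le)
        · exact (nJ (h.le.trans e)).elim
      refine br_branch hJ hH h ?_ hMH hM.2.1
      rcases HL_nested T.isTree hM.1 hJ.1 with e | e | e | e
      · exact (g2 (fl_mono e hM.2.1)).elim
      · exact (nJ e).elim
      · exact e
      · exact (fl_disj (fl_mono e hM.2.2) hJ.2.2).elim
  by_cases hc : fl G H ⊆ fl G J
  · have : ∃ γ, γ ∈ fl G Jᶜ ∧ γ ∉ fl G Hᶜ := by
      by_contra hcon
      push Not at hcon
      exact hq ⟨Set.Subset.antisymm (fl_mono h.le) hc, Set.Subset.antisymm hcon (fl_mono (Poc.anti h.le))⟩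
    obtain ⟨γ, g1, g2⟩ := this
    by_cases g3 : γ ∈ fl G H
    · exact (fl_disj (hc g3) g1).elim
    have : ∃ δ, δ ∈ fl G Jᶜ ∧ δ • H ≤ H := by
      rcases HL_nested T.isTree (HL_smul T γ hH.1) hH.1 with e | e | e | e
      · exact ⟨γ, g1, e⟩
      · refine ⟨γ⁻¹, fl_inv g1, ?_⟩
        rw [← smul_le_iff' γ, smul_inv_smul]; exact e
      · exact (g2 (fl_of_le' hH.1 e)).elim
      · exact (g3 (fl_of_le hH.1 e)).elim
    obtain ⟨δ, d1, d2⟩ := this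
    have d1 : δ • Jᶜᶜ < Jᶜ := d1
    rw [Poc.cc] at d1
    refine br_branch (K := δ • J) (κ := δ * α * δ⁻¹) hJ hH h d1.le (lt_of_lt_of_le ((smul_lt_iff' δ).2 h) d2) ?_
    rw [fl_smul]
    convert hJ.2.1 using 1
    group
  · rw [Set.not_subset] at hc
    obtain ⟨γ, g1, g2⟩ := hc
    exact case1 γ g1 g2

theorem Br_flip {α β : G} {H : Set T.V} : Hᶜ ∈ Br T β α ↔ H ∈ Br T α β :=
  ⟨fun h => by simpa using Br_symm h, Br_symm⟩

theorem br_min {a b : G} (hg : GoodPair T a b) {H : Set T.V} (hH : H ∈ HL T.graph) :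
    ∃ α β, H ∈ Br T α β ∧ Br T α β = {J ∈ HL T.graph | fl G J = fl G H ∧ fl G Jᶜ = fl G Hᶜ} := by
  obtain ⟨α0, h0⟩ := flip hg hH
  obtain ⟨β0, h1⟩ := flip hg (HL_compl T.isTree hH)
  obtain ⟨⟨α, β⟩, hp, hmin⟩ : ∃ p ∈ {p : G × G | H ∈ Br T p.1 p.2}, ∀ p' ∈ {p : G × G | H ∈ Br T p.1 p.2},
      ¬ (Br T p'.1 p'.2).ncard < (Br T p.1 p.2).ncard :=
    WellFounded.has_min (measure fun p : G × G => (Br T p.1 p.2).ncard).wf _ ⟨(α0, β0), hH, h0, h1⟩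
  have hp : H ∈ Br T α β := hp
  have hmin : ∀ α' β', H ∈ Br T α' β' → Br T α' β' ⊆ Br T α β → ∀ J ∈ Br T α β, J ∈ Br T α' β' := by
    intro α' β' h1 h2 J hJ
    by_contra h3
    refine hmin (α', β') h1 (Set.ncard_lt_ncard ⟨h2, fun h => h3 (h hJ)⟩ (Br_fin α β))
  refine ⟨α, β, hp, ?_⟩
  ext J
  constructor
  · intro hJ
    refine ⟨hJ.1, ?_⟩
    by_contra hq
    rcases Br_cmp hJ hp with e | e
    · rcases eq_or_lt_of_le e with rfl | e
      · exact hq ⟨rfl, rfl⟩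
      obtain ⟨α', k1, k2, k3⟩ := br_drop hJ hp e hq
      exact k3 (hmin α' β k1 k2 J hJ)
    · rcases eq_or_lt_of_le e with rfl | e
      · exact hq ⟨rfl, rfl⟩
      obtain ⟨β', k1, k2, k3⟩ := br_drop (Br_symm hJ) (Br_symm hp) (compl_lt' e)
        (fun h => hq ⟨by simpa using h.2, h.1⟩)
      refine k3 (Br_symm (hmin α β' (Br_flip.1 k1) (fun M hM => Br_flip.1 (k2 (Br_symm hM))) J hJ))
  · rintro ⟨h1, h2, h3⟩
    exact ⟨h1, h2 ▸ hp.2.1, h3 ▸ hp.2.2⟩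

theorem hyp_of_lt {g : G} {H : Set T.V} (hH : H ∈ HL T.graph) (h : g • H < H) : T.Hyperbolic g := by
  intro v e
  have e : g • v = v := e
  have ei : g⁻¹ • v = v := by rw [inv_smul_eq_iff, e]
  have ep : ∀ (k : G), k • v = v → ∀ n : ℕ, k ^ n • v = v := by
    intro k hk n
    induction n with
    | zero => rw [pow_zero, one_smul]
    | succ n ih => rw [pow_succ, mul_smul, hk, ih]
  obtain ⟨n, hn⟩ := absorb T h hH v
  obtain ⟨m, hm⟩ := absorb T (inv_lt_c T h) (HL_compl T.isTree hH) v
  have h1 := hn n le_rfl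
  have h2 := hm m le_rfl
  rw [ep g e] at h1
  rw [ep _ ei] at h2
  exact h2 h1

theorem gp_of_br {a b : G} (ha : T.Hyperbolic a) (hb : T.Hyperbolic b) {H : Set T.V} (h : H ∈ Br T a b) :
    GoodPair T a b := by
  refine ⟨ha, hb, hyp_of_lt h.1 ?_⟩
  have e1 : b⁻¹ • Hᶜᶜ < Hᶜ := fl_inv h.2.2
  have e2 : a⁻¹ • Hᶜ < H := fl_inv h.2.1
  have e3 : b • Hᶜᶜ < Hᶜ := h.2.2
  have e4 : a • Hᶜ < H := h.2.1
  rw [Poc.cc] at e1 e3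
  rw [mul_smul, mul_smul, mul_smul]
  refine lt_trans ?_ e4
  rw [smul_lt_iff']
  refine lt_trans ?_ e3
  rw [smul_lt_iff']
  refine lt_trans ?_ e2
  rw [smul_lt_iff']
  exact e1

theorem helly {a b : G} (h : ¬ (Br T a b).Nonempty) : ∃ x, Chr T a x ∧ Chr T b x := by
  let Fm : Set (Set T.V) := {J ∈ HL T.graph | a ∈ fl G J ∨ b ∈ fl G J}
  have hm : ∀ J ∈ Fm, ∀ K ∈ Fm, ¬ K ≤ Jᶜ := by
    rintro J ⟨hJ, j⟩ K ⟨hK, k⟩ e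
    have e' := le_compl_comm' e
    rcases j with j | j <;> rcases k with k | k
    · exact fl_disj j (fl_mono e k)
    · exact h ⟨J, hJ, j, fl_mono e k⟩
    · exact h ⟨K, hK, k, fl_mono e' j⟩
    · exact fl_disj j (fl_mono e k)
  have hf : ∀ x, {J ∈ Fm | x ∉ J}.Finite := by
    intro x
    refine ((hsep_fin T.isTree (a • x) x).union (hsep_fin T.isTree (b • x) x)).subset ?_
    rintro J ⟨⟨hJ, j⟩, hx⟩
    exact j.imp (fun j => fl_sep x hJ j hx) (fun j => fl_sep x hJ j hx)
  obtain ⟨x0⟩ := T.nonempty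
  obtain ⟨x, -, hx⟩ : ∃ x ∈ (Set.univ : Set T.V), ∀ y ∈ (Set.univ : Set T.V),
      ¬ {J ∈ Fm | y ∉ J}.ncard < {J ∈ Fm | x ∉ J}.ncard :=
    WellFounded.has_min (measure fun x : T.V => {J ∈ Fm | x ∉ J}.ncard).wf _ ⟨x0, trivial⟩
  have key : ∀ J ∈ Fm, x ∈ J := by
    intro J hJ
    by_contra hxJ
    obtain ⟨u, v, ad, rfl⟩ := hJ.1
    refine hx u trivial (Set.ncard_lt_ncard ⟨?_, fun hs => (hs ⟨hJ, hxJ⟩).2 (half_self _ _)⟩ (hf x))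
    rintro K ⟨hK, hu⟩
    refine ⟨hK, fun hxK => ?_⟩
    rcases HL_nested T.isTree hK.1 hJ.1 with e | e | e | e
    · exact hxJ (e hxK)
    · exact hu (e (half_self _ _))
    · exact hm _ hJ K hK e
    · have := half_min ad (HL_compl T.isTree hK.1) hu e
      refine hm _ hJ K hK ?_
      rw [← this, Poc.cc]
  exact ⟨x, fun J hJ j => key J ⟨hJ, Or.inl j⟩, fun J hJ j => key J ⟨hJ, Or.inr j⟩⟩

end Mini

section MG
variable {G : Type u} [Group G] (T : MGTree G)

theorem wt_tw : Wt T.toGTree (tw T) where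
  nn := fun A => by
    by_cases h : A ∈ HL T.graph
    · exact (tw_pos T h).le
    · exact (tw_zero T h).ge
  wc := tw_compl T
  wg := tw_smul T

theorem tdist_Dw (x y : T.V) : T.dist x y = Dw T.toGTree (tw T) x y := tdist T x y

theorem chr_axis {g : G} {x : T.V} (h : Chr T.toGTree g x) : x ∈ T.Axis g := by
  show T.dist x (T.act g x) = T.ell g
  have hl : ∀ z : T.V, T.dist x (g • x) ≤ T.dist z (g • z) := by
    intro z
    rw [tdist_Dw, tdist_Dw, ← Lw_btw (wt_tw T) h.btw, Lw_ind (wt_tw T) g x z]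
    refine max_le (Dw_nn (wt_tw T) _ _) ?_
    have := Dw_tri (wt_tw T) z (g • z) (g • g • z)
    rw [Dw_smul (wt_tw T)] at this
    linarith
  refine (IsLeast.csInf_eq (s := {y | ∃ v, y = T.dist v (T.act g v)}) ⟨⟨x, rfl⟩, ?_⟩).symm
  rintro _ ⟨z, rfl⟩
  exact hl z

theorem irr_gp (h : T.Irr) : ∃ a b, GoodPair T.toGTree a b := by
  obtain ⟨a, b, ha, hb, he⟩ := h
  by_cases hc : (Br T.toGTree a b).Nonempty
  · obtain ⟨H, hH⟩ := hc
    exact ⟨a, b, gp_of_br ha hb hH⟩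
  · obtain ⟨x, h1, h2⟩ := helly hc
    have : x ∈ T.Axis a ∩ T.Axis b := ⟨chr_axis T h1, chr_axis T h2⟩
    rw [he] at this
    exact this.elim

end MG

section LabSec
variable (G : Type u) [Group G]

/-- labels: pairs of distinct subsets of the group -/
@[ext] structure Lab : Type u where
  l : Set G
  r : Set G
  ne : l ≠ r

variable {G}

instance labPO : PartialOrder (Lab G) where
  le x y := x.l ⊆ y.l ∧ y.r ⊆ x.r
  le_refl x := ⟨subset_rfl, subset_rfl⟩
  le_trans x y z h k := ⟨h.1.trans k.1, k.2.trans h.2⟩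
  le_antisymm x y h k := Lab.ext (h.1.antisymm k.1) (k.2.antisymm h.2)

instance labPoc : Poc (Lab G) where
  compl x := ⟨x.r, x.l, x.ne.symm⟩
  cc _ := rfl
  anti h := ⟨h.2, h.1⟩

theorem lab_ne (x : Lab G) : x ≠ xᶜ := fun e => x.ne (congrArg (fun y : Lab G => y.l) e)

theorem lab_ext {x y : Lab G} (h1 : x.l = y.l) (h2 : x.r = y.r) : x = y := Lab.ext h1 h2

instance labAut : PocAct (MulAut G) (Lab G) where
  smul φ x := ⟨{g | φ⁻¹ g ∈ x.l}, {g | φ⁻¹ g ∈ x.r}, fun e => x.ne (by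
    ext g
    have := Set.ext_iff.1 e (φ g)
    simpa using this)⟩
  one_smul x := rfl
  mul_smul φ ψ x := by
    apply lab_ext
    · ext g; show (φ * ψ)⁻¹ g ∈ x.l ↔ ψ⁻¹ (φ⁻¹ g) ∈ x.l; rw [mul_inv_rev]; rfl
    · ext g; show (φ * ψ)⁻¹ g ∈ x.r ↔ ψ⁻¹ (φ⁻¹ g) ∈ x.r; rw [mul_inv_rev]; rfl
  mono φ h k e := ⟨fun g hg => e.1 hg, fun g hg => e.2 hg⟩
  scompl φ h := rfl

/-- restriction of actions along a homomorphism -/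
@[reducible] def resAct {K P : Type u} [Group K] [Poc P] [PocAct K P] (f : G →* K) : PocAct G P where
  toMulAction := MulAction.compHom P f
  mono g _ _ e := PocAct.mono (f g) e
  scompl g h := PocAct.scompl (f g) h

instance labAct : PocAct G (Lab G) := resAct (MulAut.conj (G := G))

instance subAct (Γ : Subgroup (MulAut G)) {P : Type u} [Poc P] [PocAct (MulAut G) P] : PocAct Γ P := resAct Γ.subtype

theorem lab_conj (g : G) (x : Lab G) : g • x = (MulAut.conj g) • x := rfl

theorem aut_conj (φ : MulAut G) (g : G) : MulAut.conj (φ g) * φ = φ * MulAut.conj g := by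
  ext x; simp

theorem lab_compat (φ : MulAut G) (g : G) (x : Lab G) : (φ g) • (φ • x) = φ • (g • x) := by
  rw [lab_conj, lab_conj, smul_smul, smul_smul, aut_conj]

/-- seed of the base point -/
def Seed (a b : G) (x : Lab G) : Prop :=
  (a ∈ x.l ∧ a ∉ x.r) ∨ ((a ∈ x.l ↔ a ∈ x.r) ∧ b ∈ x.l ∧ b ∉ x.r)

theorem lab_base (a b : G) : ∃ o : Pt (Lab G), ∀ x, Seed a b x → x ∈ o.m := by
  obtain ⟨o, ho⟩ := pt_ext (P := Lab G) lab_ne (s := {x | Seed a b x}) (by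
    rintro x (hx | hx) y hy ⟨h1, h2⟩
    · have := h1 hx.1
      rcases hy with hy | hy
      · exact hy.2 this
      · exact hx.2 (h2 (hy.1.2 this))
    · have := h1 hx.2.1
      rcases hy with hy | hy
      · exact hy.2 (h1 (hx.1.2 (h2 hy.1)))
      · exact hy.2.2 this)
  exact ⟨o, fun x hx => ho hx⟩

/-- some base point -/
noncomputable def labO (a b : G) : Pt (Lab G) := (lab_base a b).choose

theorem labO_seed {a b : G} {x : Lab G} (h : Seed a b x) : x ∈ (labO a b).m := (lab_base a b).choose_spec x h

/-- the label of a half tree -/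
noncomputable def qq (T : GTree G) (H : Set T.V) : Lab G :=
  if h : fl G H ≠ fl G Hᶜ then ⟨fl G H, fl G Hᶜ, h⟩ else ⟨{1}, ∅, Set.singleton_ne_empty _⟩

variable {T : GTree G} {a b : G}

theorem qq_ok (hg : GoodPair T a b) {H : Set T.V} (hH : H ∈ HL T.graph) : fl G H ≠ fl G Hᶜ := by
  intro e
  obtain ⟨γ, hγ⟩ := flip hg hH
  exact fl_disj hγ (e ▸ hγ)

theorem qq_val (hg : GoodPair T a b) {H : Set T.V} (hH : H ∈ HL T.graph) : (qq T H).l = fl G H ∧ (qq T H).r = fl G Hᶜ := by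
  unfold qq; rw [dif_pos (qq_ok hg hH)]; exact ⟨rfl, rfl⟩

theorem qq_eq (hg : GoodPair T a b) {H J : Set T.V} (hH : H ∈ HL T.graph) (hJ : J ∈ HL T.graph) :
    qq T J = qq T H ↔ fl G J = fl G H ∧ fl G Jᶜ = fl G Hᶜ := by
  rw [Lab.ext_iff, (qq_val hg hH).1, (qq_val hg hH).2, (qq_val hg hJ).1, (qq_val hg hJ).2]

theorem qq_push (T : MGTree G) (hg : GoodPair T.toGTree a b) (x : T.V) {o : Pt (Lab G)}
    (ho : ∀ y, Seed a b y → y ∈ o.m) : PushH G o (ppt x) (tw T) (qq T.toGTree) := by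
  have hm := @tw_HL _ _ T
  have hcomp : ∀ {h}, tw T h ≠ 0 → qq T.toGTree hᶜ = (qq T.toGTree h)ᶜ := by
    intro h hh
    have h1 := qq_val hg (HL_compl T.isTree (hm hh))
    have h2 := qq_val hg (hm hh)
    refine Lab.ext (h1.1.trans h2.2.symm) (h1.2.trans ?_)
    rw [Poc.cc]; exact h2.1.symm
  have seed : ∀ {H}, H ∈ HL T.graph → x ∉ H → qq T.toGTree H ∈ o.m → a ∈ fl G H ∨ b ∈ fl G H ∨
      (a ∉ fl G H ∧ a ∉ fl G Hᶜ ∧ b ∉ fl G H ∧ b ∉ fl G Hᶜ) := by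
    intro H hH _ ho'
    by_contra hcon
    push Not at hcon
    obtain ⟨h1, h2, h3⟩ := hcon
    have : Seed a b (qq T.toGTree Hᶜ) := by
      unfold Seed
      rw [(qq_val hg (HL_compl T.isTree hH)).1, (qq_val hg (HL_compl T.isTree hH)).2, Poc.cc]
      by_cases ha : a ∈ fl G Hᶜ
      · exact Or.inl ⟨ha, h1⟩
      · exact Or.inr ⟨⟨fun h => absurd h ha, fun h => absurd h h1⟩, h3 h1 ha h2, h2⟩
    have h4 := ho _ this
    rw [hcomp (by rw [← sp_tw] at hH; exact hH), o.co] at h4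
    exact h4 ho'
  have half1 : {H | H ∈ HL T.graph ∧ x ∉ H ∧ qq T.toGTree H ∈ o.m}.Finite := by
    refine (((hsep_fin T.isTree (a • x) x).union (hsep_fin T.isTree (b • x) x)).union (CA hg)).subset ?_
    rintro H ⟨h1, h2, h3⟩
    rcases seed h1 h2 h3 with e | e | e
    · exact Or.inl (Or.inl (fl_sep x h1 e h2))
    · exact Or.inl (Or.inr (fl_sep x h1 e h2))
    · exact Or.inr ⟨h1, e⟩
  refine ⟨?_, hcomp, ?_, ?_, ?_, ?_, fun hh => HL_ess T.toGTree (hm hh)⟩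
  · intro h k hh hk e
    constructor
    · rw [(qq_val hg (hm hh)).1, (qq_val hg (hm hk)).1]; exact fl_mono e
    · rw [(qq_val hg (hm hh)).2, (qq_val hg (hm hk)).2]; exact fl_mono (Poc.anti e)
  · intro g h hh
    have h1 := qq_val hg (HL_smul T.toGTree g (hm hh))
    have h2 := qq_val hg (hm hh)
    have e : ∀ γ, (MulAut.conj g)⁻¹ γ = g⁻¹ * γ * g := fun γ => by rw [← map_inv]; simp
    apply lab_ext
    · rw [h1.1]; ext γ
      show _ ↔ (MulAut.conj g)⁻¹ γ ∈ (qq T.toGTree h).l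
      rw [h2.1, e]; exact fl_smul
    · rw [h1.2]; ext γ
      show γ ∈ fl G (g • h)ᶜ ↔ (MulAut.conj g)⁻¹ γ ∈ (qq T.toGTree h).r
      rw [h2.2, e, ← PocAct.scompl]; exact fl_smul
  · intro A
    by_cases hne : ∃ H ∈ HL T.graph, qq T.toGTree H = A
    · obtain ⟨H, hH, rfl⟩ := hne
      obtain ⟨α, β, h1, h2⟩ := br_min hg hH
      refine (Br_fin (T := T.toGTree) α β).subset ?_
      rintro J ⟨hJ, e⟩
      rw [h2]
      exact ⟨hm hJ, (qq_eq hg hH (hm hJ)).1 e⟩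
    · convert Set.finite_empty
      ext H
      exact ⟨fun hh => hne ⟨H, hm hh.1, hh.2⟩, fun hh => hh.elim⟩
  · intro g h hh e
    have hH := hm hh
    have h2 := qq_val hg hH
    have e1 : ∀ γ, (MulAut.conj g)⁻¹ γ = g⁻¹ * γ * g := fun γ => by rw [← map_inv]; simp
    have k1 : fl G (g • h) = fl G hᶜ := by
      have := congrArg (fun y : Lab G => y.l) e
      ext γ
      have h3 := Set.ext_iff.1 this γ
      have h4 : (MulAut.conj g)⁻¹ γ ∈ (qq T.toGTree h).l ↔ γ ∈ (qq T.toGTree h).r := h3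
      rw [h2.1, h2.2, e1] at h4
      rw [fl_smul]; exact h4
    have k2 : fl G (g • h)ᶜ = fl G h := by
      have := congrArg (fun y : Lab G => y.r) e
      ext γ
      have h3 := Set.ext_iff.1 this γ
      have h4 : (MulAut.conj g)⁻¹ γ ∈ (qq T.toGTree h).r ↔ γ ∈ (qq T.toGTree h).l := h3
      rw [h2.1, h2.2, e1] at h4
      rw [← PocAct.scompl, fl_smul]; exact h4
    obtain ⟨γ, hγ⟩ := flip hg hH
    obtain ⟨γ', hγ'⟩ := flip hg (HL_compl T.isTree hH)
    rcases HL_nested T.isTree (HL_smul T.toGTree g hH) hH with l | l | l | l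
    · have := fl_mono (G := G) l; rw [k1] at this
      exact fl_disj (this hγ') hγ'
    · have := fl_mono (G := G) l; rw [k1] at this
      exact fl_disj hγ (this hγ)
    · have h3 := fl_of_le' hH l
      rw [← k1] at h3
      have h5 := fl_self.1 h3
      rw [k1] at h3
      exact fl_disj h5 h3
    · have h3 := fl_of_le hH l
      have h4 := h3
      rw [← k2, ← PocAct.scompl] at h4
      exact fl_disj h3 (fl_self.1 h4)
  · refine (half1.union (half1.image fun H => Hᶜ)).subset ?_
    rintro H ⟨hh, hne⟩
    by_cases hx : x ∈ H
    · right
      refine ⟨Hᶜ, ⟨HL_compl T.isTree (hm hh), fun k => k hx, ?_⟩, Poc.cc H⟩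
      rw [hcomp hh, o.co]
      intro k; exact hne ⟨fun _ => k, fun _ => hx⟩
    · left
      refine ⟨hm hh, hx, ?_⟩
      by_contra k
      exact hne ⟨fun k' => absurd k' hx, fun k' => absurd k' k⟩

noncomputable def wtT (T : MGTree G) : Lab G → ℝ := pushw (tw T) (qq T.toGTree)

theorem wtT_good [Group.FG G] (T : MGTree G) (hg : GoodPair T.toGTree a b) :
    Good T.toGTree.Elliptic (labO a b) (wtT T) :=
  have ⟨x⟩ := T.nonempty
  push_good (goodT T x) (qq_push T hg x fun _ => labO_seed)

theorem gp_same {T T' : GTree G} (h : SameDef T T') (hg : GoodPair T a b) : GoodPair T' a b := by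
  have key : ∀ g, T.Hyperbolic g → T'.Hyperbolic g := by
    intro g hh v hv
    have : T'.Elliptic (Subgroup.zpowers g) := by
      refine ⟨v, fun k hk => ?_⟩
      obtain ⟨n, rfl⟩ := Subgroup.mem_zpowers_iff.1 hk
      rw [map_zpow]
      exact Function.IsFixedPt.perm_zpow hv n
    obtain ⟨w, hw⟩ := (h _).2 this
    exact hh w (hw g (Subgroup.mem_zpowers g))
  exact ⟨key _ hg.ha, key _ hg.hb, key _ hg.hc⟩

end LabSec

section ColSec
variable {G : Type u} [Group G]

theorem col_sub {S T : GTree G} {c : S.V → T.V} (hc : IsCollapseMap S T c) {u v : S.V} (a : S.graph.Adj u v)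
    (a' : T.graph.Adj (c u) (c v)) : c ⁻¹' half T.graph (c u) (c v) ⊆ half S.graph u v := by
  intro p hp
  by_contra hn
  have hK : p ∈ half S.graph v u := by rw [← half_compl S.isTree a]; exact hn
  obtain ⟨q, hq⟩ := (S.isTree.connected p v).exists_isPath
  obtain ⟨d, hd, h1, h2⟩ := walk_exit (A := c ⁻¹' half T.graph (c u) (c v)) q hp (half_not T.isTree a')
  have h3 := hc.2.2.1 _ _ d.adj (fun e => h2 (by
    show c d.toProd.2 ∈ half T.graph (c u) (c v)
    rw [← e]; exact h1))
  have h4 := (half_cross T.isTree a' h3 h1 h2).1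
  have h5 : d.toProd.1 ∈ half S.graph v u :=
    half_convex S.isTree ⟨v, u, a.symm, rfl⟩ q hq (q.dart_fst_mem_support_of_mem_darts hd) hK (half_self _ _)
  obtain ⟨r, hr⟩ := (S.isTree.connected d.toProd.1 u).exists_isPath
  obtain ⟨e, he, k1, k2⟩ := walk_exit r h5 (half_not S.isTree a.symm)
  have k3 := (half_cross S.isTree a.symm e.adj k1 k2).1
  have k4 := hc.2.2.2.2 _ _ h4 r hr _ (r.dart_fst_mem_support_of_mem_darts he)
  rw [k3, h4] at k4
  exact a'.ne k4.symm

theorem col_half {S T : GTree G} {c : S.V → T.V} (hc : IsCollapseMap S T c) {u v : S.V} (a : S.graph.Adj u v)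
    (a' : T.graph.Adj (c u) (c v)) : c ⁻¹' half T.graph (c u) (c v) = half S.graph u v := by
  apply (col_sub hc a a').antisymm
  have := col_sub hc a.symm a'.symm
  rw [← half_compl T.isTree a', ← half_compl S.isTree a] at this
  intro x hx
  by_contra hn
  exact this hn hx

variable {S T : MGTree G} {c : S.V → T.V} (hc : IsCollapseMap S.toGTree T.toGTree c)

theorem col_HL {S T : GTree G} {c : S.V → T.V} (hc : IsCollapseMap S T c) {B : Set T.V} (hB : B ∈ HL T.graph) :
    c ⁻¹' B ∈ HL S.graph := by
  obtain ⟨u', v', a', rfl⟩ := hB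
  obtain ⟨u, v, a, rfl, rfl⟩ := hc.2.2.2.1 u' v' a'
  exact ⟨u, v, a, col_half hc a a'⟩

theorem col_smul {S T : GTree G} {c : S.V → T.V} (hc : IsCollapseMap S T c) (g : G) (B : Set T.V) :
    c ⁻¹' (g • B) = g • c ⁻¹' B := by
  ext x
  show g⁻¹ • c x ∈ B ↔ c (g⁻¹ • x) ∈ B
  have := hc.1 g⁻¹ x
  rw [tact, tact] at this
  rw [this]

theorem col_fl {S T : GTree G} {c : S.V → T.V} (hc : IsCollapseMap S T c) (B : Set T.V) :
    fl G (c ⁻¹' B) = fl G B := by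
  ext γ
  show γ • (c ⁻¹' B)ᶜ < c ⁻¹' B ↔ γ • Bᶜ < B
  rw [← Set.preimage_compl, ← col_smul hc]
  have key : ∀ A B : Set T.V, c ⁻¹' A ≤ c ⁻¹' B ↔ A ≤ B := fun A B => hc.2.1.preimage_subset_preimage_iff
  rw [lt_iff_le_not_ge, lt_iff_le_not_ge, key, key]

theorem col_qq {S T : GTree G} {c : S.V → T.V} (hc : IsCollapseMap S T c) {a b : G} (hS : GoodPair S a b)
    (hT : GoodPair T a b) {B : Set T.V} (hB : B ∈ HL T.graph) : qq S (c ⁻¹' B) = qq T B := by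
  apply Lab.ext
  · rw [(qq_val hT hB).1, (qq_val hS (col_HL hc hB)).1, col_fl hc]
  · rw [(qq_val hT hB).2, (qq_val hS (col_HL hc hB)).2, ← Set.preimage_compl, col_fl hc]

/-- pulled back weights -/
noncomputable def colw {S : GTree G} (T : MGTree G) (c : S.V → T.V) (A : Set S.V) : ℝ :=
  if c ⁻¹' (c '' A) = A then tw T (c '' A) else 0

theorem colw_pre {S : GTree G} {c : S.V → T.V} (hs : Function.Surjective c) (B : Set T.V) :
    colw T c (c ⁻¹' B) = tw T B := by
  unfold colw
  rw [Set.image_preimage_eq _ hs, if_pos rfl]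

theorem colw_zero {S : GTree G} {c : S.V → T.V} {A : Set S.V} (h : ∀ B, A ≠ c ⁻¹' B) : colw T c A = 0 := by
  unfold colw
  rw [if_neg fun e => h _ e.symm]

theorem colw_wt {S : GTree G} {c : S.V → T.V} (hc : IsCollapseMap S T.toGTree c) : Wt S (colw T c) := by
  have key : ∀ (A A' : Set S.V) (f : Set T.V → Set T.V), (∀ B, A = c ⁻¹' B → A' = c ⁻¹' (f B)) →
      (∀ B, A' = c ⁻¹' B → ∃ B', A = c ⁻¹' B') → (∀ B, tw T (f B) = tw T B) → colw T c A' = colw T c A := by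
    intro A A' f h1 h2 h3
    by_cases h : ∃ B, A = c ⁻¹' B
    · obtain ⟨B, rfl⟩ := h
      rw [h1 B rfl, colw_pre hc.2.1, colw_pre hc.2.1, h3]
    · rw [colw_zero fun B e => h ⟨B, e⟩, colw_zero fun B e => h (h2 B e)]
  refine ⟨?_, ?_, ?_⟩
  · intro A
    unfold colw
    split_ifs
    · by_cases h : c '' A ∈ HL T.graph
      · exact (tw_pos T h).le
      · rw [tw_zero T h]
    · exact le_rfl
  · intro A
    refine key A _ (fun B => Bᶜ) ?_ ?_ (tw_compl T)
    · rintro B rfl; rfl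
    · intro B e; exact ⟨Bᶜ, by rw [Set.preimage_compl, ← e, compl_compl]⟩
  · intro g A
    refine key A _ (fun B => g • B) ?_ ?_ (tw_smul T g)
    · rintro B rfl; exact (col_smul hc g B).symm
    · intro B e
      exact ⟨g⁻¹ • B, by rw [col_smul hc, ← e, inv_smul_smul]⟩

theorem colw_sum {S : GTree G} {c : S.V → T.V} (hc : IsCollapseMap S T.toGTree c) {r : Set (Set S.V)}
    {t : Set (Set T.V)} (h : ∀ B ∈ HL T.graph, c ⁻¹' B ∈ r ↔ B ∈ t) :
    ∑ᶠ A ∈ r, colw T c A = ∑ᶠ B ∈ t, tw T B := by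
  have hm := @tw_HL _ _ T
  rw [← finsum_mem_inter_support, ← finsum_mem_inter_support (tw T)]
  symm
  apply finsum_mem_eq_of_bijOn (fun B => c ⁻¹' B)
  · refine ⟨?_, fun _ _ _ _ e => hc.2.1.preimage_injective e, ?_⟩
    · rintro B ⟨h1, h2⟩
      refine ⟨(h B (hm h2)).2 h1, ?_⟩
      show colw T c (c ⁻¹' B) ≠ 0
      rw [colw_pre hc.2.1]; exact h2
    · rintro A ⟨h1, h2⟩
      by_cases h3 : ∃ B, A = c ⁻¹' B
      · obtain ⟨B, rfl⟩ := h3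
        have h4 : colw T c (c ⁻¹' B) ≠ 0 := h2
        rw [colw_pre hc.2.1] at h4
        exact ⟨B, ⟨(h B (hm h4)).1 h1, h4⟩, rfl⟩
      · exact absurd (colw_zero fun B e => h3 ⟨B, e⟩) h2
  · intro B _; exact (colw_pre hc.2.1 B).symm

theorem colw_D {S : GTree G} {c : S.V → T.V} (hc : IsCollapseMap S T.toGTree c) (x y : S.V) :
    Dw S (colw T c) x y = Dw T.toGTree (tw T) (c x) (c y) :=
  colw_sum hc fun B hB => ⟨fun h => ⟨hB, h.2.1, h.2.2⟩, fun h => ⟨col_HL hc hB, h.2.1, h.2.2⟩⟩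

theorem colw_L {S : GTree G} {c : S.V → T.V} (hc : IsCollapseMap S T.toGTree c) (g : G) (x : S.V) :
    Lw (T := S) (colw T c) g x = Lw (T := T.toGTree) (tw T) g (c x) := by
  have e : ∀ y, c (g • y) = g • c y := hc.1 g
  unfold Lw
  rw [colw_D hc, colw_D hc, e, e]

/-- translation lengths -/
noncomputable def TL (T : MGTree G) (g : G) : ℝ := Lw (T := T.toGTree) (tw T) g T.nonempty.some

theorem TL_eq (T : MGTree G) (g : G) (x : T.V) : Lw (T := T.toGTree) (tw T) g x = TL T g := Lw_ind (wt_tw T) g _ _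

theorem wtT_zero {S : GTree G} {c : S.V → T.V} (hc : IsCollapseMap S T.toGTree c) {a b : G} (hS : GoodPair S a b)
    (hT : GoodPair T.toGTree a b) {ℓ : Lab G} (h : ∀ H ∈ HL S.graph, qq S H ≠ ℓ) : wtT T ℓ = 0 := by
  have hm := @tw_HL _ _ T
  unfold wtT pushw
  have : {H | tw T H ≠ 0 ∧ qq T.toGTree H = ℓ} = ∅ := by
    ext B
    refine ⟨?_, fun h => h.elim⟩
    rintro ⟨h1, h2⟩
    exact h _ (col_HL hc (hm h1)) (by rw [col_qq hc hS hT (hm h1), h2])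
  rw [this, finsum_mem_empty]

theorem wtT_len {S : GTree G} {c : S.V → T.V} (hc : IsCollapseMap S T.toGTree c) {a b : G} (hS : GoodPair S a b)
    (hT : GoodPair T.toGTree a b) {α β : G} {H : Set S.V} (hH : H ∈ HL S.graph) (h1 : H ∈ Br S α β)
    (h2 : Br S α β = {J ∈ HL S.graph | fl G J = fl G H ∧ fl G Jᶜ = fl G Hᶜ}) :
    wtT T (qq S H) = (TL T (α * β) - TL T α - TL T β) / 2 := by
  have hm := @tw_HL _ _ T
  obtain ⟨z⟩ := S.nonempty
  have := Lw_Br (colw_wt hc) ⟨H, h1⟩ z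
  rw [colw_L hc, colw_L hc, colw_L hc, TL_eq, TL_eq, TL_eq] at this
  rw [← this]
  unfold wtT pushw
  symm
  apply colw_sum hc
  intro B hB
  rw [h2]
  have hne : tw T B ≠ 0 := (tw_pos T hB).ne'
  have e := qq_eq hS hH (col_HL hc hB)
  constructor
  · rintro ⟨k1, k2⟩
    exact ⟨hne, by rw [← col_qq hc hS hT hB]; exact e.2 k2⟩
  · rintro ⟨k1, k2⟩
    exact ⟨col_HL hc hB, e.1 (by rw [col_qq hc hS hT hB, k2])⟩

theorem TL_cont (g : G) : Continuous (fun T : MGTree G => TL T g) := by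
  rw [continuous_iff_continuousAt]
  intro T
  rw [Metric.continuousAt_iff']
  intro ε hε
  obtain ⟨x⟩ := T.nonempty
  filter_upwards [basic_nhds T {x} {g, g * g} (half_pos hε)] with T' hT'
  obtain ⟨f, hf⟩ := hT'
  have h1 := hf x (by simp) x (by simp) g (by simp)
  have h2 := hf x (by simp) x (by simp) (g * g) (by simp)
  rw [tdist_Dw, tdist_Dw, tact, tact] at h1 h2
  rw [← TL_eq T g x, ← TL_eq T' g (f x), Real.dist_eq]
  unfold Lw
  rw [mul_smul, mul_smul] at h2
  rw [max_comm 0, max_comm 0]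
  refine (abs_max_sub_max_le_abs _ _ _).trans_lt ?_
  rw [abs_lt] at h1 h2 ⊢
  constructor <;> linarith [h1.1, h1.2, h2.1, h2.2]

theorem wtT_iso {T T' : MGTree G} (h : EquivIsometric T T') {a b : G} (hT : GoodPair T.toGTree a b)
    (hT' : GoodPair T'.toGTree a b) : wtT T = wtT T' := by
  have e1 : ∀ g, TL T g = TL T' g := by
    intro g
    have := TL_cont g
    have i1 := (iso_dist' h)
    obtain ⟨e, e0, _, e2⟩ := i1
    have : T' ⤳ T := gr_spec e e0 e2
    have h3 := this.map (TL_cont g)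
    exact (h3.eq).symm
  obtain ⟨c, hc⟩ : CollapseOf T'.toGTree T.toGTree := by
    obtain ⟨e, e0, e1, _⟩ := iso_dist' h
    exact iso_collapse e e0 e1
  obtain ⟨c', hc'⟩ := collapse_self T.toGTree
  funext ℓ
  by_cases hℓ : ∃ H ∈ HL T.graph, qq T.toGTree H = ℓ
  · obtain ⟨H, hH, rfl⟩ := hℓ
    obtain ⟨α, β, h1, h2⟩ := br_min hT hH
    rw [wtT_len hc' hT hT hH h1 h2, wtT_len hc hT hT' hH h1 h2, e1, e1, e1]
  · push Not at hℓ
    rw [wtT_zero hc' hT hT hℓ, wtT_zero hc hT hT' hℓ]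

theorem wtT_cont {T₀ : MGTree G} {D : Set (MGTree G)} (hD : D = {T | SameDef T₀.toGTree T.toGTree}) {a b : G}
    (hg : GoodPair T₀.toGTree a b) (ℓ : Lab G) : Continuous (fun x : DSp D => wtT x.1 ℓ) := by
  have gd : ∀ T ∈ D, GoodPair T.toGTree a b := fun T hT => gp_same (by rw [hD] at hT; exact hT) hg
  apply dsp_dom
  intro S hS
  by_cases hℓ : ∃ H ∈ HL S.graph, qq S.toGTree H = ℓ
  · obtain ⟨H, hH, rfl⟩ := hℓ
    obtain ⟨α, β, h1, h2⟩ := br_min (gd S hS) hH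
    have : ((fun x : DSp D => wtT x.1 (qq S.toGTree H)) ∘ cinc D S) =
        fun x => (TL x.1 (α * β) - TL x.1 α - TL x.1 β) / 2 := by
      funext x
      obtain ⟨c, hc⟩ := x.2.2
      exact wtT_len hc (gd S hS) (gd _ x.2.1) hH h1 h2
    rw [this]
    have k := fun g => (TL_cont g).comp (continuous_subtype_val (p := fun T => T ∈ closedCone D S))
    exact (((k _).sub (k _)).sub (k _)).div_const 2
  · push Not at hℓ
    have : ((fun x : DSp D => wtT x.1 ℓ) ∘ cinc D S) = fun _ => 0 := by
      funext x
      obtain ⟨c, hc⟩ := x.2.2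
      exact wtT_zero hc (gd S hS) (gd _ x.2.1) hℓ
    rw [this]; exact continuous_const

/-- finitely many orbits of labels over a cone -/
theorem wtT_orb [Group.FG G] {S : MGTree G} {a b : G} (hS : GoodPair S.toGTree a b) :
    ∃ M : Set (Lab G), M.Finite ∧ ∀ T : MGTree G, GoodPair T.toGTree a b → CollapseOf T.toGTree S.toGTree →
      ∀ ℓ, wtT T ℓ ≠ 0 → ∃ g : G, g • ℓ ∈ M := by
  obtain ⟨x⟩ := S.nonempty
  obtain ⟨M, hM, _, h⟩ := (HL_sys S.toGTree x).orb
  refine ⟨qq S.toGTree '' M, hM.image _, ?_⟩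
  rintro T hT ⟨c, hc⟩ ℓ hℓ
  by_cases hℓ' : ∃ H ∈ HL S.graph, qq S.toGTree H = ℓ
  · obtain ⟨H, hH, rfl⟩ := hℓ'
    obtain ⟨g, hgM⟩ := h H hH
    refine ⟨g, g • H, hgM, ?_⟩
    exact (qq_push S hS x fun _ => labO_seed).smul g (tw_pos S hH).ne'
  · push Not at hℓ'
    exact absurd (wtT_zero hc hS hT hℓ') hℓ

theorem precomp_fl (φ : MulAut G) (T : MGTree G) (H : Set T.V) (γ : G) :
    γ ∈ fl G (P := Set (MGTree.precomp φ T).V) H ↔ φ γ ∈ fl G H := by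
  have e : ∀ A : Set T.V, (HSMul.hSMul (α := G) (β := Set (MGTree.precomp φ T).V) γ A : Set (MGTree.precomp φ T).V) =
      φ γ • A := by
    intro A
    ext x
    show (T.act (φ γ⁻¹)) x ∈ A ↔ T.act (φ γ)⁻¹ x ∈ A
    rw [map_inv φ]
  exact iff_of_eq (congrArg (fun B : Set T.V => B < H) (e Hᶜ))

theorem precomp_gp (φ : MulAut G) (T : MGTree G) {a b : G} (h : GoodPair T.toGTree (φ a) (φ b)) :
    GoodPair (MGTree.precomp φ T).toGTree a b := by
  refine ⟨h.ha, h.hb, ?_⟩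
  have := h.hc
  rw [← map_inv, ← map_inv, ← map_mul, ← map_mul, ← map_mul] at this
  exact this

theorem wtT_precomp (φ : MulAut G) (T : MGTree G) {a b : G} (h : GoodPair T.toGTree (φ a) (φ b)) (ℓ : Lab G) :
    wtT (MGTree.precomp φ T) ℓ = wtT T (φ • ℓ) := by
  have hm := @tw_HL _ _ T
  have key : ∀ H ∈ HL T.graph, φ • qq (MGTree.precomp φ T).toGTree H = qq T.toGTree H := by
    intro H hH
    have h1 := qq_val (precomp_gp φ T h) (H := H) hH
    have h2 := qq_val h hH
    apply Lab.ext
    · ext γ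
      show φ⁻¹ γ ∈ (qq (MGTree.precomp φ T).toGTree H).l ↔ _
      rw [h1.1, h2.1, precomp_fl, MulAut.apply_inv_self]
    · ext γ
      show φ⁻¹ γ ∈ (qq (MGTree.precomp φ T).toGTree H).r ↔ _
      rw [h1.2, h2.2]
      refine (precomp_fl φ T Hᶜ _).trans ?_
      rw [MulAut.apply_inv_self]
  unfold wtT pushw
  have : {H | tw (MGTree.precomp φ T) H ≠ 0 ∧ qq (MGTree.precomp φ T).toGTree H = ℓ} =
      {H : Set T.V | tw T H ≠ 0 ∧ qq T.toGTree H = φ • ℓ} := by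
    ext H
    show tw T H ≠ 0 ∧ _ ↔ tw T H ≠ 0 ∧ _
    apply and_congr_right
    intro hh
    rw [← key H (hm hh)]
    constructor
    · rintro rfl; rfl
    · intro e; exact MulAction.injective φ e
  rw [this]
  rfl

end ColSec

section FixSec
variable {G P : Type u} [Group G] [Poc P] [PocAct G P] {o : Pt P} {El : Subgroup G → Prop} {wt : P → ℝ}

/-- invariance of a weight under a bigger group -/
structure GInv (Γ : Subgroup (MulAut G)) [PocAct Γ P] (o : Pt P) (wt : P → ℝ) : Prop where
  comp : ∀ (γ : Γ) (g : G) (h : P), (γ.1 g) • (γ • h) = γ • (g • h)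
  conj : ∀ g : G, ∃ γ : Γ, ∀ h : P, γ • h = g • h
  inv : ∀ (γ : Γ) h, wt (γ • h) = wt h
  fin : ∀ γ : Γ, {h | wt h ≠ 0 ∧ h ∈ o.m ∧ γ • h ∉ o.m}.Finite

theorem GInv.ess {Γ : Subgroup (MulAut G)} [PocAct Γ P] (I : GInv Γ o wt) (γ : Γ) {h : P} (hh : Ess G h) :
    Ess G (γ • h) := by
  obtain ⟨g, hg⟩ := hh
  exact ⟨γ.1 g, by rw [I.comp]; exact (smul_lt_iff' γ).2 hg⟩

theorem GInv.sys {Γ : Subgroup (MulAut G)} [PocAct Γ P] (I : GInv Γ o wt) (H : Good El o wt) : Sys Γ o (ep G wt) where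
  compl hh := H.tsys.compl hh
  smul γ h hh := ⟨by show wt (γ • h) ≠ 0; rw [I.inv]; exact hh.1, I.ess γ hh.2⟩
  nested hh hk := H.tsys.nested hh hk
  fin γ := (I.fin γ).subset fun h hh => ⟨hh.1.1, hh.2⟩
  hit hh := by
    obtain ⟨g, hg⟩ := H.tsys.hit hh
    obtain ⟨γ, hγ⟩ := I.conj g
    exact ⟨γ, by rw [hγ]; exact hg⟩

theorem fix_rho {Γ : Subgroup (MulAut G)} [PocAct Γ P] (I : GInv Γ o wt) (H : Good El o wt) (γ : Γ) :
    EquivIsometric (MGTree.precomp γ.1 (rho H)) (rho H) := by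
  refine ⟨actV (I.sys H) γ⁻¹, ?_, ?_, ?_⟩
  · rintro g (v : Vtx o (ep G wt))
    apply Subtype.ext
    show sv γ⁻¹ (sv (γ.1 g) v.1) = sv g (sv γ⁻¹ v.1)
    ext h
    simp only [mem_sv, inv_inv]
    rw [← I.comp, map_inv]
  · rintro (u : Vtx o (ep G wt)) (v : Vtx o (ep G wt))
    have key : ∀ (γ : Γ) (u v : Vtx o (ep G wt)), (dualGraph o (ep G wt)).Adj u v →
        (dualGraph o (ep G wt)).Adj (actV (I.sys H) γ u) (actV (I.sys H) γ v) := by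
      rintro γ u v ⟨h, hh⟩
      refine ⟨γ • h, ?_⟩
      rw [actV_val, actV_val, sv_diff, hh, Set.image_singleton]
    refine ⟨key _ u v, fun h => ?_⟩
    have := key γ _ _ h
    have e : ∀ u, actV (I.sys H) γ (actV (I.sys H) γ⁻¹ u) = u := fun u => by
      rw [← Equiv.Perm.mul_apply, ← map_mul, mul_inv_cancel, map_one]; rfl
    have h2 := e u
    have h3 := e v
    exact h2 ▸ h3 ▸ this
  · rintro (u : Vtx o (ep G wt)) (v : Vtx o (ep G wt)) _
    rw [one_mul]
    exact dlen_act (I.sys H) wt I.inv γ⁻¹ u v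

end FixSec

section Stage
variable {G : Type u} [Group G]

/-- preimage in the automorphism group -/
def Gam (F : Subgroup (OutG G)) : Subgroup (MulAut G) :=
  F.comap (QuotientGroup.mk' (MulAut.conj : G →* MulAut G).range)

theorem conj_Gam (F : Subgroup (OutG G)) (g : G) : MulAut.conj g ∈ Gam F := by
  have : QuotientGroup.mk' (MulAut.conj : G →* MulAut G).range (MulAut.conj g) = 1 :=
    (QuotientGroup.eq_one_iff _).2 ⟨g, rfl⟩
  show QuotientGroup.mk' (MulAut.conj : G →* MulAut G).range (MulAut.conj g) ∈ F
  rw [this]; exact F.one_mem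

/-- the standing assumptions -/
structure Stg (T₀ : MGTree G) (D : Set (MGTree G)) (Γ : Subgroup (MulAut G)) (a b : G) : Prop where
  hD : D = {T | SameDef T₀.toGTree T.toGTree}
  hg : GoodPair T₀.toGTree a b
  conj : ∀ g, MulAut.conj g ∈ Γ
  fix0 : ∀ φ ∈ Γ, EquivIsometric (MGTree.precomp φ T₀) T₀

variable {T₀ : MGTree G} {D : Set (MGTree G)} {Γ : Subgroup (MulAut G)} {a b : G} (X : Stg T₀ D Γ a b)

theorem Stg.same (X : Stg T₀ D Γ a b) {T : MGTree G} (hT : T ∈ D) : SameDef T₀.toGTree T.toGTree := by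
  have := X.hD; subst this; exact hT

theorem Stg.mem (X : Stg T₀ D Γ a b) {T : MGTree G} (hT : SameDef T₀.toGTree T.toGTree) : T ∈ D := by
  have := X.hD; subst this; exact hT

theorem Stg.mem0 (X : Stg T₀ D Γ a b) : T₀ ∈ D := X.mem fun _ => Iff.rfl

theorem Stg.el (X : Stg T₀ D Γ a b) {T : MGTree G} (hT : T ∈ D) : T.toGTree.Elliptic = T₀.toGTree.Elliptic :=
  funext fun K => propext (X.same hT K).symm

theorem Stg.gp (X : Stg T₀ D Γ a b) {T : MGTree G} (hT : T ∈ D) : GoodPair T.toGTree a b := gp_same (X.same hT) X.hg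

theorem Stg.gpφ (X : Stg T₀ D Γ a b) {T : MGTree G} (hT : T ∈ D) {φ : MulAut G} (hφ : φ ∈ Γ) :
    GoodPair T.toGTree (φ a) (φ b) := by
  apply gp_same (X.same hT)
  obtain ⟨e, e1, _⟩ := X.fix0 φ hφ
  have key : ∀ g, T₀.toGTree.Hyperbolic g → T₀.toGTree.Hyperbolic (φ g) := by
    intro g hg v hv
    have h1 := e1 g v
    have h2 : e (T₀.act (φ g) v) = T₀.act g (e v) := h1
    rw [hv] at h2
    exact hg _ h2.symm
  refine ⟨key _ X.hg.ha, key _ X.hg.hb, ?_⟩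
  have := key _ X.hg.hc
  rw [map_mul, map_mul, map_mul, map_inv, map_inv] at this
  exact this

theorem Stg.good [Group.FG G] (X : Stg T₀ D Γ a b) {T : MGTree G} (hT : T ∈ D) :
    Good T₀.toGTree.Elliptic (labO a b) (wtT T) := by
  have := wtT_good T (X.gp hT)
  rwa [X.el hT] at this

theorem Stg.rho [Group.FG G] (X : Stg T₀ D Γ a b) {P : Type u} [Poc P] [PocAct G P] {o : Pt P} {wt : P → ℝ}
    (H : Good T₀.toGTree.Elliptic o wt) : rho H ∈ D := X.mem fun K => (rho_el H K).symm

/-- translated base point -/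
def Pt.tr {K P : Type u} [Group K] [Poc P] [PocAct K P] (o : Pt P) (γ : K) : Pt P where
  m := {h | γ • h ∈ o.m}
  up e h := o.up (PocAct.mono γ e) h
  co h := by
    show γ • hᶜ ∈ o.m ↔ γ • h ∉ o.m
    rw [PocAct.scompl]; exact o.co _

theorem Stg.fin [Group.FG G] (X : Stg T₀ D Γ a b) {T : MGTree G} (hT : T ∈ D) {φ : MulAut G} (hφ : φ ∈ Γ) :
    {h | wtT T h ≠ 0 ∧ h ∈ (labO a b).m ∧ φ • h ∉ (labO a b).m}.Finite := by
  obtain ⟨x⟩ := T.nonempty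
  have h1 := (qq_push T (X.gp hT) x fun _ => labO_seed).diff
  have h2 := (qq_push T (X.gpφ hT (inv_mem hφ)) x (o := (labO a b).tr φ) (by
    intro y hy
    exact labO_seed (x := φ • y) hy)).diff
  refine ((h1.union h2).image (qq T.toGTree)).subset ?_
  rintro h ⟨k1, k2, k3⟩
  obtain ⟨H, k4, rfl⟩ := (pushw_ne (goodT T x) (qq_push T (X.gp hT) x fun _ => labO_seed) h).1 k1
  refine ⟨H, ?_, rfl⟩
  by_cases hx : x ∈ H
  · right; exact ⟨k4, fun e => k3 (e.1 hx)⟩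
  · left; exact ⟨k4, fun e => hx (e.2 k2)⟩

/-- trees with invariant weights -/
def YY (D : Set (MGTree G)) (Γ : Subgroup (MulAut G)) : Set (DSp D) := {x | ∀ φ ∈ Γ, ∀ ℓ, wtT x.1 (φ • ℓ) = wtT x.1 ℓ}

theorem Stg.YY_closed (X : Stg T₀ D Γ a b) : IsClosed (YY D Γ) := by
  have : YY D Γ = ⋂ φ ∈ Γ, ⋂ ℓ, {x : DSp D | wtT x.1 (φ • ℓ) = wtT x.1 ℓ} := by
    ext x; simp only [YY, Set.mem_iInter]; rfl
  rw [this]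
  exact isClosed_biInter fun φ _ => isClosed_iInter fun ℓ =>
    isClosed_eq (wtT_cont X.hD X.hg _) (wtT_cont X.hD X.hg _)

theorem Stg.YY_fix (X : Stg T₀ D Γ a b) {T : MGTree G} (hT : T ∈ D)
    (h : ∀ φ ∈ Γ, EquivIsometric (MGTree.precomp φ T) T) : mkD T hT ∈ YY D Γ := by
  intro φ hφ ℓ
  show wtT T (φ • ℓ) = wtT T ℓ
  have h1 := X.gpφ hT hφ
  rw [← wtT_precomp φ T h1, wtT_iso (h φ hφ) (precomp_gp φ T h1) (X.gp hT)]

theorem Stg.ginv [Group.FG G] (X : Stg T₀ D Γ a b) {T : MGTree G} (hT : T ∈ D) (h : mkD T hT ∈ YY D Γ) :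
    GInv Γ (labO a b) (wtT T) where
  comp γ g x := lab_compat γ.1 g x
  conj g := ⟨⟨_, X.conj g⟩, fun _ => rfl⟩
  inv γ x := h γ.1 γ.2 x
  fin γ := X.fin hT γ.2

end Stage

section H1
variable {G : Type u} [Group G] {T₀ : MGTree G} {D : Set (MGTree G)} {Γ : Subgroup (MulAut G)} {a b : G}

theorem Stg.c1_spec [Group.FG G] (X : Stg T₀ D Γ a b) {T : MGTree G} (hT : T ∈ D) :
    mkD T hT ⤳ mkD (Skora.rho (X.good hT)) (X.rho _) := by
  obtain ⟨x⟩ := T.nonempty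
  have hm : ∀ {h}, tw T h ≠ 0 ↔ h ∈ HL T.graph := fun {h} => by rw [← sp_tw]; rfl
  have Q := qq_push T (X.gp hT) x (o := labO a b) fun _ => labO_seed
  obtain ⟨o', ho'⟩ := pt_ext (P := Set T.V) (fun h e => by
    have := Set.ext_iff.1 e x
    by_cases hx : x ∈ h
    · exact this.1 hx hx
    · exact hx (this.2 hx)) (s := {H | tw T H ≠ 0 ∧ qq T.toGTree H ∈ (labO a b).m}) (by
      rintro H ⟨h1, h2⟩ K ⟨k1, k2⟩ e
      have k3 : tw T Kᶜ ≠ 0 := by rw [tw_compl]; exact k1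
      have := (labO a b).up (Q.mono h1 k3 e) h2
      rw [Q.compl k1, (labO a b).co] at this
      exact this k2)
  have hb : ∀ H, tw T H ≠ 0 → (H ∈ o'.m ↔ qq T.toGTree H ∈ (labO a b).m) := by
    intro H hH
    refine ⟨fun h => ?_, fun h => ho' ⟨hH, h⟩⟩
    by_contra hn
    have := ho' (a := Hᶜ) ⟨by rw [tw_compl]; exact hH, by rw [Q.compl hH, (labO a b).co]; exact hn⟩
    exact (o'.co H).1 this h
  have G0 : Good T₀.toGTree.Elliptic (ppt x) (tw T) := by
    have := goodT T x; rwa [X.el hT] at this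
  have hd : {h | tw T h ≠ 0 ∧ ¬ (h ∈ (ppt x).m ↔ h ∈ o'.m)}.Finite := by
    refine Q.diff.subset ?_
    rintro h ⟨h1, h2⟩
    refine ⟨h1, ?_⟩
    rw [← hb h h1]; exact h2
  have G1 : Good T₀.toGTree.Elliptic o' (tw T) := base_good G0 hd fun hh => Q.ess hh
  have i1 : EquivIsometric T (Skora.rho G0) := iso_rho T x
  have i2 := base_iso G0 G1 hd
  have i3 : Inseparable (mkD T hT) (mkD (Skora.rho G1) (X.rho G1)) := iso_insep (iso_trans i1 i2)
  refine i3.specializes.trans ?_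
  refine Proj.spec (p := qq T.toGTree) (X.good hT) G1 ?_ _ _
  refine ⟨Q.mono, Q.compl, Q.smul, ?_, ?_⟩
  · intro h hh; exact (hb h hh)
  · intro A; rfl

end H1

section Dbl0

/-- doubled pocset -/
@[ext] structure Dbl (P : Type u) where
  lab : P
  b : Bool

variable {P : Type u} [Poc P]

instance dblPO : PartialOrder (Dbl P) where
  le x y := x.lab < y.lab ∨ (x.lab = y.lab ∧ x.b ≤ y.b)
  le_refl x := Or.inr ⟨rfl, le_refl _⟩
  le_trans x y z h1 h2 := by
    rcases h1 with h1 | ⟨h1, h1'⟩ <;> rcases h2 with h2 | ⟨h2, h2'⟩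
    · exact Or.inl (h1.trans h2)
    · exact Or.inl (h2 ▸ h1)
    · exact Or.inl (h1 ▸ h2)
    · exact Or.inr ⟨h1.trans h2, h1'.trans h2'⟩
  le_antisymm x y h1 h2 := by
    rcases h1 with h1 | ⟨h1, h1'⟩ <;> rcases h2 with h2 | ⟨h2, h2'⟩
    · exact absurd (h1.trans h2) (lt_irrefl _)
    · exact absurd h1 (h2 ▸ lt_irrefl _)
    · exact absurd h2 (h1 ▸ lt_irrefl _)
    · exact Dbl.ext h1 (le_antisymm h1' h2')

instance dblPoc : Poc (Dbl P) where
  compl x := ⟨x.labᶜ, !x.b⟩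
  cc x := Dbl.ext (Poc.cc _) (by simp)
  anti {x y} h := by
    rcases h with h | ⟨h, h'⟩
    · left
      refine lt_of_le_of_ne (Poc.anti h.le) fun e => h.ne (compl_inj' e.symm)
    · right
      refine ⟨by simp [h], ?_⟩
      show (!y.b) ≤ (!x.b)
      revert h'; cases x.b <;> cases y.b <;> simp

theorem dbl_cl (x : Dbl P) : xᶜ.lab = x.labᶜ := rfl
theorem dbl_cb (x : Dbl P) : xᶜ.b = !x.b := rfl

instance dblAct {K : Type u} [Group K] [PocAct K P] : PocAct K (Dbl P) where
  smul k x := ⟨k • x.lab, x.b⟩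
  one_smul x := Dbl.ext (one_smul _ _) rfl
  mul_smul k k' x := Dbl.ext (mul_smul _ _ _) rfl
  mono k x y h := by
    rcases h with h | ⟨h, h'⟩
    · exact Or.inl ((smul_lt_iff' k).2 h)
    · exact Or.inr ⟨congrArg (k • ·) h, h'⟩
  scompl k x := Dbl.ext (PocAct.scompl k x.lab) rfl

theorem dbl_sl {K : Type u} [Group K] [PocAct K P] (k : K) (x : Dbl P) : (k • x).lab = k • x.lab := rfl
theorem dbl_sb {K : Type u} [Group K] [PocAct K P] (k : K) (x : Dbl P) : (k • x).b = x.b := rfl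

theorem dbl_mono {x y : Dbl P} (h : x ≤ y) : x.lab ≤ y.lab := by
  rcases h with h | ⟨h, -⟩
  · exact h.le
  · exact h.le

theorem dbl_noinv {K : Type u} [Group K] [PocAct K P] (k : K) (x : Dbl P) : k • x ≠ xᶜ := by
  intro e
  have := congrArg Dbl.b e
  rw [dbl_sb, dbl_cb] at this
  revert this; cases x.b <;> simp

theorem dbl_lt {x y : Dbl P} (h : x.lab < y.lab) : x < y :=
  lt_of_le_of_ne (Or.inl h) fun e => h.ne (congrArg Dbl.lab e)

theorem dbl_ess {K : Type u} [Group K] [PocAct K P] {x : Dbl P} (h : Ess K x.lab) : Ess K x := by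
  obtain ⟨k, hk⟩ := h
  exact ⟨k, dbl_lt hk⟩

/-- base point of doubled pocset -/
def dblO (o : Pt P) : Pt (Dbl P) where
  m := {x | x.lab ∈ o.m}
  up h hm := o.up (dbl_mono h) hm
  co x := o.co x.lab

/-- doubled weights -/
noncomputable def dblw (wt : P → ℝ) (x : Dbl P) : ℝ := wt x.lab / 2

theorem dblw_ne {wt : P → ℝ} {x : Dbl P} : dblw wt x ≠ 0 ↔ wt x.lab ≠ 0 := by
  unfold dblw
  constructor
  · intro h e; exact h (by rw [e, zero_div])
  · intro h e; exact h (by linarith)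

theorem dbl_pre (s : Set P) : {x : Dbl P | x.lab ∈ s} = (fun h => ⟨h, true⟩) '' s ∪ (fun h => ⟨h, false⟩) '' s := by
  ext ⟨h, b⟩
  cases b <;> simp [Dbl.ext_iff]

theorem dbl_fin {s : Set P} (hs : s.Finite) : {x : Dbl P | x.lab ∈ s}.Finite := by
  rw [dbl_pre]; exact (hs.image _).union (hs.image _)

theorem dbl_card {s : Set P} (hs : s.Finite) : {x : Dbl P | x.lab ∈ s}.ncard ≤ 2 * s.ncard := by
  rw [dbl_pre]
  refine (Set.ncard_union_le _ _).trans ?_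
  have h1 := Set.ncard_image_le (f := fun h => (⟨h, true⟩ : Dbl P)) hs
  have h2 := Set.ncard_image_le (f := fun h => (⟨h, false⟩ : Dbl P)) hs
  omega

theorem dbl_sum {wt : P → ℝ} {s : Set P} (hs : s.Finite) :
    ∑ᶠ x ∈ {x : Dbl P | x.lab ∈ s}, dblw wt x = ∑ᶠ h ∈ s, wt h := by
  rw [dbl_pre, finsum_mem_union _ (hs.image _) (hs.image _), finsum_mem_image, finsum_mem_image]
  · show (∑ᶠ h ∈ s, wt h / 2) + (∑ᶠ h ∈ s, wt h / 2) = _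
    rw [← finsum_mem_add_distrib hs]
    refine finsum_mem_congr rfl fun h _ => ?_
    ring
  · intro x _ y _ e; exact congrArg Dbl.lab e
  · intro x _ y _ e; exact congrArg Dbl.lab e
  · rw [Set.disjoint_left]
    rintro x ⟨y, -, rfl⟩ ⟨z, -, e⟩
    exact absurd (congrArg Dbl.b e) (by simp)

variable {G : Type u} [Group G] [PocAct G P] {o : Pt P} {wt : P → ℝ} {El : Subgroup G → Prop}

theorem dbl_sepo {K : Type u} [Group K] [PocAct K P] (k : K) :
    sepo (dblO o) (sp (dblw wt)) k = {x : Dbl P | x.lab ∈ sepo o (sp wt) k} := by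
  ext x
  show dblw wt x ≠ 0 ∧ _ ↔ wt x.lab ≠ 0 ∧ _
  rw [dblw_ne]; rfl

theorem dbl_good (H : Good El o wt) : Good El (dblO o) (dblw wt) where
  nonneg x := by have := H.nonneg x.lab; unfold dblw; linarith
  wc x := by unfold dblw; rw [dbl_cl, H.wc]
  wg g x := by unfold dblw; rw [dbl_sl, H.wg]
  sys :=
    { compl := fun {x} hx => dblw_ne.2 (by rw [dbl_cl, H.wc]; exact dblw_ne.1 hx)
      smul := fun g x hx => dblw_ne.2 (by rw [dbl_sl, H.wg]; exact dblw_ne.1 hx)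
      nested := by
        intro x y hx hy
        rcases H.sys.nested (dblw_ne.1 hx) (dblw_ne.1 hy) with e | e | e | e
        · rcases e.lt_or_eq with e | e
          · exact Or.inl (Or.inl e)
          · rcases le_total x.b y.b with f | f
            · exact Or.inl (Or.inr ⟨e, f⟩)
            · exact Or.inr (Or.inl (Or.inr ⟨e.symm, f⟩))
        · rcases e.lt_or_eq with e | e
          · exact Or.inr (Or.inl (Or.inl e))
          · rcases le_total x.b y.b with f | f
            · exact Or.inl (Or.inr ⟨e.symm, f⟩)
            · exact Or.inr (Or.inl (Or.inr ⟨e, f⟩))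
        · rcases e.lt_or_eq with e | e
          · exact Or.inr (Or.inr (Or.inl (Or.inl e)))
          · rcases le_total x.b (!y.b) with f | f
            · exact Or.inr (Or.inr (Or.inl (Or.inr ⟨e, f⟩)))
            · refine Or.inr (Or.inr (Or.inr (compl_le_comm' (Or.inr ⟨e.symm, f⟩))))
        · rcases e.lt_or_eq with e | e
          · exact Or.inr (Or.inr (Or.inr (Or.inl e)))
          · rcases le_total (!x.b) y.b with f | f
            · exact Or.inr (Or.inr (Or.inr (Or.inr ⟨e, f⟩)))
            · refine Or.inr (Or.inr (Or.inl (le_compl_comm' (Or.inr ⟨e.symm, f⟩))))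
      fin := by
        intro g
        have := dbl_sepo (o := o) (wt := wt) g
        show (sepo (dblO o) (sp (dblw wt)) g).Finite
        rw [this]; exact dbl_fin (H.sys.fin g)
      hit := fun {x} hx => H.sys.hit (dblw_ne.1 hx) }
  noinv g x _ := dbl_noinv g x
  E1 K hK := by
    obtain ⟨C, hC⟩ := H.E1 K hK
    refine ⟨2 * C, fun k hk => ?_⟩
    rw [dbl_sepo]
    exact (dbl_card (H.sys.fin k)).trans (Nat.mul_le_mul_left 2 (hC k hk))
  E2 K hK := by
    obtain ⟨C, hC⟩ := hK
    refine H.E2 K ⟨C, fun k hk => ?_⟩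
    have := hC k hk
    rwa [dbl_sepo, dbl_sum (s := sepo o (sp wt) k) (H.sys.fin k)] at this

theorem dbl_proj : Proj G o (dblO o) wt (dblw wt) Dbl.lab where
  mono _ _ h := dbl_mono h
  compl _ := rfl
  smul _ _ _ := rfl
  base _ := Iff.rfl
  sum A := by
    have h1 : ∑ᶠ x ∈ {x : Dbl P | x.lab ∈ ({A} : Set P)}, dblw wt x = wt A := by
      rw [dbl_sum (Set.finite_singleton A), finsum_mem_singleton]
    rw [← h1]
    rw [← finsum_mem_inter_support]
    have : {x : Dbl P | x.lab ∈ ({A} : Set P)} ∩ Function.support (dblw wt) = {x | dblw wt x ≠ 0 ∧ x.lab = A} := by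
      ext x; simp [and_comm]
    rw [this]

theorem dbl_ginv {Γ : Subgroup (MulAut G)} [PocAct Γ P] (I : GInv Γ o wt) : GInv Γ (dblO o) (dblw wt) where
  comp γ g h := Dbl.ext (I.comp γ g h.lab) rfl
  conj g := by
    obtain ⟨γ, h⟩ := I.conj g
    exact ⟨γ, fun x => Dbl.ext (h _) rfl⟩
  inv γ h := by unfold dblw; rw [dbl_sl, I.inv]
  fin γ := by
    refine (dbl_fin (I.fin γ)).subset ?_
    rintro x ⟨h1, h2, h3⟩
    exact ⟨dblw_ne.1 h1, h2, h3⟩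

end Dbl0

section I1
variable {G : Type u} [Group G] {T₀ : MGTree G} {D : Set (MGTree G)} {Γ : Subgroup (MulAut G)} {a b : G}

/-- extended action on a tree -/
structure WA (W : GTree G) (Γ : Subgroup (MulAut G)) [MulAction Γ W.V] : Prop where
  adj : ∀ (γ : Γ) {u v : W.V}, W.graph.Adj u v → W.graph.Adj (γ • u) (γ • v)
  comp : ∀ (γ : Γ) (g : G) (w : W.V), (γ.1 g) • (γ • w) = γ • (g • w)
  conj : ∀ g : G, ∃ γ : Γ, γ.1 = MulAut.conj g ∧ ∀ w : W.V, γ • w = g • w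

theorem eqv_map {A B : Type u} [MulAction G A] [MulAction G B]
    (h : ∀ x : A, ∃ y : B, ∀ g : G, g • x = x → g • y = y) : ∃ q : A → B, ∀ (g : G) x, q (g • x) = g • q x := by
  choose f hf using h
  have hr : ∀ x : A, ∃ g : G, g • (Quotient.out (s := MulAction.orbitRel G A) (Quotient.mk _ x)) = x := by
    intro x
    have := Quotient.mk_out (s := MulAction.orbitRel G A) x
    obtain ⟨g, hg⟩ := (MulAction.orbitRel_apply.1 this)
    exact ⟨g⁻¹, by rw [← hg]; simp⟩
  choose r hr using hr
  refine ⟨fun x => r x • f (Quotient.out (s := MulAction.orbitRel G A) (Quotient.mk _ x)), fun g x => ?_⟩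
  have e : (Quotient.mk (MulAction.orbitRel G A) (g • x)) = Quotient.mk (MulAction.orbitRel G A) x :=
    Quotient.sound (MulAction.orbitRel_apply.2 ⟨g, rfl⟩)
  have h1 := hr x
  have h2 := hr (g • x)
  show r (g • x) • f _ = g • (r x • f _)
  rw [e] at h2 ⊢
  generalize Quotient.out (s := MulAction.orbitRel G A) (Quotient.mk _ x) = z at *
  have := hf z ((r x)⁻¹ * g⁻¹ * r (g • x)) (by rw [mul_smul, mul_smul, h2, inv_smul_smul, inv_smul_eq_iff, h1])
  rw [mul_smul, mul_smul, inv_smul_eq_iff, inv_smul_eq_iff] at this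
  exact this

theorem lip [Group.FG G] (W T : GTree G) (h : ∀ K, W.Elliptic K → T.Elliptic K) :
    ∃ (q : W.V → T.V) (N : ℕ), (∀ (g : G) x, q (g • x) = g • q x) ∧
      ∀ {u v : W.V} (p : W.graph.Walk u v), (hsep T.graph (q u) (q v)).ncard ≤ N * p.length := by
  obtain ⟨q, hq⟩ := eqv_map (G := G) (A := W.V) (B := T.V) (fun x => by
    obtain ⟨y, hy⟩ := h (MulAction.stabilizer G x) ⟨x, fun g hg => hg⟩
    exact ⟨y, fun g hg => hy g hg⟩)
  obtain ⟨w⟩ := W.nonempty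
  obtain ⟨M, hM, -, hM2⟩ := (HL_sys W w).orb
  let f : Set W.V → ℕ := fun A => if h : ∃ p : W.V × W.V, W.graph.Adj p.1 p.2 ∧ A = half W.graph p.1 p.2 then
    (hsep T.graph (q h.choose.1) (q h.choose.2)).ncard else 0
  have hf : ∀ {u v : W.V}, W.graph.Adj u v → f (half W.graph u v) = (hsep T.graph (q u) (q v)).ncard := by
    intro u v e
    have hh : ∃ p : W.V × W.V, W.graph.Adj p.1 p.2 ∧ half W.graph u v = half W.graph p.1 p.2 := ⟨(u, v), e, rfl⟩
    show (if h : _ then _ else _) = _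
    rw [dif_pos hh]
    obtain ⟨e1, e2⟩ := half_inj W.isTree e hh.choose_spec.1 hh.choose_spec.2
    rw [← e1, ← e2]
  obtain ⟨N, hN⟩ := (hM.image f).bddAbove
  refine ⟨q, N, hq, ?_⟩
  have hE : ∀ {u v : W.V}, W.graph.Adj u v → (hsep T.graph (q u) (q v)).ncard ≤ N := by
    intro u v e
    obtain ⟨g, hg⟩ := hM2 _ ⟨u, v, e, rfl⟩
    have := hN ⟨_, hg, rfl⟩
    rwa [smul_half, hf ((adj_smul W).2 e), hq, hq, hsep_smul_card] at this
  intro u v p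
  induction p with
  | nil =>
    have : hsep T.graph (q ‹W.V›) (q ‹W.V›) = ∅ := Set.eq_empty_of_forall_notMem fun A hA => hA.2.2 hA.2.1
    simp [this]
  | cons e p ih =>
    refine (hsep_tri T _ (q _) _).trans ((Nat.add_le_add (hE e) ih).trans ?_)
    rw [SimpleGraph.Walk.length_cons]
    linarith

theorem not_seed {x : Lab G} (h : ¬ Seed a b x) : a ∈ x.r ∨ b ∈ x.r ∨ (a ∉ x.l ∧ a ∉ x.r ∧ b ∉ x.l ∧ b ∉ x.r) := by
  unfold Seed at h
  tauto

theorem Stg.bdd [Group.FG G] (X : Stg T₀ D Γ a b) {T : MGTree G} (hT : T ∈ D) (h : mkD T hT ∈ YY D Γ)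
    (W : GTree G) [MulAction Γ W.V] (hW : WA W Γ) (he : W.Elliptic = T₀.toGTree.Elliptic) (w : W.V) :
    ∃ C : ℕ, ∀ γ ∈ MulAction.stabilizer Γ w, (sepo (labO a b) (sp (wtT T)) γ).Finite ∧
      (sepo (labO a b) (sp (wtT T)) γ).ncard ≤ C := by
  obtain ⟨q, N, hq, hN⟩ := lip W T.toGTree (fun K hK => by rw [X.el hT, ← he]; exact hK)
  have hg := X.gp hT
  let E : Set (Lab G) := {ℓ | wtT T ℓ ≠ 0 ∧ a ∉ ℓ.l ∧ a ∉ ℓ.r ∧ b ∉ ℓ.l ∧ b ∉ ℓ.r}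
  have hl : ∀ ℓ, wtT T ℓ ≠ 0 → ∃ H ∈ HL T.graph, qq T.toGTree H = ℓ ∧ ℓ.l = fl G H ∧ ℓ.r = fl G Hᶜ := by
    intro ℓ hℓ
    obtain ⟨H, h1, rfl⟩ := (pushw_ne (goodT T (q w)) (qq_push T hg (q w) fun _ => labO_seed) ℓ).1 hℓ
    have : H ∈ HL T.graph := by rw [← sp_tw]; exact h1
    exact ⟨H, this, rfl, qq_val hg this⟩
  have hE : E.Finite := by
    refine ((CA hg).image (qq T.toGTree)).subset ?_
    rintro ℓ ⟨h1, h2⟩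
    obtain ⟨H, h3, rfl, h4, h5⟩ := hl ℓ h1
    rw [h4, h5] at h2
    exact ⟨H, ⟨h3, h2⟩, rfl⟩
  let S : G → Set (Lab G) := fun g => (qq T.toGTree) '' (hsep T.graph (g • q w) (q w))
  let S' : G → Set (Lab G) := fun g => (fun H => qq T.toGTree Hᶜ) '' (hsep T.graph (g • q w) (q w))
  have hS : ∀ g, (S g).Finite := fun g => (hsep_fin T.isTree _ _).image _
  have hS' : ∀ g, (S' g).Finite := fun g => (hsep_fin T.isTree _ _).image _
  obtain ⟨pa⟩ := W.isTree.connected (a • w) w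
  obtain ⟨pb⟩ := W.isTree.connected (b • w) w
  have len : ∀ γ ∈ MulAction.stabilizer Γ w, ∀ (g : G) (p : W.graph.Walk (g • w) w),
      (S ((γ⁻¹).1 g)).ncard ≤ N * p.length ∧ (S' ((γ⁻¹).1 g)).ncard ≤ N * p.length := by
    intro γ hγ g p
    have hγ' : γ⁻¹ • w = w := by rw [inv_smul_eq_iff]; exact (MulAction.mem_stabilizer_iff.1 hγ).symm
    let F : W.graph →g W.graph := ⟨fun x => γ⁻¹ • x, fun e => hW.adj _ e⟩
    have e1 : F (g • w) = (γ⁻¹).1 g • w := by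
      show γ⁻¹ • (g • w) = _
      rw [← hW.comp, hγ']
    have := hN ((p.map F).copy e1 hγ')
    rw [SimpleGraph.Walk.length_copy, SimpleGraph.Walk.length_map, hq] at this
    exact ⟨(Set.ncard_image_le (hsep_fin T.isTree _ _)).trans this,
      (Set.ncard_image_le (hsep_fin T.isTree _ _)).trans this⟩
  refine ⟨2 * (N * pa.length) + 2 * (N * pb.length) + 2 * E.ncard, fun γ hγ => ?_⟩
  have sub : sepo (labO a b) (sp (wtT T)) γ ⊆
      ((S a ∪ S b) ∪ (S' ((γ⁻¹).1 a) ∪ S' ((γ⁻¹).1 b))) ∪ (E ∪ (fun ℓ => γ⁻¹ • ℓ) '' E) := by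
    rintro ℓ ⟨h1, h2, h3⟩
    obtain ⟨H, h4, h4', h5, h6⟩ := hl ℓ h1
    by_cases hx : q w ∈ H
    · have h7 : ¬ Seed a b (γ • ℓ) := fun h => h3 (labO_seed h)
      have e1 : ∀ g : G, g ∈ (γ • ℓ).r ↔ (γ⁻¹).1 g ∈ ℓ.r := fun g => Iff.rfl
      rcases not_seed h7 with h8 | h8 | h8
      · rw [e1, h6] at h8
        refine Or.inl (Or.inr (Or.inl ⟨Hᶜ, fl_sep _ (HL_compl T.isTree h4) h8 (fun h => h hx), ?_⟩))
        show qq T.toGTree Hᶜᶜ = ℓ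
        rw [compl_compl, h4']
      · rw [e1, h6] at h8
        refine Or.inl (Or.inr (Or.inr ⟨Hᶜ, fl_sep _ (HL_compl T.isTree h4) h8 (fun h => h hx), ?_⟩))
        show qq T.toGTree Hᶜᶜ = ℓ
        rw [compl_compl, h4']
      · refine Or.inr (Or.inr ⟨γ • ℓ, ⟨?_, h8⟩, inv_smul_smul _ _⟩)
        exact fun e => h1 (((X.ginv hT h).inv γ ℓ).symm.trans e)
    · have h7 : ¬ Seed a b ℓᶜ := fun h => ((labO a b).co ℓ).1 (labO_seed h) h2
      have h5' : ℓᶜ.r = fl G H := h5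
      rcases not_seed h7 with h8 | h8 | h8
      · rw [h5'] at h8
        exact Or.inl (Or.inl (Or.inl ⟨H, fl_sep _ h4 h8 hx, h4'⟩))
      · rw [h5'] at h8
        exact Or.inl (Or.inl (Or.inr ⟨H, fl_sep _ h4 h8 hx, h4'⟩))
      · exact Or.inr (Or.inl ⟨h1, h8.2.1, h8.1, h8.2.2.2, h8.2.2.1⟩)
  have fin := (((hS a).union (hS b)).union ((hS' ((γ⁻¹).1 a)).union (hS' ((γ⁻¹).1 b)))).union
    (hE.union (hE.image (fun ℓ => γ⁻¹ • ℓ)))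
  refine ⟨fin.subset sub, (Set.ncard_le_ncard sub fin).trans ?_⟩
  have u1 := Set.ncard_union_le ((S a ∪ S b) ∪ (S' ((γ⁻¹).1 a) ∪ S' ((γ⁻¹).1 b))) (E ∪ (fun ℓ => γ⁻¹ • ℓ) '' E)
  have u2 := Set.ncard_union_le (S a ∪ S b) (S' ((γ⁻¹).1 a) ∪ S' ((γ⁻¹).1 b))
  have u3 := Set.ncard_union_le (S a) (S b)
  have u4 := Set.ncard_union_le (S' ((γ⁻¹).1 a)) (S' ((γ⁻¹).1 b))
  have u5 := Set.ncard_union_le E ((fun ℓ => γ⁻¹ • ℓ) '' E)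
  have u6 := Set.ncard_image_le (f := fun ℓ => γ⁻¹ • ℓ) hE
  have v1 := (len 1 (one_mem _) a pa).1
  have v2 := (len 1 (one_mem _) b pb).1
  have v3 := (len γ hγ a pa).2
  have v4 := (len γ hγ b pb).2
  have w1 : ((1 : Γ)⁻¹).1 a = a := by simp
  have w2 : ((1 : Γ)⁻¹).1 b = b := by simp
  rw [w1] at v1
  rw [w2] at v2
  omega

end I1

section I2a
variable {Λ W P : Type u} [Group Λ] [MulAction Λ W] [Poc P] [PocAct Λ P]

/-- orbit representative -/
noncomputable def rp (Λ : Type u) {W : Type u} [Group Λ] [MulAction Λ W] (w : W) : W :=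
  Quotient.out (s := MulAction.orbitRel Λ W) (Quotient.mk _ w)

theorem rp_ex (w : W) : ∃ g : Λ, g • rp Λ w = w := by
  have := Quotient.mk_out (s := MulAction.orbitRel Λ W) w
  obtain ⟨g, hg⟩ := (MulAction.orbitRel_apply.1 this)
  refine ⟨g⁻¹, ?_⟩
  unfold rp
  rw [← hg]; simp

theorem rp_smul (g : Λ) (w : W) : rp Λ (g • w) = rp Λ w := by
  unfold rp
  rw [show (Quotient.mk (MulAction.orbitRel Λ W) (g • w)) = Quotient.mk (MulAction.orbitRel Λ W) w from
    Quotient.sound (MulAction.orbitRel_apply.2 ⟨g, rfl⟩)]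

/-- transporter to the representative -/
noncomputable def rg (Λ : Type u) {W : Type u} [Group Λ] [MulAction Λ W] (w : W) : Λ := (rp_ex (Λ := Λ) w).choose

theorem rg_spec (w : W) : rg Λ w • rp Λ w = w := (rp_ex (Λ := Λ) w).choose_spec

/-- canonical vertex associated with w -/
def sW (Λ : Type u) {W P : Type u} [Group Λ] [MulAction Λ W] [Poc P] [PocAct Λ P] (o : Pt P) (w : W) : Set P :=
  {h | ctr (MulAction.stabilizer Λ (rp Λ w)) o.m ((rg Λ w)⁻¹ • h)}

theorem sW_smul {o : Pt P} (γ : Λ) (w : W) (h : P) : γ • h ∈ sW Λ o (γ • w) ↔ h ∈ sW Λ o w := by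
  show ctr _ _ _ ↔ ctr _ _ _
  rw [rp_smul]
  have : (rg Λ (γ • w))⁻¹ • γ • h = ((rg Λ (γ • w))⁻¹ * γ * rg Λ w) • ((rg Λ w)⁻¹ • h) := by
    simp [mul_smul]
  rw [this]
  refine ctr_inv ?_
  rw [MulAction.mem_stabilizer_iff, mul_smul, mul_smul, rg_spec, inv_smul_eq_iff]
  have := rg_spec (Λ := Λ) (γ • w)
  rw [rp_smul] at this
  exact this.symm

theorem sW_vtx {o : Pt P} {L : Set P} (S : Sys Λ o L) (ni : ∀ (k : Λ) {h : P}, h ∈ L → k • h ≠ hᶜ) (w : W)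
    (hb : ∀ w : W, ∃ C : ℕ, ∀ k ∈ MulAction.stabilizer Λ w, (sepo o L k).ncard ≤ C) :
    IsVtx o L {h ∈ L | h ∈ sW Λ o w} := by
  have CH : CtrH (MulAction.stabilizer Λ (rp Λ w)) o L :=
    { compl := fun hh => S.compl hh
      smul := fun k _ _ hh => S.smul k hh
      nested := fun a b => S.nested a b
      nle := fun hh e => S.not_le_compl hh e
      noinv := fun k _ _ hh => ni k hh
      nlt := by
        intro k hk h hh e
        obtain ⟨C, hC⟩ := hb (rp Λ w)
        obtain ⟨n, hn⟩ := orbit_unb S hh e C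
        exact absurd (hC (k ^ n) (pow_mem hk n)) (not_le.2 hn)
      bdd := by
        obtain ⟨C, hC⟩ := hb (rp Λ w)
        exact ⟨C, fun k hk => ⟨S.fin k, hC k hk⟩⟩ }
  have := sv_vtx S (rg Λ w) (ctr_vtx CH)
  convert this using 1
  ext h
  rw [mem_sv]
  constructor
  · rintro ⟨h1, h2⟩; exact ⟨S.smul _ h1, h2⟩
  · rintro ⟨h1, h2⟩
    refine ⟨?_, h2⟩
    have := S.smul (rg Λ w) h1
    rwa [smul_inv_smul] at this

/-- the cut of h -/
def kW (Λ : Type u) {W P : Type u} [Group Λ] [MulAction Λ W] [Poc P] [PocAct Λ P] (o : Pt P) (h : P) : Set W :=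
  {w | h ∈ sW Λ o w}

theorem kW_smul {o : Pt P} (γ : Λ) (h : P) : kW (W := W) Λ o (γ • h) = γ • kW (W := W) Λ o h := by
  ext w
  rw [mem_sact]
  show γ • h ∈ sW Λ o w ↔ h ∈ sW Λ o (γ⁻¹ • w)
  rw [← sW_smul γ (γ⁻¹ • w) h, smul_inv_smul]

theorem vtx_hit {o : Pt P} {L v : Set P} (S : Sys Λ o L) (hv : IsVtx o L v) {h : P} (hh : h ∈ L) (he : Ess Λ h) :
    ∃ g : Λ, g • h ∉ v := by
  obtain ⟨g, hg⟩ := he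
  by_contra hcon
  push Not at hcon
  obtain ⟨n, hn⟩ := chain_out S hh hg
  refine chain_inf (h := g ^ n • h) (g := g) ?_ hv.fin fun m => ?_
  · rw [← mul_smul, ← pow_succ', pow_succ, mul_smul, smul_lt_iff']; exact hg
  · refine ⟨?_, ?_⟩
    · rw [← mul_smul]; exact hcon _
    · intro hm
      refine hn (o.up ?_ hm)
      have : ∀ m : ℕ, g ^ m • (g ^ n • h) ≤ g ^ n • h := by
        intro m
        induction m with
        | zero => simp
        | succ m ih =>
          refine le_trans ?_ ih
          rw [pow_succ, mul_smul, smul_le_iff', ← mul_smul, ← pow_succ', pow_succ, mul_smul, smul_le_iff']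
          exact hg.le
      exact this m

end I2a

section I2
variable {G : Type u} [Group G] {T₀ : MGTree G} {D : Set (MGTree G)} {Γ : Subgroup (MulAut G)} {a b : G}

theorem hyp_pow [Group.FG G] {T : MGTree G} {g : G} (hg : T.toGTree.Hyperbolic g) {n : ℕ} (hn : 0 < n) : T.toGTree.Hyperbolic (g ^ n) := by
  intro v hv
  have hv : g ^ n • v = v := hv
  have hfin : (Set.range fun k : ℤ => g ^ k • v).Finite := by
    refine ((Set.finite_Ico (0 : ℤ) n).image (fun k : ℤ => g ^ k • v)).subset ?_
    rintro _ ⟨k, rfl⟩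
    refine ⟨k % n, ⟨Int.emod_nonneg _ (by omega), Int.emod_lt_of_pos _ (by omega)⟩, ?_⟩
    show g ^ (k % n) • v = g ^ k • v
    conv_rhs => rw [← Int.emod_add_mul_ediv k n, zpow_add, zpow_mul, mul_smul]
    have : ∀ j : ℤ, (g ^ (n : ℤ)) ^ j • v = v := by
      intro j
      have h1 : g ^ (n : ℤ) ∈ MulAction.stabilizer G v := by rw [zpow_natCast]; exact hv
      exact zpow_mem h1 j
    rw [this]
  let f : T.V → ℝ := fun y => ∑ᶠ h ∈ hsep T.graph v y, tw T h
  obtain ⟨C, hC⟩ := (hfin.image f).bddAbove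
  obtain ⟨y, hy⟩ := (goodT T v).E2 (Subgroup.zpowers g) ⟨C, by
    rintro k ⟨j, rfl⟩
    rw [sp_tw, sepo_hsep]
    exact hC ⟨_, ⟨-j, rfl⟩, by show f (g ^ (-j) • v) = f ((g ^ j)⁻¹ • v); rw [zpow_neg]⟩⟩
  exact hg y (hy g (Subgroup.mem_zpowers g))

theorem fin_pow {P : Type u} [MulAction G P] {s : Set P} (hs : s.Finite) {g : G} {h : P} (hh : ∀ n : ℕ, g ^ n • h ∈ s) :
    ∃ n : ℕ, 0 < n ∧ g ^ n • h = h := by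
  obtain ⟨i, -, j, -, hij, e⟩ := Set.infinite_univ.exists_ne_map_eq_of_mapsTo (f := fun n : ℕ => g ^ n • h) (fun n _ => hh n) hs
  have key : ∀ {i j : ℕ}, i < j → g ^ i • h = g ^ j • h → ∃ n : ℕ, 0 < n ∧ g ^ n • h = h := by
    intro i j hij e
    refine ⟨j - i, by omega, ?_⟩
    have : j = i + (j - i) := by omega
    rw [this, pow_add, mul_smul] at e
    exact (MulAction.injective _ e).symm
  rcases lt_or_gt_of_ne hij with h1 | h1
  · exact key h1 e
  · exact key h1 e.symm

theorem wtT_nofix [Group.FG G] {T : MGTree G} (hp : GoodPair T.toGTree a b) {g : G} (hg : T.toGTree.Hyperbolic g)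
    {ℓ : Lab G} (hℓ : wtT T ℓ ≠ 0) : g • ℓ ≠ ℓ := by
  intro e
  obtain ⟨x⟩ := T.nonempty
  have Q := qq_push T hp x (o := labO a b) fun _ => labO_seed
  obtain ⟨H, h1, rfl⟩ := (pushw_ne (goodT T x) Q ℓ).1 hℓ
  have hw : ∀ k : G, tw T (k • H) ≠ 0 := fun k => by rw [tw_smul]; exact h1
  have he : ∀ n : ℕ, g ^ n • qq T.toGTree H = qq T.toGTree H := by
    intro n
    induction n with
    | zero => simp
    | succ n ih => rw [pow_succ, mul_smul, e, ih]
  obtain ⟨n, hn, hH⟩ := fin_pow (g := g) (h := H) (Q.fib (qq T.toGTree H)) (fun n => ⟨hw _, by rw [Q.smul _ h1, he]⟩)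
  refine HL_fix T.toGTree (hyp_pow hg hn) ?_ hH
  rw [← sp_tw]; exact h1

theorem wtT_ess [Group.FG G] {T : MGTree G} (hp : GoodPair T.toGTree a b) {ℓ : Lab G} (hℓ : wtT T ℓ ≠ 0) : Ess G ℓ := by
  obtain ⟨x⟩ := T.nonempty
  have Q := qq_push T hp x (o := labO a b) fun _ => labO_seed
  obtain ⟨H, h1, rfl⟩ := (pushw_ne (goodT T x) Q ℓ).1 hℓ
  obtain ⟨g, hg⟩ := Q.ess h1
  have hw : ∀ k : G, tw T (k • H) ≠ 0 := fun k => by rw [tw_smul]; exact h1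
  have hH : H ∈ HL T.graph := by rw [← sp_tw]; exact h1
  refine ⟨g, ?_⟩
  rw [← Q.smul g h1]
  refine lt_of_le_of_ne (Q.mono (hw g) h1 hg.le) ?_
  rw [Q.smul g h1]
  exact wtT_nofix hp (hyp_of_lt hH hg) hℓ

/-- doubled weights of T on labels -/
noncomputable abbrev w2 (T : MGTree G) : Dbl (Lab G) → ℝ := dblw (wtT T)

theorem Stg.w2good [Group.FG G] (X : Stg T₀ D Γ a b) {T : MGTree G} (hT : T ∈ D) :
    Good T₀.toGTree.Elliptic (dblO (labO a b)) (w2 T) := dbl_good (X.good hT)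

theorem Stg.w2ess [Group.FG G] (X : Stg T₀ D Γ a b) {T : MGTree G} (hT : T ∈ D) {x : Dbl (Lab G)} (hx : w2 T x ≠ 0) :
    Ess G x := dbl_ess (wtT_ess (X.gp hT) (dblw_ne.1 hx))

theorem Stg.ep2 [Group.FG G] (X : Stg T₀ D Γ a b) {T : MGTree G} (hT : T ∈ D) : ep G (w2 T) = sp (w2 T) := by
  ext x; exact ⟨fun h => h.1, fun h => ⟨h, X.w2ess hT h⟩⟩

theorem Stg.w2sys [Group.FG G] (X : Stg T₀ D Γ a b) {T : MGTree G} (hT : T ∈ D) (h : mkD T hT ∈ YY D Γ) :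
    Sys Γ (dblO (labO a b)) (sp (w2 T)) := by
  have := (dbl_ginv (X.ginv hT h)).sys (X.w2good hT)
  rwa [X.ep2 hT] at this

/-- the cut map -/
abbrev kk (a b : G) (Γ : Subgroup (MulAut G)) (W : GTree G) [MulAction Γ W.V] (x : Dbl (Lab G)) : Set W.V :=
  kW Γ (dblO (labO a b)) x

theorem Stg.svtx [Group.FG G] (X : Stg T₀ D Γ a b) {T : MGTree G} (hT : T ∈ D) (h : mkD T hT ∈ YY D Γ)
    (W : GTree G) [MulAction Γ W.V] (hW : WA W Γ) (he : W.Elliptic = T₀.toGTree.Elliptic) (w : W.V) :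
    IsVtx (dblO (labO a b)) (sp (w2 T)) {x ∈ sp (w2 T) | w ∈ kk a b Γ W x} := by
  refine sW_vtx (X.w2sys hT h) (fun k x _ => dbl_noinv k x) w fun w => ?_
  obtain ⟨C, hC⟩ := X.bdd hT h W hW he w
  refine ⟨2 * C, fun k hk => ?_⟩
  have e : sepo (dblO (labO a b)) (sp (w2 T)) k = {x : Dbl (Lab G) | x.lab ∈ sepo (labO a b) (sp (wtT T)) k} := dbl_sepo k
  rw [e]
  have := dbl_card (hC k hk).1
  have h2 := (hC k hk).2
  omega

theorem Stg.kpush [Group.FG G] (X : Stg T₀ D Γ a b) {T : MGTree G} (hT : T ∈ D) (h : mkD T hT ∈ YY D Γ)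
    (W : GTree G) [MulAction Γ W.V] (hW : WA W Γ) (he : W.Elliptic = T₀.toGTree.Elliptic) (w0 : W.V) :
    PushH G (ppt w0) (dblO (labO a b)) (w2 T) (kk a b Γ W) := by
  have hv := X.svtx hT h W hW he
  have HG := X.w2good hT
  have mono : ∀ {h k}, w2 T h ≠ 0 → w2 T k ≠ 0 → h ≤ k → kk a b Γ W h ≤ kk a b Γ W k := by
    intro x y hx hy hxy w hw
    exact ((hv w).up (h := x) ⟨hx, hw⟩ hy hxy).2
  have cmpl : ∀ {h}, w2 T h ≠ 0 → kk a b Γ W hᶜ = (kk a b Γ W h)ᶜ := by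
    intro x hx
    ext w
    have := (hv w).tot (h := x) hx
    have hx' : w2 T xᶜ ≠ 0 := by rw [HG.wc]; exact hx
    constructor
    · intro h1 h2; exact (this.1 ⟨hx', h1⟩) ⟨hx, h2⟩
    · intro h1; exact (this.2 fun h2 => h1 h2.2).2
  have smul : ∀ (g : G) {h}, w2 T h ≠ 0 → kk a b Γ W (g • h) = g • kk a b Γ W h := by
    intro g x _
    obtain ⟨γ, h1, h2⟩ := hW.conj g
    have e1 : g • x = γ • x := by
      refine Dbl.ext ?_ rfl
      show g • x.lab = γ.1 • x.lab
      rw [h1]; rfl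
    have e2 : g • kk a b Γ W x = γ • kk a b Γ W x := by
      ext w
      rw [mem_sact, mem_sact]
      have : g⁻¹ • w = γ⁻¹ • w := by rw [inv_smul_eq_iff, ← h2, smul_inv_smul]
      rw [this]
    rw [e1, e2]; exact kW_smul γ x
  have ne : ∀ {x}, w2 T x ≠ 0 → ∃ w, w ∉ kk a b Γ W x := by
    intro x hx
    obtain ⟨g, hg⟩ := vtx_hit HG.sys (hv w0) hx (X.w2ess hT hx)
    refine ⟨g⁻¹ • w0, fun hw => hg ⟨by show w2 T _ ≠ 0; rw [HG.wg]; exact hx, ?_⟩⟩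
    rw [smul g hx, mem_sact]; exact hw
  have fib : ∀ A, {h | w2 T h ≠ 0 ∧ kk a b Γ W h = A}.Finite := by
    intro A
    by_cases hne : ∃ x, w2 T x ≠ 0 ∧ kk a b Γ W x = A
    swap
    · refine Set.Finite.subset Set.finite_empty fun x hx => hne ⟨x, hx⟩
    obtain ⟨x, hx, rfl⟩ := hne
    obtain ⟨w, hw⟩ := ne hx
    obtain ⟨w', hw'⟩ := ne (x := xᶜ) (by rw [HG.wc]; exact hx)
    rw [cmpl hx, Set.notMem_compl_iff] at hw'
    refine ((hv w').dfin (hv w)).subset ?_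
    rintro y ⟨h1, h2⟩
    exact ⟨⟨h1, by rw [h2]; exact hw'⟩, fun h3 => hw (by rw [← h2]; exact h3.2)⟩
  refine ⟨mono, cmpl, smul, fib, ?_, ?_, fun hx => X.w2ess hT hx⟩
  · intro g x hx e
    by_cases hy : T.toGTree.Hyperbolic g
    · have h2 : (g ^ 2) • kk a b Γ W x = kk a b Γ W x := by
        rw [pow_two, mul_smul, e, PocAct.scompl, e]; exact compl_compl _
      have hw : ∀ k : G, w2 T (k • x) ≠ 0 := fun k => by rw [HG.wg]; exact hx
      have h3 : ∀ n : ℕ, (g ^ 2) ^ n • kk a b Γ W x = kk a b Γ W x := by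
        intro n
        induction n with
        | zero => simp
        | succ n ih => rw [pow_succ, mul_smul, h2, ih]
      obtain ⟨n, hn, hH⟩ := fin_pow (g := g ^ 2) (h := x) (fib (kk a b Γ W x)) (fun n => ⟨hw _, by rw [smul _ hx, h3]⟩)
      refine wtT_nofix (X.gp hT) (g := g ^ (2 * n)) (hyp_pow hy (by omega)) (dblw_ne.1 hx) ?_
      rw [pow_mul]
      exact congrArg Dbl.lab hH
    · have : ∃ v, T.toGTree.act g v = v := by
        by_contra hcon; push Not at hcon; exact hy hcon
      obtain ⟨v, hv⟩ := this
      have h1 : T.toGTree.Elliptic (Subgroup.zpowers g) := ⟨v, fun k hk => by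
        have : Subgroup.zpowers g ≤ MulAction.stabilizer G v := by rw [Subgroup.zpowers_le]; exact hv
        exact this hk⟩
      rw [X.el hT, ← he] at h1
      obtain ⟨w, hw⟩ := h1
      have hw : g • w = w := hw g (Subgroup.mem_zpowers g)
      have h2 : w ∈ g • kk a b Γ W x ↔ w ∈ kk a b Γ W x := by
        conv_lhs => rw [← hw]
        exact smul_mem_sact
      rw [e] at h2
      by_cases hx : w ∈ kk a b Γ W x
      · exact h2.2 hx hx
      · exact hx (h2.1 hx)
  · refine ((hv w0).dfin (base_vtx HG.sys)).union ((base_vtx HG.sys).dfin (hv w0)) |>.subset ?_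
    rintro x ⟨h1, h2⟩
    rw [mem_ppt] at h2
    by_cases hx : x ∈ (dblO (labO a b)).m
    · right; exact ⟨⟨hx, h1⟩, fun h3 => h2 ⟨fun _ => h3.2, fun _ => hx⟩⟩
    · left
      refine ⟨⟨h1, ?_⟩, fun h3 => hx h3.1⟩
      by_contra hn; exact h2 ⟨fun h => absurd h hx, fun h => absurd h hn⟩

/-- pushed weights on cuts of W -/
noncomputable def lam (a b : G) (Γ : Subgroup (MulAut G)) (W : GTree G) [MulAction Γ W.V] (T : MGTree G) : Set W.V → ℝ :=
  pushw (w2 T) (kk a b Γ W)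

theorem Stg.lgood [Group.FG G] (X : Stg T₀ D Γ a b) {T : MGTree G} (hT : T ∈ D) (h : mkD T hT ∈ YY D Γ)
    (W : GTree G) [MulAction Γ W.V] (hW : WA W Γ) (he : W.Elliptic = T₀.toGTree.Elliptic) (w0 : W.V) :
    Good T₀.toGTree.Elliptic (ppt w0) (lam a b Γ W T) :=
  push_good (X.w2good hT) (X.kpush hT h W hW he w0)

theorem Stg.c3_spec [Group.FG G] (X : Stg T₀ D Γ a b) {T : MGTree G} (hT : T ∈ D) (h : mkD T hT ∈ YY D Γ)
    (W : GTree G) [MulAction Γ W.V] (hW : WA W Γ) (he : W.Elliptic = T₀.toGTree.Elliptic) (w0 : W.V) :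
    mkD (Skora.rho (X.w2good hT)) (X.rho _) ⤳ mkD (Skora.rho (X.lgood hT h W hW he w0)) (X.rho _) := by
  have Q := X.kpush hT h W hW he w0
  have HG := X.w2good hT
  obtain ⟨o', ho'⟩ := pt_ext (P := Dbl (Lab G)) (fun x e => by
    have := congrArg Dbl.b e
    rw [dbl_cb] at this
    revert this; cases x.b <;> simp) (s := {x | w2 T x ≠ 0 ∧ w0 ∈ kk a b Γ W x}) (by
      rintro H ⟨h1, h2⟩ K ⟨k1, k2⟩ e
      have k3 : w2 T Kᶜ ≠ 0 := by rw [HG.wc]; exact k1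
      have := Q.mono h1 k3 e h2
      rw [Q.compl k1] at this
      exact this k2)
  have hb : ∀ x, w2 T x ≠ 0 → (x ∈ o'.m ↔ w0 ∈ kk a b Γ W x) := by
    intro x hx
    refine ⟨fun h => ?_, fun h => ho' ⟨hx, h⟩⟩
    by_contra hn
    have := ho' (a := xᶜ) ⟨by rw [HG.wc]; exact hx, by rw [Q.compl hx]; exact hn⟩
    exact (o'.co x).1 this h
  have hd : {h | w2 T h ≠ 0 ∧ ¬ (h ∈ (dblO (labO a b)).m ↔ h ∈ o'.m)}.Finite := by
    refine Q.diff.subset ?_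
    rintro h ⟨h1, h2⟩
    exact ⟨h1, by rw [mem_ppt, ← hb h h1]; exact h2⟩
  have G1 : Good T₀.toGTree.Elliptic o' (w2 T) := base_good HG hd fun hh => Q.ess hh
  have i2 := base_iso HG G1 hd
  have i3 : Inseparable (mkD (Skora.rho HG) (X.rho HG)) (mkD (Skora.rho G1) (X.rho G1)) := iso_insep i2
  refine i3.specializes.trans ?_
  haveI : Nonempty (Dbl (Lab G)) := ⟨⟨⟨{1}, ∅, Set.singleton_ne_empty _⟩, true⟩⟩
  refine Proj.spec (p := kk a b Γ W) (X.lgood hT h W hW he w0) G1 ?_ _ _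
  exact ⟨Q.mono, Q.compl, Q.smul, fun {x} hx => hb x hx, fun A => rfl⟩

theorem pushk_inv {Λ W P : Type u} [Group Λ] [MulAction Λ W] [Poc P] [PocAct Λ P] {o : Pt P} {wt : P → ℝ}
    (hi : ∀ (γ : Λ) x, wt (γ • x) = wt x) (γ : Λ) (A : Set W) :
    pushw wt (kW (W := W) Λ o) (γ • A) = pushw wt (kW (W := W) Λ o) A := by
  unfold pushw
  have e : {x : P | wt x ≠ 0 ∧ kW Λ o x = γ • A} = (fun x => γ • x) '' {x | wt x ≠ 0 ∧ kW Λ o x = A} := by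
    ext x
    constructor
    · rintro ⟨h1, h2⟩
      refine ⟨γ⁻¹ • x, ⟨by rw [hi]; exact h1, ?_⟩, smul_inv_smul _ _⟩
      rw [kW_smul, inv_smul_eq_iff]; exact h2
    · rintro ⟨y, ⟨h1, h2⟩, rfl⟩
      refine ⟨by show wt (γ • y) ≠ 0; rw [hi]; exact h1, ?_⟩
      show kW Λ o (γ • y) = _
      rw [kW_smul, h2]
  rw [e, finsum_mem_image (Function.Injective.injOn (MulAction.injective γ))]
  exact finsum_mem_congr rfl fun x _ => hi γ x

theorem Stg.linv [Group.FG G] (X : Stg T₀ D Γ a b) {T : MGTree G} (hT : T ∈ D) (h : mkD T hT ∈ YY D Γ)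
    (W : GTree G) [MulAction Γ W.V] (γ : Γ) (A : Set W.V) : lam a b Γ W T (γ • A) = lam a b Γ W T A :=
  pushk_inv (dbl_ginv (X.ginv hT h)).inv γ A

end I2

section J1
variable {V : Type u} {Γ : SimpleGraph V}

/-- a folded piece A of the cut H, with active region N -/
structure Fw (Γ : SimpleGraph V) (H B A N : Set V) : Prop where
  con : ∀ x ∈ N, ∀ y ∈ N, ∃ p : Γ.Walk x y, p.IsPath ∧ ∀ z ∈ p.support, z ∈ N
  eqv : ∀ x ∈ N, (x ∈ A ↔ x ∈ H)
  out : ∀ {x y}, x ∈ N → y ∉ N → Γ.Adj x y → x ∉ B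
  leaf : ∀ {x y y'}, x ∈ N → x ∉ B → y ∈ N → y' ∈ N → Γ.Adj x y → Γ.Adj x y' → y = y'
  cross : ∀ {x y}, Γ.Adj x y → x ∈ A → y ∉ A → x ∈ N ∧ y ∈ N
  ne : ∃ u v, Γ.Adj u v ∧ u ∈ N ∧ v ∈ N ∧ u ∈ H ∧ v ∉ H

variable {H B A N H' B' A' N' : Set V}

theorem Fw.compl (F : Fw Γ H B A N) : Fw Γ Hᶜ B Aᶜ N where
  con := F.con
  eqv x hx := not_congr (F.eqv x hx)
  out := F.out
  leaf := F.leaf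
  cross := by
    intro x y a h1 h2
    rw [Set.notMem_compl_iff] at h2
    exact (F.cross a.symm h2 h1).symm
  ne := by
    obtain ⟨u, v, a, h1, h2, h3, h4⟩ := F.ne
    exact ⟨v, u, a.symm, h2, h1, h4, fun h => h h3⟩

theorem Fw.lemX (F : Fw Γ H B A N) (F' : Fw Γ H' B' A' N') (hc : ∀ z ∈ H', z ∈ B → z ∈ B') {x y : V}
    (p : Γ.Walk x y) (hp : p.IsPath) (hs : ∀ z ∈ p.support, z ∈ N) (h1 : x ∈ A') (h2 : x ∉ N') : y ∈ A' := by
  induction p with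
  | nil => exact h1
  | @cons x z y a p ih =>
    have hz : z ∈ A' := by
      by_contra hz; exact h2 (F'.cross a h1 hz).1
    rw [SimpleGraph.Walk.cons_isPath_iff] at hp
    have hs' : ∀ t ∈ p.support, t ∈ N := fun t ht => hs t (by rw [SimpleGraph.Walk.support_cons]; exact List.mem_cons_of_mem _ ht)
    by_cases hz' : z ∈ N'
    · have hb : z ∉ B := fun hb => F'.out hz' h2 a.symm (hc z ((F'.eqv z hz').1 hz) hb)
      cases p with
      | nil => exact hz
      | @cons _ t _ b p =>
        exfalso
        have := F.leaf (hs' z (by simp)) hb (hs x (by simp)) (hs' t (by simp)) a.symm b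
        exact hp.2 (by rw [this]; simp)
    · exact ih hp.1 hs' hz hz'

theorem Fw.lemX' (F : Fw Γ H B A N) (F' : Fw Γ H' B' A' N') (hc : ∀ z ∈ H', z ∈ B → z ∈ B') {x : V}
    (hx : x ∈ N) (h1 : x ∉ H') (h2 : x ∈ A') : N ⊆ A' := by
  intro y hy
  obtain ⟨p, hp, hs⟩ := F.con x hx y hy
  exact F.lemX F' hc p hp hs h2 fun h => h1 ((F'.eqv x h).1 h2)

theorem Fw.nested (ht : Γ.IsTree) (F : Fw Γ H B A N) (F' : Fw Γ H' B' A' N') (hd : H ⊆ H'ᶜ)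
    (hc : ∀ z ∈ H', z ∈ B → z ∈ B') (hc' : ∀ z ∈ H, z ∈ B' → z ∈ B) :
    A ⊆ A' ∨ A' ⊆ A ∨ A ⊆ A'ᶜ ∨ Aᶜ ⊆ A' := by
  obtain ⟨u, v, -, hu, -, hu', -⟩ := F.ne
  obtain ⟨u', v', -, hv, -, hv', -⟩ := F'.ne
  have X1 : (∃ x ∈ N, x ∈ H ∧ x ∈ A') → N ⊆ A' := fun ⟨x, h1, h2, h3⟩ => F.lemX' F' hc h1 (hd h2) h3
  have X2 : (∃ x ∈ N', x ∈ H' ∧ x ∈ A) → N' ⊆ A := fun ⟨x, h1, h2, h3⟩ =>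
    F'.lemX' F hc' h1 (fun h => hd h h2) h3
  have walk : ∀ (S : Set V) (x y : V), x ∈ S → y ∉ S → ∃ p q, Γ.Adj p q ∧ p ∈ S ∧ q ∉ S := by
    intro S x y hx hy
    obtain ⟨p⟩ := ht.connected x y
    obtain ⟨d, -, h2, h3⟩ := walk_exit p hx hy
    exact ⟨_, _, d.adj, h2, h3⟩
  by_cases c1 : ∃ x ∈ N, x ∈ H ∧ x ∈ A' <;> by_cases c2 : ∃ x ∈ N', x ∈ H' ∧ x ∈ A
  · right; right; right
    intro w hw
    by_contra hw'
    obtain ⟨p, q, a, ⟨h1, h2⟩, h3⟩ := walk (Aᶜ ∩ A'ᶜ) w u ⟨hw, hw'⟩ (fun h => h.2 (X1 c1 hu))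
    by_cases hq : q ∈ A
    · exact h2 (X1 c1 (F.cross a.symm hq h1).2)
    · have hq' : q ∈ A' := by
        by_contra h; exact h3 ⟨hq, h⟩
      exact h1 (X2 c2 (F'.cross a.symm hq' h2).2)
  · left
    intro w hw
    by_contra hw'
    have : u' ∉ A := fun h => c2 ⟨u', hv, hv', h⟩
    obtain ⟨p, q, a, ⟨h1, h2⟩, h3⟩ := walk (A ∩ A'ᶜ) w u' ⟨hw, hw'⟩ (fun h => this h.1)
    by_cases hq : q ∈ A
    · have hq' : q ∈ A' := by
        by_contra h; exact h3 ⟨hq, h⟩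
      have h4 := (F'.cross a.symm hq' h2).1
      exact c2 ⟨q, h4, (F'.eqv q h4).1 hq', hq⟩
    · exact h2 (X1 c1 (F.cross a h1 hq).1)
  · right; left
    intro w hw
    by_contra hw'
    have : u ∉ A' := fun h => c1 ⟨u, hu, hu', h⟩
    obtain ⟨p, q, a, ⟨h1, h2⟩, h3⟩ := walk (A' ∩ Aᶜ) w u ⟨hw, hw'⟩ (fun h => this h.1)
    by_cases hq : q ∈ A'
    · have hq' : q ∈ A := by
        by_contra h; exact h3 ⟨hq, h⟩
      have h4 := (F.cross a.symm hq' h2).1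
      exact c1 ⟨q, h4, (F.eqv q h4).1 hq', hq⟩
    · exact h2 (X2 c2 (F'.cross a h1 hq).1)
  · right; right; left
    intro w hw hw'
    have : u ∉ A' := fun h => c1 ⟨u, hu, hu', h⟩
    obtain ⟨p, q, a, ⟨h1, h2⟩, h3⟩ := walk (A ∩ A') w u ⟨hw, hw'⟩ (fun h => this h.2)
    by_cases hq : q ∈ A
    · have hq' : q ∉ A' := fun h => h3 ⟨hq, h⟩
      have h4 := (F'.cross a h2 hq').1
      exact c2 ⟨p, h4, (F'.eqv p h4).1 h2, h1⟩
    · have h4 := (F.cross a h1 hq).1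
      exact c1 ⟨p, h4, (F.eqv p h4).1 h1, h2⟩

theorem Fw.detN (F : Fw Γ H B A N) (F' : Fw Γ H B A' N') {x x' w : V} (p : Γ.Walk x w) (hp : p.IsPath)
    (hs : ∀ z ∈ p.support, z ∈ N) (h1 : x ∈ N') (h2 : x' ∈ N) (a : Γ.Adj x x') (h3 : x' ∉ p.support) : w ∈ N' := by
  induction p generalizing x' with
  | nil => exact h1
  | @cons x z y b p ih =>
    rw [SimpleGraph.Walk.cons_isPath_iff] at hp
    have hs' : ∀ t ∈ p.support, t ∈ N := fun t ht => hs t (by rw [SimpleGraph.Walk.support_cons]; exact List.mem_cons_of_mem _ ht)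
    have hx : x ∈ N := hs x (by simp)
    have hz : z ∈ N' := by
      by_contra hz
      have := F.leaf hx (F'.out h1 hz b) h2 (hs' z (by simp)) a b
      exact h3 (by rw [this]; simp)
    exact ih hp.1 hs' hz hx b.symm hp.2

theorem Fw.sub (F : Fw Γ H B A N) (F' : Fw Γ H B A' N') {u v : V} (a : Γ.Adj u v) (h1 : u ∈ N) (h2 : v ∈ N)
    (h3 : u ∈ N') (h4 : v ∈ N') : N ⊆ N' := by
  intro w hw
  obtain ⟨p, hp, hs⟩ := F.con u h1 w hw
  cases p with
  | nil => exact h3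
  | @cons _ z _ b p =>
    rw [SimpleGraph.Walk.cons_isPath_iff] at hp
    have hs' : ∀ t ∈ p.support, t ∈ N := fun t ht => hs t (by rw [SimpleGraph.Walk.support_cons]; exact List.mem_cons_of_mem _ ht)
    have hz : z ∈ N' := by
      by_contra hz
      have := F.leaf h1 (F'.out h3 hz b) h2 (hs' z (by simp)) a b
      exact hz (this ▸ h4)
    exact F.detN F' p hp.1 hs' hz h1 b.symm hp.2

theorem cut_ext (hcn : Γ.Connected) {n : V} (hn : n ∈ N) (h1 : ∀ x ∈ N, (x ∈ A ↔ x ∈ A'))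
    (h2 : ∀ {x y}, Γ.Adj x y → x ∈ A → y ∉ A → x ∈ N ∧ y ∈ N)
    (h3 : ∀ {x y}, Γ.Adj x y → x ∈ A' → y ∉ A' → x ∈ N ∧ y ∈ N) : A = A' := by
  ext w
  obtain ⟨p⟩ := hcn w n
  induction p with
  | nil => exact h1 _ hn
  | @cons x z y a p ih =>
    have ih := ih hn
    by_cases hN : x ∈ N
    · exact h1 _ hN
    · have e1 : x ∈ A ↔ z ∈ A := by
        constructor
        · intro h; by_contra h'; exact hN (h2 a h h').1
        · intro h; by_contra h'; exact hN (h2 a.symm h h').2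
      have e2 : x ∈ A' ↔ z ∈ A' := by
        constructor
        · intro h; by_contra h'; exact hN (h3 a h h').1
        · intro h; by_contra h'; exact hN (h3 a.symm h h').2
      rw [e1, e2, ih]

theorem Fw.det (ht : Γ.IsTree) (F : Fw Γ H B A N) (F' : Fw Γ H B A' N') {u v : V} (a : Γ.Adj u v) (h1 : u ∈ N)
    (h2 : v ∈ N) (h3 : u ∈ N') (h4 : v ∈ N') : A = A' := by
  have e : N = N' := (F.sub F' a h1 h2 h3 h4).antisymm (F'.sub F a h3 h4 h1 h2)
  subst e
  exact cut_ext ht.connected h1 (fun x hx => (F.eqv x hx).trans (F'.eqv x hx).symm) F.cross F'.cross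

inductive NN (Γ : SimpleGraph V) (B : Set V) (u v : V) : V → Prop
  | left : NN Γ B u v u
  | right : NN Γ B u v v
  | step {x y : V} : NN Γ B u v x → x ∈ B → Γ.Adj x y → NN Γ B u v y

theorem fw_exists (ht : Γ.IsTree) (H B : Set V) {u v : V} (a : Γ.Adj u v) (hu : u ∈ H) (hv : v ∉ H) :
    ∃ A N, Fw Γ H B A N ∧ u ∈ N ∧ v ∈ N := by
  let N : Set V := {w | NN Γ B u v w}
  have toU : ∀ w ∈ N, ∃ p : Γ.Walk w u, ∀ z ∈ p.support, z ∈ N := by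
    intro w hw
    induction hw with
    | left => exact ⟨.nil, by simp; exact NN.left⟩
    | right => exact ⟨.cons a.symm .nil, by simp; exact ⟨NN.right, NN.left⟩⟩
    | @step x y hx hB b ih =>
      obtain ⟨p, hp⟩ := ih
      refine ⟨.cons b.symm p, ?_⟩
      intro z hz
      rw [SimpleGraph.Walk.support_cons, List.mem_cons] at hz
      rcases hz with rfl | hz
      · exact NN.step hx hB b
      · exact hp z hz
  have con : ∀ x ∈ N, ∀ y ∈ N, ∃ p : Γ.Walk x y, p.IsPath ∧ ∀ z ∈ p.support, z ∈ N := by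
    intro x hx y hy
    obtain ⟨p, hp⟩ := toU x hx
    obtain ⟨q, hq⟩ := toU y hy
    refine ⟨(p.append q.reverse).bypass, SimpleGraph.Walk.bypass_isPath _, fun z hz => ?_⟩
    have := SimpleGraph.Walk.support_bypass_subset_support _ hz
    rw [SimpleGraph.Walk.mem_support_append_iff, SimpleGraph.Walk.support_reverse, List.mem_reverse] at this
    rcases this with h | h
    · exact hp z h
    · exact hq z h
  have sidex : ∀ {x y n : V} (_ : Γ.Adj x y) (p : Γ.Walk y n), x ∉ p.support → n ∉ half Γ x y := by
    intro x y n b p hx hn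
    have h1 : y ∉ half Γ x y := half_not ht b
    obtain ⟨d, hd, h2, h3⟩ := walk_exit p.reverse hn h1
    have := (half_cross ht b d.adj h2 h3).1
    apply hx
    rw [← this]
    have := SimpleGraph.Walk.dart_fst_mem_support_of_mem_darts _ hd
    rwa [SimpleGraph.Walk.support_reverse, List.mem_reverse] at this
  have uniq : ∀ {n m : V} (p : Γ.Walk n m), n ∈ N → m ∈ N → (∀ d ∈ p.darts, ¬ (d.fst ∈ N ∧ d.snd ∈ N)) → n = m := by
    intro n m p hn hm hd
    obtain ⟨q, hq, hs⟩ := con n hn m hm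
    cases q with
    | nil => rfl
    | @cons _ z _ b q =>
      rw [SimpleGraph.Walk.cons_isPath_iff] at hq
      exfalso
      obtain ⟨d, h1, h2, h3⟩ := walk_exit p (half_self n z) (sidex b q hq.2)
      obtain ⟨e1, e2⟩ := half_cross ht b d.adj h2 h3
      exact hd d h1 ⟨by rw [e1]; exact hn, by rw [e2]; exact hs z (by simp)⟩
  let A : Set V := {w | ∃ n ∈ N, n ∈ H ∧ ∃ p : Γ.Walk w n, ∀ d ∈ p.darts, ¬ (d.fst ∈ N ∧ d.snd ∈ N)}
  have ncr : ∀ {x y}, Γ.Adj x y → ¬ (x ∈ N ∧ y ∈ N) → x ∈ A → y ∈ A := by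
    rintro x y b hb ⟨n, h1, h2, p, h3⟩
    refine ⟨n, h1, h2, .cons b.symm p, ?_⟩
    intro d hd
    rw [SimpleGraph.Walk.darts_cons, List.mem_cons] at hd
    rcases hd with rfl | hd
    · exact fun h => hb h.symm
    · exact h3 d hd
  refine ⟨A, N, ⟨con, ?_, ?_, ?_, ?_, ⟨u, v, a, NN.left, NN.right, hu, hv⟩⟩, NN.left, NN.right⟩
  · intro x hx
    constructor
    · rintro ⟨n, h1, h2, p, h3⟩
      rw [uniq p hx h1 h3]; exact h2
    · intro h; exact ⟨x, hx, h, .nil, by simp⟩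
  · intro x y hx hy b hB
    exact hy (NN.step hx hB b)
  · intro x y y' hx hxB hy hy' b b'
    by_contra hne
    have av : ∀ w ∈ N, w ≠ x → ∃ p : Γ.Walk w (if x = u then v else u), x ∉ p.support := by
      intro w hw
      induction hw with
      | left => 
        intro h
        rw [if_neg (Ne.symm h)]
        exact ⟨.nil, by simpa using h.symm⟩
      | right =>
        intro h
        by_cases hxu : x = u
        · rw [if_pos hxu]; exact ⟨.nil, by simpa using h.symm⟩
        · rw [if_neg hxu]; exact ⟨.cons a.symm .nil, by simp [hxu, h.symm]⟩
      | @step z t hz hB c ih =>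
        intro h
        obtain ⟨p, hp⟩ := ih (fun e => hxB (e ▸ hB))
        exact ⟨.cons c.symm p, by simp [hp, h.symm]⟩
    obtain ⟨p, hp⟩ := av y hy b.ne'
    obtain ⟨q, hq⟩ := av y' hy' b'.ne'
    have h1 := sidex b (p.append q.reverse) (by
      rw [SimpleGraph.Walk.mem_support_append_iff, SimpleGraph.Walk.support_reverse, List.mem_reverse]
      exact fun h => h.elim hp hq)
    have h2 := half_cross ht b b' (half_self x y) h1
    exact hne h2.2.symm
  · intro x y b hx hy
    by_contra h
    exact hy (ncr b h hx)

theorem exit_split {S : Set V} {x w : V} (p : Γ.Walk x w) (hx : x ∈ S) (hw : w ∉ S) :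
    ∃ (u v : V) (p1 : Γ.Walk x u) (a : Γ.Adj u v) (p2 : Γ.Walk v w), p = p1.append (.cons a p2) ∧ u ∈ S ∧ v ∉ S := by
  induction p with
  | nil => exact absurd hx hw
  | @cons x z y b p ih =>
    by_cases hz : z ∈ S
    · obtain ⟨u, v, p1, a, p2, rfl, h1, h2⟩ := ih hz hw
      exact ⟨u, v, .cons b p1, a, p2, rfl, h1, h2⟩
    · exact ⟨x, z, .nil, b, p, rfl, hx, hz⟩

theorem Fw.reach (F : Fw Γ H B A N) {x w : V} (p : Γ.Walk x w) (hx : x ∈ N) (hs : ∀ z ∈ p.support, z ≠ w → z ∈ B) :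
    w ∈ N := by
  induction p with
  | nil => exact hx
  | @cons x z y b p ih =>
    by_cases e : x = y
    · exact e ▸ hx
    have hz : z ∈ N := by
      by_contra hz
      exact F.out hx hz b (hs x (by simp) e)
    exact ih hz fun t ht => hs t (by rw [SimpleGraph.Walk.support_cons]; exact List.mem_cons_of_mem _ ht)

theorem path_disj {x u v w : V} (p1 : Γ.Walk x u) (a : Γ.Adj u v) (p2 : Γ.Walk v w)
    (hp : (p1.append (.cons a p2)).IsPath) {z : V} (h1 : z ∈ p1.support) (h2 : z ∈ p2.support) : False := by
  have := hp.support_nodup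
  rw [SimpleGraph.Walk.support_append, SimpleGraph.Walk.support_cons, List.tail_cons] at this
  exact (List.nodup_append.1 this).2.2 z h1 z h2 rfl

theorem Fw.sym (F : Fw Γ H B A N) {x w : V} (p : Γ.Walk x w) (h : ¬ (x ∈ A ↔ w ∈ A)) :
    ∃ (u v : V) (p1 : Γ.Walk x u) (a : Γ.Adj u v) (p2 : Γ.Walk v w), p = p1.append (.cons a p2) ∧ u ∈ N ∧ v ∈ N := by
  by_cases hx : x ∈ A
  · obtain ⟨u, v, p1, a, p2, e, h1, h2⟩ := exit_split p hx (fun hw => h ⟨fun _ => hw, fun _ => hx⟩)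
    exact ⟨u, v, p1, a, p2, e, F.cross a h1 h2⟩
  · obtain ⟨u, v, p1, a, p2, e, h1, h2⟩ := exit_split (S := Aᶜ) p hx (fun hw => h ⟨fun h => absurd h hx, fun h => absurd h hw⟩)
    exact ⟨u, v, p1, a, p2, e, (F.cross a.symm (by simpa using h2) h1).symm⟩

/-- no crossing on both sides of a vertex outside B -/
theorem Fw.block (ht : Γ.IsTree) (F : Fw Γ H B A N) {x y w : V} (p : Γ.Walk x y) (q : Γ.Walk y w)
    (hp : (p.append q).IsPath) (hy : y ∉ B) (h1 : ¬ (x ∈ A ↔ y ∈ A)) (h2 : ¬ (y ∈ A ↔ w ∈ A)) : False := by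
  obtain ⟨u, v, p1, a, p2, rfl, hu, hv⟩ := F.sym p h1
  obtain ⟨u', v', q1, a', q2, rfl, hu', hv'⟩ := F.sym q h2
  obtain ⟨c, hc, hs⟩ := F.con u hu v' hv'
  have hq : ((SimpleGraph.Walk.cons a p2).append (q1.concat a')).IsPath := by
    have e0 : (p1.append (SimpleGraph.Walk.cons a p2)).append (q1.append (.cons a' q2)) =
        (p1.append ((SimpleGraph.Walk.cons a p2).append (q1.concat a'))).append q2 := by
      rw [← SimpleGraph.Walk.concat_append q1, SimpleGraph.Walk.append_assoc, SimpleGraph.Walk.append_assoc p1]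
    rw [e0] at hp
    exact hp.of_append_left.of_append_right
  have e : c = (SimpleGraph.Walk.cons a p2).append (q1.concat a') := by
    have := ht.isAcyclic.path_unique ⟨c, hc⟩ ⟨_, hq⟩
    exact congrArg Subtype.val this
  rw [e] at hs
  obtain ⟨t, r1, b1, e1⟩ : ∃ (t : V) (r1 : Γ.Walk u t) (b1 : Γ.Adj t y), SimpleGraph.Walk.cons a p2 = r1.concat b1 := by
    obtain ⟨t, r1, b1, e1⟩ := SimpleGraph.Walk.exists_cons_eq_concat a p2
    exact ⟨t, r1, b1, e1⟩
  obtain ⟨t', b2, r2, e2⟩ : ∃ (t' : V) (b2 : Γ.Adj y t') (r2 : Γ.Walk t' v'), q1.concat a' = .cons b2 r2 := by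
    obtain ⟨t', b2, r2, e2⟩ := SimpleGraph.Walk.exists_concat_eq_cons q1 a'
    exact ⟨t', b2, r2, e2⟩
  rw [e1, e2] at hs hq
  have h3 : t ∈ N := hs t (by simp [SimpleGraph.Walk.concat_eq_append])
  have h4 : t' ∈ N := hs t' (by simp)
  have h5 : y ∈ N := hs y (by simp)
  have h6 := F.leaf h5 hy h3 h4 b1.symm b2
  subst h6
  refine path_disj (r1.concat b1) b2 r2 hq (z := t) ?_ (by simp)
  simp [SimpleGraph.Walk.concat_eq_append]

theorem fw_sep (ht : Γ.IsTree) (H B : Set V) : ∀ (n : ℕ) {x w : V} (p : Γ.Walk x w), p.IsPath → p.length ≤ n →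
    x ∈ H → w ∉ H → ∃ A N, Fw Γ H B A N ∧ x ∈ A ∧ w ∉ A := by
  intro n
  induction n with
  | zero =>
    intro x w p hp hn hx hw
    exact absurd hx ((SimpleGraph.Walk.eq_of_length_eq_zero (Nat.le_zero.1 hn)) ▸ hw)
  | succ n ih =>
    intro x w p hp hn hx hw
    by_cases hB : ∃ y ∈ p.support, y ≠ x ∧ y ≠ w ∧ y ∉ B
    · obtain ⟨y, hy, h1, h2, h3⟩ := hB
      have hsp := p.take_spec hy
      have hl : (p.takeUntil y hy).length + (p.dropUntil y hy).length = p.length := by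
        rw [← SimpleGraph.Walk.length_append, hsp]
      have l1 : (p.takeUntil y hy).length ≠ 0 := fun h => h1 (SimpleGraph.Walk.eq_of_length_eq_zero h).symm
      have l2 : (p.dropUntil y hy).length ≠ 0 := fun h => h2 (SimpleGraph.Walk.eq_of_length_eq_zero h)
      have hp' : ((p.takeUntil y hy).append (p.dropUntil y hy)).IsPath := by rw [hsp]; exact hp
      by_cases hyH : y ∈ H
      · obtain ⟨A, N, F, h4, h5⟩ := ih (p.dropUntil y hy) hp'.of_append_right (by omega) hyH hw
        refine ⟨A, N, F, ?_, h5⟩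
        by_contra hxA
        exact F.block ht _ _ hp' h3 (fun h => hxA (h.2 h4)) (fun h => h5 (h.1 h4))
      · obtain ⟨A, N, F, h4, h5⟩ := ih (p.takeUntil y hy) hp'.of_append_left (by omega) hx hyH
        refine ⟨A, N, F, h4, ?_⟩
        intro hxA
        exact F.block ht _ _ hp' h3 (fun h => h5 (h.1 h4)) (fun h => h5 (h.2 hxA))
    · push Not at hB
      obtain ⟨u, v, p1, a, p2, rfl, h1, h2⟩ := exit_split p hx hw
      obtain ⟨A, N, F, h3, h4⟩ := fw_exists ht H B a h1 h2
      refine ⟨A, N, F, ?_, ?_⟩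
      · have : x ∈ N := F.reach p1.reverse h3 (by
          intro z hz hzx
          rw [SimpleGraph.Walk.support_reverse, List.mem_reverse] at hz
          refine hB z (by rw [SimpleGraph.Walk.mem_support_append_iff]; exact Or.inl hz) hzx ?_
          rintro rfl
          exact path_disj p1 a p2 hp hz (by simp))
        exact (F.eqv x this).2 hx
      · have : w ∈ N := F.reach p2 h4 (by
          intro z hz hzx
          refine hB z (by rw [SimpleGraph.Walk.mem_support_append_iff]; exact Or.inr (by simp [hz])) ?_ hzx
          rintro rfl
          exact path_disj p1 a p2 hp (by simp) hz)
        exact fun h => hw ((F.eqv w this).1 h)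

/-- the pieces of a cut -/
def OW (Γ : SimpleGraph V) (H B : Set V) : Set (Set V) := {A | ∃ N, Fw Γ H B A N}

theorem OW_compl (h : A ∈ OW Γ H B) : Aᶜ ∈ OW Γ Hᶜ B := by
  obtain ⟨N, F⟩ := h; exact ⟨N, F.compl⟩

theorem OW_sep (ht : Γ.IsTree) {x w : V} (hx : x ∈ H) (hw : w ∉ H) : ∃ A ∈ OW Γ H B, x ∈ A ∧ w ∉ A := by
  obtain ⟨p⟩ := ht.connected x w
  obtain ⟨A, N, F, h⟩ := fw_sep ht H B _ p.bypass p.bypass_isPath le_rfl hx hw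
  exact ⟨A, ⟨N, F⟩, h⟩

theorem OW_fin (ht : Γ.IsTree) (H B : Set V) (x w : V) : {A ∈ OW Γ H B | x ∈ A ∧ w ∉ A}.Finite := by
  obtain ⟨p⟩ := ht.connected x w
  have : {A ∈ OW Γ H B | x ∈ A ∧ w ∉ A} ⊆ ⋃ d ∈ {d | d ∈ p.darts}, {A | ∃ N, Fw Γ H B A N ∧ d.fst ∈ N ∧ d.snd ∈ N} := by
    rintro A ⟨⟨N, F⟩, h1, h2⟩
    obtain ⟨d, hd, h3, h4⟩ := walk_exit p h1 h2
    simp only [Set.mem_iUnion]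
    exact ⟨d, hd, N, F, F.cross d.adj h3 h4⟩
  refine (Set.Finite.biUnion (List.finite_toSet _) fun d _ => ?_).subset this
  refine Set.Subsingleton.finite ?_
  rintro A ⟨N, F, h1, h2⟩ A' ⟨N', F', h3, h4⟩
  exact F.det ht F' d.adj h1 h2 h3 h4

theorem OW_cross (h : A ∈ OW Γ H B) {x y : V} (a : Γ.Adj x y) (hx : x ∈ A) (hy : y ∉ A) : x ∈ H ∧ y ∉ H := by
  obtain ⟨N, F⟩ := h
  have := F.cross a hx hy
  exact ⟨(F.eqv x this.1).1 hx, fun h => hy ((F.eqv y this.2).2 h)⟩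

theorem OW_ne (h : A ∈ OW Γ H B) : ∃ u v, Γ.Adj u v ∧ u ∈ A ∧ v ∉ A := by
  obtain ⟨N, F⟩ := h
  obtain ⟨u, v, a, h1, h2, h3, h4⟩ := F.ne
  exact ⟨u, v, a, (F.eqv u h1).2 h3, fun h => h4 ((F.eqv v h2).1 h)⟩

end J1

section J2
variable {V : Type u} {Γ : SimpleGraph V} {l : Set V → ℝ} {s τ τ' : ℝ} {H H' A A' B : Set V}

/-- convex hull in a tree -/
def cv (Γ : SimpleGraph V) (S : Set V) : Set V := {z | ∃ x ∈ S, ∃ y ∈ S, ∀ p : Γ.Walk x y, z ∈ p.support}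

theorem cv_self {S : Set V} {z : V} (h : z ∈ S) : z ∈ cv Γ S := ⟨z, h, z, h, fun p => p.start_mem_support⟩

theorem cv_mono {S S' : Set V} (h : S ⊆ S') : cv Γ S ⊆ cv Γ S' := by
  rintro z ⟨x, hx, y, hy, hp⟩; exact ⟨x, h hx, y, h hy, hp⟩

/-- depth of w below the cut H -/
noncomputable def dD (l : Set V → ℝ) (H : Set V) (w : V) : ℝ := ∑ᶠ K ∈ {K | l K ≠ 0 ∧ w ∈ K ∧ K ⊂ H}, l K

/-- active vertices -/
def VV (Γ : SimpleGraph V) (l : Set V → ℝ) (s τ : ℝ) (H : Set V) : Set V :=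
  {w | w ∈ cv Γ H ∧ w ∈ cv Γ Hᶜ ∧ (w ∈ H → (1 - s) * (dD l H w + τ * l H) ≤ s) ∧
    (w ∉ H → (1 - s) * (dD l Hᶜ w + (1 - τ) * l H) ≤ s)}

theorem dD_nonneg (nn : ∀ A, 0 ≤ l A) (H : Set V) (w : V) : 0 ≤ dD l H w :=
  finsum_nonneg fun A => finsum_nonneg fun _ => nn A

theorem dD_fin (hfin : ∀ u v : V, {A | l A ≠ 0 ∧ u ∈ A ∧ v ∉ A}.Finite) {v : V} (hv : v ∉ H) (w : V) :
    {K | l K ≠ 0 ∧ w ∈ K ∧ K ⊂ H}.Finite :=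
  (hfin w v).subset fun _ h => ⟨h.1, h.2.1, fun h1 => hv (h.2.2.1 h1)⟩

theorem VV_compl (wc : ∀ A, l Aᶜ = l A) : VV Γ l s τ Hᶜ = VV Γ l s (1 - τ) H := by
  ext w
  simp only [VV, Set.mem_ofPred_eq, compl_compl, wc, Set.mem_compl_iff, not_not, sub_sub_cancel]
  tauto

theorem coh (nn : ∀ A, 0 ≤ l A) (hfin : ∀ u v : V, {A | l A ≠ 0 ∧ u ∈ A ∧ v ∉ A}.Finite)
    (wc : ∀ A, l Aᶜ = l A) (hs : s ≤ 1) (ht : τ ≤ 1) (ht' : τ' ≤ 1) (hne : H.Nonempty) (hl : l H' ≠ 0)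
    (hd : H ⊆ H'ᶜ) (hc : H' = Hᶜ → τ + τ' ≤ 1) : ∀ z ∈ H', z ∈ VV Γ l s τ H → z ∈ VV Γ l s τ' H' := by
  rintro z hz ⟨h1, h2, h3, h4⟩
  have hzH : z ∉ H := fun h => hd h hz
  refine ⟨cv_self hz, cv_mono hd h1, fun _ => ?_, fun h => absurd hz h⟩
  refine le_trans (mul_le_mul_of_nonneg_left ?_ (by linarith)) (h4 hzH)
  by_cases e : H' = Hᶜ
  · have := hc e
    rw [e, wc]
    nlinarith [nn H]
  · have hsub : H' ⊂ Hᶜ := lt_of_le_of_ne (fun x hx h => hd h hx) e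
    obtain ⟨v, hv⟩ := hne
    have f1 : {K | l K ≠ 0 ∧ z ∈ K ∧ K ⊂ Hᶜ}.Finite := dD_fin hfin (v := v) (fun h : v ∈ Hᶜ => h hv) z
    have hsub2 : insert H' {K | l K ≠ 0 ∧ z ∈ K ∧ K ⊂ H'} ⊆ {K | l K ≠ 0 ∧ z ∈ K ∧ K ⊂ Hᶜ} := by
      rintro K (rfl | h)
      · exact ⟨hl, hz, hsub⟩
      · exact ⟨h.1, h.2.1, h.2.2.trans hsub⟩
    have : l H' + dD l H' z ≤ dD l Hᶜ z := by
      unfold dD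
      rw [← finsum_mem_insert l (fun h => h.2.2.ne rfl) (f1.subset ((Set.subset_insert _ _).trans hsub2))]
      rw [finsum_mem_eq_finite_toFinset_sum _ f1, finsum_mem_eq_finite_toFinset_sum _ (f1.subset hsub2)]
      exact Finset.sum_le_sum_of_subset_of_nonneg (Set.Finite.toFinset_subset_toFinset.2 hsub2) fun i _ _ => nn i
    nlinarith [nn H, nn H']

theorem OW_nonempty (h : A ∈ OW Γ H B) : H.Nonempty ∧ Hᶜ.Nonempty := by
  obtain ⟨u, v, a, h1, h2⟩ := OW_ne h
  obtain ⟨h3, h4⟩ := OW_cross h a h1 h2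
  exact ⟨⟨u, h3⟩, ⟨v, h4⟩⟩

theorem nest_right (h : A ≤ A'ᶜ ∨ A'ᶜ ≤ A ∨ A ≤ A'ᶜᶜ ∨ Aᶜ ≤ A'ᶜ) : A ≤ A' ∨ A' ≤ A ∨ A ≤ A'ᶜ ∨ Aᶜ ≤ A' := by
  rcases h with h | h | h | h
  · exact Or.inr (Or.inr (Or.inl h))
  · exact Or.inr (Or.inr (Or.inr (Set.compl_subset_comm.1 h)))
  · exact Or.inl (by rwa [compl_compl] at h)
  · exact Or.inr (Or.inl (Set.compl_subset_compl.1 h))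

theorem nest_left (h : Aᶜ ≤ A' ∨ A' ≤ Aᶜ ∨ Aᶜ ≤ A'ᶜ ∨ Aᶜᶜ ≤ A') : A ≤ A' ∨ A' ≤ A ∨ A ≤ A'ᶜ ∨ Aᶜ ≤ A' := by
  rcases h with h | h | h | h
  · exact Or.inr (Or.inr (Or.inr h))
  · exact Or.inr (Or.inr (Or.inl (Set.subset_compl_comm.1 h)))
  · exact Or.inr (Or.inl (Set.compl_subset_compl.1 h))
  · exact Or.inl (by rwa [compl_compl] at h)

theorem VV_nest (hT : Γ.IsTree) (nn : ∀ A, 0 ≤ l A) (hfin : ∀ u v : V, {A | l A ≠ 0 ∧ u ∈ A ∧ v ∉ A}.Finite)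
    (wc : ∀ A, l Aᶜ = l A) (hs : s ≤ 1)
    (hn : ∀ {H H'}, l H ≠ 0 → l H' ≠ 0 → H ≤ H' ∨ H' ≤ H ∨ H ≤ H'ᶜ ∨ Hᶜ ≤ H') (ht : τ ∈ Set.Ioo (0 : ℝ) 1)
    (ht' : τ' ∈ Set.Ioo (0 : ℝ) 1) (hl : l H ≠ 0) (hl' : l H' ≠ 0)
    (hA : A ∈ OW Γ H (VV Γ l s τ H)) (hA' : A' ∈ OW Γ H' (VV Γ l s τ' H')) :
    A ≤ A' ∨ A' ≤ A ∨ A ≤ A'ᶜ ∨ Aᶜ ≤ A' := by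
  have base : ∀ {H H' A A' : Set V} {τ τ' : ℝ}, τ ≤ 1 → τ' ≤ 1 → l H ≠ 0 → l H' ≠ 0 →
      A ∈ OW Γ H (VV Γ l s τ H) → A' ∈ OW Γ H' (VV Γ l s τ' H') → H ⊆ H'ᶜ → (H' = Hᶜ → τ + τ' ≤ 1) →
      A ≤ A' ∨ A' ≤ A ∨ A ≤ A'ᶜ ∨ Aᶜ ≤ A' := by
    intro H H' A A' τ τ' ht ht' hl hl' hA hA' hd hc
    have c1 := coh (Γ := Γ) (s := s) nn hfin wc hs ht ht' (OW_nonempty hA).1 hl' hd hc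
    have c2 := coh (Γ := Γ) (s := s) nn hfin wc hs ht' ht (OW_nonempty hA').1 hl (Set.subset_compl_comm.1 hd)
      (fun e => by rw [add_comm]; exact hc (by rw [e, compl_compl]))
    obtain ⟨N, F⟩ := hA
    obtain ⟨N', F'⟩ := hA'
    exact F.nested hT F' hd c1 c2
  have key : ∀ {H H' A A' : Set V} {τ τ' : ℝ}, τ ∈ Set.Ioo (0 : ℝ) 1 → τ' ∈ Set.Ioo (0 : ℝ) 1 → l H ≠ 0 → l H' ≠ 0 →
      A ∈ OW Γ H (VV Γ l s τ H) → A' ∈ OW Γ H' (VV Γ l s τ' H') → H ⊆ H'ᶜ →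
      A ≤ A' ∨ A' ≤ A ∨ A ≤ A'ᶜ ∨ Aᶜ ≤ A' := by
    intro H H' A A' τ τ' ht ht' hl hl' hA hA' hd
    by_cases hc : H' = Hᶜ → τ + τ' ≤ 1
    · exact base ht.2.le ht'.2.le hl hl' hA hA' hd hc
    · push Not at hc
      obtain ⟨e, hc⟩ := hc
      have hA1 := OW_compl hA
      have hA1' := OW_compl hA'
      rw [← sub_sub_cancel 1 τ, ← VV_compl wc] at hA1
      rw [← sub_sub_cancel 1 τ', ← VV_compl wc] at hA1'
      have := base (by linarith [ht.1]) (by linarith [ht'.1]) (by rw [wc]; exact hl) (by rw [wc]; exact hl') hA1 hA1'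
        (by rw [e, compl_compl]) (fun _ => by linarith)
      exact nest_left (nest_right this)
  have hA1 := OW_compl hA
  have hA1' := OW_compl hA'
  rw [← sub_sub_cancel 1 τ, ← VV_compl wc] at hA1
  rw [← sub_sub_cancel 1 τ', ← VV_compl wc] at hA1'
  have i1 : 1 - τ ∈ Set.Ioo (0 : ℝ) 1 := ⟨by linarith [ht.2], by linarith [ht.1]⟩
  have i1' : 1 - τ' ∈ Set.Ioo (0 : ℝ) 1 := ⟨by linarith [ht'.2], by linarith [ht'.1]⟩
  have l1 : l Hᶜ ≠ 0 := by rwa [wc]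
  have l1' : l H'ᶜ ≠ 0 := by rwa [wc]
  rcases hn hl hl' with h | h | h | h
  · exact nest_right (key ht i1' hl l1' hA hA1' (by rw [compl_compl]; exact h))
  · exact nest_left (key i1 ht' l1 hl' hA1 hA' (Set.compl_subset_compl.2 h))
  · exact key ht ht' hl hl' hA hA' h
  · exact nest_left (nest_right (key i1 i1' l1 l1' hA1 hA1' (by rw [compl_compl]; exact h)))

/-- s = 1: nothing is folded -/
theorem OW_hull (ht : Γ.IsTree) (hB : ∀ z, z ∈ cv Γ H → z ∈ cv Γ Hᶜ → z ∈ B) (h : A ∈ OW Γ H B) : A = H := by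
  obtain ⟨N, F⟩ := h
  obtain ⟨u, v, -, hu, hv, hu', hv'⟩ := F.ne
  have key : ∀ {x y z : V}, Γ.Adj x y → x ∈ H → y ∉ H → (z = x ∨ z = y) → z ∈ N := by
    intro x y z b hx hy hz
    by_contra hzN
    obtain ⟨p⟩ := ht.connected u z
    obtain ⟨q, q', p1, a, p2, -, hq, hq'⟩ : ∃ (q q' : V) (p1 : Γ.Walk u q) (a : Γ.Adj q q') (p2 : Γ.Walk q' z),
        p.bypass = p1.append (.cons a p2) ∧ q ∈ N ∧ z ∈ half Γ q' q ∧ q' ∉ N := by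
      obtain ⟨q, q', p1, a, p2, e, h1, h2⟩ := exit_split p.bypass hu hzN
      refine ⟨q, q', p1, a, p2, e, h1, ?_, h2⟩
      by_contra hh
      obtain ⟨c, hc, h3, h4⟩ := walk_exit p2 (half_self q' q) hh
      obtain ⟨-, h6⟩ := half_cross ht a.symm c.adj h3 h4
      have hp := p.bypass_isPath
      rw [e] at hp
      exact path_disj p1 a p2 hp p1.end_mem_support (h6 ▸ p2.dart_snd_mem_support_of_mem_darts hc)
    obtain ⟨hz', hq'⟩ := hq'
    have hN : ∀ n ∈ N, n ∉ half Γ q' q := by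
      intro n hn hh
      obtain ⟨c, -, hs⟩ := F.con n hn q hq
      obtain ⟨d, hd, h1, h2⟩ := walk_exit c hh (half_not ht a.symm)
      have := (half_cross ht a.symm d.adj h1 h2).1
      exact hq' (this ▸ hs _ (c.dart_fst_mem_support_of_mem_darts hd))
    have hw : ∀ {t n : V}, n ∈ N → (t = x ∨ t = y) → ∀ p : Γ.Walk t n, q ∈ p.support := by
      intro t n hn hto r
      by_cases hth : t ∈ half Γ q' q
      · obtain ⟨d, hd, h1, h2⟩ := walk_exit r hth (hN n hn)
        exact (half_cross ht a.symm d.adj h1 h2).2 ▸ r.dart_snd_mem_support_of_mem_darts hd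
      · have hzt : Γ.Adj z t := by
          rcases hz with rfl | rfl <;> rcases hto with rfl | rfl
          · exact absurd hz' hth
          · exact b
          · exact b.symm
          · exact absurd hz' hth
        exact (half_cross ht a.symm hzt hz' hth).2 ▸ r.start_mem_support
    exact F.out hq hq' a (hB q ⟨x, hx, u, hu', hw hu (Or.inl rfl)⟩ ⟨y, hy, v, hv', hw hv (Or.inr rfl)⟩)
  exact cut_ext ht.connected hu F.eqv F.cross fun b hx hy => ⟨key b hx hy (Or.inl rfl), key b hx hy (Or.inr rfl)⟩

/-- s = 0: everything is folded -/
theorem OW_empty (ht : Γ.IsTree) (hB : B = ∅) (h : A ∈ OW Γ H B) : A ∈ HL Γ := by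
  obtain ⟨N, F⟩ := h
  obtain ⟨u, v, a, hu, hv, hu', hv'⟩ := F.ne
  have hB' : ∀ x, x ∉ B := by rw [hB]; exact fun x => id
  have hN : ∀ n ∈ N, n = u ∨ n = v := by
    intro n hn
    obtain ⟨p, hp, hs⟩ := F.con u hu n hn
    cases p with
    | nil => exact Or.inl rfl
    | @cons _ z _ b p =>
      have e := F.leaf hu (hB' u) (hs z (by simp)) hv b a
      subst e
      cases p with
      | nil => exact Or.inr rfl
      | @cons _ z' _ b' p =>
        have e := F.leaf hv (hB' _) (hs z' (by simp)) hu b' a.symm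
        subst e
        exact absurd hp.support_nodup (by simp)
  have : A = half Γ u v := by
    refine cut_ext ht.connected hu ?_ F.cross ?_
    · intro x hx
      rw [F.eqv x hx]
      rcases hN x hx with rfl | rfl
      · exact ⟨fun _ => half_self _ _, fun _ => hu'⟩
      · exact ⟨fun h => absurd h hv', fun h => absurd h (half_not ht a)⟩
    · intro x y b h1 h2
      obtain ⟨rfl, rfl⟩ := half_cross ht a b h1 h2
      exact ⟨hu, hv⟩
  rw [this]
  exact ⟨u, v, a, rfl⟩

variable {Λ : Type u} [Group Λ] [MulAction Λ V]

theorem sact_ex {γ : Λ} {S : Set V} {x : V} (h : x ∈ γ • S) : ∃ y ∈ S, x = γ • y := ⟨γ⁻¹ • x, h, by simp⟩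

theorem OW_smul (ha : ∀ (γ : Λ) {u v : V}, Γ.Adj u v → Γ.Adj (γ • u) (γ • v)) (γ : Λ) (h : A ∈ OW Γ H B) :
    γ • A ∈ OW Γ (γ • H) (γ • B) := by
  obtain ⟨N, F⟩ := h
  have ha' : ∀ {u v : V}, Γ.Adj (γ • u) (γ • v) → Γ.Adj u v := fun h => by simpa using ha γ⁻¹ h
  refine ⟨γ • N, ?_, ?_, ?_, ?_, ?_, ?_⟩
  · intro x hx y hy
    obtain ⟨x, kx, rfl⟩ := sact_ex hx
    obtain ⟨y, ky, rfl⟩ := sact_ex hy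
    obtain ⟨p, hp, hs⟩ := F.con x kx y ky
    let f : Γ →g Γ := ⟨fun x => γ • x, fun {_ _} h => ha γ h⟩
    refine ⟨p.map f, hp.map (MulAction.injective γ), ?_⟩
    intro z hz
    rw [SimpleGraph.Walk.support_map] at hz
    obtain ⟨t, ht, rfl⟩ := List.mem_map.1 hz
    exact smul_mem_sact.2 (hs t ht)
  · intro x hx
    exact F.eqv _ hx
  · intro x y hx hy b
    obtain ⟨x, kx, rfl⟩ := sact_ex hx
    exact fun hB => F.out (x := x) (y := γ⁻¹ • y) kx hy (ha' (by simpa using b)) (smul_mem_sact.1 hB)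
  · intro x y y' hx hB hy hy' b b'
    obtain ⟨x, kx, rfl⟩ := sact_ex hx
    obtain ⟨y, ky, rfl⟩ := sact_ex hy
    obtain ⟨y', ky', rfl⟩ := sact_ex hy'
    rw [F.leaf kx (fun h => hB (smul_mem_sact.2 h)) ky ky' (ha' b) (ha' b')]
  · intro x y b hx hy
    exact F.cross (x := γ⁻¹ • x) (y := γ⁻¹ • y) (ha _ b) hx hy
  · obtain ⟨u, v, a, h1, h2, h3, h4⟩ := F.ne
    exact ⟨γ • u, γ • v, ha γ a, smul_mem_sact.2 h1, smul_mem_sact.2 h2, smul_mem_sact.2 h3,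
      fun h => h4 (smul_mem_sact.1 h)⟩

theorem dD_smul (hl : ∀ (γ : Λ) A, l (γ • A) = l A) (γ : Λ) (H : Set V) (w : V) : dD l (γ • H) (γ • w) = dD l H w := by
  symm
  refine finsum_mem_eq_of_bijOn (fun A => γ • A) ⟨?_, (MulAction.injective γ).injOn, ?_⟩ fun A _ => (hl γ A).symm
  · rintro K ⟨h1, h2, h3⟩
    exact ⟨by rwa [hl], smul_mem_sact.2 h2, (smul_lt_iff' γ).2 h3⟩
  · rintro K ⟨h1, h2, h3⟩
    refine ⟨γ⁻¹ • K, ⟨by rwa [hl], ?_, ?_⟩, by simp⟩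
    · rw [← smul_mem_sact (g := γ), smul_inv_smul]; exact h2
    · exact (smul_lt_iff' γ).1 (by rw [smul_inv_smul]; exact h3)

theorem cv_smul (ha : ∀ (γ : Λ) {u v : V}, Γ.Adj u v → Γ.Adj (γ • u) (γ • v)) (γ : Λ) {z : V} (h : z ∈ cv Γ H) :
    γ • z ∈ cv Γ (γ • H) := by
  obtain ⟨x, hx, y, hy, hp⟩ := h
  refine ⟨γ • x, smul_mem_sact.2 hx, γ • y, smul_mem_sact.2 hy, fun p => ?_⟩
  let f : Γ →g Γ := ⟨fun x => γ⁻¹ • x, fun {_ _} h => ha γ⁻¹ h⟩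
  have := hp ((p.map f).copy (inv_smul_smul γ x) (inv_smul_smul γ y))
  rw [SimpleGraph.Walk.support_copy, SimpleGraph.Walk.support_map] at this
  obtain ⟨t, ht, e⟩ := List.mem_map.1 this
  have e : γ⁻¹ • t = z := e
  rwa [← e, smul_inv_smul]

theorem VV_smul (ha : ∀ (γ : Λ) {u v : V}, Γ.Adj u v → Γ.Adj (γ • u) (γ • v)) (hl : ∀ (γ : Λ) A, l (γ • A) = l A)
    (γ : Λ) (s τ : ℝ) (H : Set V) : VV Γ l s τ (γ • H) = γ • VV Γ l s τ H := by
  have key : ∀ (γ : Λ) (H : Set V) {w : V}, w ∈ VV Γ l s τ H → γ • w ∈ VV Γ l s τ (γ • H) := by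
    rintro γ H w ⟨h1, h2, h3, h4⟩
    have e : (γ • H)ᶜ = γ • Hᶜ := rfl
    refine ⟨cv_smul ha γ h1, by rw [e]; exact cv_smul ha γ h2, fun h => ?_, fun h => ?_⟩
    · rw [dD_smul hl, hl]; exact h3 (smul_mem_sact.1 h)
    · rw [e, dD_smul hl, hl]; exact h4 (fun h5 => h (smul_mem_sact.2 h5))
  ext w
  constructor
  · intro h
    have := key γ⁻¹ _ h
    rwa [inv_smul_smul] at this
  · intro h
    have := key γ _ h
    rwa [smul_inv_smul] at this

end J2

section J3
variable {G : Type u} [Group G] {W : MGTree G} {l : Set W.V → ℝ}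

/-- admissible cut weights on W -/
structure LH (W : MGTree G) (l : Set W.V → ℝ) : Prop where
  good : ∀ w, Good W.toGTree.Elliptic (ppt w) l
  fin : ∀ u v, {A | l A ≠ 0 ∧ u ∈ A ∧ v ∉ A}.Finite
  ess : ∀ {A}, l A ≠ 0 → Ess G A

theorem ess_dart {H : Set W.V} (h : Ess G H) : ∃ u v, W.graph.Adj u v ∧ u ∈ H ∧ v ∉ H := by
  obtain ⟨g, hg⟩ := h
  obtain ⟨x, hx, hx'⟩ := Set.exists_of_ssubset hg
  obtain ⟨p⟩ := W.isTree.connected x (g⁻¹ • x)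
  obtain ⟨d, -, h1, h2⟩ := walk_exit p hx (fun h => hx' h)
  exact ⟨_, _, d.adj, h1, h2⟩

theorem LH.stab (L : LH W l) {H : Set W.V} (hl : l H ≠ 0) : W.toGTree.Elliptic (MulAction.stabilizer G H) := by
  obtain ⟨u, v, a, hu, hv⟩ := ess_dart (L.ess hl)
  have Gd := L.good u
  refine Gd.E2 _ ⟨∑ᶠ A ∈ {A | l A ≠ 0 ∧ u ∈ A ∧ v ∉ A}, l A + ∑ᶠ A ∈ {A | l A ≠ 0 ∧ v ∈ A ∧ u ∉ A}, l A, fun k hk => ?_⟩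
  refine ms_bound Gd.nonneg Gd.wg k (L.fin u v) (L.fin v u) ?_
  rintro A ⟨h1, h2, h3⟩
  have h2 : u ∈ A := h2
  have h3 : k⁻¹ • u ∉ A := h3
  have hk : k • H = H := hk
  have mh : ∀ x, k⁻¹ • x ∈ H ↔ x ∈ H := fun x => by rw [← mem_sact, hk]
  rcases Gd.sys.nested (h := A) (k := H) h1 hl with h | h | h | h
  · exact Or.inl ⟨h1, h2, fun h4 => hv (h h4)⟩
  · exact absurd (h ((mh u).2 hu)) h3
  · exact absurd hu (h h2)
  · refine Or.inr ⟨by rw [Gd.wg]; exact h1, ?_, fun h => h3 h⟩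
    show k⁻¹ • v ∈ A
    by_contra h4
    exact hv ((mh v).1 (h h4))

theorem LH.dart [Group.FG G] (L : LH W l) (H : Set W.V) : ∃ E : Set (W.V × W.V), E.Finite ∧
    ∀ {u v}, W.graph.Adj u v → l H ≠ 0 → u ∈ H → v ∉ H → ∃ k : G, k • H = H ∧ (k • u, k • v) ∈ E := by
  obtain ⟨w⟩ := W.nonempty
  obtain ⟨M, hMf, hM, hMo⟩ := (HL_sys W.toGTree w).orb
  have hM2 : ∀ m : Set W.V, ∃ u v : W.V, m ∈ M → W.graph.Adj u v ∧ m = half W.graph u v := by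
    intro m
    by_cases hm : m ∈ M
    · obtain ⟨u, v, h1, h2⟩ := hM hm
      exact ⟨u, v, fun _ => ⟨h1, h2⟩⟩
    · exact ⟨w, w, fun h => absurd h hm⟩
  choose f f' hf using hM2
  let c : Set W.V → G := fun H' => if h : ∃ g : G, g • H = H' then h.choose else 1
  refine ⟨⋃ m ∈ M, (fun H' => ((c H')⁻¹ • f m, (c H')⁻¹ • f' m)) '' {A | l A ≠ 0 ∧ f m ∈ A ∧ f' m ∉ A},
    hMf.biUnion fun m _ => (L.fin _ _).image _, ?_⟩
  intro u v a hl hu hv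
  obtain ⟨g, hg⟩ := hMo (half W.graph u v) ⟨u, v, a, rfl⟩
  have e1 := (smul_half W.toGTree g u v).symm.trans (hf _ hg).2
  obtain ⟨e2, e3⟩ := half_inj W.isTree ((adj_smul W.toGTree).2 a) (hf _ hg).1 e1
  have hc : c (g • H) • H = g • H := by
    have : ∃ g' : G, g' • H = g • H := ⟨g, rfl⟩
    show (if h : ∃ g' : G, g' • H = g • H then h.choose else 1) • H = _
    rw [dif_pos this]; exact this.choose_spec
  refine ⟨(c (g • H))⁻¹ * g, by rw [mul_smul, inv_smul_eq_iff, hc], Set.mem_biUnion hg ⟨g • H, ⟨?_, ?_, ?_⟩, ?_⟩⟩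
  · rw [(L.good w).wg]; exact hl
  · rw [← e2]; exact smul_mem_sact.2 hu
  · rw [← e3]; exact fun h => hv (smul_mem_sact.1 h)
  · simp only [mul_smul, ← e2, ← e3]

theorem cv_exit {V : Type u} {Γ : SimpleGraph V} (ht : Γ.IsTree) {S : Set V} {z w : V} (hz : z ∉ S) (h : z ∈ cv Γ S) :
    ∃ u v, Γ.Adj u v ∧ u ∈ S ∧ v ∉ S ∧ ∀ p : Γ.Walk v w, z ∈ p.support := by
  obtain ⟨x, hx, y, hy, hp⟩ := h
  have key : ∀ {x}, x ∈ S → (∀ p : Γ.Walk x w, z ∈ p.support) →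
      ∃ u v, Γ.Adj u v ∧ u ∈ S ∧ v ∉ S ∧ ∀ p : Γ.Walk v w, z ∈ p.support := by
    intro x hx hall
    obtain ⟨p⟩ := ht.connected x z
    obtain ⟨u, v, p1, a, p2, e, h1, h2⟩ := exit_split p.bypass hx hz
    refine ⟨u, v, a, h1, h2, fun r => ?_⟩
    have := hall (p1.append (.cons a r))
    rw [SimpleGraph.Walk.support_append, SimpleGraph.Walk.support_cons, List.tail_cons, List.mem_append] at this
    rcases this with h | h
    · have hp := p.bypass_isPath
      rw [e] at hp
      exact (path_disj p1 a p2 hp h p2.end_mem_support).elim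
    · exact h
  by_cases hall : ∀ p : Γ.Walk x w, z ∈ p.support
  · exact key hx hall
  · push Not at hall
    obtain ⟨r, hr⟩ := hall
    refine key hy fun r' => ?_
    have := hp (r.append r'.reverse)
    rw [SimpleGraph.Walk.mem_support_append_iff] at this
    simpa [hr] using this

theorem LH.hull [Group.FG G] (L : LH W l) {H : Set W.V} (hl : l H ≠ 0) : ∃ Z : Set W.V, Z.Finite ∧
    ∀ z, z ∈ cv W.graph H → z ∈ cv W.graph Hᶜ → ∃ k : G, k • H = H ∧ k • z ∈ Z := by
  obtain ⟨E, hE, hE'⟩ := L.dart H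
  obtain ⟨w, hw⟩ := L.stab hl
  have hc := W.isTree.connected
  refine ⟨⋃ t ∈ Prod.fst '' E ∪ Prod.snd '' E, {z | z ∈ (hc t w).some.support},
    ((hE.image _).union (hE.image _)).biUnion fun t _ => List.finite_toSet _, ?_⟩
  intro z h1 h2
  have key : ∀ {k : G} {t : W.V}, k • H = H → k • t ∈ Prod.fst '' E ∪ Prod.snd '' E →
      (∀ p : W.graph.Walk t w, z ∈ p.support) → ∃ k : G, k • H = H ∧ k • z ∈
        ⋃ t ∈ Prod.fst '' E ∪ Prod.snd '' E, {z | z ∈ (hc t w).some.support} := by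
    intro k t hk ht hp
    refine ⟨k, hk, Set.mem_biUnion ht ?_⟩
    let f : W.graph →g W.graph := ⟨fun x => k⁻¹ • x, fun {_ _} h => (adj_smul W.toGTree).2 h⟩
    have hw' : k⁻¹ • w = w := by
      rw [inv_smul_eq_iff]; exact (hw k hk).symm
    have := hp (((hc (k • t) w).some.map f).copy (inv_smul_smul k t) hw')
    rw [SimpleGraph.Walk.support_copy, SimpleGraph.Walk.support_map] at this
    obtain ⟨x, hx, e⟩ := List.mem_map.1 this
    have e : k⁻¹ • x = z := e
    rw [← e, smul_inv_smul]; exact hx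
  by_cases hz : z ∈ H
  · obtain ⟨u, v, a, h3, h4, h5⟩ := cv_exit W.isTree (w := w) (S := Hᶜ) (fun h => h hz) h2
    obtain ⟨k, hk, hkE⟩ := hE' a.symm hl (by simpa using h4) h3
    exact key hk (Or.inl ⟨_, hkE, rfl⟩) h5
  · obtain ⟨u, v, a, h3, h4, h5⟩ := cv_exit W.isTree (w := w) hz h1
    obtain ⟨k, hk, hkE⟩ := hE' a hl h3 h4
    exact key hk (Or.inr ⟨_, hkE, rfl⟩) h5

theorem LH.sat [Group.FG G] (L : LH W l) {H : Set W.V} (hl : l H ≠ 0) : ∃ Z : Set W.V, Z.Finite ∧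
    ∀ l' : Set W.V → ℝ, (∀ (g : G) A, l' (g • A) = l' A) → ∀ s τ,
      VV W.graph l' s τ H = {w | ∃ k : G, k • H = H ∧ k • w ∈ VV W.graph l' s τ H ∩ Z} := by
  obtain ⟨Z, hZ, hZ'⟩ := L.hull hl
  refine ⟨Z, hZ, fun l' hl' s τ => ?_⟩
  have hk : ∀ {k : G} {w}, k • H = H → (k • w ∈ VV W.graph l' s τ H ↔ w ∈ VV W.graph l' s τ H) := by
    intro k w hk
    have e : k • VV W.graph l' s τ H = VV W.graph l' s τ H := by
      rw [← VV_smul (fun γ u v h => (adj_smul W.toGTree).2 h) hl', hk]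
    have := smul_mem_sact (g := k) (A := VV W.graph l' s τ H) (x := w)
    rwa [e] at this
  ext w
  constructor
  · intro h
    obtain ⟨k, hk1, hk2⟩ := hZ' w h.1 h.2.1
    exact ⟨k, hk1, (hk hk1).2 h, hk2⟩
  · rintro ⟨k, hk1, hk2, -⟩
    exact (hk hk1).1 hk2

/-- possible active regions -/
def Bs (H : Set W.V) : Set (Set W.V) :=
  {B | ∃ (l' : Set W.V → ℝ) (s τ : ℝ), (∀ (g : G) A, l' (g • A) = l' A) ∧ B = VV W.graph l' s τ H}

theorem LH.bsfin [Group.FG G] (L : LH W l) {H : Set W.V} (hl : l H ≠ 0) : (Bs H).Finite := by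
  obtain ⟨Z, hZ, hs⟩ := L.sat hl
  refine (hZ.finite_subsets.image fun P => {w | ∃ k : G, k • H = H ∧ k • w ∈ P}).subset ?_
  rintro B ⟨l', s, τ, h1, rfl⟩
  exact ⟨_, fun x hx => hx.2, (hs l' h1 s τ).symm⟩

theorem LH.bs (L : LH W l) (s τ : ℝ) (H : Set W.V) : VV W.graph l s τ H ∈ Bs H := by
  obtain ⟨w⟩ := W.nonempty
  exact ⟨l, s, τ, (L.good w).wg, rfl⟩

theorem bs_walls [Group.FG G] (L : LH W l) {H : Set W.V} (hl : l H ≠ 0) (x y : W.V) :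
    {A | (∃ B ∈ Bs H, A ∈ OW W.graph H B) ∧ x ∈ A ∧ y ∉ A}.Finite := by
  refine ((L.bsfin hl).biUnion fun B _ => OW_fin W.isTree H B x y).subset ?_
  rintro A ⟨⟨B, hB, hA⟩, h⟩
  exact Set.mem_biUnion hB ⟨hA, h⟩

/-- folded walls -/
def Wl (l : Set W.V → ℝ) (s : ℝ) : Set (Set W.V) :=
  {A | ∃ H τ, l H ≠ 0 ∧ τ ∈ Set.Ioo (0 : ℝ) 1 ∧ A ∈ OW W.graph H (VV W.graph l s τ H)}

theorem LH.wfin [Group.FG G] (L : LH W l) (s : ℝ) (x y : W.V) : {A | A ∈ Wl l s ∧ x ∈ A ∧ y ∉ A}.Finite := by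
  obtain ⟨p⟩ := W.isTree.connected x y
  have f1 : (⋃ d ∈ {d | d ∈ p.darts}, {H | l H ≠ 0 ∧ d.toProd.1 ∈ H ∧ d.toProd.2 ∉ H}).Finite :=
    (List.finite_toSet p.darts).biUnion fun d _ => L.fin _ _
  refine (f1.biUnion (t := fun H => {A | l H ≠ 0 ∧ (∃ B ∈ Bs H, A ∈ OW W.graph H B) ∧ x ∈ A ∧ y ∉ A}) fun H _ => ?_).subset ?_
  · by_cases hl : l H = 0
    · simp [hl]
    · exact (bs_walls L hl x y).subset fun A h => h.2
  · rintro A ⟨⟨H, τ, hl, -, hA⟩, hx, hy⟩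
    obtain ⟨d, hd, h1, h2⟩ := walk_exit p hx hy
    exact Set.mem_biUnion (Set.mem_biUnion (x := d) hd ⟨hl, OW_cross hA d.adj h1 h2⟩) ⟨hl, ⟨_, L.bs s τ H, hA⟩, hx, hy⟩

end J3

section J4
variable {G : Type u} [Group G] {W : MGTree G} {l : Set W.V → ℝ} {s : ℝ} {A H : Set W.V}

/-- proportion of the cut H folded to A -/
noncomputable def mm (l : Set W.V → ℝ) (s : ℝ) (H A : Set W.V) : ℝ :=
  (MeasureTheory.volume {τ : ℝ | τ ∈ Set.Ioo (0 : ℝ) 1 ∧ A ∈ OW W.graph H (VV W.graph l s τ H)}).toReal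

/-- folded weight -/
noncomputable def fo (l : Set W.V → ℝ) (s : ℝ) (A : Set W.V) : ℝ := ∑ᶠ H, l H * mm l s H A

theorem vol_le {p : ℝ → Prop} : MeasureTheory.volume {τ : ℝ | τ ∈ Set.Ioo (0 : ℝ) 1 ∧ p τ} ≤ 1 :=
  (MeasureTheory.measure_mono fun _ h => h.1).trans (by simp)

theorem mm_nonneg : 0 ≤ mm l s H A := ENNReal.toReal_nonneg

theorem mm_ne (h : mm l s H A ≠ 0) : ∃ τ ∈ Set.Ioo (0 : ℝ) 1, A ∈ OW W.graph H (VV W.graph l s τ H) := by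
  by_contra hc
  push Not at hc
  apply h
  have : {τ : ℝ | τ ∈ Set.Ioo (0 : ℝ) 1 ∧ A ∈ OW W.graph H (VV W.graph l s τ H)} = ∅ :=
    Set.eq_empty_of_forall_notMem fun τ hτ => hc τ hτ.1 hτ.2
  rw [mm, this]; simp

theorem fo_ne (h : fo l s A ≠ 0) : A ∈ Wl l s := by
  obtain ⟨H, hH⟩ : ∃ H, l H * mm l s H A ≠ 0 := by
    by_contra hc
    push Not at hc
    exact h (finsum_eq_zero_of_forall_eq_zero hc)
  obtain ⟨τ, h1, h2⟩ := mm_ne (right_ne_zero_of_mul hH)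
  exact ⟨H, τ, left_ne_zero_of_mul hH, h1, h2⟩

theorem fo_sup {u v : W.V} (a : W.graph.Adj u v) (hu : u ∈ A) (hv : v ∉ A) :
    (Function.support fun H => l H * mm l s H A) ⊆ {H | l H ≠ 0 ∧ u ∈ H ∧ v ∉ H} := by
  intro H hH
  obtain ⟨τ, h1, h2⟩ := mm_ne (right_ne_zero_of_mul hH)
  exact ⟨left_ne_zero_of_mul hH, OW_cross h2 a hu hv⟩

theorem LH.fo_fin (L : LH W l) (s : ℝ) (A : Set W.V) : (Function.support fun H => l H * mm l s H A).Finite := by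
  by_cases h : ∃ u v, W.graph.Adj u v ∧ u ∈ A ∧ v ∉ A
  · obtain ⟨u, v, a, hu, hv⟩ := h
    exact (L.fin u v).subset (fo_sup a hu hv)
  · convert Set.finite_empty
    refine Set.eq_empty_of_forall_notMem fun H hH => ?_
    obtain ⟨τ, h1, h2⟩ := mm_ne (right_ne_zero_of_mul hH)
    exact h (OW_ne h2)

theorem fo_nonneg (nn : ∀ A, 0 ≤ l A) (s : ℝ) (A : Set W.V) : 0 ≤ fo l s A :=
  finsum_nonneg fun H => mul_nonneg (nn H) mm_nonneg

theorem fo_compl (wc : ∀ A, l Aᶜ = l A) (s : ℝ) (A : Set W.V) : fo l s Aᶜ = fo l s A := by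
  unfold fo
  rw [← finsum_comp_equiv (compl_involutive (α := Set W.V)).toPerm]
  refine finsum_congr fun H => ?_
  show l Hᶜ * mm l s Hᶜ Aᶜ = _
  rw [wc]
  refine congrArg (l H * ·) ?_
  have : {τ : ℝ | τ ∈ Set.Ioo (0 : ℝ) 1 ∧ Aᶜ ∈ OW W.graph Hᶜ (VV W.graph l s τ Hᶜ)} =
      (fun τ => 1 - τ) ⁻¹' {τ : ℝ | τ ∈ Set.Ioo (0 : ℝ) 1 ∧ A ∈ OW W.graph H (VV W.graph l s τ H)} := by
    ext τ
    rw [Set.mem_preimage]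
    show (_ ∧ _) ↔ (_ ∧ _)
    rw [VV_compl wc]
    have e1 : τ ∈ Set.Ioo (0 : ℝ) 1 ↔ 1 - τ ∈ Set.Ioo (0 : ℝ) 1 := by
      constructor <;> rintro ⟨h1, h2⟩ <;> constructor <;> linarith
    have e2 : Aᶜ ∈ OW W.graph Hᶜ (VV W.graph l s (1 - τ) H) ↔ A ∈ OW W.graph H (VV W.graph l s (1 - τ) H) :=
      ⟨fun h => by simpa using OW_compl h, OW_compl⟩
    rw [e1, e2]
  unfold mm
  rw [this]
  refine congrArg ENNReal.toReal ?_
  exact (MeasureTheory.Measure.measurePreserving_sub_left MeasureTheory.volume (1 : ℝ)).measure_preimage_equiv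
    (f := MeasurableEquiv.subLeft (1 : ℝ)) _

theorem fo_smul {Λ : Type u} [Group Λ] [MulAction Λ W.V]
    (ha : ∀ (γ : Λ) {u v : W.V}, W.graph.Adj u v → W.graph.Adj (γ • u) (γ • v))
    (hl : ∀ (γ : Λ) A, l (γ • A) = l A) (γ : Λ) (s : ℝ) (A : Set W.V) : fo l s (γ • A) = fo l s A := by
  unfold fo
  rw [← finsum_comp_equiv (MulAction.toPerm γ : Equiv.Perm (Set W.V))]
  refine finsum_congr fun H => ?_
  show l (γ • H) * mm l s (γ • H) (γ • A) = _
  rw [hl]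
  refine congrArg (l H * ·) ?_
  have : ∀ τ, γ • A ∈ OW W.graph (γ • H) (VV W.graph l s τ (γ • H)) ↔ A ∈ OW W.graph H (VV W.graph l s τ H) := by
    intro τ
    rw [VV_smul ha hl]
    refine ⟨fun h => ?_, OW_smul ha γ⟩
    have := OW_smul ha γ⁻¹ h
    rwa [inv_smul_smul, inv_smul_smul, inv_smul_smul] at this
  simp only [mm, this]

theorem gadj (γ : G) {u v : W.V} (h : W.graph.Adj u v) : W.graph.Adj (γ • u) (γ • v) := (adj_smul W.toGTree).2 h

theorem LH.nn (L : LH W l) (A : Set W.V) : 0 ≤ l A := (L.good W.nonempty.some).nonneg A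
theorem LH.wc (L : LH W l) (A : Set W.V) : l Aᶜ = l A := (L.good W.nonempty.some).wc A
theorem LH.wg (L : LH W l) (g : G) (A : Set W.V) : l (g • A) = l A := (L.good W.nonempty.some).wg g A

theorem LH.wnest (L : LH W l) (hs : s ≤ 1) {A A' : Set W.V} (h : A ∈ Wl l s) (h' : A' ∈ Wl l s) :
    A ≤ A' ∨ A' ≤ A ∨ A ≤ A'ᶜ ∨ Aᶜ ≤ A' := by
  obtain ⟨H, τ, h1, h2, h3⟩ := h
  obtain ⟨H', τ', h1', h2', h3'⟩ := h'
  exact VV_nest W.isTree L.nn L.fin L.wc hs (fun a b => (L.good W.nonempty.some).sys.nested a b) h2 h2' h1 h1' h3 h3'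

theorem LH.wnoinv [Group.FG G] (L : LH W l) (h : A ∈ Wl l s) (g : G) : g • A ≠ Aᶜ := by
  intro e
  obtain ⟨H, τ, h1, -, h3⟩ := h
  have e2 : (g * g) • A = A := by
    rw [mul_smul, e]; show g • Aᶜ = A
    have : g • Aᶜ = (g • A)ᶜ := rfl
    rw [this, e, compl_compl]
  obtain ⟨u, v, a, hu, hv⟩ := OW_ne h3
  have hk : ∀ {k : G}, k • A = A → k⁻¹ • H ∈ {H | l H ≠ 0 ∧ u ∈ H ∧ v ∉ H} := by
    intro k hk
    have hu' : k • u ∈ A := by rw [← hk]; exact smul_mem_sact.2 hu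
    have hv' : k • v ∉ A := by rw [← hk]; exact fun h => hv (smul_mem_sact.1 h)
    obtain ⟨h4, h5⟩ := OW_cross h3 (gadj k a) hu' hv'
    refine ⟨by rw [L.wg]; exact h1, ?_, ?_⟩
    · show k⁻¹⁻¹ • u ∈ H
      rwa [inv_inv]
    · show k⁻¹⁻¹ • v ∉ H
      rwa [inv_inv]
  have hpow : ∀ n : ℕ, (g * g) ^ n • A = A := by
    intro n
    induction n with
    | zero => simp
    | succ n ih => rw [pow_succ, mul_smul, e2, ih]
  obtain ⟨n, hn, hn'⟩ := fin_pow (L.fin u v) (g := (g * g)⁻¹) (h := H) fun n => by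
    rw [inv_pow]; exact hk (hpow n)
  have hst : (g * g) ^ n • H = H := by
    rw [inv_pow, inv_smul_eq_iff] at hn'; exact hn'.symm
  obtain ⟨w, hw⟩ := L.stab h1
  by_cases hg : W.toGTree.Hyperbolic g
  · have := hyp_pow hg (n := 2 * n) (by omega)
    refine this w (hw (g ^ (2 * n)) ?_)
    rw [pow_mul, pow_two]; exact hst
  · unfold GTree.Hyperbolic at hg
    push Not at hg
    obtain ⟨w, hw⟩ := hg
    have hw : g • w = w := hw
    have h4 := smul_mem_sact (g := g) (A := A) (x := w)
    rw [hw, e] at h4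
    by_cases h5 : w ∈ A
    · exact h4.2 h5 h5
    · exact h5 (h4.1 h5)

theorem LH.fo_sum [Group.FG G] (L : LH W l) (s : ℝ) (x y : W.V) :
    ∑ᶠ H ∈ {H | l H ≠ 0 ∧ x ∈ H ∧ y ∉ H}, l H ≤ ∑ᶠ A ∈ {A | A ∈ Wl l s ∧ x ∈ A ∧ y ∉ A}, fo l s A := by
  have f1 := L.fin x y
  have f2 := L.wfin s x y
  rw [finsum_mem_eq_finite_toFinset_sum _ f1, finsum_mem_eq_finite_toFinset_sum _ f2]
  have h1 : ∀ A, ∑ H ∈ f1.toFinset, l H * mm l s H A ≤ fo l s A := by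
    intro A
    rw [fo, finsum_eq_sum_of_support_subset (s := f1.toFinset ∪ (L.fo_fin s A).toFinset) _ (by
      intro H hH
      exact Finset.mem_coe.2 (Finset.mem_union_right _ ((Set.Finite.mem_toFinset _).2 hH)))]
    exact Finset.sum_le_sum_of_subset_of_nonneg Finset.subset_union_left fun H _ _ => mul_nonneg (L.nn H) mm_nonneg
  refine le_trans ?_ (Finset.sum_le_sum fun A _ => h1 A)
  rw [Finset.sum_comm]
  refine Finset.sum_le_sum fun H hH => ?_
  rw [← Finset.mul_sum]
  refine le_mul_of_one_le_right (L.nn H) ?_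
  obtain ⟨hl, hx, hy⟩ := (Set.Finite.mem_toFinset f1).1 hH
  have hne : ∀ A ∈ f2.toFinset, MeasureTheory.volume {τ : ℝ | τ ∈ Set.Ioo (0 : ℝ) 1 ∧ A ∈ OW W.graph H (VV W.graph l s τ H)} ≠ ⊤ :=
    fun A _ => (lt_of_le_of_lt vol_le ENNReal.one_lt_top).ne
  have : (1 : ENNReal) ≤ ∑ A ∈ f2.toFinset, MeasureTheory.volume {τ : ℝ | τ ∈ Set.Ioo (0 : ℝ) 1 ∧ A ∈ OW W.graph H (VV W.graph l s τ H)} := by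
    refine le_trans ?_ (MeasureTheory.measure_biUnion_finset_le _ _)
    calc (1 : ENNReal) = MeasureTheory.volume (Set.Ioo (0 : ℝ) 1) := by simp
      _ ≤ _ := MeasureTheory.measure_mono fun τ hτ => ?_
    obtain ⟨A, hA, hxA, hyA⟩ := OW_sep (B := VV W.graph l s τ H) W.isTree hx hy
    exact Set.mem_biUnion (x := A) ((Set.Finite.mem_toFinset f2).2 ⟨⟨H, τ, hl, hτ, hA⟩, hxA, hyA⟩) ⟨hτ, hA⟩
  have h2 := ENNReal.toReal_mono (ENNReal.sum_ne_top.2 hne) this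
  rwa [ENNReal.toReal_one, ENNReal.toReal_sum hne] at h2

end J4

section GE
variable {G P : Type u} [Group G] [Poc P] [PocAct G P] {o : Pt P} {El : Subgroup G → Prop} {wt : P → ℝ}

theorem ess_iff (g : G) {h : P} : Ess G (g • h) ↔ Ess G h :=
  ⟨fun e => by simpa using e.smul g⁻¹, fun e => e.smul g⟩

theorem good_ess [Group.FG G] (H : Good El o wt) : Good El o (fun h => if Ess G h then wt h else 0) := by
  have hc : ∀ h : P, Ess G hᶜ ↔ Ess G h := fun h => ⟨fun e => by simpa using e.compl, fun e => e.compl⟩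
  have e : sp (fun h => if Ess G h then wt h else 0) = ep G wt := by
    ext h
    show (if Ess G h then wt h else 0) ≠ 0 ↔ wt h ≠ 0 ∧ Ess G h
    by_cases hh : Ess G h <;> simp [hh]
  have TS := H.tsys
  refine ⟨fun h => ?_, fun h => ?_, fun g h => ?_, ?_, fun g h hh => ?_, fun K hK => ?_, fun K hK => ?_⟩
  · show 0 ≤ (if Ess G h then wt h else 0)
    split_ifs; exacts [H.nonneg h, le_rfl]
  · simp only [hc, H.wc]
  · simp only [ess_iff, H.wg]
  · rw [e]; exact TS.toSys
  · have : h ∈ ep G wt := e ▸ hh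
    exact H.noinv g this.1
  · obtain ⟨C, hC⟩ := H.E1 K hK
    rw [e]
    have sub : ∀ k : G, sepo o (ep G wt) k ⊆ sepo o (sp wt) k := fun k h hh => ⟨hh.1.1, hh.2⟩
    exact ⟨C, fun k hk => (Set.ncard_le_ncard (sub k) (H.sys.fin k)).trans (hC k hk)⟩
  · rw [e] at hK
    obtain ⟨C, hC⟩ := hK
    obtain ⟨M, hM, hML, hMo⟩ := TS.toSys.orb
    obtain ⟨ε, hε, hε'⟩ : ∃ ε : ℝ, 0 < ε ∧ ∀ m ∈ M, ε ≤ wt m := by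
      rcases M.eq_empty_or_nonempty with rfl | hne
      · exact ⟨1, one_pos, by simp⟩
      · obtain ⟨m, hm, h⟩ := Set.exists_min_image M wt hM hne
        exact ⟨wt m, H.pos (hML hm).1, h⟩
    have hlow : ∀ h ∈ ep G wt, ε ≤ wt h := by
      intro h hh
      obtain ⟨g, hg⟩ := hMo h hh
      rw [← H.wg g]; exact hε' _ hg
    obtain ⟨C', hC'⟩ := exists_nat_ge (C / ε)
    obtain ⟨v, hv, hf⟩ := bdd_fix TS.toSys (fun g _ hh => TS.noinv g hh) (K := K) (C := C') fun k hk => by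
      have f : (sepo o (ep G wt) k).Finite := TS.toSys.fin k
      have h1 := hC k hk
      have h2 : ((sepo o (ep G wt) k).ncard : ℝ) * ε ≤ C := by
        refine le_trans ?_ h1
        rw [finsum_mem_eq_finite_toFinset_sum _ f, Set.ncard_eq_toFinset_card _ f, ← nsmul_eq_mul]
        refine Finset.card_nsmul_le_sum _ _ _ fun h hh => ?_
        have hh := (Set.Finite.mem_toFinset f).1 hh
        rw [if_pos hh.1.2]; exact hlow h hh.1
      have h3 := ((le_div_iff₀ hε).2 h2).trans hC'
      exact_mod_cast h3
    refine rho_el_mp H ⟨⟨v, hv⟩, fun k hk => Subtype.ext (hf k hk)⟩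

end GE

section J4b
variable {G : Type u} [Group G] {W : MGTree G} {l : Set W.V → ℝ} {s : ℝ} {A H : Set W.V}

/-- essential folded weight -/
noncomputable def fe (l : Set W.V → ℝ) (s : ℝ) (A : Set W.V) : ℝ := if Ess G A then fo l s A else 0

theorem fe_ne (h : fe l s A ≠ 0) : A ∈ Wl l s ∧ Ess G A := by
  unfold fe at h
  split_ifs at h with h1
  · exact ⟨fo_ne h, h1⟩
  · exact absurd rfl h

theorem LH.wcompl (L : LH W l) (h : A ∈ Wl l s) : Aᶜ ∈ Wl l s := by
  obtain ⟨H, τ, h1, h2, h3⟩ := h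
  refine ⟨Hᶜ, 1 - τ, by rw [L.wc]; exact h1, ⟨by linarith [h2.2], by linarith [h2.1]⟩, ?_⟩
  rw [VV_compl L.wc, sub_sub_cancel]
  exact OW_compl h3

theorem LH.hit [Group.FG G] (L : LH W l) (h : A ∈ Wl l s) (he : Ess G A) (w : W.V) : ∃ g : G, w ∈ g • A := by
  by_contra hc
  push Not at hc
  obtain ⟨g, hg⟩ := he.compl
  obtain ⟨H, τ, h1, h2, h3⟩ := L.wcompl h
  obtain ⟨u, v, a, hu, hv⟩ := OW_ne h3
  have hv : v ∈ A := by simpa using hv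
  refine chain_inf hg (s := {B | B ∈ Wl l s ∧ w ∈ B ∧ v ∉ B}) (L.wfin s w v) fun n => ?_
  have hle : ∀ n : ℕ, g ^ n • Aᶜ ≤ Aᶜ := fun n => by simpa using (chain_anti hg).antitone (Nat.zero_le n)
  refine ⟨?_, ?_, fun h4 => hle n h4 hv⟩
  · refine ⟨g ^ n • H, τ, by rw [L.wg]; exact h1, h2, ?_⟩
    rw [VV_smul (fun γ _ _ h => gadj γ h) L.wg]
    exact OW_smul (fun γ _ _ h => gadj γ h) _ h3
  · exact hc (g ^ n)

theorem LH.fgood [Group.FG G] (L : LH W l) (hs : s ≤ 1) (w : W.V) : Good W.toGTree.Elliptic (ppt w) (fe l s) := by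
  have hfc := fo_compl L.wc s
  have hfg : ∀ (g : G) A, fo l s (g • A) = fo l s A := fun g A => fo_smul (fun γ _ _ h => gadj γ h) L.wg g s A
  let hb : Set W.V → Prop := fun A => (∃ g : G, w ∈ g • A) ∧ ∃ g : G, w ∈ g • Aᶜ
  let fb : Set W.V → ℝ := fun A => if hb A then fo l s A else 0
  have fb_ne : ∀ {A}, fb A ≠ 0 ↔ hb A ∧ fo l s A ≠ 0 := by
    intro A; show (if hb A then fo l s A else 0) ≠ 0 ↔ _
    by_cases h : hb A <;> simp [h]
  have hbc : ∀ A, hb Aᶜ ↔ hb A := fun A => by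
    show (_ ∧ _) ↔ (_ ∧ _); rw [compl_compl]; exact and_comm
  have hbg1 : ∀ (g : G) A, hb A → hb (g • A) := by
    rintro g A ⟨⟨k, hk⟩, ⟨k', hk'⟩⟩
    refine ⟨⟨k * g⁻¹, by rwa [mul_smul, inv_smul_smul]⟩, ⟨k' * g⁻¹, ?_⟩⟩
    have : (g • A)ᶜ = g • Aᶜ := rfl
    rwa [this, mul_smul, inv_smul_smul]
  have hbg : ∀ (g : G) A, hb (g • A) ↔ hb A := fun g A =>
    ⟨fun h => by have := hbg1 g⁻¹ _ h; rwa [inv_smul_smul] at this, hbg1 g A⟩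
  have hsub : ∀ {A}, fb A ≠ 0 → A ∈ Wl l s := fun h => fo_ne (fb_ne.1 h).2
  have GB : Good W.toGTree.Elliptic (ppt w) fb := by
    have wc : ∀ A, fb Aᶜ = fb A := fun A => by
      show (if hb Aᶜ then fo l s Aᶜ else 0) = (if hb A then fo l s A else 0)
      simp only [hbc, hfc]
    have wg : ∀ (g : G) A, fb (g • A) = fb A := fun g A => by
      show (if hb (g • A) then fo l s (g • A) else 0) = (if hb A then fo l s A else 0)
      simp only [hbg, hfg]
    refine ⟨fun A => ?_, wc, wg, ⟨?_, ?_, fun a b => L.wnest hs (hsub a) (hsub b), ?_, ?_⟩, fun g h hh => L.wnoinv (hsub hh) g, ?_, ?_⟩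
    · show 0 ≤ (if hb A then fo l s A else 0)
      split_ifs; exacts [fo_nonneg L.nn s A, le_rfl]
    · intro A hA; show fb Aᶜ ≠ 0; rwa [wc]
    · intro g A hA; show fb (g • A) ≠ 0; rwa [wg]
    · exact fun g => (L.wfin s w (g⁻¹ • w)).subset fun A hA => ⟨hsub hA.1, hA.2⟩
    · exact fun hA => (fb_ne.1 hA).1.1
    · rintro K ⟨x, hx⟩
      have F : ∀ u v, {A | fb A ≠ 0 ∧ u ∈ A ∧ v ∉ A}.Finite := fun u v => (L.wfin s u v).subset fun A hA => ⟨hsub hA.1, hA.2⟩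
      refine ⟨{A | fb A ≠ 0 ∧ w ∈ A ∧ x ∉ A}.ncard + {A | fb A ≠ 0 ∧ x ∈ A ∧ w ∉ A}.ncard, fun k hk => ?_⟩
      have hkx : k⁻¹ • x = x := by rw [inv_smul_eq_iff]; exact (hx k hk).symm
      rw [← Set.ncard_image_of_injective {A | fb A ≠ 0 ∧ x ∈ A ∧ w ∉ A} (MulAction.injective k⁻¹)]
      refine le_trans (Set.ncard_le_ncard ?_ ((F _ _).union ((F _ _).image _))) (Set.ncard_union_le _ _)
      rintro A ⟨h1, h2, h3⟩
      by_cases hxA : x ∈ A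
      · refine Or.inr ⟨k • A, ⟨by rw [wg]; exact h1, ?_, h3⟩, inv_smul_smul k A⟩
        show k⁻¹ • x ∈ A
        rwa [hkx]
      · exact Or.inl ⟨h1, h2, hxA⟩
    · rintro K ⟨C, hC⟩
      refine (L.good w).E2 K ⟨C, fun k hk => le_trans ?_ (hC k hk)⟩
      refine (L.fo_sum s w (k⁻¹ • w)).trans (le_of_eq ?_)
      have e : sepo (ppt w) (sp fb) k = {A | A ∈ Wl l s ∧ w ∈ A ∧ k⁻¹ • w ∉ A} ∩ Function.support fb := by
        ext A
        exact ⟨fun h => ⟨⟨hsub h.1, h.2⟩, h.1⟩, fun h => ⟨h.2, h.1.2⟩⟩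
      rw [e, finsum_mem_inter_support]
      refine finsum_mem_congr rfl fun A hA => ?_
      show _ = (if hb A then fo l s A else 0)
      rw [if_pos]
      refine ⟨⟨1, by rw [one_smul]; exact hA.2.1⟩, ⟨k, ?_⟩⟩
      exact hA.2.2
  have := good_ess GB
  convert this using 1
  ext A
  show (if Ess G A then fo l s A else 0) = (if Ess G A then (if hb A then fo l s A else 0) else 0)
  by_cases he : Ess G A
  · rw [if_pos he, if_pos he]
    by_cases h0 : fo l s A = 0
    · simp [h0]
    · rw [if_pos]
      have hA := fo_ne h0
      exact ⟨L.hit hA he w, L.hit (L.wcompl hA) he.compl w⟩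
  · rw [if_neg he, if_neg he]

end J4b

section J5
open MeasureTheory Topology

theorem pat_cont {ζ : Type u} [Finite ζ] (σ : ζ → Prop) (Q : Set (Set ζ)) :
    Continuous fun q : ℝ × ℝ × (ζ → ℝ) => q.2.1 * (volume {τ : ℝ | τ ∈ Set.Ioo (0 : ℝ) 1 ∧
      {z | (σ z → (1 - q.1) * (q.2.2 z + τ * q.2.1) ≤ q.1) ∧
        (¬ σ z → (1 - q.1) * (q.2.2 z + (1 - τ) * q.2.1) ≤ q.1)} ∈ Q}).toReal := by
  let e : ℝ × ℝ × (ζ → ℝ) → ℝ → ζ → ℝ := fun q τ z =>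
    (1 - q.1) * (q.2.2 z + (if σ z then τ else 1 - τ) * q.2.1) - q.1
  let P : ℝ × ℝ × (ζ → ℝ) → ℝ → Set ζ := fun q τ => {z | e q τ z ≤ 0}
  have hP : ∀ q τ, {z | (σ z → (1 - q.1) * (q.2.2 z + τ * q.2.1) ≤ q.1) ∧
        (¬ σ z → (1 - q.1) * (q.2.2 z + (1 - τ) * q.2.1) ≤ q.1)} = P q τ := by
    intro q τ
    ext z
    show _ ↔ (1 - q.1) * (q.2.2 z + (if σ z then τ else 1 - τ) * q.2.1) - q.1 ≤ 0
    rw [sub_nonpos]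
    by_cases h : σ z <;> simp [h]
  have hc : ∀ τ z, Continuous fun q => e q τ z := by
    intro τ z
    fun_prop
  have hcτ : ∀ q z, Measurable fun τ => e q τ z := by
    intro q z
    by_cases h : σ z <;> simp only [e, h, if_true, if_false] <;> fun_prop
  have hms : ∀ q, MeasurableSet {τ | P q τ ∈ Q} := by
    intro q
    have h1 : Measurable (P q) := measurable_set_iff.2 fun z => (measurableSet_le (hcτ q z) measurable_const).mem
    exact h1 (Set.toFinite Q).measurableSet
  have key : Continuous fun q : ℝ × ℝ × (ζ → ℝ) =>
      ∫ τ in Set.Ioo (0 : ℝ) 1, {τ | P q τ ∈ Q}.indicator (fun _ => q.2.1) τ := by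
    rw [continuous_iff_continuousAt]
    intro q₀
    refine continuousAt_of_dominated (bound := fun _ => |q₀.2.1| + 1)
      (Filter.Eventually.of_forall fun q => (measurable_const.indicator (hms q)).aestronglyMeasurable) ?_
      (integrable_const _) ?_
    · have h1 : ContinuousAt (fun q : ℝ × ℝ × (ζ → ℝ) => |q.2.1|) q₀ := by fun_prop
      filter_upwards [h1.eventually_lt_const (lt_add_one _)] with q hq
      refine Filter.Eventually.of_forall fun τ => ?_
      exact (norm_indicator_le_norm_self _ _).trans hq.le
    · by_cases hl : q₀.2.1 = 0
      · refine Filter.Eventually.of_forall fun τ => ?_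
        have h0 : {τ | P q₀ τ ∈ Q}.indicator (fun _ => q₀.2.1) τ = 0 := by
          rw [hl]; simp
        rw [ContinuousAt, h0]
        refine squeeze_zero_norm (a := fun q : ℝ × ℝ × (ζ → ℝ) => |q.2.1|)
          (fun q => norm_indicator_le_norm_self _ _) ?_
        have h1 : ContinuousAt (fun q : ℝ × ℝ × (ζ → ℝ) => |q.2.1|) q₀ := by fun_prop
        rw [ContinuousAt, hl, abs_zero] at h1
        exact h1
      · have hfin : {τ | ∃ z, e q₀ τ z = 0}.Finite := by
          have : {τ | ∃ z, e q₀ τ z = 0} = ⋃ z, {τ | e q₀ τ z = 0} := by ext; simp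
          rw [this]
          refine Set.finite_iUnion fun z => Set.Subsingleton.finite fun τ h τ' h' => ?_
          have h : e q₀ τ z = 0 := h
          have h' : e q₀ τ' z = 0 := h'
          have hs : 1 - q₀.1 ≠ 0 := by
            intro hs
            simp only [e, hs, zero_mul] at h
            linarith
          have h2 : (1 - q₀.1) * ((if σ z then τ else 1 - τ) - (if σ z then τ' else 1 - τ')) * q₀.2.1 = 0 := by
            simp only [e] at h h'
            linear_combination h - h'
          rcases mul_eq_zero.1 h2 with h3 | h3
          · have h4 := (mul_eq_zero.1 h3).resolve_left hs
            split_ifs at h4 <;> linarith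
          · exact absurd h3 hl
        have hae : ∀ᵐ τ ∂(volume.restrict (Set.Ioo (0 : ℝ) 1)), τ ∉ {τ | ∃ z, e q₀ τ z = 0} :=
          ae_restrict_of_ae (measure_eq_zero_iff_ae_notMem.1 (hfin.measure_zero _))
        filter_upwards [hae] with τ hτ
        have hev : ∀ᶠ q in 𝓝 q₀, P q τ = P q₀ τ := by
          have : ∀ᶠ q in 𝓝 q₀, ∀ z, (e q τ z ≤ 0 ↔ e q₀ τ z ≤ 0) := by
            refine Filter.eventually_all.2 fun z => ?_
            have hz : e q₀ τ z ≠ 0 := fun h => hτ ⟨z, h⟩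
            rcases lt_or_gt_of_ne hz with h | h
            · filter_upwards [(hc τ z).continuousAt.eventually_lt_const h] with q hq
              exact ⟨fun _ => h.le, fun _ => hq.le⟩
            · filter_upwards [(hc τ z).continuousAt.eventually_const_lt h] with q hq
              exact ⟨fun h' => absurd h' (not_le.2 hq), fun h' => absurd h' (not_le.2 h)⟩
          filter_upwards [this] with q hq
          ext z; exact hq z
        have hcc : ContinuousAt (fun q : ℝ × ℝ × (ζ → ℝ) => if P q₀ τ ∈ Q then q.2.1 else 0) q₀ := by
          split_ifs <;> fun_prop
        refine hcc.congr ?_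
        filter_upwards [hev] with q hq
        show (if P q₀ τ ∈ Q then q.2.1 else 0) = if P q τ ∈ Q then q.2.1 else 0
        rw [hq]
  convert key using 2 with q
  simp only [hP]
  rw [integral_indicator (hms q), setIntegral_const, smul_eq_mul, mul_comm, Measure.real,
    Measure.restrict_apply (hms q), Set.inter_comm]
  rfl

end J5

section fam
variable {G P : Type u} {ι : Type*} [Group G] [Poc P] [PocAct G P] {wt : ι → P → ℝ}

theorem fam_fin (wg : ∀ κ (g : G) h, wt κ (g • h) = wt κ h) {M : Set P} (hM : M.Finite)
    (hc : ∀ κ h, wt κ h ≠ 0 → ∃ g : G, g • h ∈ M) {R : P → Prop} (hR : ∀ κ, {h | wt κ h ≠ 0 ∧ R h}.Finite) :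
    {h | ∃ κ, wt κ h ≠ 0 ∧ R h}.Finite := by
  refine (hM.biUnion (t := fun m => {h | ∃ hm : ∃ κ, wt κ m ≠ 0, wt hm.choose h ≠ 0 ∧ R h}) fun m _ => ?_).subset ?_
  · by_cases hm : ∃ κ, wt κ m ≠ 0
    · exact (hR hm.choose).subset fun h hh => hh.2
    · exact Set.finite_empty.subset fun h hh => hm hh.1
  · rintro h ⟨κ, h1, h2⟩
    obtain ⟨g, hg⟩ := hc κ h h1
    have hm : ∃ κ, wt κ (g • h) ≠ 0 := ⟨κ, by rwa [wg]⟩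
    refine Set.mem_biUnion hg ⟨hm, ?_, h2⟩
    have := hm.choose_spec
    rwa [wg] at this

theorem fam_sum [TopologicalSpace ι] {R : P → Prop} (hb : ∀ h, Continuous fun κ => wt κ h)
    (hS : {h | ∃ κ, wt κ h ≠ 0 ∧ R h}.Finite) : Continuous fun κ => ∑ᶠ h ∈ {h | wt κ h ≠ 0 ∧ R h}, wt κ h := by
  have : ∀ κ, ∑ᶠ h ∈ {h | wt κ h ≠ 0 ∧ R h}, wt κ h = ∑ h ∈ hS.toFinset, wt κ h := by
    intro κ
    rw [← finsum_mem_eq_finite_toFinset_sum, ← finsum_mem_inter_support _ {h | ∃ κ, wt κ h ≠ 0 ∧ R h}]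
    refine finsum_mem_congr (Set.Subset.antisymm (fun h hh => ⟨⟨κ, hh⟩, hh.1⟩) ?_) fun _ _ => rfl
    rintro h ⟨⟨_, _, h3⟩, h4⟩
    exact ⟨h4, h3⟩
  simp only [this]
  exact continuous_finsetSum _ fun h _ => hb h

end fam

section J5b
variable {G : Type u} {ι : Type*} [Group G] {W : MGTree G} [TopologicalSpace ι] {lm : ι → Set W.V → ℝ}

/-- continuous family of cut weights -/
structure Fam (lm : ι → Set W.V → ℝ) : Prop where
  lh : ∀ κ, LH W (lm κ)
  cont : ∀ A, Continuous fun κ => lm κ A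
  orb : ∃ M : Set (Set W.V), M.Finite ∧ ∀ κ h, lm κ h ≠ 0 → ∃ g : G, g • h ∈ M

theorem Fam.fin (X : Fam lm) {R : Set W.V → Prop} (hR : ∀ κ, {h | lm κ h ≠ 0 ∧ R h}.Finite) :
    {h | ∃ κ, lm κ h ≠ 0 ∧ R h}.Finite := by
  obtain ⟨M, h1, h2⟩ := X.orb
  exact fam_fin (fun κ => (X.lh κ).wg) h1 h2 hR

theorem Fam.dcont (X : Fam lm) {H : Set W.V} {v : W.V} (hv : v ∉ H) (w : W.V) : Continuous fun κ => dD (lm κ) H w :=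
  fam_sum X.cont (X.fin fun κ => dD_fin (X.lh κ).fin hv w)

theorem Fam.mcont [Group.FG G] (X : Fam lm) {κ₀ : ι} {H : Set W.V} (h0 : lm κ₀ H ≠ 0) {u v : W.V} (hu : u ∈ H)
    (hv : v ∉ H) (A : Set W.V) : Continuous fun q : ι × ℝ => lm q.1 H * mm (lm q.1) q.2 H A := by
  obtain ⟨Z, hZ, hs⟩ := (X.lh κ₀).sat h0
  have : Finite Z := hZ
  let Q : Set (Set Z) := {S | A ∈ OW W.graph H
    {w | ∃ k : G, k • H = H ∧ (k • w ∈ cv W.graph H ∧ k • w ∈ cv W.graph Hᶜ) ∧ ∃ z ∈ S, (z : W.V) = k • w}}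
  have hc := pat_cont (fun z : Z => (z : W.V) ∈ H) Q
  have hq : Continuous fun q : ι × ℝ => (q.2, lm q.1 H,
      fun z : Z => if (z : W.V) ∈ H then dD (lm q.1) H z else dD (lm q.1) Hᶜ z) := by
    refine continuous_snd.prodMk (((X.cont H).comp continuous_fst).prodMk (continuous_pi fun z => ?_))
    split_ifs
    · exact (X.dcont hv _).comp continuous_fst
    · exact (X.dcont (H := Hᶜ) (v := u) (fun h => h hu) _).comp continuous_fst
  convert hc.comp hq using 2 with q
  refine congrArg (lm q.1 H * ·) (congrArg ENNReal.toReal (congrArg _ ?_))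
  ext τ
  refine and_congr Iff.rfl ?_
  show _ ↔ A ∈ OW W.graph H _
  rw [hs (lm q.1) (X.lh q.1).wg q.2 τ]
  refine iff_of_eq (congrArg (fun B => A ∈ OW W.graph H B) ?_)
  ext w
  refine exists_congr fun k => and_congr Iff.rfl ⟨?_, ?_⟩
  · rintro ⟨⟨h1, h2, h3, h4⟩, h5⟩
    refine ⟨⟨h1, h2⟩, ⟨k • w, h5⟩, ⟨fun h => ?_, fun h => ?_⟩, rfl⟩
    · simpa only [if_pos h] using h3 h
    · simpa only [if_neg h] using h4 h
  · rintro ⟨⟨h1, h2⟩, ⟨z, hz⟩, ⟨h3, h4⟩, rfl⟩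
    refine ⟨⟨h1, h2, fun h => ?_, fun h => ?_⟩, hz⟩
    · have := h3 h
      simpa only [if_pos h] using this
    · have := h4 h
      simpa only [if_neg h] using this

theorem Fam.fcont [Group.FG G] (X : Fam lm) (A : Set W.V) : Continuous fun q : ι × ℝ => fe (lm q.1) q.2 A := by
  unfold fe
  by_cases he : Ess G A
  swap
  · simp only [if_neg he]; exact continuous_const
  simp only [if_pos he]
  obtain ⟨u, v, a, hu, hv⟩ := ess_dart he
  have hf := X.fin fun κ => (X.lh κ).fin u v
  have : ∀ q : ι × ℝ, fo (lm q.1) q.2 A = ∑ H ∈ hf.toFinset, lm q.1 H * mm (lm q.1) q.2 H A := fun q =>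
    finsum_eq_sum_of_support_subset _ fun H hH => Finset.mem_coe.2 ((Set.Finite.mem_toFinset hf).2 ⟨q.1, fo_sup a hu hv hH⟩)
  simp only [this]
  refine continuous_finsetSum _ fun H hH => ?_
  obtain ⟨κ, h1, h2, h3⟩ := (Set.Finite.mem_toFinset hf).1 hH
  exact X.mcont h1 h2 h3 A

theorem Fam.forb [Group.FG G] (X : Fam lm) : ∃ M : Set (Set W.V), M.Finite ∧
    ∀ κ s A, fe (lm κ) s A ≠ 0 → ∃ g : G, g • A ∈ M := by
  obtain ⟨M, hM, hM'⟩ := X.orb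
  have : ∀ m : Set W.V, ∃ N : Set (Set W.V), N.Finite ∧ ∀ κ s A, lm κ m ≠ 0 → (∃ τ, A ∈ OW W.graph m (VV W.graph (lm κ) s τ m)) →
      ∃ g : G, g • A ∈ N := by
    intro m
    by_cases hm : ∃ κ, lm κ m ≠ 0
    swap
    · exact ⟨∅, Set.finite_empty, fun κ _ _ h => absurd ⟨κ, h⟩ hm⟩
    obtain ⟨κ₀, h0⟩ := hm
    obtain ⟨E, hE, hE'⟩ := (X.lh κ₀).dart m
    refine ⟨_, hE.biUnion fun e _ => bs_walls (X.lh κ₀) h0 e.1 e.2, fun κ s A h ⟨τ, hA⟩ => ?_⟩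
    obtain ⟨u, v, a, hu, hv⟩ := OW_ne hA
    obtain ⟨hu', hv'⟩ := OW_cross hA a hu hv
    obtain ⟨k, hk, hk'⟩ := hE' a h0 hu' hv'
    refine ⟨k, Set.mem_biUnion hk' ⟨⟨_, (X.lh κ).bs s τ m, ?_⟩, smul_mem_sact.2 hu, fun h => hv (smul_mem_sact.1 h)⟩⟩
    have h4 := OW_smul (fun γ _ _ h => gadj γ h) k hA
    rwa [← VV_smul (fun γ _ _ h => gadj γ h) (X.lh κ).wg, hk] at h4
  choose N hN hN' using this
  refine ⟨_, hM.biUnion fun m _ => hN m, fun κ s A hA => ?_⟩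
  obtain ⟨⟨H, τ, h1, h2, h3⟩, -⟩ := fe_ne hA
  obtain ⟨g, hg⟩ := hM' κ H h1
  have h4 := OW_smul (fun γ _ _ h => gadj γ h) g h3
  rw [← VV_smul (fun γ _ _ h => gadj γ h) (X.lh κ).wg] at h4
  obtain ⟨g', hg'⟩ := hN' (g • H) κ s (g • A) (by rwa [(X.lh κ).wg]) ⟨τ, h4⟩
  exact ⟨g' * g, Set.mem_biUnion hg (by rwa [mul_smul])⟩

end J5b

section J5c
variable {G : Type u} [Group G] {W : MGTree G} {l : Set W.V → ℝ}

theorem LH.one (L : LH W l) : fe l 1 = l := by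
  funext A
  have hh : ∀ {τ H A'}, A' ∈ OW W.graph H (VV W.graph l 1 τ H) → A' = H := by
    intro τ H A' h
    refine OW_hull W.isTree (B := VV W.graph l 1 τ H) (fun z h1 h2 => ?_) h
    exact ⟨h1, h2, fun _ => by simp, fun _ => by simp⟩
  have h2 : fo l 1 A = l A * mm l 1 A A := finsum_eq_single _ A fun H hH => by
    by_contra hc
    obtain ⟨τ, -, h3⟩ := mm_ne (right_ne_zero_of_mul hc)
    exact hH (hh h3).symm
  unfold fe
  by_cases hl : l A = 0
  · rw [h2, hl, zero_mul, ite_self]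
  rw [if_pos (L.ess hl), h2]
  obtain ⟨u, v, a, hu, hv⟩ := ess_dart (L.ess hl)
  have : mm l 1 A A = 1 := by
    have : {τ : ℝ | τ ∈ Set.Ioo (0 : ℝ) 1 ∧ A ∈ OW W.graph A (VV W.graph l 1 τ A)} = Set.Ioo 0 1 := by
      refine Set.Subset.antisymm (fun _ h => h.1) fun τ hτ => ⟨hτ, ?_⟩
      obtain ⟨A', hA, -, -⟩ := OW_sep (B := VV W.graph l 1 τ A) W.isTree hu hv
      have e := hh hA
      rwa [e] at hA
    rw [mm, this]; simp
  rw [this, mul_one]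

theorem LH.zero (L : LH W l) {A : Set W.V} (h : fe l 0 A ≠ 0) : A ∈ HL W.graph := by
  obtain ⟨⟨H, τ, h1, h2, h3⟩, -⟩ := fe_ne h
  refine OW_empty W.isTree ?_ h3
  have hp : 0 < l H := lt_of_le_of_ne (L.nn H) h1.symm
  refine Set.eq_empty_of_forall_notMem fun w ⟨_, _, h5, h6⟩ => ?_
  by_cases hw : w ∈ H
  · have := h5 hw
    nlinarith [dD_nonneg L.nn H w, mul_pos h2.1 hp]
  · have := h6 hw
    nlinarith [dD_nonneg L.nn Hᶜ w, mul_pos (sub_pos.2 h2.2) hp]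

end J5c

section K1
open Topology
variable {G : Type u} [Group G] {T₀ : MGTree G} {D : Set (MGTree G)} {Γ : Subgroup (MulAut G)} {a b : G}

theorem Stg.llh [Group.FG G] (X : Stg T₀ D Γ a b) {T : MGTree G} (hT : T ∈ D) (h : mkD T hT ∈ YY D Γ)
    (W : MGTree G) [MulAction Γ W.V] (hW : WA W.toGTree Γ) (he : W.toGTree.Elliptic = T₀.toGTree.Elliptic) :
    LH W (lam a b Γ W.toGTree T) where
  good w := by rw [he]; exact X.lgood hT h W.toGTree hW he w
  fin u v := by
    have Q := X.kpush hT h W.toGTree hW he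
    refine (((Q u).diff.union (Q v).diff).image (kk a b Γ W.toGTree)).subset ?_
    rintro A ⟨h1, h2, h3⟩
    obtain ⟨x, hx, rfl⟩ := (pushw_ne (X.w2good hT) (Q u) A).1 h1
    refine ⟨x, ?_, rfl⟩
    by_cases hm : x ∈ (dblO (labO a b)).m
    · exact Or.inr ⟨hx, fun e => h3 (e.1 hm)⟩
    · exact Or.inl ⟨hx, fun e => hm (e.2 h2)⟩
  ess := by
    intro A hA
    have Q := X.kpush hT h W.toGTree hW he W.nonempty.some
    obtain ⟨x, hx, rfl⟩ := (pushw_ne (X.w2good hT) Q A).1 hA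
    obtain ⟨g, hg⟩ := X.w2ess hT hx
    have hgx : ∀ k : G, w2 T (k • x) ≠ 0 := fun k => by rw [(X.w2good hT).wg]; exact hx
    refine ⟨g, lt_of_le_of_ne ?_ fun e => ?_⟩
    · rw [← Q.smul g hx]; exact Q.mono (hgx g) hx hg.le
    · refine chain_inf hg (Q.fib (kk a b Γ W.toGTree x)) fun n => ⟨hgx _, ?_⟩
      rw [Q.smul _ hx]
      induction n with
      | zero => rw [pow_zero, one_smul]
      | succ n ih => rw [pow_succ, mul_smul, e, ih]

/-- parametrized trees in one cone -/
structure Para (D : Set (MGTree G)) (Γ : Subgroup (MulAut G)) {K : Type*} [TopologicalSpace K] (f : K → MGTree G) : Prop where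
  mem : ∀ κ, f κ ∈ D
  yy : ∀ κ, mkD (f κ) (mem κ) ∈ YY D Γ
  cont : ∀ ℓ, Continuous fun κ => wtT (f κ) ℓ
  orb : ∃ M : Set (Lab G), M.Finite ∧ ∀ κ ℓ, wtT (f κ) ℓ ≠ 0 → ∃ g : G, g • ℓ ∈ M

section pa
variable {K : Type*} [TopologicalSpace K] {f : K → MGTree G}

theorem Para.cont2 (p : Para D Γ f) (x : Dbl (Lab G)) : Continuous fun κ => w2 (f κ) x :=
  (p.cont x.lab).div_const 2

theorem Para.orb2 (p : Para D Γ f) : ∃ M : Set (Dbl (Lab G)), M.Finite ∧ ∀ κ x, w2 (f κ) x ≠ 0 → ∃ g : G, g • x ∈ M := by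
  obtain ⟨M, hM, h⟩ := p.orb
  refine ⟨(fun q : Lab G × Bool => (⟨q.1, q.2⟩ : Dbl (Lab G))) '' (M ×ˢ Set.univ), (hM.prod Set.finite_univ).image _, ?_⟩
  intro κ x hx
  obtain ⟨g, hg⟩ := h κ x.lab (dblw_ne.1 hx)
  exact ⟨g, (g • x.lab, x.b), ⟨hg, trivial⟩, rfl⟩

theorem Para.fam [Group.FG G] (p : Para D Γ f) (X : Stg T₀ D Γ a b)
    (W : MGTree G) [MulAction Γ W.V] (hW : WA W.toGTree Γ) (he : W.toGTree.Elliptic = T₀.toGTree.Elliptic) :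
    Fam (fun κ => lam a b Γ W.toGTree (f κ)) := by
  have Q := fun κ => X.kpush (p.mem κ) (p.yy κ) W.toGTree hW he W.nonempty.some
  obtain ⟨M, hM, hM'⟩ := p.orb2
  refine ⟨fun κ => X.llh (p.mem κ) (p.yy κ) W hW he, fun A => ?_, kk a b Γ W.toGTree '' M, hM.image _, ?_⟩
  · exact fam_sum p.cont2 (fam_fin (fun κ => (X.w2good (p.mem κ)).wg) hM hM' fun κ => (Q κ).fib A)
  · intro κ A hA
    obtain ⟨x, hx, rfl⟩ := (pushw_ne (X.w2good (p.mem κ)) (Q κ) A).1 hA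
    obtain ⟨g, hg⟩ := hM' κ x hx
    exact ⟨g, g • x, hg, (Q κ).smul g hx⟩

end pa

theorem wginv {W : MGTree G} [MulAction Γ W.V] (hW : WA W.toGTree Γ) {w0 : W.V} {wt : Set W.V → ℝ}
    (inv : ∀ (γ : Γ) A, wt (γ • A) = wt A) (fin : ∀ u v, {A | wt A ≠ 0 ∧ u ∈ A ∧ v ∉ A}.Finite) : GInv Γ (ppt w0) wt where
  comp γ g A := by
    ext x
    show γ⁻¹ • ((γ.1 g)⁻¹ • x) ∈ A ↔ g⁻¹ • (γ⁻¹ • x) ∈ A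
    have := hW.comp γ g⁻¹ (γ⁻¹ • x)
    rw [smul_inv_smul, map_inv] at this
    rw [this, inv_smul_smul]
  conj g := by
    obtain ⟨γ, -, h⟩ := hW.conj g
    refine ⟨γ, fun A => ?_⟩
    ext x
    show γ⁻¹ • x ∈ A ↔ g⁻¹ • x ∈ A
    rw [show γ⁻¹ • x = g⁻¹ • x by rw [inv_smul_eq_iff, h, smul_inv_smul]]
  inv := inv
  fin γ := fin w0 (γ⁻¹ • w0)

theorem good_line {P : Type u} [Poc P] [PocAct G P] {o : Pt P} {El : Subgroup G → Prop} {w0 w1 : P → ℝ}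
    (H : Good El o w0) (H' : Good El o w1) (hs : ∀ h, w0 h ≠ 0 → w1 h ≠ 0) {t : ℝ} (h0 : 0 ≤ t) (h1 : t ≤ 1) :
    Good El o (fun h => (1 - t) * w0 h + t * w1 h) := by
  rcases h0.eq_or_lt with rfl | ht
  · simpa using H
  have e : sp (fun h => (1 - t) * w0 h + t * w1 h) = sp w1 := by
    ext h
    show (1 - t) * w0 h + t * w1 h ≠ 0 ↔ w1 h ≠ 0
    constructor
    · intro hh hc
      have : w0 h = 0 := by by_contra h2; exact hs h h2 hc
      rw [this, hc] at hh; simp at hh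
    · intro hh
      have := H'.pos hh
      have := H.nonneg h
      have := mul_nonneg (sub_nonneg.2 h1) this
      positivity
  refine ⟨fun h => ?_, fun h => ?_, fun g h => ?_, e ▸ H'.sys, fun g h hh => H'.noinv g (show h ∈ sp w1 from e ▸ hh), e ▸ H'.E1, ?_⟩
  · have := mul_nonneg (sub_nonneg.2 h1) (H.nonneg h)
    have := mul_nonneg ht.le (H'.nonneg h)
    show 0 ≤ (1 - t) * w0 h + t * w1 h
    linarith
  · simp only [H.wc, H'.wc]
  · simp only [H.wg, H'.wg]
  · rw [e]
    rintro K ⟨C, hC⟩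
    refine H'.E2 K ⟨C / t, fun k hk => (le_div_iff₀' ht).2 (le_trans ?_ (hC k hk))⟩
    have f : (sepo o (sp w1) k).Finite := H'.sys.fin k
    rw [finsum_mem_eq_finite_toFinset_sum _ f, finsum_mem_eq_finite_toFinset_sum _ f, Finset.mul_sum]
    exact Finset.sum_le_sum fun h _ => le_add_of_nonneg_left (mul_nonneg (sub_nonneg.2 h1) (H.nonneg h))

/-- fixed points in the deformation space -/
def FX (D : Set (MGTree G)) (Γ : Subgroup (MulAut G)) : Set (DSp D) :=
  {x | ∀ φ ∈ Γ, EquivIsometric (MGTree.precomp φ x.1) x.1}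

theorem Stg.toYY (X : Stg T₀ D Γ a b) (x : FX D Γ) : x.1 ∈ YY D Γ := X.YY_fix x.1.2 x.2

/-- family of weights giving a homotopy -/
structure HF (T₀ : MGTree G) (D : Set (MGTree G)) (Γ : Subgroup (MulAut G)) {P : Type u} [Poc P] [PocAct G P] [PocAct Γ P]
    (o : Pt P) (ω : MGTree G → unitInterval → P → ℝ) : Prop where
  good : ∀ T (hT : T ∈ D), mkD T hT ∈ YY D Γ → ∀ t, Good T₀.toGTree.Elliptic o (ω T t)
  ginv : ∀ T (hT : T ∈ D), mkD T hT ∈ YY D Γ → ∀ t, GInv Γ o (ω T t)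
  cont : ∀ {K : Type (u + 1)} [TopologicalSpace K] (f : K → MGTree G), Para D Γ f → ∀ h, Continuous fun q : K × unitInterval => ω (f q.1) q.2 h
  orb : ∀ {K : Type (u + 1)} [TopologicalSpace K] (f : K → MGTree G), Para D Γ f →
    ∃ M : Set P, M.Finite ∧ ∀ κ t h, ω (f κ) t h ≠ 0 → ∃ g : G, g • h ∈ M

section hf
variable {P : Type u} [Poc P] [PocAct G P] [PocAct Γ P] {o : Pt P} {ω : MGTree G → unitInterval → P → ℝ}

theorem HF.hcont [Group.FG G] (Y : HF T₀ D Γ o ω) (X : Stg T₀ D Γ a b) :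
    Continuous fun q : YY D Γ × unitInterval => mkD (Skora.rho (Y.good q.1.1.1 q.1.1.2 q.1.2 q.2)) (X.rho _) := by
  refine sub_dom_I X.YY_closed fun S hS => ?_
  let K := {x : {T : MGTree G // T ∈ closedCone D S} // cinc D S x ∈ YY D Γ}
  have p : Para D Γ (fun x : K => x.1.1) := by
    refine ⟨fun x => x.1.2.1, fun x => x.2, fun ℓ => ?_, ?_⟩
    · exact (wtT_cont X.hD X.hg ℓ).comp ((cinc_cont hS).comp continuous_subtype_val)
    · obtain ⟨M, hM, h⟩ := wtT_orb (X.gp hS)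
      exact ⟨M, hM, fun x ℓ => h x.1.1 (X.gp x.1.2.1) x.1.2.2 ℓ⟩
  obtain ⟨M, hM, h⟩ := Y.orb _ p
  exact rho_cont (fun q : K × unitInterval => ω q.1.1.1 q.2) (fun q => Y.good q.1.1.1 q.1.1.2.1 q.1.2 q.2) (fun q => X.rho _) (Y.cont _ p) hM
    fun q => h q.1 q.2

/-- the induced maps on the fixed set -/
noncomputable def HF.map [Group.FG G] (Y : HF T₀ D Γ o ω) (X : Stg T₀ D Γ a b) : C(unitInterval × FX D Γ, FX D Γ) where
  toFun q := ⟨mkD (Skora.rho (Y.good q.2.1.1 q.2.1.2 (X.toYY q.2) q.1)) (X.rho _), fun φ hφ =>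
    fix_rho (Y.ginv q.2.1.1 q.2.1.2 (X.toYY q.2) q.1) (Y.good q.2.1.1 q.2.1.2 (X.toYY q.2) q.1) ⟨φ, hφ⟩⟩
  continuous_toFun := by
    refine Continuous.subtype_mk ((Y.hcont X).comp (f := fun q : unitInterval × FX D Γ => (⟨q.2.1, X.toYY q.2⟩, q.1)) ?_) _
    exact ((continuous_subtype_val.comp continuous_snd).subtype_mk _).prodMk continuous_fst

/-- the map at a time -/
noncomputable def HF.ev [Group.FG G] (Y : HF T₀ D Γ o ω) (X : Stg T₀ D Γ a b) (t : unitInterval) : C(FX D Γ, FX D Γ) :=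
  (Y.map X).comp ⟨fun x => (t, x), by fun_prop⟩

theorem HF.htpy [Group.FG G] (Y : HF T₀ D Γ o ω) (X : Stg T₀ D Γ a b) : (Y.ev X 0).Homotopic (Y.ev X 1) :=
  ⟨⟨Y.map X, fun _ => rfl, fun _ => rfl⟩⟩

theorem rho_eq {El : Subgroup G → Prop} {wt wt' : P → ℝ} (H : Good El o wt) (H' : Good El o wt') (e : wt = wt') :
    rho H = rho H' := by
  subst e; rfl

end hf
theorem Stg.hf1 [Group.FG G] (X : Stg T₀ D Γ a b) : HF T₀ D Γ (labO a b) (fun T _ => wtT T) where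
  good _ hT _ _ := X.good hT
  ginv _ hT h _ := X.ginv hT h
  cont _ p h := (p.cont h).comp continuous_fst
  orb _ p := by
    obtain ⟨M, hM, h⟩ := p.orb
    exact ⟨M, hM, fun κ _ => h κ⟩

theorem Stg.hf2 [Group.FG G] (X : Stg T₀ D Γ a b) : HF T₀ D Γ (dblO (labO a b)) (fun T _ => w2 T) where
  good _ hT _ _ := X.w2good hT
  ginv _ hT h _ := dbl_ginv (X.ginv hT h)
  cont _ p h := (p.cont2 h).comp continuous_fst
  orb _ p := by
    obtain ⟨M, hM, h⟩ := p.orb2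
    exact ⟨M, hM, fun κ _ => h κ⟩

section W
variable (W : MGTree G) [MulAction Γ W.V]

theorem Stg.feinv [Group.FG G] (X : Stg T₀ D Γ a b) {T : MGTree G} (hT : T ∈ D) (h : mkD T hT ∈ YY D Γ)
    (hW : WA W.toGTree Γ) (s : ℝ) (γ : Γ) (A : Set W.V) :
    fe (lam a b Γ W.toGTree T) s (γ • A) = fe (lam a b Γ W.toGTree T) s A := by
  have Z : GInv Γ (ppt W.nonempty.some) (fun _ : Set W.V => (0 : ℝ)) := wginv hW (fun _ _ => rfl) fun _ _ => by simp
  have e : Ess G (γ • A) ↔ Ess G A := ⟨fun h => by simpa using Z.ess γ⁻¹ h, Z.ess γ⟩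
  unfold fe
  simp only [e]
  rw [fo_smul (fun γ _ _ h => hW.adj γ h) (X.linv hT h W.toGTree)]

theorem Stg.hf3 [Group.FG G] (X : Stg T₀ D Γ a b) (hW : WA W.toGTree Γ)
    (he : W.toGTree.Elliptic = T₀.toGTree.Elliptic) (w0 : W.V) :
    HF T₀ D Γ (ppt w0) (fun T (t : unitInterval) => fe (lam a b Γ W.toGTree T) t) where
  good T hT h t := by rw [← he]; exact (X.llh hT h W hW he).fgood t.2.2 w0
  ginv T hT h t := wginv hW (X.feinv W hT h hW t) fun u v =>
    ((X.llh hT h W hW he).wfin t u v).subset fun A hA => ⟨(fe_ne hA.1).1, hA.2⟩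
  cont f p A := ((p.fam X W hW he).fcont A).comp (continuous_fst.prodMk (continuous_subtype_val.comp continuous_snd))
  orb f p := by
    obtain ⟨M, hM, h⟩ := (p.fam X W hW he).forb
    exact ⟨M, hM, fun κ t => h κ t⟩

theorem twinv (hW : WA W.toGTree Γ) (hl : ∀ u v, W.len u v = 1) (γ : Γ) (A : Set W.V) : tw W (γ • A) = tw W A := by
  have h1 : ∀ A, A ∈ HL W.graph → tw W A = 1 := by
    rintro A ⟨u, v, a, rfl⟩
    rw [tw_half W a, hl]
  have h2 : ∀ (γ : Γ) A, A ∈ HL W.graph → γ • A ∈ HL W.graph := by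
    rintro γ A ⟨u, v, a, rfl⟩
    refine ⟨γ • u, γ • v, hW.adj γ a, half_smul (fun g _ _ => hW.adj g) γ u v⟩
  by_cases hA : A ∈ HL W.graph
  · rw [h1 A hA, h1 _ (h2 γ A hA)]
  · rw [tw_zero W hA, tw_zero W fun h => hA (by simpa using h2 γ⁻¹ _ h)]

theorem tw_ginv [Group.FG G] (hW : WA W.toGTree Γ) (hl : ∀ u v, W.len u v = 1) (w0 : W.V) : GInv Γ (ppt w0) (tw W) :=
  wginv hW (twinv W hW hl) fun u v => (hsep_fin W.isTree u v).subset fun A hA => ⟨by rw [← sp_tw]; exact hA.1, hA.2⟩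

theorem Stg.hf4 [Group.FG G] (X : Stg T₀ D Γ a b) (hW : WA W.toGTree Γ)
    (he : W.toGTree.Elliptic = T₀.toGTree.Elliptic) (hl : ∀ u v, W.len u v = 1) (w0 : W.V) :
    HF T₀ D Γ (ppt w0) (fun T (t : unitInterval) A => (1 - (t : ℝ)) * fe (lam a b Γ W.toGTree T) 0 A + t * tw W A) := by
  have hne : ∀ {l : Set W.V → ℝ} (L : LH W l) A, fe l 0 A ≠ 0 → tw W A ≠ 0 := fun L A h => (tw_pos W (L.zero h)).ne'
  have hor : ∀ {l : Set W.V → ℝ} (L : LH W l) (t : ℝ) A, (1 - t) * fe l 0 A + t * tw W A ≠ 0 → tw W A ≠ 0 := by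
    intro l L t A h h'
    refine h ?_
    have : fe l 0 A = 0 := by by_contra h2; exact hne L A h2 h'
    rw [h', this]; ring
  refine ⟨fun T hT h t => ?_, fun T hT h t => ?_, fun {K} _ f p A => ?_, fun f p => ?_⟩
  · rw [← he]
    exact good_line ((X.llh hT h W hW he).fgood zero_le_one w0) (goodT W w0) (hne (X.llh hT h W hW he)) t.2.1 t.2.2
  · refine wginv hW (fun γ A => ?_) fun u v => ?_
    · rw [X.feinv W hT h hW, twinv W hW hl]
    · exact (hsep_fin W.isTree u v).subset fun A hA => ⟨by rw [← sp_tw]; exact hor (X.llh hT h W hW he) t A hA.1, hA.2⟩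
  · have h1 : Continuous fun q : K × unitInterval => fe (lam a b Γ W.toGTree (f q.1)) 0 A :=
      ((p.fam X W hW he).fcont A).comp (continuous_fst.prodMk continuous_const)
    have h2 : Continuous fun q : K × unitInterval => (q.2 : ℝ) := continuous_subtype_val.comp continuous_snd
    exact ((continuous_const.sub h2).mul h1).add (h2.mul continuous_const)
  · obtain ⟨M, hM, -, h⟩ := (HL_sys W.toGTree w0).orb
    refine ⟨M, hM, fun κ t A hA => h A ?_⟩
    rw [← sp_tw]; exact hor (X.llh (p.mem κ) (p.yy κ) W hW he) t A hA

theorem Stg.contr [Group.FG G] (X : Stg T₀ D Γ a b) (hW : WA W.toGTree Γ)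
    (he : W.toGTree.Elliptic = T₀.toGTree.Elliptic) (hl : ∀ u v, W.len u v = 1) : ContractibleSpace (FX D Γ) := by
  obtain ⟨w0⟩ := W.nonempty
  have HT : Good T₀.toGTree.Elliptic (ppt w0) (tw W) := by rw [← he]; exact goodT W w0
  let Y3 := X.hf3 W hW he w0
  let Y4 := X.hf4 W hW he hl w0
  have s1 : ∀ x, (ContinuousMap.id (FX D Γ)) x ⤳ X.hf1.ev X 0 x := fun x => (subtype_specializes_iff _ _).2 (X.c1_spec x.1.2)
  have s2 : ∀ x, X.hf2.ev X 0 x ⤳ X.hf1.ev X 0 x := fun x => by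
    haveI : Nonempty (Dbl (Lab G)) := ⟨⟨⟨{1}, ∅, Set.singleton_ne_empty _⟩, true⟩⟩
    exact (subtype_specializes_iff _ _).2 (Proj.spec (X.good x.1.2) (X.w2good x.1.2) dbl_proj (X.rho _) (X.rho _))
  have s3 : ∀ x, X.hf2.ev X 0 x ⤳ Y3.ev X 1 x := fun x => by
    refine (subtype_specializes_iff _ _).2 ?_
    have h := X.c3_spec x.1.2 (X.toYY x) W.toGTree hW he w0
    have e : (Y3.ev X 1 x).1 = mkD (Skora.rho (X.lgood x.1.2 (X.toYY x) W.toGTree hW he w0)) (X.rho _) :=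
      Subtype.ext (rho_eq (Y3.good _ x.1.2 (X.toYY x) 1) (X.lgood x.1.2 (X.toYY x) W.toGTree hW he w0)
        (X.llh x.1.2 (X.toYY x) W hW he).one)
    rw [e]; exact h
  have e4 : Y3.ev X 0 = Y4.ev X 0 := by
    refine ContinuousMap.ext fun x => Subtype.ext (Subtype.ext (rho_eq (Y3.good _ x.1.2 (X.toYY x) 0) (Y4.good _ x.1.2 (X.toYY x) 0) ?_))
    funext A; simp
  let pt : FX D Γ := ⟨mkD (Skora.rho HT) (X.rho _), fun φ hφ => fix_rho (tw_ginv W hW hl w0) HT ⟨φ, hφ⟩⟩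
  have e5 : Y4.ev X 1 = ContinuousMap.const _ pt := by
    refine ContinuousMap.ext fun x => Subtype.ext (Subtype.ext (rho_eq (Y4.good _ x.1.2 (X.toYY x) 1) HT ?_))
    funext A; simp
  rw [contractible_iff_id_nullhomotopic]
  refine ⟨pt, (spec_homotopic _ _ s1).trans (((spec_homotopic _ _ s2).symm.trans (spec_homotopic _ _ s3)).trans ?_)⟩
  refine (Y3.htpy X).symm.trans ?_
  rw [e4, ← e5]
  exact Y4.htpy X

end W

/-- unit edge lengths -/
def unitT (T : GTree G) : MGTree G where
  toGTree := T
  len _ _ := 1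
  len_symm _ _ := rfl
  len_pos _ _ _ := one_pos
  len_equivariant _ _ _ := rfl

theorem Stg.fxc [Group.FG G] (X : Stg T₀ D Γ a b) : ContractibleSpace (FX D Γ) := by
  have h0 := X.YY_fix X.mem0 X.fix0
  have H := X.w2good X.mem0
  have I := dbl_ginv (X.ginv X.mem0 h0)
  let W : MGTree G := unitT (Skora.rho H).toGTree
  letI : MulAction Γ W.V := MulAction.compHom (Vtx (dblO (labO a b)) (ep G (w2 T₀))) (actV (I.sys H))
  refine X.contr W ⟨?_, ?_, ?_⟩ (funext fun K => propext (rho_el H K)) fun _ _ => rfl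
  · rintro γ u v ⟨h, hh⟩
    refine ⟨γ • h, ?_⟩
    show sv γ _ \ sv γ _ = _
    rw [sv_diff, hh, Set.image_singleton]
    rfl
  · rintro γ g (v : Vtx (dblO (labO a b)) (ep G (w2 T₀)))
    apply Subtype.ext
    show sv (γ.1 g) (sv γ v.1) = sv γ (sv g v.1)
    ext h
    simp only [mem_sv]
    have := I.comp γ⁻¹ (γ.1 g)⁻¹ h
    have e : (γ⁻¹).1 (γ.1 g)⁻¹ = g⁻¹ := by
      rw [map_inv]; exact congrArg _ (MulEquiv.symm_apply_apply _ _)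
    rw [e] at this
    exact Iff.of_eq (congrArg (· ∈ v.1) this.symm)
  · intro g
    refine ⟨⟨_, X.conj g⟩, rfl, ?_⟩
    rintro (w : Vtx (dblO (labO a b)) (ep G (w2 T₀)))
    apply Subtype.ext
    show sv (⟨MulAut.conj g, X.conj g⟩ : Γ) w.1 = sv g w.1
    ext h
    simp only [mem_sv]
    refine Iff.of_eq (congrArg (· ∈ w.1) ?_)
    have e : (⟨MulAut.conj g, X.conj g⟩ : Γ)⁻¹ = ⟨MulAut.conj g⁻¹, X.conj g⁻¹⟩ := Subtype.ext (map_inv _ g).symm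
    rw [e]
    exact Dbl.ext rfl rfl

end K1
end Skora

/-- **Theorem (Guirardel–Levitt, Theorem 8.3).** Let `D` be an irreducible deformation
space of `G`-trees.  If a finitely generated subgroup `F ⊆ Out(G)` fixes a tree
`T₀ ∈ D`, then the fixed point set of `F` in `D` is contractible in the weak
topology. -/
theorem statement_19 {G : Type u} [Group G] [Group.FG G] (T₀ : MGTree G)
    (hirr : T₀.Irr)
    (D : Set (MGTree G)) (hD : D = {T : MGTree G | SameDef T₀.toGTree T.toGTree})
    (F : Subgroup (OutG G)) (hFG : F.FG)
    (hfix : ∀ φ : MulAut G, toOutG G φ ∈ F → EquivIsometric (MGTree.precomp φ T₀) T₀)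
    (FixD : Set (MGTree G))
    (hFixD : FixD = {T ∈ D | ∀ φ : MulAut G, toOutG G φ ∈ F →
      EquivIsometric (MGTree.precomp φ T) T})
    (hsub : FixD ⊆ D) :
    @ContractibleSpace (Quot (fun a b : ↥FixD => EquivIsometric a.1 b.1))
      ((TopologicalSpace.induced
          (fun x : ↥FixD => (⟨x.1, hsub x.2⟩ : ↥D)) (weakTop G D)).coinduced
        (Quot.mk (fun a b : ↥FixD => EquivIsometric a.1 b.1))) := by
  obtain ⟨a, b, hab⟩ := Skora.irr_gp T₀ hirr
  have X : Skora.Stg T₀ D (Skora.Gam F) a b := ⟨hD, hab, Skora.conj_Gam F, fun φ hφ => hfix φ hφ⟩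
  have C := X.fxc
  letI t : TopologicalSpace ↥FixD := (weakTop G D).induced fun x : ↥FixD => (⟨x.1, hsub x.2⟩ : ↥D)
  let j : ↥FixD → Skora.DSp D := fun x => ⟨x.1, hsub x.2⟩
  have hj : Topology.IsInducing j := ⟨rfl⟩
  have hm : ∀ T ∈ FixD, T ∈ {T ∈ D | ∀ φ : MulAut G, toOutG G φ ∈ F → EquivIsometric (MGTree.precomp φ T) T} :=
    fun T h => hFixD ▸ h
  let e : ↥FixD ≃ Skora.FX D (Skora.Gam F) :=
    { toFun := fun x => ⟨j x, fun φ hφ => (hm x.1 x.2).2 φ hφ⟩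
      invFun := fun y => ⟨y.1.1, by rw [hFixD]; exact ⟨y.1.2, fun φ hφ => y.2 φ hφ⟩⟩
      left_inv := fun _ => rfl
      right_inv := fun _ => rfl }
  have he : Topology.IsInducing e := Topology.IsInducing.subtypeVal.of_comp_iff.1 hj
  haveI : ContractibleSpace ↥FixD := (e.toHomeomorphOfIsInducing he).contractibleSpace
  exact Skora.quot_contr _ fun x y h => hj.inseparable_iff.1 (Skora.iso_insep h)
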